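/- Let A be a real symmetric positive definite 2×2 matrix and Q(x) = xᵀAx on ℝ², and let κ > 0 and κ' > 0. There exists C = C(A, p, κ, κ') such that for all λ > 1, all 0 < δ < 1 and all 2 ≤ p < ∞ with either (i) δ > λ^{−1/3+κ}, or (ii) p < 5 − κ and δ > λ^{−1+κ'}, the following holds: for every finitely supported a : ℤ² → ℂ vanishing outside {k ∈ ℤ² : |√(Q(k)) − λ| < δ}, one has ‖f‖_{L^p} ≤ C (λ^{1/2 − 2/p} δ^{1/2} + (λδ)^{(1/2)(1/2 − 1/p)}) ‖a‖_{ℓ²}. -/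

import Mathlib

open MeasureTheory

noncomputable def trigSum2 (a : (Fin 2 → ℤ) →₀ ℂ) (x : Fin 2 → ℝ) : ℂ :=
  ∑ k ∈ a.support, a k * Complex.exp (2 * Real.pi * Complex.I * ((∑ i, (k i : ℝ) * x i : ℝ) : ℂ))

noncomputable def lpNorm2 (p : ℝ) (a : (Fin 2 → ℤ) →₀ ℂ) : ℝ :=
  (∫ x in (Set.univ.pi fun _ : Fin 2 => Set.Icc (0:ℝ) 1), ‖trigSum2 a x‖ ^ p) ^ (1 / p)

noncomputable def l2Norm2 (a : (Fin 2 → ℤ) →₀ ℂ) : ℝ :=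
  (∑ k ∈ a.support, ‖a k‖ ^ 2) ^ ((1:ℝ) / 2)

noncomputable def Qform2 (A : Matrix (Fin 2) (Fin 2) ℝ) (x : Fin 2 → ℝ) : ℝ :=
  ∑ i, ∑ j, A i j * x i * x j

namespace TorusShell

section

/-- The additive character `t ↦ e^{2πit}`. -/
noncomputable def ee (t : ℝ) : ℂ := Complex.exp (2 * Real.pi * Complex.I * t)

lemma ee_add (s t : ℝ) : ee (s + t) = ee s * ee t := by
  simp only [ee, ← Complex.exp_add]; congr 1; push_cast; ring

@[simp] lemma ee_zero : ee 0 = 1 := by simp [ee]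

@[simp] lemma norm_ee (t : ℝ) : ‖ee t‖ = 1 := by
  rw [ee, show (2 * Real.pi * Complex.I * t : ℂ) = ((2 * Real.pi * t : ℝ) : ℂ) * Complex.I by
    push_cast; ring]
  exact Complex.norm_exp_ofReal_mul_I _

lemma conj_ee (t : ℝ) : (starRingEnd ℂ) (ee t) = ee (-t) := by
  simp only [ee, ← Complex.exp_conj]; congr 1; simp [map_ofNat]

lemma ee_int (n : ℤ) : ee n = 1 := by
  rw [ee, Complex.exp_eq_one_iff]; exact ⟨n, by push_cast; ring⟩

lemma continuous_ee : Continuous ee := by unfold ee; fun_prop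

/-- A probability space with two coordinate functions whose characters are orthonormal, such as
the two-dimensional torus. -/
structure Torus (Ω : Type*) [MeasurableSpace Ω] where
  /-- the probability measure -/
  μ : Measure Ω
  /-- the first coordinate -/
  X : Ω → ℝ
  /-- the second coordinate -/
  Y : Ω → ℝ
  prob : IsProbabilityMeasure μ
  measX : Measurable X
  measY : Measurable Y
  orth : ∀ k : ℤ × ℤ, k ≠ 0 → ∫ w, ee (k.1 * X w + k.2 * Y w) ∂μ = 0

variable {Ω : Type*} [MeasurableSpace Ω] (T : Torus Ω)

instance : IsProbabilityMeasure T.μ := T.prob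

/-- The character of frequency `k`. -/
noncomputable def Torus.chr (k : ℤ × ℤ) (w : Ω) : ℂ := ee (k.1 * T.X w + k.2 * T.Y w)

/-- The trigonometric polynomial with frequencies in `S` and coefficients `a`. -/
noncomputable def Torus.trig (S : Finset (ℤ × ℤ)) (a : ℤ × ℤ → ℂ) (w : Ω) : ℂ :=
  ∑ k ∈ S, a k * T.chr k w

/-- The squared `ℓ²` norm of the coefficients. -/
noncomputable def nsq (S : Finset (ℤ × ℤ)) (a : ℤ × ℤ → ℂ) : ℝ := ∑ k ∈ S, ‖a k‖ ^ 2

lemma nsq_nonneg (S : Finset (ℤ × ℤ)) (a : ℤ × ℤ → ℂ) : 0 ≤ nsq S a :=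
  Finset.sum_nonneg fun _ _ => by positivity

variable {T}

lemma chr_add (k l : ℤ × ℤ) (w : Ω) : T.chr (k + l) w = T.chr k w * T.chr l w := by
  simp only [Torus.chr, ← ee_add]; congr 1; simp; ring

lemma chr_conj (k : ℤ × ℤ) (w : Ω) : (starRingEnd ℂ) (T.chr k w) = T.chr (-k) w := by
  simp only [Torus.chr, conj_ee]; congr 1; simp; ring

@[simp] lemma chr_zero (w : Ω) : T.chr 0 w = 1 := by simp [Torus.chr]

@[simp] lemma norm_chr (k : ℤ × ℤ) (w : Ω) : ‖T.chr k w‖ = 1 := norm_ee _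

@[fun_prop] lemma measurable_chr (k : ℤ × ℤ) : Measurable (T.chr k) := by
  unfold Torus.chr
  have := T.measX
  have := T.measY
  exact continuous_ee.measurable.comp (by fun_prop)

@[fun_prop] lemma measurable_trig (S : Finset (ℤ × ℤ)) (a : ℤ × ℤ → ℂ) :
    Measurable (T.trig S a) := by
  unfold Torus.trig; fun_prop

lemma norm_trig_le_sum (S : Finset (ℤ × ℤ)) (a : ℤ × ℤ → ℂ) (w : Ω) :
    ‖T.trig S a w‖ ≤ ∑ k ∈ S, ‖a k‖ := by
  refine (norm_sum_le _ _).trans (le_of_eq ?_)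
  simp

lemma norm_trig_sq_le (S : Finset (ℤ × ℤ)) (a : ℤ × ℤ → ℂ) (w : Ω) :
    ‖T.trig S a w‖ ^ 2 ≤ S.card * nsq S a := by
  have h := norm_trig_le_sum (T := T) S a w
  have h2 := sq_sum_le_card_mul_sum_sq (s := S) (f := fun k => ‖a k‖)
  calc _ ≤ (∑ k ∈ S, ‖a k‖) ^ 2 := by gcongr
    _ ≤ _ := h2

lemma integrable_of_bdd {E : Type*} [NormedAddCommGroup E] {μ : Measure Ω} [IsFiniteMeasure μ]
    {f : Ω → E} (hm : AEStronglyMeasurable f μ) (C : ℝ) (hb : ∀ w, ‖f w‖ ≤ C) : Integrable f μ :=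
  Integrable.of_bound hm C (Filter.Eventually.of_forall hb)

lemma integral_chr (k : ℤ × ℤ) : ∫ w, T.chr k w ∂T.μ = if k = 0 then 1 else 0 := by
  split_ifs with h
  · subst h; simp
  · exact T.orth k h

/-- Functions whose spectrum lies in `A`. -/
noncomputable def Torus.poly (T : Torus Ω) (A : Set (ℤ × ℤ)) : Submodule ℂ (Ω → ℂ) :=
  Submodule.span ℂ (T.chr '' A)

lemma chr_mem_poly {A : Set (ℤ × ℤ)} {k : ℤ × ℤ} (hk : k ∈ A) : T.chr k ∈ T.poly A :=
  Submodule.subset_span ⟨k, hk, rfl⟩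

lemma trig_mem_poly {A : Set (ℤ × ℤ)} {S : Finset (ℤ × ℤ)} (a : ℤ × ℤ → ℂ)
    (h : ∀ k ∈ S, k ∈ A) : T.trig S a ∈ T.poly A := by
  have : T.trig S a = ∑ k ∈ S, a k • T.chr k := by
    ext w; simp [Torus.trig]
  rw [this]
  exact Submodule.sum_mem _ fun k hk => Submodule.smul_mem _ _ (chr_mem_poly (h k hk))

lemma poly_mul {A B : Set (ℤ × ℤ)} {f g : Ω → ℂ} (hf : f ∈ T.poly A) (hg : g ∈ T.poly B) :
    f * g ∈ T.poly {n | ∃ k ∈ A, ∃ l ∈ B, n = k + l} := by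
  induction hf using Submodule.span_induction with
  | mem x hx =>
    obtain ⟨k, hk, rfl⟩ := hx
    induction hg using Submodule.span_induction with
    | mem y hy =>
      obtain ⟨l, hl, rfl⟩ := hy
      have : T.chr k * T.chr l = T.chr (k + l) := by ext w; simp [chr_add]
      rw [this]; exact chr_mem_poly ⟨k, hk, l, hl, rfl⟩
    | zero => simp
    | add y z _ _ h1 h2 => rw [mul_add]; exact Submodule.add_mem _ h1 h2
    | smul c y _ h => rw [mul_smul_comm]; exact Submodule.smul_mem _ _ h
  | zero => simp
  | add y z _ _ h1 h2 => rw [add_mul]; exact Submodule.add_mem _ h1 h2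
  | smul c y _ h => rw [smul_mul_assoc]; exact Submodule.smul_mem _ _ h

lemma poly_conj {A : Set (ℤ × ℤ)} {f : Ω → ℂ} (hf : f ∈ T.poly A) :
    (fun w => (starRingEnd ℂ) (f w)) ∈ T.poly {n | -n ∈ A} := by
  induction hf using Submodule.span_induction with
  | mem x hx =>
    obtain ⟨k, hk, rfl⟩ := hx
    simp only [chr_conj]
    exact chr_mem_poly (by simpa using hk)
  | zero =>
    convert Submodule.zero_mem (T.poly {n | -n ∈ A}) using 1
    ext w; simp
  | add y z _ _ h1 h2 =>
    simp only [Pi.add_apply, map_add]; exact Submodule.add_mem _ h1 h2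
  | smul c y _ h =>
    have : (fun w => (starRingEnd ℂ) ((c • y) w)) =
        (starRingEnd ℂ) c • fun w => (starRingEnd ℂ) (y w) := by ext w; simp
    rw [this]; exact Submodule.smul_mem _ _ h

lemma integral_poly_eq_zero {A : Set (ℤ × ℤ)} {f : Ω → ℂ} (hf : f ∈ T.poly A)
    (h0 : (0 : ℤ × ℤ) ∉ A) : Integrable f T.μ ∧ ∫ w, f w ∂T.μ = 0 := by
  induction hf using Submodule.span_induction with
  | mem x hx =>
    obtain ⟨k, hk, rfl⟩ := hx
    refine ⟨integrable_of_bdd (by fun_prop) 1 (by simp), ?_⟩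
    rw [integral_chr, if_neg]; rintro rfl; exact h0 hk
  | zero => simp
  | add y z _ _ h1 h2 =>
    refine ⟨h1.1.add h2.1, ?_⟩
    simp only [Pi.add_apply]
    rw [integral_add h1.1 h2.1, h1.2, h2.2, add_zero]
  | smul c y _ h =>
    refine ⟨h.1.smul c, ?_⟩
    simp only [Pi.smul_apply]
    rw [integral_smul, h.2, smul_zero]

/-- Bounded measurable functions. -/
def BM {E : Type*} [NormedAddCommGroup E] [MeasurableSpace E] (f : Ω → E) : Prop :=
  Measurable f ∧ ∃ C, ∀ w, ‖f w‖ ≤ C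

lemma BM.integrable {f : Ω → ℝ} (h : BM f) {μ : Measure Ω} [IsFiniteMeasure μ] :
    Integrable f μ := by
  obtain ⟨hm, C, hC⟩ := h; exact integrable_of_bdd (by fun_prop) C hC

lemma BM.integrable_complex {f : Ω → ℂ} (h : BM f) {μ : Measure Ω} [IsFiniteMeasure μ] :
    Integrable f μ := by
  obtain ⟨hm, C, hC⟩ := h; exact integrable_of_bdd (by fun_prop) C hC

lemma BM.trig (S : Finset (ℤ × ℤ)) (a : ℤ × ℤ → ℂ) : BM (T.trig S a) :=
  ⟨by fun_prop, _, norm_trig_le_sum S a⟩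

lemma BM.norm {f : Ω → ℂ} (h : BM f) : BM fun w => ‖f w‖ :=
  ⟨h.1.norm, h.2.imp fun C hC w => by simpa using hC w⟩

lemma BM.mul {E : Type*} [NormedRing E] [MeasurableSpace E] [MeasurableMul₂ E] {f g : Ω → E}
    (hf : BM f) (hg : BM g) : BM fun w => f w * g w := by
  obtain ⟨hm, C, hC⟩ := hf
  obtain ⟨hm', C', hC'⟩ := hg
  refine ⟨hm.mul hm', C * C', fun w => (norm_mul_le _ _).trans ?_⟩
  exact mul_le_mul (hC w) (hC' w) (norm_nonneg _) ((norm_nonneg _).trans (hC w))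

lemma BM.pow {f : Ω → ℝ} (hf : BM f) (n : ℕ) : BM fun w => f w ^ n := by
  induction n with
  | zero => exact ⟨by simp, 1, by simp⟩
  | succ n ih => simpa [pow_succ] using ih.mul hf

lemma BM.conj {f : Ω → ℂ} (h : BM f) : BM fun w => (starRingEnd ℂ) (f w) :=
  ⟨Complex.continuous_conj.measurable.comp h.1, h.2.imp fun C hC w => by simpa using hC w⟩

lemma BM.ofReal {f : Ω → ℝ} (h : BM f) : BM fun w => (f w : ℂ) :=
  ⟨Complex.measurable_ofReal.comp h.1, h.2.imp fun C hC w => by simpa using hC w⟩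

lemma BM.sum {E : Type*} [NormedAddCommGroup E] [MeasurableSpace E] [MeasurableAdd₂ E] {ι : Type*}
    (s : Finset ι) {f : ι → Ω → E} (h : ∀ i ∈ s, BM (f i)) : BM fun w => ∑ i ∈ s, f i w := by
  classical
  choose! C hC using fun i hi => (h i hi).2
  refine ⟨Finset.measurable_fun_sum _ fun i hi => (h i hi).1, ∑ i ∈ s, C i, fun w => ?_⟩
  exact (norm_sum_le _ _).trans (Finset.sum_le_sum fun i hi => hC i hi w)

lemma BM.const_mul {f : Ω → ℝ} (h : BM f) (c : ℝ) : BM fun w => c * f w :=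
  BM.mul ⟨measurable_const, ‖c‖, fun _ => le_rfl⟩ h

lemma BM.rpow {f : Ω → ℝ} (h : BM f) (h0 : ∀ w, 0 ≤ f w) {p : ℝ} (hp : 0 ≤ p) :
    BM fun w => f w ^ p := by
  obtain ⟨hm, C, hC⟩ := h
  refine ⟨hm.pow_const p, C ^ p, fun w => ?_⟩
  rw [Real.norm_of_nonneg (Real.rpow_nonneg (h0 w) p)]
  exact Real.rpow_le_rpow (h0 w) ((Real.le_norm_self _).trans (hC w)) hp

lemma BM.indicator {E : Type*} [NormedAddCommGroup E] [MeasurableSpace E] {f : Ω → E} (h : BM f)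
    {s : Set Ω} (hs : MeasurableSet s) : BM (s.indicator f) := by
  obtain ⟨hm, C, hC⟩ := h
  exact ⟨hm.indicator hs, C, fun w => (norm_indicator_le_norm_self f w).trans (hC w)⟩

/-- Parseval's identity. -/
lemma integral_norm_trig_sq (S : Finset (ℤ × ℤ)) (a : ℤ × ℤ → ℂ) :
    ∫ w, ‖T.trig S a w‖ ^ 2 ∂T.μ = nsq S a := by
  have h : ∀ w, ((‖T.trig S a w‖ ^ 2 : ℝ) : ℂ) =
      ∑ k ∈ S, ∑ l ∈ S, a k * (starRingEnd ℂ) (a l) * T.chr (k - l) w := by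
    intro w
    rw [← Complex.normSq_eq_norm_sq, ← Complex.mul_conj, Torus.trig, map_sum,
      Finset.sum_mul_sum]
    refine Finset.sum_congr rfl fun k _ => Finset.sum_congr rfl fun l _ => ?_
    rw [map_mul, chr_conj, sub_eq_add_neg, chr_add]; ring
  have hi : ∀ (c : ℂ) (k : ℤ × ℤ), Integrable (fun w => c * T.chr k w) T.μ := fun c k =>
    integrable_of_bdd (by fun_prop) ‖c‖ (by simp)
  apply Complex.ofReal_injective
  rw [← integral_complex_ofReal]
  simp_rw [h]
  rw [integral_finsetSum _ fun k _ => integrable_finsetSum _ fun l _ => hi _ _]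
  simp_rw [integral_finsetSum _ fun l (_ : l ∈ S) => hi _ _, integral_const_mul, integral_chr,
    sub_eq_zero, mul_ite, mul_one, mul_zero]
  simp only [Finset.sum_ite_eq, nsq]
  push_cast
  refine Finset.sum_congr rfl fun k hk => ?_
  rw [if_pos hk, Complex.mul_conj, Complex.normSq_eq_norm_sq]; push_cast; rfl

/-- Almost orthogonality: a family whose members are orthogonal, with weight `G`, as soon as their
indices differ by more than `R`. -/
lemma integral_norm_sum_sq_le (J : Finset ℤ) (F : ℤ → Ω → ℂ) (G : Ω → ℝ) (R : ℕ)
    (hF : ∀ i, BM (F i)) (hG : BM G) (hG0 : ∀ w, 0 ≤ G w)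
    (h : ∀ i ∈ J, ∀ j ∈ J, (R : ℤ) < |i - j| →
      ∫ w, F i w * (starRingEnd ℂ) (F j w) * (G w : ℂ) ∂T.μ = 0) :
    ∫ w, ‖∑ i ∈ J, F i w‖ ^ 2 * G w ∂T.μ ≤
      (2 * R + 1) * ∑ i ∈ J, ∫ w, ‖F i w‖ ^ 2 * G w ∂T.μ := by
  have hI : ∀ i j, Integrable (fun w => F i w * (starRingEnd ℂ) (F j w) * (G w : ℂ)) T.μ :=
    fun i j => (((hF i).mul (hF j).conj).mul hG.ofReal).integrable_complex
  have hN : ∀ i, Integrable (fun w => ‖F i w‖ ^ 2 * G w) T.μ := fun i =>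
    (((hF i).norm.pow 2).mul hG).integrable
  have e1 : ∀ w, ((‖∑ i ∈ J, F i w‖ ^ 2 * G w : ℝ) : ℂ) =
      ∑ i ∈ J, ∑ j ∈ J, F i w * (starRingEnd ℂ) (F j w) * (G w : ℂ) := by
    intro w
    rw [Complex.ofReal_mul, ← Complex.normSq_eq_norm_sq, ← Complex.mul_conj, map_sum,
      Finset.sum_mul_sum, Finset.sum_mul]
    exact Finset.sum_congr rfl fun i _ => Finset.sum_mul _ _ _
  have e2 : ∫ w, ‖∑ i ∈ J, F i w‖ ^ 2 * G w ∂T.μ =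
      ∑ i ∈ J, ∑ j ∈ J, (∫ w, F i w * (starRingEnd ℂ) (F j w) * (G w : ℂ) ∂T.μ).re := by
    have : ((∫ w, ‖∑ i ∈ J, F i w‖ ^ 2 * G w ∂T.μ : ℝ) : ℂ) =
        ∑ i ∈ J, ∑ j ∈ J, ∫ w, F i w * (starRingEnd ℂ) (F j w) * (G w : ℂ) ∂T.μ := by
      rw [← integral_complex_ofReal]
      simp_rw [e1]
      rw [integral_finsetSum _ fun i _ => integrable_finsetSum _ fun j _ => hI i j]
      exact Finset.sum_congr rfl fun i _ => integral_finsetSum _ fun j _ => hI i j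
    have h3 := congrArg Complex.re this
    simpa using h3
  rw [e2]
  have e3 : ∀ i ∈ J, ∀ j ∈ J, (∫ w, F i w * (starRingEnd ℂ) (F j w) * (G w : ℂ) ∂T.μ).re ≤
      if |i - j| ≤ (R : ℤ) then ((∫ w, ‖F i w‖ ^ 2 * G w ∂T.μ) +
        ∫ w, ‖F j w‖ ^ 2 * G w ∂T.μ) / 2 else 0 := by
    intro i hi j hj
    split_ifs with hij
    · refine (Complex.re_le_norm _).trans ((norm_integral_le_integral_norm _).trans ?_)
      rw [← integral_add (hN i) (hN j), ← integral_div]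
      refine integral_mono (hI i j).norm (((hN i).add (hN j)).div_const 2) fun w => ?_
      simp only [norm_mul, RCLike.norm_conj]
      rw [Complex.norm_real, Real.norm_of_nonneg (hG0 w)]
      nlinarith [mul_nonneg (sq_nonneg (‖F i w‖ - ‖F j w‖)) (hG0 w)]
    · rw [h i hi j hj (not_le.1 hij)]; simp
  have hc : ∀ i : ℤ, ((J.filter fun j => |i - j| ≤ (R : ℤ)).card : ℝ) ≤ 2 * R + 1 := by
    intro i
    have : (J.filter fun j => |i - j| ≤ (R : ℤ)) ⊆ Finset.Icc (i - R) (i + R) := by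
      intro j hj
      have := abs_le.1 (Finset.mem_filter.1 hj).2
      rw [Finset.mem_Icc]; omega
    have := Finset.card_le_card this
    rw [Int.card_Icc] at this
    have h2 : (J.filter fun j => |i - j| ≤ (R : ℤ)).card ≤ 2 * R + 1 := by omega
    exact_mod_cast h2
  set N : ℤ → ℝ := fun i => ∫ w, ‖F i w‖ ^ 2 * G w ∂T.μ with hNdef
  have hN0 : ∀ i, 0 ≤ N i := fun i => integral_nonneg fun w => mul_nonneg (by positivity) (hG0 w)
  have half : ∀ i ∈ J, (∑ j ∈ J, if |i - j| ≤ (R : ℤ) then N i / 2 else 0) ≤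
      (2 * R + 1) * (N i / 2) := by
    intro i _
    rw [← Finset.sum_filter, Finset.sum_const, nsmul_eq_mul]
    exact mul_le_mul_of_nonneg_right (hc i) (by have := hN0 i; positivity)
  calc _ ≤ ∑ i ∈ J, ∑ j ∈ J, if |i - j| ≤ (R : ℤ) then (N i + N j) / 2 else 0 :=
        Finset.sum_le_sum fun i hi => Finset.sum_le_sum fun j hj => e3 i hi j hj
    _ = (∑ i ∈ J, ∑ j ∈ J, if |i - j| ≤ (R : ℤ) then N i / 2 else 0) +
        ∑ i ∈ J, ∑ j ∈ J, if |j - i| ≤ (R : ℤ) then N j / 2 else 0 := by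
      rw [← Finset.sum_add_distrib]
      refine Finset.sum_congr rfl fun i _ => ?_
      rw [← Finset.sum_add_distrib]
      refine Finset.sum_congr rfl fun j _ => ?_
      rw [abs_sub_comm j i]
      split_ifs <;> ring
    _ ≤ ∑ i ∈ J, (2 * R + 1) * (N i / 2) + ∑ i ∈ J, (2 * R + 1) * (N i / 2) :=
      add_le_add (Finset.sum_le_sum half)
        (by rw [Finset.sum_comm]; exact Finset.sum_le_sum half)
    _ = _ := by
      rw [← Finset.sum_add_distrib, Finset.mul_sum]
      exact Finset.sum_congr rfl fun i _ => by ring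

end

section

variable {Ω : Type*} [MeasurableSpace Ω] {T : Torus Ω}

/-! ### Elementary counting -/

lemma card_le_of_diff_le (s : Finset ℤ) {l : ℝ} (hl : 0 ≤ l)
    (h : ∀ x ∈ s, ∀ y ∈ s, (x : ℝ) - y ≤ l) : (s.card : ℝ) ≤ l + 1 := by
  rcases s.eq_empty_or_nonempty with rfl | hs
  · simp; linarith
  have hsub : s ⊆ Finset.Icc (s.min' hs) (s.max' hs) := fun x hx =>
    Finset.mem_Icc.2 ⟨s.min'_le x hx, s.le_max' x hx⟩
  have h1 := Finset.card_le_card hsub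
  rw [Int.card_Icc] at h1
  have h2 := h _ (s.max'_mem hs) _ (s.min'_mem hs)
  have h3 : (s.card : ℤ) ≤ s.max' hs - s.min' hs + 1 := by
    have := s.min'_le_max' hs
    omega
  have h4 : (s.card : ℝ) ≤ ((s.max' hs - s.min' hs + 1 : ℤ) : ℝ) := by exact_mod_cast h3
  push_cast at h4
  linarith

lemma card_le_of_dist_le (s : Finset ℤ) (c : ℝ) {r : ℝ} (hr : 0 ≤ r)
    (h : ∀ x ∈ s, |(x : ℝ) - c| ≤ r) : (s.card : ℝ) ≤ 2 * r + 1 :=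
  card_le_of_diff_le s (by positivity) fun x hx y hy => by
    have := abs_le.1 (h x hx)
    have := abs_le.1 (h y hy)
    linarith

lemma card_le_mul_card_image' {α β : Type*} [DecidableEq β] (s : Finset α) (f : α → β) {c : ℝ}
    (h : ∀ b ∈ s.image f, ((s.filter fun a => f a = b).card : ℝ) ≤ c) :
    (s.card : ℝ) ≤ c * (s.image f).card := by
  rw [Finset.card_eq_sum_card_image f s]
  push_cast
  refine (Finset.sum_le_sum h).trans (le_of_eq ?_)
  rw [Finset.sum_const, nsmul_eq_mul, mul_comm]

lemma sum_comp_le {α β : Type*} [DecidableEq β] (s : Finset α) (t : Finset β) (f : α → β)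
    (hf : ∀ a ∈ s, f a ∈ t) (φ : β → ℝ) (hφ : ∀ b, 0 ≤ φ b) {c : ℝ}
    (h : ∀ b ∈ t, ((s.filter fun a => f a = b).card : ℝ) ≤ c) :
    ∑ a ∈ s, φ (f a) ≤ c * ∑ b ∈ t, φ b := by
  rw [← Finset.sum_fiberwise_of_maps_to hf, Finset.mul_sum]
  refine Finset.sum_le_sum fun b hb => ?_
  calc ∑ a ∈ s.filter (fun a => f a = b), φ (f a)
      = ∑ a ∈ s.filter (fun a => f a = b), φ b :=
        Finset.sum_congr rfl fun a ha => by rw [(Finset.mem_filter.1 ha).2]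
    _ = (s.filter fun a => f a = b).card * φ b := by rw [Finset.sum_const, nsmul_eq_mul]
    _ ≤ c * φ b := mul_le_mul_of_nonneg_right (h b hb) (hφ b)

/-! ### Shells around a convex graph -/

/-- `S` lies in the `M δ`-neighbourhood of the graph over `[-M λ, M λ]` of a function `g` whose
curvature is comparable to `1 / λ`, with `ψ` a (sub)gradient of `g`. -/
structure Shell (M lam δ : ℝ) (g ψ : ℝ → ℝ) (S : Finset (ℤ × ℤ)) : Prop where
  one_le_M : 1 ≤ M
  one_le_lam : 1 ≤ lam
  pos : 0 < δ
  le_one : δ ≤ 1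
  one_le_mul : 1 ≤ lam * δ
  fst_le : ∀ k ∈ S, |(k.1 : ℝ)| ≤ M * lam
  near : ∀ k ∈ S, |(k.2 : ℝ) - g k.1| ≤ M * δ
  lower : ∀ u c, |u| ≤ M * lam → |c| ≤ M * lam →
    (u - c) ^ 2 / (M * lam) ≤ g u - g c - ψ c * (u - c)
  upper : ∀ u c, |u| ≤ M * lam → |c| ≤ M * lam →
    g u - g c - ψ c * (u - c) ≤ M * (u - c) ^ 2 / lam
  slope : ∀ c, |c| ≤ M * lam → |ψ c| ≤ M

namespace Shell

variable {M lam δ : ℝ} {g ψ : ℝ → ℝ} {S : Finset (ℤ × ℤ)}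

lemma M_pos (h : Shell M lam δ g ψ S) : 0 < M := by linarith [h.one_le_M]

lemma lam_pos (h : Shell M lam δ g ψ S) : 0 < lam := by linarith [h.one_le_lam]

lemma mono (h : Shell M lam δ g ψ S) {S' : Finset (ℤ × ℤ)} (hS : S' ⊆ S) :
    Shell M lam δ g ψ S' :=
  { h with
    fst_le := fun k hk => h.fst_le k (hS hk)
    near := fun k hk => h.near k (hS hk) }

lemma card_fiber (h : Shell M lam δ g ψ S) (z : ℤ) :
    ((S.filter fun k => k.1 = z).card : ℝ) ≤ 3 * M := by
  have e : (S.filter fun k => k.1 = z).card = ((S.filter fun k => k.1 = z).image Prod.snd).card :=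
    (Finset.card_image_of_injOn fun x hx y hy hxy => by
      simp only [Finset.coe_filter, Set.mem_ofPred_eq] at hx hy
      exact Prod.ext (hx.2.trans hy.2.symm) hxy).symm
  rw [e]
  have hM := h.one_le_M
  have := card_le_of_dist_le ((S.filter fun k => k.1 = z).image Prod.snd) (g z) (r := M)
    (by linarith) (fun x hx => by
      simp only [Finset.mem_image, Finset.mem_filter] at hx
      obtain ⟨k, ⟨hk, rfl⟩, rfl⟩ := hx
      have := h.near k hk
      nlinarith [h.le_one])
  linarith

lemma psi_mono (h : Shell M lam δ g ψ S) {u c : ℝ} (hu : |u| ≤ M * lam) (hc : |c| ≤ M * lam) :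
    2 * (u - c) ^ 2 / (M * lam) ≤ (ψ u - ψ c) * (u - c) := by
  have h1 := h.lower u c hu hc
  have h2 := h.lower c u hc hu
  have e : (c - u) ^ 2 = (u - c) ^ 2 := by ring
  rw [e] at h2
  have : 2 * (u - c) ^ 2 / (M * lam) = (u - c) ^ 2 / (M * lam) + (u - c) ^ 2 / (M * lam) := by
    ring
  rw [this]; linarith

/-- Convexity of `u ↦ g (m + u) + g (m - u)`. -/
lemma symm_convex (h : Shell M lam δ g ψ S) {m s t : ℝ} (ht : 0 ≤ t) (hts : t ≤ s)
    (h1 : |m + s| ≤ M * lam) (h2 : |m - s| ≤ M * lam) :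
    2 * (s ^ 2 - t ^ 2) / (M * lam) ≤ g (m + s) + g (m - s) - (g (m + t) + g (m - t)) := by
  have h3 : |m + t| ≤ M * lam := by
    rw [abs_le] at *; constructor <;> linarith
  have h4 : |m - t| ≤ M * lam := by
    rw [abs_le] at *; constructor <;> linarith
  have hp : 0 < M * lam := mul_pos h.M_pos h.lam_pos
  have a1 := h.lower _ _ h1 h3
  have a2 := h.lower _ _ h2 h4
  have a3 : 2 * (2 * t) * (s - t) / (M * lam) ≤ (ψ (m + t) - ψ (m - t)) * (s - t) := by
    rcases ht.eq_or_lt with rfl | ht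
    · simp
    have := h.psi_mono h3 h4
    have e : 2 * (2 * t) / (M * lam) ≤ ψ (m + t) - ψ (m - t) := by
      rw [show m + t - (m - t) = 2 * t by ring] at this
      have h5 : 2 * (2 * t) ^ 2 / (M * lam) = (2 * (2 * t) / (M * lam)) * (2 * t) := by ring
      rw [h5] at this
      exact le_of_mul_le_mul_right this (by positivity)
    have := mul_le_mul_of_nonneg_right e (sub_nonneg.2 hts)
    calc _ = 2 * (2 * t) / (M * lam) * (s - t) := by ring
      _ ≤ _ := this
  have e : 2 * (s ^ 2 - t ^ 2) / (M * lam) = (s - t) ^ 2 / (M * lam) + (s - t) ^ 2 / (M * lam) +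
      2 * (2 * t) * (s - t) / (M * lam) := by ring
  rw [e]
  rw [show m + s - (m + t) = s - t by ring] at a1
  rw [show (m - s - (m - t)) ^ 2 = (s - t) ^ 2 by ring] at a2
  linarith

/-- Two representations of the same vector as a sum of two points of the shell have nearly the
same gap. -/
lemma gap_sq_sub_le (h : Shell M lam δ g ψ S) {k k' l l' : ℤ × ℤ} (hk : k ∈ S) (hk' : k' ∈ S)
    (hl : l ∈ S) (hl' : l' ∈ S) (e : k + k' = l + l') :
    ((l.1 : ℝ) - l'.1) ^ 2 - ((k.1 : ℝ) - k'.1) ^ 2 ≤ 8 * M ^ 2 * (lam * δ) := by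
  have hp : 0 < M * lam := mul_pos h.M_pos h.lam_pos
  by_contra! hlt
  set s : ℝ := |((l.1 : ℝ) - l'.1) / 2| with hs
  set t : ℝ := |((k.1 : ℝ) - k'.1) / 2| with ht
  set m : ℝ := ((k.1 : ℝ) + k'.1) / 2 with hm
  have e1 : (k.1 : ℝ) + k'.1 = l.1 + l'.1 := by exact_mod_cast congrArg Prod.fst e
  have e2 : (k.2 : ℝ) + k'.2 = l.2 + l'.2 := by exact_mod_cast congrArg Prod.snd e
  have hs2 : s ^ 2 = (((l.1 : ℝ) - l'.1) / 2) ^ 2 := sq_abs _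
  have ht2 : t ^ 2 = (((k.1 : ℝ) - k'.1) / 2) ^ 2 := sq_abs _
  have hP : 0 ≤ M ^ 2 * (lam * δ) := by have := h.one_le_mul; positivity
  have hst : t ≤ s := abs_le_of_sq_le_sq' (by nlinarith) (abs_nonneg _) |>.2
  have key : ∀ p q : ℤ × ℤ, p ∈ S → q ∈ S → (p.1 : ℝ) + q.1 = 2 * m →
      |m + abs (((p.1 : ℝ) - q.1) / 2)| ≤ M * lam ∧ |m - abs (((p.1 : ℝ) - q.1) / 2)| ≤ M * lam ∧
      |g (m + abs (((p.1 : ℝ) - q.1) / 2)) + g (m - abs (((p.1 : ℝ) - q.1) / 2)) - (p.2 + q.2)| ≤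
        2 * M * δ := by
    intro p q hpS hqS hpq
    have f1 := h.fst_le p hpS
    have f2 := h.fst_le q hqS
    have n1 := abs_le.1 (h.near p hpS)
    have n2 := abs_le.1 (h.near q hqS)
    rcases abs_choice (((p.1 : ℝ) - q.1) / 2) with h0 | h0 <;> rw [h0]
    · rw [show m + ((p.1 : ℝ) - q.1) / 2 = p.1 by linarith,
        show m - ((p.1 : ℝ) - q.1) / 2 = q.1 by linarith]
      exact ⟨f1, f2, abs_le.2 ⟨by linarith, by linarith⟩⟩
    · rw [show m + -(((p.1 : ℝ) - q.1) / 2) = q.1 by linarith,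
        show m - -(((p.1 : ℝ) - q.1) / 2) = p.1 by linarith]
      exact ⟨f2, f1, abs_le.2 ⟨by linarith, by linarith⟩⟩
  obtain ⟨b1, b2, b3⟩ := key l l' hl hl' (by rw [hm]; linarith)
  obtain ⟨c1, c2, c3⟩ := key k k' hk hk' (by rw [hm]; linarith)
  have := h.symm_convex (abs_nonneg _) hst b1 b2
  rw [abs_le] at b3 c3
  have h5 : 2 * (s ^ 2 - t ^ 2) / (M * lam) ≤ 4 * M * δ := by linarith
  rw [div_le_iff₀ hp, hs2, ht2] at h5
  nlinarith

lemma card_rep_le (h : Shell M lam δ g ψ S) {k k' : ℤ × ℤ} (hk : k ∈ S) (hk' : k' ∈ S) :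
    ((S.filter fun l => k + k' - l ∈ S).card : ℝ) ≤
      108 * M ^ 3 * (1 + lam * δ / (1 + |(k.1 : ℝ) - k'.1|)) := by
  set R := S.filter fun l => k + k' - l ∈ S with hR
  set D : ℝ := |(k.1 : ℝ) - k'.1| with hD
  set P := lam * δ with hP
  have hM := h.one_le_M
  have hP1 : 1 ≤ P := h.one_le_mul
  have hD0 : 0 ≤ D := abs_nonneg _
  set W : ℝ := 16 * M ^ 2 * P / (1 + D) with hW
  have hW0 : 0 ≤ W := by positivity
  have hD2 : D ^ 2 = ((k.1 : ℝ) - k'.1) ^ 2 := sq_abs _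
  have hMP : 1 ≤ M ^ 2 * P := by
    have : 1 ≤ M ^ 2 := by nlinarith
    nlinarith
  have gap : ∀ z ∈ R.image Prod.fst, |(|2 * (z : ℝ) - (k.1 + k'.1)|) - D| ≤ W := by
    intro z hz
    obtain ⟨l, hl, rfl⟩ := Finset.mem_image.1 hz
    obtain ⟨hlS, hl'⟩ := Finset.mem_filter.1 hl
    have a1 := h.gap_sq_sub_le hk hk' hlS hl' (by abel)
    have a2 := h.gap_sq_sub_le hlS hl' hk hk' (by abel)
    simp only [Prod.fst_sub, Prod.fst_add] at a1 a2
    push_cast at a1 a2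
    set x : ℝ := |2 * (l.1 : ℝ) - (k.1 + k'.1)| with hx
    have hx0 : 0 ≤ x := abs_nonneg _
    have hx2 : x ^ 2 = ((l.1 : ℝ) - (k.1 + k'.1 - l.1)) ^ 2 := by
      rw [hx, sq_abs]; ring
    rw [← hx2, ← hD2] at a1 a2
    have hDint : D = 0 ∨ 1 ≤ D := by
      rw [hD]
      rcases eq_or_ne k.1 k'.1 with h0 | h0
      · left; simp [h0]
      · right
        have := Int.one_le_abs (sub_ne_zero.2 h0)
        exact_mod_cast this
    rw [hW, le_div_iff₀ (by positivity)]
    rcases hDint with h0 | h1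
    · rw [h0] at a1 a2 ⊢
      simp only [sub_zero, add_zero, mul_one, abs_of_nonneg hx0]
      nlinarith
    · have h3 : |x - D| * (x + D) ≤ 8 * M ^ 2 * P := by
        rw [← abs_of_nonneg (add_nonneg hx0 hD0), ← abs_mul, abs_le]
        constructor <;> nlinarith
      nlinarith [abs_nonneg (x - D)]
  have count : ((R.image Prod.fst).card : ℝ) ≤ 2 * W + 2 := by
    set I := R.image Prod.fst
    have e := Finset.card_filter_add_card_filter_not (s := I)
      (fun z : ℤ => 0 ≤ 2 * (z : ℝ) - (k.1 + k'.1))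
    have e1 := card_le_of_diff_le (I.filter fun z : ℤ => 0 ≤ 2 * (z : ℝ) - (k.1 + k'.1)) hW0
      (fun x hx y hy => by
        obtain ⟨hx, hx'⟩ := Finset.mem_filter.1 hx
        obtain ⟨hy, hy'⟩ := Finset.mem_filter.1 hy
        have a := abs_le.1 (gap x hx)
        have b := abs_le.1 (gap y hy)
        rw [abs_of_nonneg hx'] at a
        rw [abs_of_nonneg hy'] at b
        linarith)
    have e2 := card_le_of_diff_le (I.filter fun z : ℤ => ¬ 0 ≤ 2 * (z : ℝ) - (k.1 + k'.1)) hW0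
      (fun x hx y hy => by
        obtain ⟨hx, hx'⟩ := Finset.mem_filter.1 hx
        obtain ⟨hy, hy'⟩ := Finset.mem_filter.1 hy
        have a := abs_le.1 (gap x hx)
        have b := abs_le.1 (gap y hy)
        rw [abs_of_neg (not_le.1 hx')] at a
        rw [abs_of_neg (not_le.1 hy')] at b
        linarith)
    rw [← e]
    push_cast
    linarith
  have fib := card_le_mul_card_image' R Prod.fst (c := 3 * M) fun b _ =>
    (Nat.cast_le.2 (Finset.card_le_card (Finset.filter_subset_filter _
      (Finset.filter_subset _ _)))).trans (h.card_fiber b)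
  have hq : 0 ≤ P / (1 + D) := by positivity
  calc (R.card : ℝ) ≤ 3 * M * (2 * W + 2) := fib.trans (by gcongr)
    _ = 6 * M + 96 * (M ^ 3 * (P / (1 + D))) := by rw [hW]; ring
    _ ≤ _ := by
      have : M ≤ M ^ 3 := by nlinarith [sq_nonneg M, mul_pos h.M_pos h.M_pos]
      nlinarith [mul_nonneg (pow_nonneg h.M_pos.le 3) hq]

end Shell

/-! ### A Hausdorff–Young inequality -/

lemma geom_sum_filter_le {s : ℝ} (hs : 0 ≤ s) (I : ℕ) :
    s * ∑ i ∈ (Finset.range I).filter (fun i => 2 ^ i * s ≤ 2), (2 : ℝ) ^ i ≤ 4 := by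
  induction I with
  | zero => simp
  | succ I ih =>
    rw [Finset.range_add_one, Finset.filter_insert]
    split_ifs with h
    · rw [Finset.sum_insert (by simp)]
      have h1 : ∑ i ∈ (Finset.range I).filter (fun i => 2 ^ i * s ≤ 2), (2 : ℝ) ^ i ≤
          ∑ i ∈ Finset.range I, (2 : ℝ) ^ i :=
        Finset.sum_le_sum_of_subset_of_nonneg (Finset.filter_subset _ _)
          fun _ _ _ => by positivity
      have h2 : ∑ i ∈ Finset.range I, (2 : ℝ) ^ i ≤ 2 ^ I := by
        rw [geom_sum_eq (by norm_num)]; norm_num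
      nlinarith
    · exact ih

lemma integral_norm_cube_le_one (A : Finset (ℤ × ℤ)) (c : ℤ × ℤ → ℂ)
    (hc : ∑ n ∈ A, √‖c n‖ ^ 3 ≤ 1) : ∫ w, ‖T.trig A c w‖ ^ 3 ∂T.μ ≤ 33 := by
  obtain ⟨I, hI⟩ := pow_unbounded_of_one_lt (∑ n ∈ A, ‖c n‖) (one_lt_two)
  set B : ℕ → Finset (ℤ × ℤ) := fun i => A.filter fun n => 2 ^ i * √‖c n‖ ≤ 2 with hB
  have pw : ∀ w, ‖T.trig A c w‖ ^ 3 ≤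
      1 + ∑ i ∈ Finset.range I, 8 * 2 ^ i * ‖T.trig (B i) c w‖ ^ 2 := by
    intro w
    set y := ‖T.trig A c w‖ with hy
    have hy0 : 0 ≤ y := norm_nonneg _
    have hs0 : ∀ i ∈ Finset.range I, 0 ≤ 8 * 2 ^ i * ‖T.trig (B i) c w‖ ^ 2 := fun _ _ => by
      positivity
    rcases lt_or_ge y 1 with h1 | h1
    · have := Finset.sum_nonneg hs0
      have : y ^ 3 ≤ 1 := pow_le_one₀ hy0 h1.le
      linarith
    obtain ⟨i, hi1, hi2⟩ := exists_nat_pow_near h1 (one_lt_two)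
    have hyI : y < 2 ^ I := (norm_trig_le_sum A c w).trans_lt hI
    have hiI : i ∈ Finset.range I := by
      rw [Finset.mem_range]
      exact (pow_lt_pow_iff_right₀ (one_lt_two (α := ℝ))).1 (hi1.trans_lt hyI)
    refine le_trans ?_ (le_add_of_nonneg_left zero_le_one)
    refine le_trans ?_ (Finset.single_le_sum hs0 hiI)
    have split : T.trig A c w = T.trig (B i) c w +
        T.trig (A.filter fun n => ¬ 2 ^ i * √‖c n‖ ≤ 2) c w := by
      simp only [Torus.trig, hB]; exact (Finset.sum_filter_add_sum_filter_not _ _ _).symm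
    have big : ‖T.trig (A.filter fun n => ¬ 2 ^ i * √‖c n‖ ≤ 2) c w‖ ≤ 2 ^ i / 2 := by
      refine (norm_trig_le_sum _ _ _).trans ?_
      have : ∀ n ∈ A.filter (fun n => ¬ 2 ^ i * √‖c n‖ ≤ 2),
          ‖c n‖ ≤ 2 ^ i / 2 * √‖c n‖ ^ 3 := by
        intro n hn
        have h3 := (not_le.1 (Finset.mem_filter.1 hn).2).le
        have h4 : ‖c n‖ = √‖c n‖ ^ 2 := (Real.sq_sqrt (norm_nonneg _)).symm
        have h5 := mul_le_mul_of_nonneg_right h3 (sq_nonneg √‖c n‖)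
        nlinarith
      refine (Finset.sum_le_sum this).trans ?_
      rw [← Finset.mul_sum]
      have h6 : ∑ n ∈ A.filter (fun n => ¬ 2 ^ i * √‖c n‖ ≤ 2), √‖c n‖ ^ 3 ≤ 1 :=
        (Finset.sum_le_sum_of_subset_of_nonneg (Finset.filter_subset _ _)
          fun _ _ _ => by positivity).trans hc
      exact mul_le_of_le_one_right (by positivity) h6
    have h7 : y ≤ ‖T.trig (B i) c w‖ + 2 ^ i / 2 := by
      rw [hy, split]; exact (norm_add_le _ _).trans (by gcongr)
    set z := ‖T.trig (B i) c w‖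
    have hp : (0:ℝ) < 2 ^ i := by positivity
    rw [pow_succ] at hi2
    have h8 : y ≤ 2 * z := by linarith
    have h9 : y ^ 2 ≤ (2 * z) ^ 2 := by gcongr
    calc y ^ 3 = y ^ 2 * y := by ring
      _ ≤ (2 * z) ^ 2 * (2 ^ i * 2) := by gcongr
      _ = _ := by ring
  have hint : ∀ i, Integrable (fun w => 8 * 2 ^ i * ‖T.trig (B i) c w‖ ^ 2) T.μ := fun i =>
    (((BM.trig (B i) c).norm.pow 2).const_mul _).integrable
  calc ∫ w, ‖T.trig A c w‖ ^ 3 ∂T.μ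
      ≤ ∫ w, (1 + ∑ i ∈ Finset.range I, 8 * 2 ^ i * ‖T.trig (B i) c w‖ ^ 2) ∂T.μ :=
        integral_mono ((BM.trig A c).norm.pow 3).integrable
          ((integrable_const _).add (integrable_finsetSum _ fun i _ => hint i)) pw
    _ = 1 + ∑ i ∈ Finset.range I, 8 * 2 ^ i * nsq (B i) c := by
      rw [integral_add (integrable_const _) (integrable_finsetSum _ fun i _ => hint i),
        integral_finsetSum _ fun i _ => hint i]
      simp [integral_const_mul, integral_norm_trig_sq]
    _ = 1 + 8 * ∑ n ∈ A, ‖c n‖ ^ 2 * ∑ i ∈ (Finset.range I).filter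
          (fun i => 2 ^ i * √‖c n‖ ≤ 2), (2 : ℝ) ^ i := by
      congr 1
      simp only [nsq, hB, Finset.sum_filter, Finset.mul_sum]
      rw [Finset.sum_comm]
      refine Finset.sum_congr rfl fun n _ => Finset.sum_congr rfl fun i _ => ?_
      split_ifs <;> ring
    _ ≤ 1 + 8 * ∑ n ∈ A, 4 * √‖c n‖ ^ 3 := by
      refine add_le_add_right (mul_le_mul_of_nonneg_left
        (Finset.sum_le_sum fun n hn => ?_) (by norm_num)) 1
      have h4 : ‖c n‖ = √‖c n‖ ^ 2 := (Real.sq_sqrt (norm_nonneg _)).symm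
      have := mul_le_mul_of_nonneg_left (geom_sum_filter_le (Real.sqrt_nonneg ‖c n‖) I)
        (pow_nonneg (Real.sqrt_nonneg ‖c n‖) 3)
      calc _ = √‖c n‖ ^ 3 * (√‖c n‖ * ∑ i ∈ (Finset.range I).filter
            (fun i => 2 ^ i * √‖c n‖ ≤ 2), (2 : ℝ) ^ i) := by
            have h5 : ‖c n‖ ^ 2 = √‖c n‖ ^ 4 := by nth_rewrite 1 [h4]; ring
            rw [h5]; ring
        _ ≤ _ := by linarith
    _ ≤ 33 := by rw [← Finset.mul_sum]; linarith

lemma trig_smul (A : Finset (ℤ × ℤ)) (c : ℤ × ℤ → ℂ) (t : ℂ) (w : Ω) :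
    T.trig A (fun n => t * c n) w = t * T.trig A c w := by
  simp only [Torus.trig, Finset.mul_sum, mul_assoc]

/-- Hausdorff–Young with exponents `3/2` and `3`. -/
lemma integral_norm_cube_le (A : Finset (ℤ × ℤ)) (c : ℤ × ℤ → ℂ) :
    ∫ w, ‖T.trig A c w‖ ^ 3 ∂T.μ ≤ 33 * (∑ n ∈ A, √‖c n‖ ^ 3) ^ 2 := by
  set s := ∑ n ∈ A, √‖c n‖ ^ 3 with hs
  have hs0 : 0 ≤ s := Finset.sum_nonneg fun _ _ => by positivity
  rcases hs0.eq_or_lt with h0 | h0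
  · have hz : ∀ n ∈ A, c n = 0 := fun n hn => by
      have := (Finset.sum_eq_zero_iff_of_nonneg fun _ _ => by positivity).1 h0.symm n hn
      simpa [Real.sqrt_eq_zero] using this
    have : ∀ w, T.trig A c w = 0 := fun w => Finset.sum_eq_zero fun n hn => by simp [hz n hn]
    simp [this, ← h0]
  · set r : ℝ := s ^ (1 / 3 : ℝ) with hr
    have hr0 : 0 < r := Real.rpow_pos_of_pos h0 _
    have hr3 : r ^ 3 = s := by
      rw [hr, ← Real.rpow_natCast, ← Real.rpow_mul hs0]; norm_num
    have hn : ‖((r⁻¹ ^ 2 : ℝ) : ℂ)‖ = r⁻¹ ^ 2 := by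
      rw [Complex.norm_real, Real.norm_of_nonneg (by positivity)]
    have := integral_norm_cube_le_one (T := T) A (fun n => ((r⁻¹ ^ 2 : ℝ) : ℂ) * c n) (by
      have : ∀ n ∈ A, √‖((r⁻¹ ^ 2 : ℝ) : ℂ) * c n‖ ^ 3 = s⁻¹ * √‖c n‖ ^ 3 := fun n _ => by
        rw [norm_mul, hn, Real.sqrt_mul (by positivity), Real.sqrt_sq (by positivity), mul_pow,
          inv_pow, hr3]
      rw [Finset.sum_congr rfl this, ← Finset.mul_sum, ← hs, inv_mul_cancel₀ h0.ne'])
    simp only [trig_smul, norm_mul, hn, mul_pow, integral_const_mul] at this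
    rw [show (r⁻¹ ^ 2) ^ 3 = (s ^ 2)⁻¹ by rw [← hr3, ← pow_mul, ← pow_mul, inv_pow],
      inv_mul_le_iff₀ (by positivity)] at this
    linarith

end

section

variable {Ω : Type*} [MeasurableSpace Ω] {T : Torus Ω}

/-! ### The sixth moment -/

lemma sum_inv_sqrt_le (D : ℕ) : ∑ d ∈ Finset.range D, 1 / √((d : ℝ) + 1) ≤ 2 * √D := by
  induction D with
  | zero => simp
  | succ D ih =>
    rw [Finset.sum_range_succ]
    have h1 : 0 < √((D : ℝ) + 1) := by positivity
    have h2 : √((D : ℝ) + 1) ^ 2 = D + 1 := Real.sq_sqrt (by positivity)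
    have h3 : √(D : ℝ) ^ 2 = D := Real.sq_sqrt (by positivity)
    have h4 : 1 / √((D : ℝ) + 1) ≤ 2 * √((D : ℝ) + 1) - 2 * √(D : ℝ) := by
      rw [div_le_iff₀ h1]; nlinarith [sq_nonneg (√((D : ℝ) + 1) - √(D : ℝ))]
    push_cast
    linarith

lemma sqrt_mul_sum_inv_sqrt_filter_le {t : ℝ} (ht : 0 ≤ t) (D : ℕ) :
    √t * ∑ d ∈ (Finset.range D).filter (fun d : ℕ => ((d : ℝ) + 1) * t ≤ 1),
      1 / √((d : ℝ) + 1) ≤ 2 := by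
  induction D with
  | zero => simp
  | succ D ih =>
    by_cases h : ((D : ℝ) + 1) * t ≤ 1
    · have h1 : ∑ d ∈ (Finset.range (D + 1)).filter (fun d : ℕ => ((d : ℝ) + 1) * t ≤ 1),
          1 / √((d : ℝ) + 1) ≤ ∑ d ∈ Finset.range (D + 1), 1 / √((d : ℝ) + 1) :=
        Finset.sum_le_sum_of_subset_of_nonneg (Finset.filter_subset _ _)
          fun _ _ _ => by positivity
      have h2 := sum_inv_sqrt_le (D + 1)
      have h3 : √t * √((D + 1 : ℕ) : ℝ) ≤ 1 := by
        rw [← Real.sqrt_mul ht]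
        exact Real.sqrt_le_iff.2 ⟨by norm_num, by push_cast; linarith⟩
      calc _ ≤ √t * (2 * √((D + 1 : ℕ) : ℝ)) := by gcongr; exact h1.trans h2
        _ ≤ 2 := by linarith
    · rwa [Finset.range_add_one, Finset.filter_insert, if_neg h]

lemma sum_inv_sq_filter_le (t : ℝ) (D : ℕ) :
    ∑ d ∈ (Finset.range D).filter (fun d : ℕ => 1 < ((d : ℝ) + 1) * t),
      1 / ((d : ℝ) + 1) ^ 2 ≤ 2 * max 0 (t - 1 / (D + 1)) := by
  induction D with
  | zero => simp
  | succ D ih =>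
    rw [Finset.range_add_one, Finset.filter_insert]
    have hD : (0 : ℝ) < D + 1 := by positivity
    have hm : (1 : ℝ) / (D + 2) ≤ 1 / (D + 1) := by gcongr; norm_num
    push_cast
    rw [show (D : ℝ) + 1 + 1 = D + 2 by ring]
    split_ifs with h
    · rw [Finset.sum_insert (by simp)]
      have h1 : 1 / ((D : ℝ) + 1) ≤ t := by rw [div_le_iff₀ hD]; linarith
      rw [max_eq_right (by linarith)] at ih ⊢
      have h2 : 1 / ((D : ℝ) + 1) ^ 2 ≤ 2 * (1 / (D + 1) - 1 / (D + 2)) := by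
        rw [div_sub_div _ _ (by positivity) (by positivity), ← mul_div_assoc,
          div_le_div_iff₀ (by positivity) (by positivity)]
        nlinarith
      linarith
    · refine ih.trans ?_
      gcongr

lemma Shell.card_fiber_dist {M lam δ : ℝ} {g ψ : ℝ → ℝ} {S : Finset (ℤ × ℤ)}
    (h : Shell M lam δ g ψ S) (k : ℤ × ℤ) (d : ℕ) :
    ((S.filter fun l => (k.1 - l.1).natAbs = d).card : ℝ) ≤ 6 * M := by
  have hsub : (S.filter fun l => (k.1 - l.1).natAbs = d) ⊆
      (S.filter fun l => l.1 = k.1 - d) ∪ (S.filter fun l => l.1 = k.1 + d) := by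
    intro l hl
    simp only [Finset.mem_union, Finset.mem_filter] at hl ⊢
    obtain ⟨hlS, hl⟩ := hl
    have : l.1 = k.1 - d ∨ l.1 = k.1 + d := by omega
    exact this.imp (⟨hlS, ·⟩) (⟨hlS, ·⟩)
  have h1 := (Finset.card_le_card hsub).trans (Finset.card_union_le _ _)
  have h2 := h.card_fiber (k.1 - d)
  have h3 := h.card_fiber (k.1 + d)
  have h4 : ((S.filter fun l => (k.1 - l.1).natAbs = d).card : ℝ) ≤
      (S.filter fun l => l.1 = k.1 - d).card + (S.filter fun l => l.1 = k.1 + d).card := by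
    exact_mod_cast h1
  linarith

/-- A discrete Hardy–Littlewood–Sobolev inequality. -/
lemma Shell.sum_sum_div_sqrt_le {M lam δ : ℝ} {g ψ : ℝ → ℝ} {S : Finset (ℤ × ℤ)}
    (h : Shell M lam δ g ψ S) (b : ℤ × ℤ → ℝ) (hb : ∀ k, 0 ≤ b k) (hS : ∑ k ∈ S, b k ^ 4 ≤ 1) :
    ∑ k ∈ S, ∑ l ∈ S, b k ^ 3 * b l ^ 3 * (1 / √(((k.1 - l.1).natAbs : ℝ) + 1)) ≤ 50 * M := by
  set v : ℕ → ℝ := fun d => 1 / √((d : ℝ) + 1) with hv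
  have hv0 : ∀ d, 0 ≤ v d := fun d => by positivity
  have hv4 : ∀ d, v d ^ 4 = 1 / ((d : ℝ) + 1) ^ 2 := fun d => by
    rw [hv, div_pow, one_pow, show √((d : ℝ) + 1) ^ 4 = (√((d : ℝ) + 1) ^ 2) ^ 2 by ring,
      Real.sq_sqrt (by positivity)]
  set φ : ℝ → ℕ → ℝ := fun x d =>
    x ^ 6 * (if ((d : ℝ) + 1) * x ^ 4 ≤ 1 then v d else 0) +
      if 1 < ((d : ℝ) + 1) * x ^ 4 then v d ^ 4 else 0 with hφ
  have hφ0 : ∀ x, 0 ≤ x → ∀ d, 0 ≤ φ x d := fun x hx d => by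
    have := hv0 d
    simp only [hφ]; split_ifs <;> positivity
  set H : ℤ × ℤ → ℤ × ℤ → ℝ := fun k l => b k ^ 4 * b l ^ 4 + φ (b k) (k.1 - l.1).natAbs with hH
  have hH0 : ∀ k l, 0 ≤ H k l := fun k l =>
    add_nonneg (by have := hb k; have := hb l; positivity) (hφ0 _ (hb k) _)
  have one_side : ∀ k l, b l ≤ b k → b k ^ 3 * b l ^ 3 * v (k.1 - l.1).natAbs ≤ H k l := by
    intro k l hkl
    have h1 := hb k
    have h2 := hb l
    set d := (k.1 - l.1).natAbs
    have h3 := hv0 d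
    simp only [hH, hφ]
    rcases le_or_gt (((d : ℝ) + 1) * b k ^ 4) 1 with h4 | h4
    · rw [if_pos h4, if_neg (not_lt.2 h4)]
      have : b k ^ 3 * b l ^ 3 * v d ≤ b k ^ 3 * b k ^ 3 * v d := by gcongr
      have : 0 ≤ b k ^ 4 * b l ^ 4 := by positivity
      nlinarith
    · rw [if_neg (not_le.2 h4), if_pos h4]
      set q := b k * b l
      have hq : 0 ≤ q := by positivity
      rw [show b k ^ 3 * b l ^ 3 = q ^ 3 by ring, show b k ^ 4 * b l ^ 4 = q ^ 4 by ring]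
      rcases le_total q (v d) with h5 | h5
      · have : q ^ 3 * v d ≤ v d ^ 3 * v d := by gcongr
        nlinarith [pow_nonneg hq 4]
      · have : q ^ 3 * v d ≤ q ^ 3 * q := by gcongr
        nlinarith [pow_nonneg h3 4]
  have both : ∀ k l, b k ^ 3 * b l ^ 3 * v (k.1 - l.1).natAbs ≤ H k l + H l k := by
    intro k l
    rcases le_total (b l) (b k) with h1 | h1
    · linarith [one_side k l h1, hH0 l k]
    · have := one_side l k h1
      rw [show (l.1 - k.1).natAbs = (k.1 - l.1).natAbs by omega, mul_comm (b l ^ 3)] at this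
      linarith [hH0 k l]
  have inner : ∀ k ∈ S, ∑ l ∈ S, H k l ≤ b k ^ 4 + 24 * M * b k ^ 4 := by
    intro k hk
    have hbk := hb k
    simp only [hH, Finset.sum_add_distrib, ← Finset.mul_sum]
    refine add_le_add (mul_le_of_le_one_right (by positivity) hS) ?_
    set D := (S.image fun l => (k.1 - l.1).natAbs).sup id + 1 with hD
    have := sum_comp_le S (Finset.range D) (fun l => (k.1 - l.1).natAbs) (fun l hl => by
      rw [Finset.mem_range, hD]
      exact Nat.lt_succ_of_le (Finset.le_sup (f := id) (Finset.mem_image_of_mem _ hl)))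
      (φ (b k)) (hφ0 _ hbk) (c := 6 * M) (fun d _ => h.card_fiber_dist k d)
    refine this.trans ?_
    have e : ∑ d ∈ Finset.range D, φ (b k) d ≤ 4 * b k ^ 4 := by
      simp only [hφ, Finset.sum_add_distrib, ← Finset.mul_sum, ← Finset.sum_filter]
      have a1 := sqrt_mul_sum_inv_sqrt_filter_le (t := b k ^ 4) (by positivity) D
      rw [show b k ^ 4 = (b k ^ 2) ^ 2 by ring, Real.sqrt_sq (by positivity),
        show (b k ^ 2) ^ 2 = b k ^ 4 by ring] at a1
      have a2 := sum_inv_sq_filter_le (b k ^ 4) D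
      have a3 : max 0 (b k ^ 4 - 1 / ((D : ℝ) + 1)) ≤ b k ^ 4 :=
        max_le (by positivity) (by have : 0 ≤ 1 / ((D : ℝ) + 1) := by positivity
                                   linarith)
      simp only [hv4]
      have a4 := mul_le_mul_of_nonneg_left a1 (pow_nonneg hbk 4)
      simp only [hv]
      nlinarith
    nlinarith [h.M_pos]
  have tot : ∑ k ∈ S, ∑ l ∈ S, H k l ≤ 25 * M := by
    refine (Finset.sum_le_sum inner).trans ?_
    rw [Finset.sum_add_distrib, ← Finset.mul_sum]
    nlinarith [h.one_le_M]
  calc _ ≤ ∑ k ∈ S, ∑ l ∈ S, (H k l + H l k) :=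
        Finset.sum_le_sum fun k _ => Finset.sum_le_sum fun l _ => both k l
    _ = ∑ k ∈ S, ∑ l ∈ S, H k l + ∑ k ∈ S, ∑ l ∈ S, H k l := by
      simp only [Finset.sum_add_distrib]
      congr 1
      exact Finset.sum_comm
    _ ≤ _ := by linarith

lemma sqrt_norm_sum_cube_le {α : Type*} (s : Finset α) (z : α → ℂ) :
    √‖∑ p ∈ s, z p‖ ^ 3 ≤ √(s.card : ℝ) * ∑ p ∈ s, √‖z p‖ ^ 3 := by
  have e : ∀ x : ℝ, 0 ≤ x → √x ^ 3 = x ^ (3 / 2 : ℝ) := fun x hx => by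
    rw [Real.sqrt_eq_rpow, ← Real.rpow_natCast, ← Real.rpow_mul hx]; norm_num
  have h := Real.rpow_sum_le_const_mul_sum_rpow s (fun p => ‖z p‖) (p := 3 / 2) (by norm_num)
  simp only [abs_norm] at h
  rw [e _ (norm_nonneg _), Real.sqrt_eq_rpow]
  simp only [e _ (norm_nonneg _)]
  calc _ ≤ (∑ p ∈ s, ‖z p‖) ^ (3 / 2 : ℝ) := by gcongr; exact norm_sum_le _ _
    _ ≤ _ := by convert h using 3; norm_num

/-- The sixth moment over a shell with `N` points is at most `C (N + λδ)`. -/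
lemma Shell.integral_norm_pow_six_le {M lam δ : ℝ} {g ψ : ℝ → ℝ} {S : Finset (ℤ × ℤ)}
    (h : Shell M lam δ g ψ S) (a : ℤ × ℤ → ℂ) (ha : nsq S a ≤ 1) :
    ∫ w, ‖T.trig S a w‖ ^ 6 ∂T.μ ≤ 2 * 10 ^ 7 * M ^ 6 * (S.card + lam * δ) := by
  have hM := h.one_le_M
  have hP := h.one_le_mul
  set b : ℤ × ℤ → ℝ := fun k => √‖a k‖ with hb
  have hb0 : ∀ k, 0 ≤ b k := fun k => Real.sqrt_nonneg _
  have hb4 : ∑ k ∈ S, b k ^ 4 ≤ 1 := by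
    refine le_trans (le_of_eq (Finset.sum_congr rfl fun k _ => ?_)) ha
    rw [hb, show √‖a k‖ ^ 4 = (√‖a k‖ ^ 2) ^ 2 by ring, Real.sq_sqrt (norm_nonneg _)]
  set A : Finset (ℤ × ℤ) := (S ×ˢ S).image fun p => p.1 + p.2 with hA
  set F : ℤ × ℤ → Finset ((ℤ × ℤ) × (ℤ × ℤ)) := fun n =>
    (S ×ˢ S).filter fun p => p.1 + p.2 = n with hF
  set c : ℤ × ℤ → ℂ := fun n => ∑ p ∈ F n, a p.1 * a p.2 with hc
  have sq : ∀ w, T.trig S a w ^ 2 = T.trig A c w := by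
    intro w
    have e1 : T.trig S a w ^ 2 = ∑ p ∈ S ×ˢ S, a p.1 * a p.2 * T.chr (p.1 + p.2) w := by
      rw [pow_two, Torus.trig, Finset.sum_mul_sum, ← Finset.sum_product']
      exact Finset.sum_congr rfl fun p _ => by rw [chr_add]; ring
    rw [e1, Torus.trig, ← Finset.sum_fiberwise_of_maps_to
      (g := fun p : (ℤ × ℤ) × (ℤ × ℤ) => p.1 + p.2)
      fun p (hp : p ∈ S ×ˢ S) => Finset.mem_image_of_mem _ hp]
    refine Finset.sum_congr rfl fun n _ => ?_
    simp only [hc, Finset.sum_mul]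
    exact Finset.sum_congr rfl fun p hp => by rw [(Finset.mem_filter.1 hp).2]
  have six : ∀ w, ‖T.trig S a w‖ ^ 6 = ‖T.trig A c w‖ ^ 3 := fun w => by
    rw [← sq, norm_pow, ← pow_mul]
  simp only [six]
  refine (integral_norm_cube_le A c).trans ?_
  have hr : ∀ n, ∀ p ∈ F n, √((F n).card : ℝ) ≤
      11 * M ^ 2 * (1 + √(lam * δ) * (1 / √(((p.1.1 - p.2.1).natAbs : ℝ) + 1))) := by
    intro n p hp
    obtain ⟨hpS, hpn⟩ := Finset.mem_filter.1 hp
    obtain ⟨hp1, hp2⟩ := Finset.mem_product.1 hpS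
    have h1 : (F n).card ≤ (S.filter fun l => p.1 + p.2 - l ∈ S).card := by
      refine Finset.card_le_card_of_injOn Prod.fst ?_ ?_
      · intro q hq
        obtain ⟨hqS, hqn⟩ := Finset.mem_filter.1 hq
        obtain ⟨hq1, hq2⟩ := Finset.mem_product.1 hqS
        refine Finset.mem_filter.2 ⟨hq1, ?_⟩
        rw [hpn, ← hqn, add_sub_cancel_left]; exact hq2
      · intro q hq q' hq' e
        have e1 := (Finset.mem_filter.1 hq).2
        have e2 := (Finset.mem_filter.1 hq').2
        refine Prod.ext e ?_
        have e3 : q.1 + q.2 = q'.1 + q'.2 := e1.trans e2.symm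
        rw [e] at e3
        exact add_left_cancel e3
    have h2 := h.card_rep_le hp1 hp2
    have h3 : |(p.1.1 : ℝ) - p.2.1| = ((p.1.1 - p.2.1).natAbs : ℝ) := by
      rw [Nat.cast_natAbs]; push_cast; rfl
    rw [h3] at h2
    set d : ℝ := ((p.1.1 - p.2.1).natAbs : ℝ)
    have hd : 0 ≤ d := Nat.cast_nonneg _
    rw [Real.sqrt_le_left (by positivity)]
    have h4 : ((F n).card : ℝ) ≤ 108 * M ^ 3 * (1 + lam * δ / (1 + d)) :=
      (Nat.cast_le.2 h1).trans h2
    have h5 : √(lam * δ) ^ 2 = lam * δ := Real.sq_sqrt (by linarith)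
    have h6 : (1 / √(d + 1)) ^ 2 = 1 / (1 + d) := by
      rw [div_pow, one_pow, Real.sq_sqrt (by positivity), add_comm]
    have h7 : 0 ≤ √(lam * δ) * (1 / √(d + 1)) := by positivity
    have h8 : (√(lam * δ) * (1 / √(d + 1))) ^ 2 = lam * δ / (1 + d) := by
      rw [mul_pow, h5, h6]; ring
    refine h4.trans ?_
    rw [mul_pow, mul_pow, ← h8]
    set y := √(lam * δ) * (1 / √(d + 1))
    have h9 : M ^ 3 ≤ (M ^ 2) ^ 2 := by nlinarith [pow_pos h.M_pos 3]
    have h10 : 1 + y ^ 2 ≤ (1 + y) ^ 2 := by nlinarith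
    have h11 : 0 ≤ M ^ 3 := pow_nonneg h.M_pos.le 3
    calc 108 * M ^ 3 * (1 + y ^ 2) ≤ 108 * (M ^ 2) ^ 2 * (1 + y) ^ 2 := by gcongr
      _ ≤ _ := by
        have : 0 ≤ (M ^ 2) ^ 2 * (1 + y) ^ 2 := by positivity
        nlinarith
  have main : ∑ n ∈ A, √‖c n‖ ^ 3 ≤ 11 * M ^ 2 * (√(S.card : ℝ) + √(lam * δ) * (50 * M)) := by
    have h1 : ∀ n ∈ A, √‖c n‖ ^ 3 ≤ ∑ p ∈ F n, 11 * M ^ 2 *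
        (1 + √(lam * δ) * (1 / √(((p.1.1 - p.2.1).natAbs : ℝ) + 1))) *
          (b p.1 ^ 3 * b p.2 ^ 3) := by
      intro n _
      refine (sqrt_norm_sum_cube_le (F n) fun p => a p.1 * a p.2).trans ?_
      rw [Finset.mul_sum]
      refine Finset.sum_le_sum fun p hp => ?_
      rw [norm_mul, Real.sqrt_mul (norm_nonneg _), mul_pow]
      exact mul_le_mul_of_nonneg_right (hr n p hp) (by positivity)
    refine (Finset.sum_le_sum h1).trans ?_
    rw [Finset.sum_fiberwise_of_maps_to (g := fun p : (ℤ × ℤ) × (ℤ × ℤ) => p.1 + p.2)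
      fun p (hp : p ∈ S ×ˢ S) => Finset.mem_image_of_mem _ hp, Finset.sum_product]
    have e : ∑ k ∈ S, ∑ l ∈ S, 11 * M ^ 2 *
        (1 + √(lam * δ) * (1 / √(((k.1 - l.1).natAbs : ℝ) + 1))) * (b k ^ 3 * b l ^ 3) =
        11 * M ^ 2 * ((∑ k ∈ S, b k ^ 3) ^ 2 + √(lam * δ) *
          ∑ k ∈ S, ∑ l ∈ S, b k ^ 3 * b l ^ 3 * (1 / √(((k.1 - l.1).natAbs : ℝ) + 1))) := by
      rw [pow_two (∑ k ∈ S, b k ^ 3), Finset.sum_mul_sum]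
      simp only [Finset.mul_sum, ← Finset.sum_add_distrib]
      exact Finset.sum_congr rfl fun k _ => Finset.sum_congr rfl fun l _ => by ring
    rw [e]
    gcongr
    · have a1 := Finset.sum_mul_sq_le_sq_mul_sq S b (fun k => b k ^ 2)
      have a2 := sq_sum_le_card_mul_sum_sq (s := S) (f := fun k => b k ^ 2)
      simp only [← pow_mul] at a1 a2
      norm_num at a1 a2
      have a3 : ∑ k ∈ S, b k * b k ^ 2 = ∑ k ∈ S, b k ^ 3 :=
        Finset.sum_congr rfl fun k _ => by ring
      rw [a3] at a1
      have a4 : 0 ≤ ∑ k ∈ S, b k ^ 2 := Finset.sum_nonneg fun _ _ => by positivity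
      refine a1.trans ((mul_le_of_le_one_right a4 hb4).trans ?_)
      refine Real.le_sqrt_of_sq_le (a2.trans ?_)
      exact mul_le_of_le_one_right (Nat.cast_nonneg _) hb4
    · exact h.sum_sum_div_sqrt_le b hb0 hb4
  have hs0 : 0 ≤ ∑ n ∈ A, √‖c n‖ ^ 3 := Finset.sum_nonneg fun _ _ => by positivity
  have h5 : √(lam * δ) ^ 2 = lam * δ := Real.sq_sqrt (by linarith)
  have h6 : √(S.card : ℝ) ^ 2 = S.card := Real.sq_sqrt (Nat.cast_nonneg _)
  set N : ℝ := (S.card : ℝ)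
  have hN : 0 ≤ N := Nat.cast_nonneg _
  have h12 : (√N + √(lam * δ) * (50 * M)) ^ 2 ≤ 5000 * M ^ 2 * (N + lam * δ) := by
    have : (√N + √(lam * δ) * (50 * M)) ^ 2 ≤ 2 * (N + lam * δ * (2500 * M ^ 2)) := by
      nlinarith [sq_nonneg (√N - √(lam * δ) * (50 * M))]
    have h13 : 1 ≤ M ^ 2 := by nlinarith
    nlinarith
  calc 33 * (∑ n ∈ A, √‖c n‖ ^ 3) ^ 2
      ≤ 33 * (11 * M ^ 2 * (√N + √(lam * δ) * (50 * M))) ^ 2 := by gcongr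
    _ = 33 * 121 * M ^ 4 * (√N + √(lam * δ) * (50 * M)) ^ 2 := by ring
    _ ≤ 33 * 121 * M ^ 4 * (5000 * M ^ 2 * (N + lam * δ)) := by gcongr
    _ ≤ _ := by
      have : 0 ≤ M ^ 6 * (N + lam * δ) := by positivity
      nlinarith

end

section

variable {Ω : Type*} [MeasurableSpace Ω] {T : Torus Ω}

/-! ### Hölder inequalities for bounded functions -/

lemma BM.memLp {f : Ω → ℝ} (h : BM f) {μ : Measure Ω} [IsFiniteMeasure μ] (p : ENNReal) :
    MemLp f p μ := by
  obtain ⟨hm, C, hC⟩ := h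
  exact MemLp.of_bound (by fun_prop) C (Filter.Eventually.of_forall hC)

lemma integral_mul_le_of_holderConjugate {μ : Measure Ω} [IsFiniteMeasure μ] {p q : ℝ}
    (hpq : p.HolderConjugate q) {f g : Ω → ℝ} (hf : BM f) (hg : BM g) (hf0 : ∀ w, 0 ≤ f w)
    (hg0 : ∀ w, 0 ≤ g w) :
    ∫ w, f w * g w ∂μ ≤ (∫ w, f w ^ p ∂μ) ^ (1 / p) * (∫ w, g w ^ q ∂μ) ^ (1 / q) :=
  integral_mul_le_Lp_mul_Lq_of_nonneg hpq (Filter.Eventually.of_forall hf0)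
    (Filter.Eventually.of_forall hg0) (hf.memLp _) (hg.memLp _)

lemma integral_sq_mul_pow_four_cube_le {μ : Measure Ω} [IsFiniteMeasure μ] {f g : Ω → ℝ}
    (hf : BM f) (hg : BM g) (hg0 : ∀ w, 0 ≤ g w) :
    (∫ w, f w ^ 2 * g w ^ 4 ∂μ) ^ 3 ≤ (∫ w, f w ^ 6 ∂μ) * (∫ w, g w ^ 6 ∂μ) ^ 2 := by
  have hpq : (3 : ℝ).HolderConjugate (3 / 2) := by
    rw [Real.holderConjugate_iff]; norm_num
  have := integral_mul_le_of_holderConjugate (μ := μ) hpq (hf.pow 2) (hg.pow 4)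
    (fun w => by positivity) (fun w => by positivity)
  have e1 : ∀ w, (f w ^ 2) ^ (3 : ℝ) = f w ^ 6 := fun w => by
    rw [show (3 : ℝ) = ((3 : ℕ) : ℝ) by norm_num, Real.rpow_natCast, ← pow_mul]
  have e2 : ∀ w, (g w ^ 4) ^ (3 / 2 : ℝ) = g w ^ 6 := fun w => by
    rw [← Real.rpow_natCast, ← Real.rpow_mul (hg0 w), ← Real.rpow_natCast]; norm_num
  simp only [e1, e2] at this
  have i1 : 0 ≤ ∫ w, f w ^ 6 ∂μ := integral_nonneg fun w => by positivity
  have i2 : 0 ≤ ∫ w, g w ^ 6 ∂μ := integral_nonneg fun w => by positivity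
  have i3 : 0 ≤ ∫ w, f w ^ 2 * g w ^ 4 ∂μ := integral_nonneg fun w => by positivity
  refine (pow_le_pow_left₀ i3 this 3).trans (le_of_eq ?_)
  rw [mul_pow, ← Real.rpow_natCast, ← Real.rpow_natCast, ← Real.rpow_mul i1, ← Real.rpow_mul i2,
    ← Real.rpow_natCast]
  norm_num

lemma integral_sq_mul_pow_four_sq_le {μ : Measure Ω} [IsFiniteMeasure μ] {f g : Ω → ℝ}
    (hf : BM f) (hg : BM g) (hg0 : ∀ w, 0 ≤ g w) :
    (∫ w, f w ^ 2 * g w ^ 4 ∂μ) ^ 2 ≤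
      (∫ w, g w ^ 2 * f w ^ 4 ∂μ) * ∫ w, g w ^ 6 ∂μ := by
  have hpq : (2 : ℝ).HolderConjugate 2 := by rw [Real.holderConjugate_iff]; norm_num
  have := integral_mul_le_of_holderConjugate (μ := μ) hpq ((hf.pow 2).mul hg) (hg.pow 3)
    (fun w => mul_nonneg (by positivity) (hg0 w)) (fun w => pow_nonneg (hg0 w) 3)
  have e1 : ∀ w, f w ^ 2 * g w * g w ^ 3 = f w ^ 2 * g w ^ 4 := fun w => by ring
  have e2 : ∀ w, (f w ^ 2 * g w) ^ (2 : ℝ) = g w ^ 2 * f w ^ 4 := fun w => by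
    rw [show (2 : ℝ) = ((2 : ℕ) : ℝ) by norm_num, Real.rpow_natCast]; ring
  have e3 : ∀ w, (g w ^ 3) ^ (2 : ℝ) = g w ^ 6 := fun w => by
    rw [show (2 : ℝ) = ((2 : ℕ) : ℝ) by norm_num, Real.rpow_natCast, ← pow_mul]
  simp only [e1, e2, e3] at this
  have i1 : 0 ≤ ∫ w, g w ^ 2 * f w ^ 4 ∂μ := integral_nonneg fun w => by positivity
  have i2 : 0 ≤ ∫ w, g w ^ 6 ∂μ := integral_nonneg fun w => by positivity
  have i3 : 0 ≤ ∫ w, f w ^ 2 * g w ^ 4 ∂μ := integral_nonneg fun w => by positivity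
  refine (pow_le_pow_left₀ i3 this 2).trans (le_of_eq ?_)
  rw [mul_pow, ← Real.sqrt_eq_rpow, ← Real.sqrt_eq_rpow, Real.sq_sqrt i1, Real.sq_sqrt i2]

lemma norm_sum_pow_le {α : Type*} (s : Finset α) (x : α → ℂ) {c : ℝ} (hc : (s.card : ℝ) ≤ c)
    (n : ℕ) : ‖∑ i ∈ s, x i‖ ^ (n + 1) ≤ c ^ n * ∑ i ∈ s, ‖x i‖ ^ (n + 1) := by
  rcases s.eq_empty_or_nonempty with rfl | hs
  · simp
  have h := pow_sum_div_card_le_sum_pow (s := s) (f := fun i => ‖x i‖)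
    (fun _ _ => norm_nonneg _) n
  have hs0 : (0 : ℝ) < s.card := by exact_mod_cast hs.card_pos
  rw [div_le_iff₀ (by positivity)] at h
  calc _ ≤ (∑ i ∈ s, ‖x i‖) ^ (n + 1) := by gcongr; exact norm_sum_le _ _
    _ ≤ _ := h
    _ ≤ (∑ i ∈ s, ‖x i‖ ^ (n + 1)) * c ^ n := by
      gcongr
    _ = _ := mul_comm _ _

/-- Broad–narrow dichotomy. -/
lemma norm_sum_pow_six_le (s : Finset ℤ) (x : ℤ → ℂ) {b : ℝ} (hb : (s.card : ℝ) ≤ b)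
    (hb1 : 1 ≤ b) :
    ‖∑ i ∈ s, x i‖ ^ 6 ≤ 4 ^ 6 * ∑ i ∈ s, ‖x i‖ ^ 6 +
      b ^ 8 * ∑ i ∈ s, ∑ j ∈ s.filter (fun j => 2 ≤ |i - j|), ‖x j‖ ^ 2 * ‖x i‖ ^ 4 := by
  rcases s.eq_empty_or_nonempty with rfl | hs
  · simp
  obtain ⟨i, hi, hmax⟩ := s.exists_max_image (fun i => ‖x i‖) hs
  have hA : 0 ≤ ∑ i ∈ s, ‖x i‖ ^ 6 := Finset.sum_nonneg fun _ _ => by positivity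
  have hB0 : ∀ i ∈ s, 0 ≤ ∑ j ∈ s.filter (fun j => 2 ≤ |i - j|), ‖x j‖ ^ 2 * ‖x i‖ ^ 4 :=
    fun _ _ => Finset.sum_nonneg fun _ _ => by positivity
  have hB := Finset.sum_nonneg hB0
  by_cases h : ∃ j ∈ s.filter (fun j => 2 ≤ |i - j|), ‖x i‖ ≤ b * ‖x j‖
  · obtain ⟨j, hj, hij⟩ := h
    have h1 : ‖∑ i ∈ s, x i‖ ≤ b * ‖x i‖ := by
      refine (norm_sum_le _ _).trans ((Finset.sum_le_sum hmax).trans ?_)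
      rw [Finset.sum_const, nsmul_eq_mul]; gcongr
    have h2 : ‖x j‖ ^ 2 * ‖x i‖ ^ 4 ≤
        ∑ i ∈ s, ∑ j ∈ s.filter (fun j => 2 ≤ |i - j|), ‖x j‖ ^ 2 * ‖x i‖ ^ 4 :=
      (Finset.single_le_sum (f := fun j => ‖x j‖ ^ 2 * ‖x i‖ ^ 4)
        (fun _ _ => by positivity) hj).trans (Finset.single_le_sum hB0 hi)
    calc ‖∑ i ∈ s, x i‖ ^ 6 ≤ (b * ‖x i‖) ^ 6 := by gcongr
      _ = b ^ 6 * ‖x i‖ ^ 4 * ‖x i‖ ^ 2 := by ring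
      _ ≤ b ^ 6 * ‖x i‖ ^ 4 * (b * ‖x j‖) ^ 2 := by gcongr
      _ = b ^ 8 * (‖x j‖ ^ 2 * ‖x i‖ ^ 4) := by ring
      _ ≤ _ := by
        have := mul_le_mul_of_nonneg_left h2 (by positivity : 0 ≤ b ^ 8)
        linarith
  · push Not at h
    have h1 : ‖∑ i ∈ s, x i‖ ≤ 4 * ‖x i‖ := by
      rw [← Finset.sum_filter_add_sum_filter_not s (fun j => 2 ≤ |i - j|)]
      refine (norm_add_le _ _).trans ?_
      have a1 : ‖∑ j ∈ s.filter (fun j => 2 ≤ |i - j|), x j‖ ≤ ‖x i‖ := by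
        have : ∀ j ∈ s.filter (fun j => 2 ≤ |i - j|), ‖x j‖ ≤ ‖x i‖ / b := fun j hj => by
          rw [le_div_iff₀ (by linarith), mul_comm]; exact (h j hj).le
        refine (norm_sum_le _ _).trans ((Finset.sum_le_sum this).trans ?_)
        rw [Finset.sum_const, nsmul_eq_mul]
        have hc : ((s.filter (fun j => 2 ≤ |i - j|)).card : ℝ) ≤ b :=
          (Nat.cast_le.2 (Finset.card_filter_le _ _)).trans hb
        calc _ ≤ b * (‖x i‖ / b) := by gcongr
          _ = _ := by field_simp
      have a2 : ‖∑ j ∈ s.filter (fun j => ¬ 2 ≤ |i - j|), x j‖ ≤ 3 * ‖x i‖ := by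
        refine (norm_sum_le _ _).trans ((Finset.sum_le_sum fun j hj =>
          hmax j (Finset.mem_filter.1 hj).1).trans ?_)
        rw [Finset.sum_const, nsmul_eq_mul]
        have hc : (s.filter (fun j => ¬ 2 ≤ |i - j|)).card ≤ 3 := by
          have : (s.filter (fun j => ¬ 2 ≤ |i - j|)) ⊆ Finset.Icc (i - 1) (i + 1) := by
            intro j hj
            have := (Finset.mem_filter.1 hj).2
            rw [not_le, abs_lt] at this
            rw [Finset.mem_Icc]; omega
          have := Finset.card_le_card this
          rw [Int.card_Icc] at this
          omega
        gcongr; exact_mod_cast hc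
      linarith
    have h2 := Finset.single_le_sum (f := fun i => ‖x i‖ ^ 6) (fun _ _ => by positivity) hi
    calc ‖∑ i ∈ s, x i‖ ^ 6 ≤ (4 * ‖x i‖) ^ 6 := by gcongr
      _ = 4 ^ 6 * ‖x i‖ ^ 6 := by ring
      _ ≤ 4 ^ 6 * ∑ i ∈ s, ‖x i‖ ^ 6 := by gcongr
      _ ≤ _ := by
        have : 0 ≤ b ^ 8 := by positivity
        nlinarith

/-! ### Arcs -/

section Arcs

variable (T) (S : Finset (ℤ × ℤ)) (a : ℤ × ℤ → ℂ) (ι : ℤ × ℤ → ℤ) (b : ℕ)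

/-- The arcs of level `m`: unions of `b ^ m` consecutive caps. -/
def arc (m : ℕ) (i : ℤ) : Finset (ℤ × ℤ) := S.filter fun k => ι k / (b : ℤ) ^ m = i

/-- The indices of the arcs of level `m'` in a given arc of level `m`. -/
def subarcs (m' m : ℕ) (i : ℤ) : Finset ℤ := (arc S ι b m i).image fun k => ι k / (b : ℤ) ^ m'

/-- The squared `L⁶` norm of the part of the function in a cap. -/
noncomputable def capNorm (j : ℤ) : ℝ :=
  (∫ w, ‖T.trig (S.filter fun k => ι k = j) a w‖ ^ 6 ∂T.μ) ^ (1 / 3 : ℝ)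

/-- The sum of the squared `L⁶` norms of the caps of an arc. -/
noncomputable def arcWt (m : ℕ) (i : ℤ) : ℝ :=
  ∑ j ∈ (S.image ι).filter (fun j => j / (b : ℤ) ^ m = i), capNorm T S a ι j

variable {T S a ι b}

lemma capNorm_nonneg (j : ℤ) : 0 ≤ capNorm T S a ι j :=
  Real.rpow_nonneg (integral_nonneg fun _ => by positivity) _

lemma capNorm_cube (j : ℤ) :
    capNorm T S a ι j ^ 3 = ∫ w, ‖T.trig (S.filter fun k => ι k = j) a w‖ ^ 6 ∂T.μ := by
  have h : 0 ≤ ∫ w, ‖T.trig (S.filter fun k => ι k = j) a w‖ ^ 6 ∂T.μ :=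
    integral_nonneg fun _ => by positivity
  rw [capNorm, ← Real.rpow_natCast, ← Real.rpow_mul h]; norm_num

lemma arcWt_nonneg (m : ℕ) (i : ℤ) : 0 ≤ arcWt T S a ι b m i :=
  Finset.sum_nonneg fun _ _ => capNorm_nonneg _

lemma ediv_pow_of_le {x i : ℤ} {m' m : ℕ} (hm : m' ≤ m) (h : x / (b : ℤ) ^ m' = i) :
    x / (b : ℤ) ^ m = i / (b : ℤ) ^ (m - m') := by
  rw [← h, Int.ediv_ediv_of_nonneg (by positivity), ← pow_add, Nat.add_sub_cancel' hm]

lemma ediv_of_mem_subarcs {m' m : ℕ} (hm : m' ≤ m) {i i' : ℤ} (h : i' ∈ subarcs S ι b m' m i) :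
    i' / (b : ℤ) ^ (m - m') = i := by
  obtain ⟨k, hk, rfl⟩ := Finset.mem_image.1 h
  rw [← ediv_pow_of_le hm rfl]; exact (Finset.mem_filter.1 hk).2

lemma trig_arc_eq_sum {m' m : ℕ} (hm : m' ≤ m) (i : ℤ) (w : Ω) :
    T.trig (arc S ι b m i) a w =
      ∑ i' ∈ subarcs S ι b m' m i, T.trig (arc S ι b m' i') a w := by
  rw [Torus.trig, ← Finset.sum_fiberwise_of_maps_to (g := fun k => ι k / (b : ℤ) ^ m')
    fun k (hk : k ∈ arc S ι b m i) => Finset.mem_image_of_mem _ hk]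
  refine Finset.sum_congr rfl fun i' hi' => Finset.sum_congr ?_ fun _ _ => rfl
  ext k
  simp only [arc, Finset.mem_filter, and_assoc]
  refine and_congr_right fun _ => ⟨fun h => h.2, fun h => ⟨?_, h⟩⟩
  rw [ediv_pow_of_le hm h]
  exact ediv_of_mem_subarcs hm hi'

lemma arcWt_eq_sum {m' m : ℕ} (hm : m' ≤ m) (i : ℤ) :
    arcWt T S a ι b m i = ∑ i' ∈ subarcs S ι b m' m i, arcWt T S a ι b m' i' := by
  rw [arcWt, ← Finset.sum_fiberwise_of_maps_to (g := fun j => j / (b : ℤ) ^ m')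
    (t := subarcs S ι b m' m i)]
  · refine Finset.sum_congr rfl fun i' hi' => Finset.sum_congr ?_ fun _ _ => rfl
    ext j
    simp only [Finset.mem_filter, and_assoc]
    refine and_congr_right fun _ => ⟨fun h => h.2, fun h => ⟨?_, h⟩⟩
    rw [ediv_pow_of_le hm h]
    exact ediv_of_mem_subarcs hm hi'
  · intro j hj
    obtain ⟨hj1, hj2⟩ := Finset.mem_filter.1 hj
    obtain ⟨k, hk, rfl⟩ := Finset.mem_image.1 hj1
    exact Finset.mem_image_of_mem _ (Finset.mem_filter.2 ⟨hk, hj2⟩)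

lemma card_subarcs_le (hb : 1 ≤ b) {m' m : ℕ} (hm : m' ≤ m) (i : ℤ) :
    ((subarcs S ι b m' m i).card : ℝ) ≤ (b : ℝ) ^ (m - m') := by
  have hp : (0 : ℤ) < (b : ℤ) ^ (m - m') := by positivity
  have hsub : subarcs S ι b m' m i ⊆
      Finset.Ico (i * (b : ℤ) ^ (m - m')) ((i + 1) * (b : ℤ) ^ (m - m')) := by
    intro i' hi'
    have h := ediv_of_mem_subarcs hm hi'
    rw [Finset.mem_Ico, ← Int.le_ediv_iff_mul_le hp, ← Int.ediv_lt_iff_lt_mul hp, h]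
    omega
  have h1 := Finset.card_le_card hsub
  rw [Int.card_Ico, ← sub_mul, add_sub_cancel_left, one_mul] at h1
  have h2 : (((b : ℤ) ^ (m - m')).toNat : ℤ) = (b : ℤ) ^ (m - m') := Int.toNat_of_nonneg hp.le
  have h3 : ((subarcs S ι b m' m i).card : ℤ) ≤ (b : ℤ) ^ (m - m') := by
    rw [← h2]; exact_mod_cast h1
  exact_mod_cast h3

end Arcs

end

section

variable {Ω : Type*} [MeasurableSpace Ω] {T : Torus Ω}

/-! ### Decoupling -/

/-- Transversality of the index function `ι` on `S`: in a solution of `k + a₁ + a₂ = k' + a₃ + a₄`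
with `a₁, …, a₄` close together and `k, k'` far away on the same side, `k` and `k'` are close. -/
def Transversal (S : Finset (ℤ × ℤ)) (ι : ℤ × ℤ → ℤ) (C₀ : ℕ) : Prop :=
  ∀ σ d : ℤ, 1 ≤ σ → 0 < d → ∀ k ∈ S, ∀ k' ∈ S, ∀ a₁ ∈ S, ∀ a₂ ∈ S, ∀ a₃ ∈ S, ∀ a₄ ∈ S,
    k + a₁ + a₂ = k' + a₃ + a₄ → |ι a₂ - ι a₁| ≤ σ → |ι a₃ - ι a₁| ≤ σ → |ι a₄ - ι a₁| ≤ σ →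
    (ι a₁ + d < ι k ∧ ι a₁ + d < ι k' ∨ ι k + d < ι a₁ ∧ ι k' + d < ι a₁) →
    |ι k - ι k'| * d ≤ C₀ * σ ^ 2 + d

section

variable {S : Finset (ℤ × ℤ)} {a : ℤ × ℤ → ℂ} {ι : ℤ × ℤ → ℤ} {b C₀ : ℕ}

lemma integral_trig_orthogonal {A B D : Finset (ℤ × ℤ)}
    (h : ∀ k ∈ A, ∀ k' ∈ B, ∀ a₁ ∈ D, ∀ a₂ ∈ D, ∀ a₃ ∈ D, ∀ a₄ ∈ D,
      k + a₁ + a₂ ≠ k' + a₃ + a₄) :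
    ∫ w, T.trig A a w * (starRingEnd ℂ) (T.trig B a w) * ((‖T.trig D a w‖ ^ 4 : ℝ) : ℂ) ∂T.μ
      = 0 := by
  have hA : T.trig A a ∈ T.poly (A : Set (ℤ × ℤ)) := trig_mem_poly a fun _ => id
  have hB := poly_conj (trig_mem_poly (T := T) (A := (B : Set (ℤ × ℤ))) a fun _ => id)
  have hD : T.trig D a ∈ T.poly (D : Set (ℤ × ℤ)) := trig_mem_poly a fun _ => id
  have hD' := poly_conj hD
  have := integral_poly_eq_zero (poly_mul (poly_mul hA hB) (poly_mul (poly_mul hD hD)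
    (poly_mul hD' hD'))) (by
    rintro ⟨_, ⟨k, hk, k', hk', rfl⟩, _, ⟨_, ⟨a₁, h1, a₂, h2, rfl⟩, _, ⟨a₃, h3, a₄, h4, rfl⟩, rfl⟩, e⟩
    refine h k hk _ hk' a₁ h1 a₂ h2 _ h3 _ h4 ?_
    rw [← sub_eq_zero, e]; abel)
  rw [← this.2]
  refine integral_congr_ae (Filter.Eventually.of_forall fun w => ?_)
  have e : ((‖T.trig D a w‖ ^ 4 : ℝ) : ℂ) = T.trig D a w * T.trig D a w *
      ((starRingEnd ℂ) (T.trig D a w) * (starRingEnd ℂ) (T.trig D a w)) := by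
    have : ((‖T.trig D a w‖ ^ 2 : ℝ) : ℂ) = T.trig D a w * (starRingEnd ℂ) (T.trig D a w) := by
      rw [Complex.mul_conj, Complex.normSq_eq_norm_sq]
    rw [show ‖T.trig D a w‖ ^ 4 = ‖T.trig D a w‖ ^ 2 * ‖T.trig D a w‖ ^ 2 by ring,
      Complex.ofReal_mul, this]
    ring
  simp only [e, Pi.mul_apply]

lemma integral_arc_sq_mul_le (hT : Transversal S ι C₀) (hb : 1 ≤ b) {N s m : ℕ} (hs : 2 * s ≤ N)
    (hm : N - 2 * s ≤ m) (hmN : m ≤ N) {i i' i₁ i₂ : ℤ} (hi : 2 ≤ |i - i'|)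
    (h1 : i₁ / (b : ℤ) ^ (N - m) = i') (h2 : i₂ / (b : ℤ) ^ s = i) :
    ∫ w, ‖T.trig (arc S ι b m i₁) a w‖ ^ 2 * ‖T.trig (arc S ι b (N - s) i₂) a w‖ ^ 4 ∂T.μ ≤
      (2 * C₀ + 3) * ∑ i₃ ∈ subarcs S ι b (N - 2 * s) m i₁,
        ∫ w, ‖T.trig (arc S ι b (N - 2 * s) i₃) a w‖ ^ 2 *
          ‖T.trig (arc S ι b (N - s) i₂) a w‖ ^ 4 ∂T.μ := by
  have hb0 : (0 : ℤ) < b := by exact_mod_cast hb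
  have e : ((2 * (C₀ + 1 : ℕ) + 1 : ℝ)) = 2 * C₀ + 3 := by push_cast; ring
  rw [← e]
  simp only [trig_arc_eq_sum hm i₁]
  refine integral_norm_sum_sq_le (T := T) (subarcs S ι b (N - 2 * s) m i₁)
    (fun i₃ => T.trig (arc S ι b (N - 2 * s) i₃) a)
    (fun w => ‖T.trig (arc S ι b (N - s) i₂) a w‖ ^ 4) (C₀ + 1) (fun _ => BM.trig _ _)
    ((BM.trig _ _).norm.pow 4) (fun _ => by positivity) ?_
  intro p hp q hq hpq
  refine integral_trig_orthogonal ?_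
  intro k hk k' hk' a₁ ha₁ a₂ ha₂ a₃ ha₃ a₄ ha₄ heq
  have hp' := ediv_of_mem_subarcs hm hp
  have hq' := ediv_of_mem_subarcs hm hq
  obtain ⟨hkS, hk⟩ := Finset.mem_filter.1 hk
  obtain ⟨hkS', hk'⟩ := Finset.mem_filter.1 hk'
  obtain ⟨hS1, ha₁⟩ := Finset.mem_filter.1 ha₁
  obtain ⟨hS2, ha₂⟩ := Finset.mem_filter.1 ha₂
  obtain ⟨hS3, ha₃⟩ := Finset.mem_filter.1 ha₃
  obtain ⟨hS4, ha₄⟩ := Finset.mem_filter.1 ha₄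
  have loc : ∀ {x y : ℤ} {n : ℕ}, x / (b : ℤ) ^ n = y → y * (b : ℤ) ^ n ≤ x ∧
      x < (y + 1) * (b : ℤ) ^ n := fun {x y n} h => by
    have hp : (0 : ℤ) < (b : ℤ) ^ n := by positivity
    rw [← Int.le_ediv_iff_mul_le hp, ← Int.ediv_lt_iff_lt_mul hp, h]; omega
  have up : ∀ {x : ℤ}, x / (b : ℤ) ^ m = i₁ → x / (b : ℤ) ^ N = i' := fun h => by
    rw [ediv_pow_of_le hmN h, h1]
  have kN := loc (up (by rw [ediv_pow_of_le hm hk, hp']))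
  have kN' := loc (up (by rw [ediv_pow_of_le hm hk', hq']))
  have aN : i * (b : ℤ) ^ N ≤ ι a₁ ∧ ι a₁ < (i + 1) * (b : ℤ) ^ N := loc (by
    rw [ediv_pow_of_le (Nat.sub_le N s) ha₁, Nat.sub_sub_self (by omega), h2])
  have close : ∀ {x : ℤ × ℤ}, ι x / (b : ℤ) ^ (N - s) = i₂ →
      |ι x - ι a₁| ≤ (b : ℤ) ^ (N - s) := fun {x} hx => by
    have l1 := loc hx
    have l2 := loc ha₁
    rw [abs_le]; constructor <;> linarith
  have hbN : (0 : ℤ) < (b : ℤ) ^ N := by positivity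
  have main := hT ((b : ℤ) ^ (N - s)) ((b : ℤ) ^ N) (Order.one_le_iff_pos.2 (by positivity)) hbN k hkS
    k' hkS' a₁ hS1 a₂ hS2 a₃ hS3 a₄ hS4 heq (close ha₂) (close ha₃) (close ha₄) (by
      rcases le_abs.1 hi with h | h
      · right
        have : (i' + 2) * (b : ℤ) ^ N ≤ i * (b : ℤ) ^ N :=
          mul_le_mul_of_nonneg_right (by omega) hbN.le
        constructor <;> linarith
      · left
        have : (i + 2) * (b : ℤ) ^ N ≤ i' * (b : ℤ) ^ N :=
          mul_le_mul_of_nonneg_right (by omega) hbN.le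
        constructor <;> linarith)
  have e1 : ((b : ℤ) ^ (N - s)) ^ 2 = (b : ℤ) ^ (N - 2 * s) * (b : ℤ) ^ N := by
    rw [← pow_mul, ← pow_add]; congr 1; omega
  rw [e1] at main
  set B := (b : ℤ) ^ (N - 2 * s) with hB
  have hB0 : 1 ≤ B := Order.one_le_iff_pos.2 (by positivity)
  have m2 : |ι k - ι k'| ≤ C₀ * B + 1 := by
    refine le_of_mul_le_mul_right (main.trans (le_of_eq ?_)) hbN
    ring
  have lk := loc hk
  have lk' := loc hk'
  have hpq' : (C₀ : ℤ) + 2 ≤ |p - q| := by push_cast at hpq; omega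
  rw [abs_le] at m2
  rcases le_abs.1 hpq' with h | h
  · have : (q + C₀ + 2) * B ≤ p * B := mul_le_mul_of_nonneg_right (by omega) (by omega)
    nlinarith
  · have : (p + C₀ + 2) * B ≤ q * B := mul_le_mul_of_nonneg_right (by omega) (by omega)
    nlinarith

lemma bilinear_le (hT : Transversal S ι C₀) (hb : 1 ≤ b) {N : ℕ} {B₀ γ : ℝ} (hB₀ : 0 ≤ B₀)
    (hγ : 1 ≤ γ) (hB : ∀ m ≤ N, ∀ i, ∫ w, ‖T.trig (arc S ι b m i) a w‖ ^ 6 ∂T.μ ≤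
      B₀ * γ ^ (2 * m) * arcWt T S a ι b m i ^ 3) (t : ℕ) :
    ∀ s : ℕ, 2 ^ t * s ≤ N → ∀ (m : ℕ) (i i' i₁ i₂ : ℤ), N - 2 * s ≤ m → m ≤ N → 2 ≤ |i - i'| →
      i₁ / (b : ℤ) ^ (N - m) = i' → i₂ / (b : ℤ) ^ s = i →
      (∫ w, ‖T.trig (arc S ι b m i₁) a w‖ ^ 2 * ‖T.trig (arc S ι b (N - s) i₂) a w‖ ^ 4 ∂T.μ) *
        γ ^ (t * s) ≤ (2 * C₀ + 3) ^ 2 * (B₀ * γ ^ (2 * (N + 1))) *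
          (arcWt T S a ι b m i₁ * arcWt T S a ι b (N - s) i₂ ^ 2) := by
  set c : ℝ := 2 * C₀ + 3 with hc
  have hc1 : 1 ≤ c := by rw [hc]; have : (0 : ℝ) ≤ C₀ := Nat.cast_nonneg _; linarith
  have hnn : ∀ (f g : Ω → ℂ), 0 ≤ ∫ w, ‖f w‖ ^ 2 * ‖g w‖ ^ 4 ∂T.μ := fun f g =>
    integral_nonneg fun w => by positivity
  have hnn6 : ∀ (f : Ω → ℂ), 0 ≤ ∫ w, ‖f w‖ ^ 6 ∂T.μ := fun f =>
    integral_nonneg fun w => by positivity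
  induction t with
  | zero =>
    intro s hs m i i' i₁ i₂ _ hmN _ _ _
    rw [zero_mul, pow_zero, mul_one]
    set w₁ := arcWt T S a ι b m i₁ with hw₁
    set w₂ := arcWt T S a ι b (N - s) i₂ with hw₂
    have p1 : 0 ≤ w₁ := arcWt_nonneg _ _
    have p2 : 0 ≤ w₂ := arcWt_nonneg _ _
    set G := B₀ * γ ^ (2 * (N + 1)) with hG
    have hG0 : 0 ≤ G := by positivity
    have key := integral_sq_mul_pow_four_cube_le (μ := T.μ)
      (BM.trig (T := T) (arc S ι b m i₁) a).norm (BM.trig (T := T) (arc S ι b (N - s) i₂) a).norm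
      (fun _ => norm_nonneg _)
    have b1 : ∫ w, ‖T.trig (arc S ι b m i₁) a w‖ ^ 6 ∂T.μ ≤ G * w₁ ^ 3 := by
      refine (hB m hmN i₁).trans ?_
      rw [hG]; gcongr
      omega
    have b2 : ∫ w, ‖T.trig (arc S ι b (N - s) i₂) a w‖ ^ 6 ∂T.μ ≤ G * w₂ ^ 3 := by
      refine (hB _ (Nat.sub_le _ _) i₂).trans ?_
      rw [hG]; gcongr
      omega
    have : (∫ w, ‖T.trig (arc S ι b m i₁) a w‖ ^ 2 *
        ‖T.trig (arc S ι b (N - s) i₂) a w‖ ^ 4 ∂T.μ) ^ 3 ≤ (G * (w₁ * w₂ ^ 2)) ^ 3 := by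
      refine key.trans ?_
      calc _ ≤ (G * w₁ ^ 3) * (G * w₂ ^ 3) ^ 2 := by
            gcongr
        _ = _ := by ring
    have h3 := le_of_pow_le_pow_left₀ (by norm_num) (by positivity) this
    refine h3.trans ?_
    have h4 : 0 ≤ G * (w₁ * w₂ ^ 2) := by positivity
    have h5 : 1 ≤ c ^ 2 := one_le_pow₀ hc1
    nlinarith
  | succ t ih =>
    intro s hs m i i' i₁ i₂ hm hmN hi h1 h2
    have hts : 2 ^ t * (2 * s) ≤ N := by rw [← mul_assoc, ← pow_succ]; exact hs
    have h2s : 2 * s ≤ N := le_trans (Nat.le_mul_of_pos_left _ (by positivity)) hts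
    set w₂ := arcWt T S a ι b (N - s) i₂ with hw₂
    have p2 : 0 ≤ w₂ := arcWt_nonneg _ _
    set G := B₀ * γ ^ (2 * (N + 1)) with hG
    have hG0 : 0 ≤ G := by positivity
    have stepA := integral_arc_sq_mul_le (T := T) (a := a) hT hb h2s hm hmN hi h1 h2
    have stepB : ∀ i₃ ∈ subarcs S ι b (N - 2 * s) m i₁,
        (∫ w, ‖T.trig (arc S ι b (N - 2 * s) i₃) a w‖ ^ 2 *
          ‖T.trig (arc S ι b (N - s) i₂) a w‖ ^ 4 ∂T.μ) * γ ^ ((t + 1) * s) ≤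
        c * G * w₂ ^ 2 * arcWt T S a ι b (N - 2 * s) i₃ := by
      intro i₃ hi₃
      set w₃ := arcWt T S a ι b (N - 2 * s) i₃ with hw₃
      have p3 : 0 ≤ w₃ := arcWt_nonneg _ _
      have hi₃' : i₃ / (b : ℤ) ^ (2 * s) = i' := by
        have := ediv_of_mem_subarcs hm hi₃
        rw [← this, Int.ediv_ediv_of_nonneg (by positivity), ← pow_add] at h1
        rw [← h1]; congr 2; omega
      have ih' := ih (2 * s) hts (N - s) i' i i₂ i₃ (by omega) (Nat.sub_le _ _)
        (by rwa [abs_sub_comm]) (by rw [Nat.sub_sub_self (by omega), h2]) hi₃'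
      have key := integral_sq_mul_pow_four_sq_le (μ := T.μ)
        (BM.trig (T := T) (arc S ι b (N - 2 * s) i₃) a).norm
        (BM.trig (T := T) (arc S ι b (N - s) i₂) a).norm (fun _ => norm_nonneg _)
      have b2 := hB _ (Nat.sub_le N s) i₂
      refine le_of_sq_le_sq ?_ (by positivity)
      calc _ = (∫ w, ‖T.trig (arc S ι b (N - 2 * s) i₃) a w‖ ^ 2 *
            ‖T.trig (arc S ι b (N - s) i₂) a w‖ ^ 4 ∂T.μ) ^ 2 * γ ^ (t * (2 * s)) *
              γ ^ (2 * s) := by rw [mul_pow, ← pow_mul]; ring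
        _ ≤ ((∫ w, ‖T.trig (arc S ι b (N - s) i₂) a w‖ ^ 2 *
            ‖T.trig (arc S ι b (N - 2 * s) i₃) a w‖ ^ 4 ∂T.μ) *
            ∫ w, ‖T.trig (arc S ι b (N - s) i₂) a w‖ ^ 6 ∂T.μ) * γ ^ (t * (2 * s)) *
              γ ^ (2 * s) := by gcongr
        _ = ((∫ w, ‖T.trig (arc S ι b (N - s) i₂) a w‖ ^ 2 *
            ‖T.trig (arc S ι b (N - 2 * s) i₃) a w‖ ^ 4 ∂T.μ) * γ ^ (t * (2 * s))) *
            ((∫ w, ‖T.trig (arc S ι b (N - s) i₂) a w‖ ^ 6 ∂T.μ) * γ ^ (2 * s)) := by ring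
        _ ≤ (c ^ 2 * G * (w₂ * w₃ ^ 2)) * (B₀ * γ ^ (2 * (N - s)) * w₂ ^ 3 * γ ^ (2 * s)) := by
          gcongr
        _ = (c ^ 2 * G * (w₂ * w₃ ^ 2)) * (B₀ * γ ^ (2 * N) * w₂ ^ 3) := by
          rw [show 2 * N = 2 * (N - s) + 2 * s by omega, pow_add]; ring
        _ ≤ (c ^ 2 * G * (w₂ * w₃ ^ 2)) * (G * w₂ ^ 3) := by
          rw [hG]; gcongr
          omega
        _ = _ := by ring
    rw [arcWt_eq_sum hm i₁]
    calc _ ≤ (c * ∑ i₃ ∈ subarcs S ι b (N - 2 * s) m i₁,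
        ∫ w, ‖T.trig (arc S ι b (N - 2 * s) i₃) a w‖ ^ 2 *
          ‖T.trig (arc S ι b (N - s) i₂) a w‖ ^ 4 ∂T.μ) * γ ^ ((t + 1) * s) := by gcongr
      _ = c * ∑ i₃ ∈ subarcs S ι b (N - 2 * s) m i₁,
        (∫ w, ‖T.trig (arc S ι b (N - 2 * s) i₃) a w‖ ^ 2 *
          ‖T.trig (arc S ι b (N - s) i₂) a w‖ ^ 4 ∂T.μ) * γ ^ ((t + 1) * s) := by
        rw [mul_assoc, Finset.sum_mul]
      _ ≤ c * ∑ i₃ ∈ subarcs S ι b (N - 2 * s) m i₁,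
        c * G * w₂ ^ 2 * arcWt T S a ι b (N - 2 * s) i₃ := by
        refine mul_le_mul_of_nonneg_left (Finset.sum_le_sum fun i₃ hi₃ => stepB i₃ hi₃) (by positivity)
      _ = _ := by rw [← Finset.mul_sum]; ring

end

end

section

variable {Ω : Type*} [MeasurableSpace Ω] {T : Torus Ω}

section

variable {S : Finset (ℤ × ℤ)} {a : ℤ × ℤ → ℂ} {ι : ℤ × ℤ → ℤ} {b C₀ : ℕ}

lemma integral_cap_pow_six (i : ℤ) :
    ∫ w, ‖T.trig (arc S ι b 0 i) a w‖ ^ 6 ∂T.μ = arcWt T S a ι b 0 i ^ 3 := by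
  have e1 : arc S ι b 0 i = S.filter fun k => ι k = i := by simp [arc]
  rw [e1, ← capNorm_cube]
  congr 1
  rw [arcWt]
  simp only [pow_zero, Int.ediv_one]
  by_cases hi : i ∈ S.image ι
  · rw [Finset.filter_eq' _ i, if_pos hi, Finset.sum_singleton]
  · rw [Finset.filter_eq' _ i, if_neg hi, Finset.sum_empty]
    have : S.filter (fun k => ι k = i) = ∅ := by
      rw [Finset.filter_eq_empty_iff]
      intro k hk hki
      exact hi (Finset.mem_image.2 ⟨k, hk, hki⟩)
    have h0 : capNorm T S a ι i ^ 3 = 0 := by rw [capNorm_cube, this]; simp [Torus.trig]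
    exact pow_eq_zero_iff (by norm_num) |>.1 h0

lemma sum_pow_le_pow_sum {α : Type*} (s : Finset α) {w : α → ℝ} (hw : ∀ i ∈ s, 0 ≤ w i) (n : ℕ) :
    ∑ i ∈ s, w i ^ (n + 1) ≤ (∑ i ∈ s, w i) ^ (n + 1) := by
  rw [pow_succ' (∑ i ∈ s, w i), Finset.sum_mul]
  refine Finset.sum_le_sum fun i hi => ?_
  rw [pow_succ']
  have := Finset.single_le_sum hw hi
  exact mul_le_mul_of_nonneg_left (pow_le_pow_left₀ (hw i hi) this n) (hw i hi)

lemma integral_arc_base (hb : 1 ≤ b) (m : ℕ) (i : ℤ) :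
    ∫ w, ‖T.trig (arc S ι b m i) a w‖ ^ 6 ∂T.μ ≤ (b ^ m) ^ 5 * arcWt T S a ι b m i ^ 3 := by
  have hc := card_subarcs_le (S := S) (ι := ι) hb (Nat.zero_le m) i
  rw [Nat.sub_zero] at hc
  simp only [trig_arc_eq_sum (Nat.zero_le m) i]
  have hbm : ∀ i', BM fun w => ‖T.trig (arc S ι b 0 i') a w‖ ^ 6 := fun i' =>
    (BM.trig _ _).norm.pow 6
  calc _ ≤ ∫ w, ((b : ℝ) ^ m) ^ 5 * ∑ i' ∈ subarcs S ι b 0 m i,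
        ‖T.trig (arc S ι b 0 i') a w‖ ^ 6 ∂T.μ := by
        refine integral_mono ((BM.sum _ fun i' _ => BM.trig _ _).norm.pow 6).integrable
          ((BM.sum _ fun i' _ => hbm i').const_mul _).integrable fun w => ?_
        exact norm_sum_pow_le _ (fun i' => T.trig (arc S ι b 0 i') a w) hc 5
    _ = ((b : ℝ) ^ m) ^ 5 * ∑ i' ∈ subarcs S ι b 0 m i, arcWt T S a ι b 0 i' ^ 3 := by
        rw [integral_const_mul, integral_finsetSum _ fun i' _ => (hbm i').integrable]
        simp only [integral_cap_pow_six]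
    _ ≤ _ := by
        rw [arcWt_eq_sum (Nat.zero_le m) i]
        gcongr
        exact sum_pow_le_pow_sum _ (fun _ _ => arcWt_nonneg _ _) 2

lemma integral_arc_step (hT : Transversal S ι C₀) (hb : 1 ≤ b) {N t : ℕ} {B₀ γ : ℝ} (hB₀ : 0 ≤ B₀)
    (hγ : 1 ≤ γ) (hN : 2 ^ t ≤ N) (hγ2 : 2 * 4 ^ 6 ≤ γ ^ 2)
    (hγt : 2 * (b ^ 11 * (2 * C₀ + 3) ^ 2) ≤ γ ^ t)
    (hB : ∀ m ≤ N, ∀ i, ∫ w, ‖T.trig (arc S ι b m i) a w‖ ^ 6 ∂T.μ ≤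
      B₀ * γ ^ (2 * m) * arcWt T S a ι b m i ^ 3) (i₀ : ℤ) :
    ∫ w, ‖T.trig (arc S ι b (N + 1) i₀) a w‖ ^ 6 ∂T.μ ≤
      B₀ * γ ^ (2 * (N + 1)) * arcWt T S a ι b (N + 1) i₀ ^ 3 := by
  have hN1 : 1 ≤ N := (Nat.one_le_two_pow).trans hN
  set J := subarcs S ι b N (N + 1) i₀ with hJ
  set G := B₀ * γ ^ (2 * (N + 1)) with hG
  have hG0 : 0 ≤ G := by positivity
  set W : ℤ → ℝ := fun i => arcWt T S a ι b N i with hW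
  have hW0 : ∀ i, 0 ≤ W i := fun i => arcWt_nonneg _ _
  have hsum : arcWt T S a ι b (N + 1) i₀ = ∑ i ∈ J, W i := arcWt_eq_sum (Nat.le_succ N) i₀
  set F : ℤ → Ω → ℂ := fun i => T.trig (arc S ι b N i) a with hF
  have hFm : ∀ i, BM fun w => ‖F i w‖ := fun i => (BM.trig _ _).norm
  have hc := card_subarcs_le (S := S) (ι := ι) hb (Nat.le_succ N) i₀
  rw [Nat.succ_sub (le_refl N), Nat.sub_self, pow_one] at hc
  have hb1 : (1 : ℝ) ≤ b := by exact_mod_cast hb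
  have narrow : 4 ^ 6 * ∑ i ∈ J, ∫ w, ‖F i w‖ ^ 6 ∂T.μ ≤ G / 2 * (∑ i ∈ J, W i) ^ 3 := by
    calc _ ≤ 4 ^ 6 * ∑ i ∈ J, B₀ * γ ^ (2 * N) * W i ^ 3 := by
          gcongr with i _
          exact hB N le_rfl i
      _ = 4 ^ 6 * (B₀ * γ ^ (2 * N)) * ∑ i ∈ J, W i ^ 3 := by rw [← Finset.mul_sum]; ring
      _ ≤ 4 ^ 6 * (B₀ * γ ^ (2 * N)) * (∑ i ∈ J, W i) ^ 3 := by
          gcongr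
          exact sum_pow_le_pow_sum _ (fun i _ => hW0 i) 2
      _ ≤ _ := by
          have : 4 ^ 6 * (B₀ * γ ^ (2 * N)) ≤ G / 2 := by
            rw [hG, show 2 * (N + 1) = 2 * N + 2 by ring, pow_add]
            have : 0 ≤ B₀ * γ ^ (2 * N) := by positivity
            nlinarith
          have := Finset.sum_nonneg fun i (_ : i ∈ J) => hW0 i
          gcongr
  have pair : ∀ i ∈ J, ∀ j ∈ J.filter (fun j => 2 ≤ |i - j|),
      b ^ 8 * ∫ w, ‖F j w‖ ^ 2 * ‖F i w‖ ^ 4 ∂T.μ ≤ G / 2 * (W j * W i ^ 2) := by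
    intro i _ j hj
    have hij := (Finset.mem_filter.1 hj).2
    have hN' : N - 1 ≤ N := Nat.sub_le _ _
    have hc' := card_subarcs_le (S := S) (ι := ι) hb hN' i
    rw [Nat.sub_sub_self hN1, pow_one] at hc'
    set J₂ := subarcs S ι b (N - 1) N i with hJ₂
    have hm : ∀ i₂, BM fun w => ‖F j w‖ ^ 2 * ‖T.trig (arc S ι b (N - 1) i₂) a w‖ ^ 4 := fun i₂ =>
      ((hFm j).pow 2).mul ((BM.trig _ _).norm.pow 4)
    have s1 : ∫ w, ‖F j w‖ ^ 2 * ‖F i w‖ ^ 4 ∂T.μ ≤ b ^ 3 * ∑ i₂ ∈ J₂,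
        ∫ w, ‖F j w‖ ^ 2 * ‖T.trig (arc S ι b (N - 1) i₂) a w‖ ^ 4 ∂T.μ := by
      rw [← integral_finsetSum _ fun i₂ _ => (hm i₂).integrable, ← integral_const_mul]
      refine integral_mono (((hFm j).pow 2).mul ((hFm i).pow 4)).integrable
        ((BM.sum _ fun i₂ _ => hm i₂).const_mul _).integrable fun w => ?_
      have h4 := norm_sum_pow_le J₂ (fun i₂ => T.trig (arc S ι b (N - 1) i₂) a w) hc' 3
      rw [← trig_arc_eq_sum hN' i w] at h4
      have h2 : 0 ≤ ‖F j w‖ ^ 2 := by positivity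
      simp only
      rw [← Finset.mul_sum]
      calc _ ≤ ‖F j w‖ ^ 2 * _ := mul_le_mul_of_nonneg_left h4 h2
        _ = _ := by ring
    have s2 : ∀ i₂ ∈ J₂, (∫ w, ‖F j w‖ ^ 2 * ‖T.trig (arc S ι b (N - 1) i₂) a w‖ ^ 4 ∂T.μ) *
        γ ^ t ≤ (2 * C₀ + 3) ^ 2 * G * W j * arcWt T S a ι b (N - 1) i₂ ^ 2 := by
      intro i₂ hi₂
      have h2 := ediv_of_mem_subarcs hN' hi₂
      rw [Nat.sub_sub_self hN1] at h2
      have := bilinear_le (T := T) (a := a) hT hb hB₀ hγ hB t 1 (by omega) N i j j i₂ (by omega)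
        le_rfl hij (by simp) h2
      rw [mul_one] at this
      refine this.trans (le_of_eq ?_)
      simp only [hW, hG]; ring
    have s3 : (∫ w, ‖F j w‖ ^ 2 * ‖F i w‖ ^ 4 ∂T.μ) * γ ^ t ≤
        b ^ 3 * ((2 * C₀ + 3) ^ 2 * G * W j * W i ^ 2) := by
      calc _ ≤ (b ^ 3 * ∑ i₂ ∈ J₂,
            ∫ w, ‖F j w‖ ^ 2 * ‖T.trig (arc S ι b (N - 1) i₂) a w‖ ^ 4 ∂T.μ) * γ ^ t := by gcongr
        _ = b ^ 3 * ∑ i₂ ∈ J₂,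
            (∫ w, ‖F j w‖ ^ 2 * ‖T.trig (arc S ι b (N - 1) i₂) a w‖ ^ 4 ∂T.μ) * γ ^ t := by
            rw [mul_assoc, Finset.sum_mul]
        _ ≤ b ^ 3 * ∑ i₂ ∈ J₂, (2 * C₀ + 3) ^ 2 * G * W j * arcWt T S a ι b (N - 1) i₂ ^ 2 :=
            mul_le_mul_of_nonneg_left (Finset.sum_le_sum s2) (by positivity)
        _ = b ^ 3 * ((2 * C₀ + 3) ^ 2 * G * W j * ∑ i₂ ∈ J₂, arcWt T S a ι b (N - 1) i₂ ^ 2) := by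
            rw [← Finset.mul_sum]
        _ ≤ _ := by
            have := hW0 j
            have e : W i = ∑ i₂ ∈ J₂, arcWt T S a ι b (N - 1) i₂ := arcWt_eq_sum hN' i
            rw [e]
            gcongr
            exact sum_pow_le_pow_sum _ (fun _ _ => arcWt_nonneg _ _) 1
    have hγ0 : 0 < γ ^ t := by positivity
    have hWW : 0 ≤ G * (W j * W i ^ 2) :=
      mul_nonneg hG0 (mul_nonneg (hW0 j) (by positivity))
    refine le_of_mul_le_mul_right ?_ hγ0
    calc _ = b ^ 8 * ((∫ w, ‖F j w‖ ^ 2 * ‖F i w‖ ^ 4 ∂T.μ) * γ ^ t) := by ring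
      _ ≤ b ^ 8 * (b ^ 3 * ((2 * C₀ + 3) ^ 2 * G * W j * W i ^ 2)) := by gcongr
      _ = (b ^ 11 * (2 * C₀ + 3) ^ 2) * (G * (W j * W i ^ 2)) := by ring
      _ ≤ (γ ^ t / 2) * (G * (W j * W i ^ 2)) :=
          mul_le_mul_of_nonneg_right (by linarith) hWW
      _ = _ := by ring
  have bm2 : ∀ i j, BM fun w => ‖F j w‖ ^ 2 * ‖F i w‖ ^ 4 := fun i j =>
    ((hFm j).pow 2).mul ((hFm i).pow 4)
  have broad : b ^ 8 * ∑ i ∈ J, ∑ j ∈ J.filter (fun j => 2 ≤ |i - j|),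
      ∫ w, ‖F j w‖ ^ 2 * ‖F i w‖ ^ 4 ∂T.μ ≤ G / 2 * (∑ i ∈ J, W i) ^ 3 := by
    have hS := Finset.sum_nonneg fun i (_ : i ∈ J) => hW0 i
    calc _ = ∑ i ∈ J, ∑ j ∈ J.filter (fun j => 2 ≤ |i - j|),
          b ^ 8 * ∫ w, ‖F j w‖ ^ 2 * ‖F i w‖ ^ 4 ∂T.μ := by simp only [Finset.mul_sum]
      _ ≤ ∑ i ∈ J, ∑ j ∈ J.filter (fun j => 2 ≤ |i - j|), G / 2 * (W j * W i ^ 2) :=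
          Finset.sum_le_sum fun i hi => Finset.sum_le_sum fun j hj => pair i hi j hj
      _ ≤ ∑ i ∈ J, ∑ j ∈ J, G / 2 * (W j * W i ^ 2) :=
          Finset.sum_le_sum fun i _ => Finset.sum_le_sum_of_subset_of_nonneg
            (Finset.filter_subset _ _) fun j _ _ => by have := hW0 j; positivity
      _ = G / 2 * ((∑ i ∈ J, W i) * ∑ i ∈ J, W i ^ 2) := by
          rw [Finset.sum_comm, Finset.sum_mul_sum, Finset.mul_sum]
          refine Finset.sum_congr rfl fun i _ => ?_
          rw [Finset.mul_sum]
      _ ≤ G / 2 * ((∑ i ∈ J, W i) * (∑ i ∈ J, W i) ^ 2) := by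
          gcongr
          exact sum_pow_le_pow_sum _ (fun i _ => hW0 i) 1
      _ = _ := by ring
  have int : ∫ w, ‖T.trig (arc S ι b (N + 1) i₀) a w‖ ^ 6 ∂T.μ ≤
      4 ^ 6 * ∑ i ∈ J, ∫ w, ‖F i w‖ ^ 6 ∂T.μ + b ^ 8 * ∑ i ∈ J,
        ∑ j ∈ J.filter (fun j => 2 ≤ |i - j|), ∫ w, ‖F j w‖ ^ 2 * ‖F i w‖ ^ 4 ∂T.μ := by
    have i1 : BM fun w => ∑ i ∈ J, ‖F i w‖ ^ 6 := BM.sum _ fun i _ => (hFm i).pow 6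
    have i2' : ∀ i, BM fun w => ∑ j ∈ J.filter (fun j => 2 ≤ |i - j|), ‖F j w‖ ^ 2 * ‖F i w‖ ^ 4 :=
      fun i => BM.sum _ fun j _ => bm2 i j
    have i2 : BM fun w => ∑ i ∈ J, ∑ j ∈ J.filter (fun j => 2 ≤ |i - j|),
        ‖F j w‖ ^ 2 * ‖F i w‖ ^ 4 := BM.sum _ fun i _ => i2' i
    calc _ ≤ ∫ w, (4 ^ 6 * ∑ i ∈ J, ‖F i w‖ ^ 6 + b ^ 8 * ∑ i ∈ J,
          ∑ j ∈ J.filter (fun j => 2 ≤ |i - j|), ‖F j w‖ ^ 2 * ‖F i w‖ ^ 4) ∂T.μ := by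
          refine integral_mono ((BM.trig _ _).norm.pow 6).integrable
            ((i1.const_mul _).integrable.add (i2.const_mul _).integrable) fun w => ?_
          simp only
          rw [trig_arc_eq_sum (Nat.le_succ N) i₀ w]
          exact norm_sum_pow_six_le J (fun i => F i w) hc hb1
      _ = _ := by
          rw [integral_add (i1.const_mul _).integrable (i2.const_mul _).integrable,
            integral_const_mul, integral_const_mul,
            integral_finsetSum _ fun i _ => ((hFm i).pow 6).integrable,
            integral_finsetSum _ fun i _ => (i2' i).integrable]
          congr 2
          refine Finset.sum_congr rfl fun i _ => ?_
          rw [integral_finsetSum _ fun j _ => (bm2 i j).integrable]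
  rw [hsum]
  linarith

end

/-- Decoupling of an arc into caps, up to an arbitrarily small power of the number of caps. -/
theorem integral_arc_pow_six_le (T : Torus Ω) (C₀ : ℕ) {η : ℝ} (hη : 0 < η) :
    ∃ b : ℕ, 2 ≤ b ∧ ∃ B₀ : ℝ, 0 ≤ B₀ ∧ ∀ (S : Finset (ℤ × ℤ)) (a : ℤ × ℤ → ℂ) (ι : ℤ × ℤ → ℤ),
      Transversal S ι C₀ → ∀ (m : ℕ) (i : ℤ), ∫ w, ‖T.trig (arc S ι b m i) a w‖ ^ 6 ∂T.μ ≤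
        B₀ * ((b : ℝ) ^ m) ^ η * arcWt T S a ι b m i ^ 3 := by
  obtain ⟨b, hb2, hb⟩ : ∃ b : ℕ, 2 ≤ b ∧ (2 * 4 ^ 6 : ℝ) ≤ (b : ℝ) ^ η := by
    have h1 := (tendsto_rpow_atTop hη).comp (tendsto_natCast_atTop_atTop (R := ℝ))
    obtain ⟨b, h2, h3⟩ := ((h1.eventually_ge_atTop (2 * 4 ^ 6)).and
      (Filter.eventually_ge_atTop 2)).exists
    exact ⟨b, h3, h2⟩
  have hb0 : (0 : ℝ) < b := by positivity
  set γ : ℝ := (b : ℝ) ^ (η / 2) with hγd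
  have hγ2 : γ ^ 2 = (b : ℝ) ^ η := by
    rw [hγd, ← Real.rpow_natCast, ← Real.rpow_mul hb0.le]; congr 1; push_cast; ring
  have hγ0 : 0 < γ := by positivity
  have hγ1 : 1 < γ := by
    rw [← hγ2] at hb; nlinarith
  obtain ⟨t, ht⟩ := ((tendsto_pow_atTop_atTop_of_one_lt hγ1).eventually_ge_atTop
    (2 * (b ^ 11 * (2 * C₀ + 3) ^ 2) : ℝ)).exists
  refine ⟨b, hb2, ((b : ℝ) ^ (2 ^ t)) ^ 5, by positivity, fun S a ι hT => ?_⟩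
  have hb1 : (1 : ℝ) ≤ b := by exact_mod_cast (by omega : 1 ≤ b)
  have main : ∀ N : ℕ, ∀ m ≤ N, ∀ i, ∫ w, ‖T.trig (arc S ι b m i) a w‖ ^ 6 ∂T.μ ≤
      ((b : ℝ) ^ (2 ^ t)) ^ 5 * γ ^ (2 * m) * arcWt T S a ι b m i ^ 3 := by
    intro N
    induction N with
    | zero =>
      intro m hm i
      obtain rfl : m = 0 := by omega
      have h0 := arcWt_nonneg (T := T) (S := S) (a := a) (ι := ι) (b := b) 0 i
      rw [integral_cap_pow_six, mul_zero, pow_zero, mul_one]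
      exact le_mul_of_one_le_left (by positivity) (one_le_pow₀ (one_le_pow₀ hb1))
    | succ N ih =>
      intro m hm i
      rcases Nat.lt_or_ge m (N + 1) with h | h
      · exact ih m (by omega) i
      obtain rfl : m = N + 1 := by omega
      by_cases hN : 2 ^ t ≤ N
      · exact integral_arc_step hT (by omega) (by positivity) hγ1.le hN (hγ2 ▸ hb) ht ih i
      · have h0 := arcWt_nonneg (T := T) (S := S) (a := a) (ι := ι) (b := b) (N + 1) i
        refine (integral_arc_base (by omega) _ i).trans ?_
        have : 1 ≤ γ ^ (2 * (N + 1)) := one_le_pow₀ hγ1.le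
        calc _ ≤ ((b : ℝ) ^ (2 ^ t)) ^ 5 * arcWt T S a ι b (N + 1) i ^ 3 := by
              gcongr
              omega
          _ ≤ _ := by
              gcongr
              exact le_mul_of_one_le_right (by positivity) this
  intro m i
  refine (main m m le_rfl i).trans (le_of_eq ?_)
  rw [pow_mul, hγ2, ← Real.rpow_natCast (_ ^ η), ← Real.rpow_natCast _ m, ← Real.rpow_mul hb0.le,
    ← Real.rpow_mul hb0.le, mul_comm η]

end

section

variable {Ω : Type*} [MeasurableSpace Ω] {T : Torus Ω}

/-- The index of the cap of width `L` containing a frequency. -/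
noncomputable def capIndex (L : ℝ) (k : ℤ × ℤ) : ℤ := ⌊(k.1 : ℝ) / L⌋

lemma capIndex_le {L : ℝ} (hL : 0 < L) (k : ℤ × ℤ) : capIndex L k * L ≤ k.1 := by
  rw [← le_div_iff₀ hL]; exact Int.floor_le _

lemma lt_capIndex {L : ℝ} (hL : 0 < L) (k : ℤ × ℤ) : (k.1 : ℝ) < (capIndex L k + 1) * L := by
  rw [← div_lt_iff₀ hL]; exact Int.lt_floor_add_one _

namespace Shell

variable {M lam δ : ℝ} {g ψ : ℝ → ℝ} {S : Finset (ℤ × ℤ)}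

lemma sqrt_pos (h : Shell M lam δ g ψ S) : 0 < √(lam * δ) :=
  Real.sqrt_pos.2 (by linarith [h.one_le_mul])

lemma one_le_sqrt (h : Shell M lam δ g ψ S) : 1 ≤ √(lam * δ) :=
  Real.one_le_sqrt.2 h.one_le_mul

lemma sq_sqrt (h : Shell M lam δ g ψ S) : √(lam * δ) ^ 2 = lam * δ :=
  Real.sq_sqrt (by linarith [h.one_le_mul])

lemma two_mul_le_sub (h : Shell M lam δ g ψ S) {u u' c D : ℝ} (hu : |u| ≤ M * lam)
    (hu' : |u'| ≤ M * lam) (hc : |c| ≤ M * lam) (hD : 0 < D) (hD' : D ≤ |u' - c|)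
    (hs : 0 ≤ (u - u') * (u' - c)) :
    2 * (|u - u'| * D) ≤ M * lam * (g u - g u' - ψ c * (u - u')) := by
  have hM := mul_pos h.M_pos h.lam_pos
  have h1 := h.lower u u' hu hu'
  have h2 := h.psi_mono hu' hc
  have h3 : 0 ≤ (u - u') ^ 2 / (M * lam) := by positivity
  have hne : 0 < (u' - c) ^ 2 := by
    rw [← sq_abs]; have : 0 < |u' - c| := hD.trans_le hD'
    positivity
  rw [div_le_iff₀ hM] at h2
  have h4 : 2 * ((u - u') * (u' - c)) ≤ (ψ u' - ψ c) * (u - u') * (M * lam) := by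
    refine le_of_mul_le_mul_right ?_ hne
    have := mul_le_mul_of_nonneg_right h2 hs
    nlinarith
  have h5 : |u - u'| * |u' - c| = (u - u') * (u' - c) := by rw [← abs_mul, abs_of_nonneg hs]
  have h6 : |u - u'| * D ≤ |u - u'| * |u' - c| := by gcongr
  have h7 : (ψ u' - ψ c) * (u - u') ≤ g u - g u' - ψ c * (u - u') := by linarith
  have := mul_le_mul_of_nonneg_right h7 hM.le
  linarith

lemma transversal (h : Shell M lam δ g ψ S) {C₀ : ℕ} (hC : 11 * M ^ 2 ≤ C₀) :
    Transversal S (capIndex √(lam * δ)) C₀ := by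
  intro σ d hσ hd k hk k' hk' a₁ h1 a₂ h2 a₃ h3 a₄ h4 heq c2 c3 c4 hfar
  set L := √(lam * δ) with hL
  have hL0 : 0 < L := h.sqrt_pos
  have hL2 : L ^ 2 = lam * δ := h.sq_sqrt
  have hM := h.M_pos
  have hlam := h.lam_pos
  have hδ := h.pos
  have hσ' : (1 : ℝ) ≤ σ := by exact_mod_cast hσ
  have hd' : (0 : ℝ) < d := by exact_mod_cast hd
  set c : ℝ := ((a₁.1 : ℤ) : ℝ) with hc
  have hcM : |c| ≤ M * lam := h.fst_le _ h1
  set D : ℝ → ℝ := fun u => g u - g c - ψ c * (u - c) with hD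
  have hq : ∀ x ∈ S, |capIndex L x - capIndex L a₁| ≤ σ →
      |(x.2 : ℝ) - g c - ψ c * (x.1 - c)| ≤ 5 * M * σ ^ 2 * δ := by
    intro x hx hxσ
    have hxu := h.upper x.1 c (h.fst_le _ hx) hcM
    have hxl := h.lower x.1 c (h.fst_le _ hx) hcM
    have hn := h.near x hx
    have hdist : |(x.1 : ℝ) - c| ≤ 2 * σ * L := by
      have e1 := capIndex_le hL0 x
      have e2 := lt_capIndex hL0 x
      have e3 := capIndex_le hL0 a₁
      have e4 := lt_capIndex hL0 a₁
      have e5 : |((capIndex L x : ℝ) - capIndex L a₁)| ≤ σ := by exact_mod_cast hxσ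
      rw [abs_le] at e5 ⊢
      have e6 : 0 ≤ (σ - 1) * L := mul_nonneg (by linarith) hL0.le
      have e7 := mul_le_mul_of_nonneg_right e5.1 hL0.le
      have e8 := mul_le_mul_of_nonneg_right e5.2 hL0.le
      constructor <;> nlinarith
    have hsq : M * ((x.1 : ℝ) - c) ^ 2 / lam ≤ 4 * M * σ ^ 2 * δ := by
      rw [div_le_iff₀ hlam, ← sq_abs]
      calc M * |(x.1 : ℝ) - c| ^ 2 ≤ M * (2 * σ * L) ^ 2 := by gcongr
        _ = 4 * M * σ ^ 2 * L ^ 2 := by ring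
        _ = _ := by rw [hL2]; ring
    have hpos : 0 ≤ ((x.1 : ℝ) - c) ^ 2 / (M * lam) := by positivity
    have h1σ : M * δ ≤ M * σ ^ 2 * δ := by
      have : (1 : ℝ) ≤ σ ^ 2 := one_le_pow₀ hσ'
      have := mul_pos hM hδ
      nlinarith
    rw [abs_le] at hn ⊢
    constructor <;> linarith
  have heq1 : (k.1 : ℝ) + a₁.1 + a₂.1 = k'.1 + a₃.1 + a₄.1 := by
    have := congrArg Prod.fst heq
    simp only [Prod.fst_add] at this
    exact_mod_cast this
  have heq2 : (k.2 : ℝ) + a₁.2 + a₂.2 = k'.2 + a₃.2 + a₄.2 := by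
    have := congrArg Prod.snd heq
    simp only [Prod.snd_add] at this
    exact_mod_cast this
  have hσ0 : (0 : ℤ) ≤ σ := by omega
  have q1 := hq a₁ h1 (by simpa using hσ0)
  have q2 := hq a₂ h2 c2
  have q3 := hq a₃ h3 c3
  have q4 := hq a₄ h4 c4
  have nk := h.near k hk
  have nk' := h.near k' hk'
  have h1σ : M * δ ≤ M * σ ^ 2 * δ := by
    have : (1 : ℝ) ≤ σ ^ 2 := one_le_pow₀ hσ'
    have := mul_pos hM hδ
    nlinarith
  have hdiff : |g k.1 - g k'.1 - ψ c * ((k.1 : ℝ) - k'.1)| ≤ 22 * M * σ ^ 2 * δ := by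
    rw [abs_le] at *
    have e : ψ c * ((k.1 : ℝ) - k'.1) =
        ψ c * (a₃.1 - c) + ψ c * (a₄.1 - c) - ψ c * (a₁.1 - c) - ψ c * (a₂.1 - c) := by
      rw [← mul_add, ← mul_sub, ← mul_sub]; congr 1; linarith
    constructor <;> linarith
  have key : |(k.1 : ℝ) - k'.1| * d ≤ 11 * M ^ 2 * σ ^ 2 * L := by
    have fu := h.fst_le _ hk
    have fu' := h.fst_le _ hk'
    have hdL : 0 < d * L := by positivity
    have e3 := capIndex_le hL0 a₁
    have e4 := lt_capIndex hL0 a₁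
    have b1 := capIndex_le hL0 k
    have b2 := lt_capIndex hL0 k
    have b3 := capIndex_le hL0 k'
    have b4 := lt_capIndex hL0 k'
    have fin : 2 * (|(k.1 : ℝ) - k'.1| * (d * L)) ≤ M * lam * (22 * M * σ ^ 2 * δ) := by
      have hMl := mul_pos hM hlam
      have r1 : g k.1 - g k'.1 - ψ c * ((k.1 : ℝ) - k'.1) ≤ 22 * M * σ ^ 2 * δ :=
        (le_abs_self _).trans hdiff
      have r2 : g k'.1 - g k.1 - ψ c * ((k'.1 : ℝ) - k.1) ≤ 22 * M * σ ^ 2 * δ := by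
        refine le_trans (le_of_eq ?_) ((neg_le_abs _).trans hdiff); ring
      rcases hfar with ⟨f1, f2⟩ | ⟨f1, f2⟩
      · have g1 : (capIndex L a₁ + d + 1 : ℝ) ≤ capIndex L k := by exact_mod_cast f1
        have g2 : (capIndex L a₁ + d + 1 : ℝ) ≤ capIndex L k' := by exact_mod_cast f2
        have g3 := mul_le_mul_of_nonneg_right g1 hL0.le
        have g4 := mul_le_mul_of_nonneg_right g2 hL0.le
        have l1 : d * L ≤ k.1 - c := by linarith
        have l2 : d * L ≤ k'.1 - c := by linarith
        rcases le_total (k'.1 : ℝ) k.1 with hle | hle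
        · exact (h.two_mul_le_sub fu fu' hcM hdL (l2.trans (le_abs_self _))
            (mul_nonneg (by linarith) (by linarith))).trans (by gcongr)
        · rw [abs_sub_comm]
          exact (h.two_mul_le_sub fu' fu hcM hdL (l1.trans (le_abs_self _))
            (mul_nonneg (by linarith) (by linarith))).trans (by gcongr)
      · have g1 : (capIndex L k + d + 1 : ℝ) ≤ capIndex L a₁ := by exact_mod_cast f1
        have g2 : (capIndex L k' + d + 1 : ℝ) ≤ capIndex L a₁ := by exact_mod_cast f2
        have g3 := mul_le_mul_of_nonneg_right g1 hL0.le
        have g4 := mul_le_mul_of_nonneg_right g2 hL0.le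
        have l1 : d * L ≤ c - k.1 := by linarith
        have l2 : d * L ≤ c - k'.1 := by linarith
        rcases le_total (k'.1 : ℝ) k.1 with hle | hle
        · rw [abs_sub_comm]
          exact (h.two_mul_le_sub fu' fu hcM hdL (by rw [abs_sub_comm]; exact l1.trans (le_abs_self _))
            (mul_nonneg_of_nonpos_of_nonpos (by linarith) (by linarith))).trans (by gcongr)
        · exact (h.two_mul_le_sub fu fu' hcM hdL (by rw [abs_sub_comm]; exact l2.trans (le_abs_self _))
            (mul_nonneg_of_nonpos_of_nonpos (by linarith) (by linarith))).trans (by gcongr)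
    have e : M * lam * (22 * M * σ ^ 2 * δ) = 2 * (11 * M ^ 2 * σ ^ 2 * L) * L := by
      calc _ = 22 * M ^ 2 * σ ^ 2 * (lam * δ) := by ring
        _ = _ := by rw [← hL2]; ring
    rw [e] at fin
    refine le_of_mul_le_mul_right (?_ : _ * L ≤ _ * L) hL0
    linarith
  have hidx : |(capIndex L k : ℝ) - capIndex L k'| * L ≤ |(k.1 : ℝ) - k'.1| + L := by
    have b1 := capIndex_le hL0 k
    have b2 := lt_capIndex hL0 k
    have b3 := capIndex_le hL0 k'
    have b4 := lt_capIndex hL0 k'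
    have c1 := le_abs_self ((k.1 : ℝ) - k'.1)
    have c2 := neg_le_abs ((k.1 : ℝ) - k'.1)
    rcases abs_cases ((capIndex L k : ℝ) - capIndex L k') with ⟨e, _⟩ | ⟨e, _⟩ <;> rw [e] <;>
      linarith
  have fin : |(capIndex L k : ℝ) - capIndex L k'| * d ≤ C₀ * σ ^ 2 + d := by
    refine le_of_mul_le_mul_right (?_ : _ * L ≤ _ * L) hL0
    calc _ = |(capIndex L k : ℝ) - capIndex L k'| * L * d := by ring
      _ ≤ (|(k.1 : ℝ) - k'.1| + L) * d := by gcongr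
      _ = |(k.1 : ℝ) - k'.1| * d + L * d := by ring
      _ ≤ 11 * M ^ 2 * σ ^ 2 * L + L * d := by gcongr
      _ ≤ C₀ * σ ^ 2 * L + L * d := by gcongr
      _ = _ := by ring
  exact_mod_cast fin

end Shell

lemma capNorm_le {S : Finset (ℤ × ℤ)} {a : ℤ × ℤ → ℂ} {ι : ℤ × ℤ → ℤ} {j : ℤ} {n : ℝ}
    (hn : ((S.filter fun k => ι k = j).card : ℝ) ≤ n) :
    capNorm T S a ι j ≤ n ^ (2 / 3 : ℝ) * nsq (S.filter fun k => ι k = j) a := by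
  set A := S.filter fun k => ι k = j
  have hn0 : 0 ≤ n := (Nat.cast_nonneg _).trans hn
  have hq := nsq_nonneg A a
  have h6 : ∫ w, ‖T.trig A a w‖ ^ 6 ∂T.μ ≤ n ^ 2 * nsq A a ^ 3 := by
    calc _ ≤ ∫ w, (n * nsq A a) ^ 2 * ‖T.trig A a w‖ ^ 2 ∂T.μ := by
          refine integral_mono ((BM.trig _ _).norm.pow 6).integrable
            (((BM.trig _ _).norm.pow 2).const_mul _).integrable fun w => ?_
          have h1 : ‖T.trig A a w‖ ^ 2 ≤ n * nsq A a :=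
            (norm_trig_sq_le A a w).trans (by gcongr)
          simp only
          calc _ = (‖T.trig A a w‖ ^ 2) ^ 2 * ‖T.trig A a w‖ ^ 2 := by ring
            _ ≤ _ := by gcongr
      _ = _ := by
          rw [integral_const_mul, integral_norm_trig_sq]
          change _ * nsq A a = _
          ring
  have h0 := capNorm_nonneg (T := T) (S := S) (a := a) (ι := ι) j
  refine le_of_pow_le_pow_left₀ (n := 3) (by norm_num) (by positivity) ?_
  rw [capNorm_cube]
  refine h6.trans (le_of_eq ?_)
  rw [mul_pow, ← Real.rpow_natCast (n ^ (2 / 3 : ℝ)), ← Real.rpow_mul hn0]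
  norm_num

lemma sum_nsq_filter (S : Finset (ℤ × ℤ)) (a : ℤ × ℤ → ℂ) (ι : ℤ × ℤ → ℤ) :
    ∑ j ∈ S.image ι, nsq (S.filter fun k => ι k = j) a = nsq S a :=
  Finset.sum_fiberwise_of_maps_to (fun _ hk => Finset.mem_image_of_mem _ hk) _

/-- The `L⁶` norm is controlled, up to a small power of `λ`, by the maximal number of frequencies
in a cap. -/
theorem Shell.integral_pow_six_le_of_card_cap (T : Torus Ω) {M : ℝ} (hM : 1 ≤ M) {η : ℝ}
    (hη : 0 < η) : ∃ C : ℝ, 0 < C ∧ ∀ (lam δ : ℝ) (g ψ : ℝ → ℝ) (S : Finset (ℤ × ℤ))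
      (a : ℤ × ℤ → ℂ) (n : ℝ), Shell M lam δ g ψ S → nsq S a ≤ 1 →
        (∀ j, ((S.filter fun k => capIndex √(lam * δ) k = j).card : ℝ) ≤ n) →
        ∫ w, ‖T.trig S a w‖ ^ 6 ∂T.μ ≤ C * lam ^ η * n ^ 2 := by
  obtain ⟨b, hb2, B₀, hB₀, hdec⟩ := integral_arc_pow_six_le T ⌈11 * M ^ 2⌉₊ hη
  refine ⟨64 * B₀ * (3 * M * b) ^ η + 1, by positivity, fun lam δ g ψ S a n h ha hn => ?_⟩
  set L := √(lam * δ) with hL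
  have hL1 : 1 ≤ L := h.one_le_sqrt
  have hlam := h.one_le_lam
  have hn0 : 0 ≤ n := (Nat.cast_nonneg _).trans (hn 0)
  have hb1 : (1 : ℝ) < b := by exact_mod_cast (by omega : 1 < b)
  have hMl : 1 ≤ M * lam := one_le_mul_of_one_le_of_one_le hM hlam
  obtain ⟨N, hN1, hN2⟩ := exists_nat_pow_near (x := 3 * M * lam) (by nlinarith) hb1
  have hm : (b : ℝ) ^ (N + 1) ≤ 3 * M * b * lam := by
    rw [pow_succ]; nlinarith
  have hcap := hdec S a (capIndex L) (h.transversal (Nat.le_ceil _)) (N + 1)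
  set W := ∑ j ∈ S.image (capIndex L), capNorm T S a (capIndex L) j with hW
  have hW1 : W ≤ n ^ (2 / 3 : ℝ) := by
    calc W ≤ ∑ j ∈ S.image (capIndex L), n ^ (2 / 3 : ℝ) *
          nsq (S.filter fun k => capIndex L k = j) a :=
          Finset.sum_le_sum fun j _ => capNorm_le (hn j)
      _ = n ^ (2 / 3 : ℝ) * nsq S a := by rw [← Finset.mul_sum, sum_nsq_filter]
      _ ≤ n ^ (2 / 3 : ℝ) * 1 := by gcongr
      _ = _ := mul_one _
  have hW0 : 0 ≤ W := Finset.sum_nonneg fun _ _ => capNorm_nonneg _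
  have hW3 : W ^ 3 ≤ n ^ 2 := by
    refine (pow_le_pow_left₀ hW0 hW1 3).trans (le_of_eq ?_)
    rw [← Real.rpow_natCast, ← Real.rpow_mul hn0]; norm_num
  have harc : ∀ i, arcWt T S a (capIndex L) b (N + 1) i ≤ W := fun i =>
    Finset.sum_le_sum_of_subset_of_nonneg (Finset.filter_subset _ _) fun _ _ _ => capNorm_nonneg _
  set E := B₀ * (3 * M * b) ^ η * lam ^ η * n ^ 2 with hE
  have hhalf : ∀ i, ∫ w, ‖T.trig (arc S (capIndex L) b (N + 1) i) a w‖ ^ 6 ∂T.μ ≤ E := by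
    intro i
    refine (hcap i).trans ?_
    have h0 := arcWt_nonneg (T := T) (S := S) (a := a) (ι := capIndex L) (b := b) (N + 1) i
    have h3 : arcWt T S a (capIndex L) b (N + 1) i ^ 3 ≤ n ^ 2 :=
      (pow_le_pow_left₀ h0 (harc i) 3).trans hW3
    have h4 : ((b : ℝ) ^ (N + 1)) ^ η ≤ (3 * M * b) ^ η * lam ^ η := by
      rw [← Real.mul_rpow (by positivity) (by linarith)]
      exact Real.rpow_le_rpow (by positivity) hm hη.le
    calc _ ≤ B₀ * ((3 * M * b) ^ η * lam ^ η) * n ^ 2 := by gcongr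
      _ = E := by rw [hE]; ring
  have hsplit : ∀ w, T.trig S a w = T.trig (arc S (capIndex L) b (N + 1) (-1)) a w +
      T.trig (arc S (capIndex L) b (N + 1) 0) a w := by
    intro w
    rw [Torus.trig, ← Finset.sum_filter_add_sum_filter_not S
      (fun k => capIndex L k / (b : ℤ) ^ (N + 1) = -1)]
    congr 1
    refine Finset.sum_congr (Finset.filter_congr fun k hk => ?_) fun _ _ => rfl
    have hp : (0 : ℤ) < (b : ℤ) ^ (N + 1) := by positivity
    have f := h.fst_le k hk
    have hkL : |(k.1 : ℝ) / L| ≤ M * lam := by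
      rw [abs_div, abs_of_pos (by linarith : 0 < L)]
      exact (div_le_self (abs_nonneg _) hL1).trans f
    rw [abs_le] at hkL
    have f1 : (-(b : ℤ) ^ (N + 1) : ℤ) ≤ capIndex L k := by
      rw [capIndex, Int.le_floor]; push_cast; nlinarith
    have f2 : capIndex L k < (b : ℤ) ^ (N + 1) := by
      rw [capIndex, Int.floor_lt]; push_cast; nlinarith
    have g1 : -1 ≤ capIndex L k / (b : ℤ) ^ (N + 1) := by
      rw [Int.le_ediv_iff_mul_le hp]; linarith
    have g2 : capIndex L k / (b : ℤ) ^ (N + 1) < 1 := by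
      rw [Int.ediv_lt_iff_lt_mul hp]; linarith
    omega
  have hint : ∀ i, Integrable (fun w => ‖T.trig (arc S (capIndex L) b (N + 1) i) a w‖ ^ 6) T.μ :=
    fun i => ((BM.trig _ _).norm.pow 6).integrable
  calc ∫ w, ‖T.trig S a w‖ ^ 6 ∂T.μ ≤
        ∫ w, 32 * (‖T.trig (arc S (capIndex L) b (N + 1) (-1)) a w‖ ^ 6 +
          ‖T.trig (arc S (capIndex L) b (N + 1) 0) a w‖ ^ 6) ∂T.μ := by
        refine integral_mono ((BM.trig _ _).norm.pow 6).integrable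
          (((hint _).add (hint _)).const_mul _) fun w => ?_
        simp only
        rw [hsplit w]
        calc _ ≤ (‖T.trig (arc S (capIndex L) b (N + 1) (-1)) a w‖ +
              ‖T.trig (arc S (capIndex L) b (N + 1) 0) a w‖) ^ 6 := by
              gcongr; exact norm_add_le _ _
          _ ≤ 2 ^ (6 - 1) * _ := add_pow_le (norm_nonneg _) (norm_nonneg _) 6
          _ = _ := by norm_num
    _ ≤ 32 * (E + E) := by
        rw [integral_const_mul, integral_add (hint _) (hint _)]
        gcongr <;> exact hhalf _
    _ ≤ _ := by
        have : 0 ≤ lam ^ η * n ^ 2 := by positivity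
        rw [hE]; nlinarith

end

section

variable {Ω : Type*} [MeasurableSpace Ω] {T : Torus Ω}

/-! ### Counting lattice points in caps -/

/-- The points of `X` lie on a line. -/
def IsCollinear (X : Finset (ℤ × ℤ)) : Prop :=
  ∀ p ∈ X, ∀ q ∈ X, ∀ r ∈ X, (q.1 - p.1) * (r.2 - p.2) = (q.2 - p.2) * (r.1 - p.1)

lemma isCollinear_or_card_le {X : Finset (ℤ × ℤ)} {θ l w : ℝ} (hl : 0 < l) (hw : 0 < w)
    (h1 : ∀ p ∈ X, ∀ q ∈ X, |(p.1 : ℝ) - q.1| ≤ l)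
    (h2 : ∀ p ∈ X, ∀ q ∈ X, |(p.2 : ℝ) - q.2 - θ * (p.1 - q.1)| ≤ w) :
    IsCollinear X ∨ (X.card : ℝ) ≤ 18 * (l * w) := by
  by_cases hX : X.offDiag.Nonempty
  swap
  · left
    intro p hp q hq r hr
    have : p = q := by
      by_contra hne
      exact hX ⟨(p, q), Finset.mem_offDiag.2 ⟨hp, hq, hne⟩⟩
    rw [this]; ring
  set N : (ℤ × ℤ) × (ℤ × ℤ) → ℝ := fun z =>
    max (|(z.1.1 : ℝ) - z.2.1| / l) (|(z.1.2 : ℝ) - z.2.2 - θ * (z.1.1 - z.2.1)| / w) with hN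
  obtain ⟨⟨a, b⟩, hab, hmin⟩ := X.offDiag.exists_min_image N hX
  obtain ⟨ha, hb, hne⟩ := Finset.mem_offDiag.1 hab
  replace hne : a ≠ b := hne
  set r := N (a, b) with hr
  set s : ℝ := (a.1 : ℝ) - b.1 with hs
  set t : ℝ := (a.2 : ℝ) - b.2 - θ * s with ht
  have hst : r = max (|s| / l) (|t| / w) := rfl
  have hr0 : 0 < r := by
    rw [hst, lt_max_iff]
    by_contra hcon
    push Not at hcon
    have e1 : s = 0 := by
      have : |s| ≤ 0 := by rw [div_le_iff₀ hl] at hcon; linarith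
      exact abs_nonpos_iff.1 this
    have e2 : t = 0 := by
      have : |t| ≤ 0 := by have := hcon.2; rw [div_le_iff₀ hw] at this; linarith
      exact abs_nonpos_iff.1 this
    apply hne
    ext
    · have : (a.1 : ℝ) = b.1 := by linarith
      exact_mod_cast this
    · have : (a.2 : ℝ) = b.2 := by rw [ht, e1] at e2; linarith
      exact_mod_cast this
  have hr1 : r ≤ 1 := by
    rw [hst, max_le_iff, div_le_one hl, div_le_one hw]
    exact ⟨h1 a ha b hb, h2 a ha b hb⟩
  have hs' : |s| ≤ r * l := by rw [← div_le_iff₀ hl, hst]; exact le_max_left _ _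
  have ht' : |t| ≤ r * w := by rw [← div_le_iff₀ hw, hst]; exact le_max_right _ _
  set D : ℤ × ℤ → ℤ := fun p => (a.1 - b.1) * (p.2 - a.2) - (a.2 - b.2) * (p.1 - a.1) with hD
  have hDr : ∀ p : ℤ × ℤ, (D p : ℝ) = s * ((p.2 : ℝ) - a.2 - θ * (p.1 - a.1)) - t * (p.1 - a.1) := by
    intro p; rw [hD, ht, hs]; push_cast; ring
  have hDb : ∀ p ∈ X, |(D p : ℝ)| ≤ 2 * r * (l * w) := by
    intro p hp
    rw [hDr]
    refine (abs_sub _ _).trans ?_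
    rw [abs_mul, abs_mul]
    have := h1 p hp a ha
    have := h2 p hp a ha
    calc _ ≤ (r * l) * w + (r * w) * l := by gcongr
      _ = _ := by ring
  by_cases hcol : ∀ p ∈ X, D p = 0
  · left
    have hpar : ∀ p ∈ X, ∀ q ∈ X, (a.1 - b.1) * (p.2 - q.2) = (a.2 - b.2) * (p.1 - q.1) := by
      intro p hp q hq
      have e1 := hcol p hp
      have e2 := hcol q hq
      simp only [hD] at e1 e2
      linarith
    intro p hp q hq z hz
    have e1 := hpar q hq p hp
    have e2 := hpar z hz p hp
    by_cases hv : a.1 - b.1 = 0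
    · have hv2 : a.2 - b.2 ≠ 0 := fun hv2 => hne (Prod.ext (by omega) (by omega))
      rw [hv, zero_mul] at e1 e2
      have f1 : q.1 - p.1 = 0 := by
        rcases mul_eq_zero.1 e1.symm with h | h
        · exact absurd h hv2
        · exact h
      have f2 : z.1 - p.1 = 0 := by
        rcases mul_eq_zero.1 e2.symm with h | h
        · exact absurd h hv2
        · exact h
      rw [f1, f2]; ring
    · refine mul_left_cancel₀ hv ?_
      linear_combination (q.1 - p.1) * e2 - (z.1 - p.1) * e1
  · right
    push Not at hcol
    obtain ⟨p₀, hp₀, hDp₀⟩ := hcol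
    have hrlw : 1 ≤ 2 * r * (l * w) := by
      refine le_trans ?_ (hDb p₀ hp₀)
      have : (1 : ℤ) ≤ |D p₀| := Int.one_le_abs hDp₀
      exact_mod_cast this
    have hinv : 1 / r ≤ 2 * (l * w) := by
      rw [div_le_iff₀ hr0]; linarith
    have himg : ((X.image D).card : ℝ) ≤ 2 * (2 * r * (l * w)) + 1 := by
      refine card_le_of_dist_le _ 0 (by positivity) ?_
      intro x hx
      obtain ⟨p, hp, rfl⟩ := Finset.mem_image.1 hx
      rw [sub_zero]; exact hDb p hp
    have hfib : ∀ d ∈ X.image D, ((X.filter fun p => D p = d).card : ℝ) ≤ 1 / r + 1 + 1 := by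
      intro d hd
      obtain ⟨p₁, hp₁, rfl⟩ := Finset.mem_image.1 hd
      have hvv : 0 < s ^ 2 + t ^ 2 := by
        by_contra hcon
        have e1 : s = 0 := by nlinarith [sq_nonneg s, sq_nonneg t]
        have e2 : t = 0 := by nlinarith [sq_nonneg s, sq_nonneg t]
        rw [hst, e1, e2] at hr0
        simp at hr0
      set τ : ℤ × ℤ → ℝ := fun p => (s * (p.1 - p₁.1) +
        t * ((p.2 : ℝ) - p₁.2 - θ * (p.1 - p₁.1))) / (s ^ 2 + t ^ 2) with hτ
      have hpar : ∀ p ∈ X.filter (fun p => D p = D p₁), ∀ q ∈ X.filter (fun p => D p = D p₁),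
          (p.1 : ℝ) - q.1 = (τ p - τ q) * s ∧
          (p.2 : ℝ) - q.2 - θ * (p.1 - q.1) = (τ p - τ q) * t := by
        intro p hp q hq
        have e1 := (Finset.mem_filter.1 hp).2
        have e2 := (Finset.mem_filter.1 hq).2
        have e3 : (D p : ℝ) = D q := by rw [e1, e2]
        rw [hDr, hDr] at e3
        have e4 : (τ p - τ q) * (s ^ 2 + t ^ 2) = s * (p.1 - q.1) +
            t * ((p.2 : ℝ) - q.2 - θ * (p.1 - q.1)) := by
          rw [hτ]; field_simp; ring
        constructor
        · refine mul_right_cancel₀ hvv.ne' ?_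
          linear_combination (-s) * e4 - t * e3
        · refine mul_right_cancel₀ hvv.ne' ?_
          linear_combination (-t) * e4 + s * e3
      have hNτ : ∀ p ∈ X.filter (fun p => D p = D p₁), ∀ q ∈ X.filter (fun p => D p = D p₁),
          N (p, q) = |τ p - τ q| * r := by
        intro p hp q hq
        obtain ⟨e1, e2⟩ := hpar p hp q hq
        simp only [hN]
        rw [e2, e1, hst, abs_mul, abs_mul, mul_max_of_nonneg _ _ (abs_nonneg _)]
        congr 1 <;> ring
      have hinj : Set.InjOn (fun p => ⌊τ p⌋) (X.filter fun p => D p = D p₁ : Finset (ℤ × ℤ)) := by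
        intro p hp q hq hpq
        by_contra hne'
        have hm := hmin (p, q) (Finset.mem_offDiag.2 ⟨(Finset.mem_filter.1 hp).1,
          (Finset.mem_filter.1 hq).1, hne'⟩)
        rw [hNτ p hp q hq] at hm
        have h1 : 1 ≤ |τ p - τ q| := by
          refine le_of_mul_le_mul_right (a := r) ?_ hr0
          rw [one_mul]; exact hm
        have := Int.abs_sub_lt_one_of_floor_eq_floor hpq
        linarith
      rw [← Finset.card_image_of_injOn hinj]
      refine card_le_of_diff_le _ (by positivity) ?_
      intro x hx y hy
      obtain ⟨p, hp, rfl⟩ := Finset.mem_image.1 hx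
      obtain ⟨q, hq, rfl⟩ := Finset.mem_image.1 hy
      have hle : |τ p - τ q| ≤ 1 / r := by
        rw [le_div_iff₀ hr0, ← hNτ p hp q hq]
        simp only [hN]
        rw [max_le_iff, div_le_one hl, div_le_one hw]
        exact ⟨h1 p (Finset.mem_filter.1 hp).1 q (Finset.mem_filter.1 hq).1,
          h2 p (Finset.mem_filter.1 hp).1 q (Finset.mem_filter.1 hq).1⟩
      have f1 := Int.floor_le (τ p)
      have f2 := Int.lt_floor_add_one (τ p)
      have f3 := Int.floor_le (τ q)
      have f4 := Int.lt_floor_add_one (τ q)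
      have := le_abs_self (τ p - τ q)
      linarith
    have h1r : 1 ≤ 1 / r := by rw [le_div_iff₀ hr0]; linarith
    have hlw : 0 < l * w := by positivity
    have := card_le_mul_card_image' X D (c := 1 / r + 1 + 1) hfib
    calc (X.card : ℝ) ≤ _ := this
      _ ≤ (3 * (1 / r)) * (2 * (2 * r * (l * w)) + 1) := by
          gcongr
          linarith
      _ = 12 * (l * w) + 3 * (1 / r) := by field_simp; ring
      _ ≤ _ := by linarith

end

section

variable {Ω : Type*} [MeasurableSpace Ω] {T : Torus Ω}

lemma floor_image_card_le (X : Finset (ℤ × ℤ)) {l : ℝ} (hl : 0 ≤ l)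
    (h : ∀ p ∈ X, ∀ q ∈ X, (p.1 : ℝ) - q.1 ≤ l) : ((X.image Prod.fst).card : ℝ) ≤ l + 1 := by
  refine card_le_of_diff_le _ hl ?_
  intro x hx y hy
  obtain ⟨p, hp, rfl⟩ := Finset.mem_image.1 hx
  obtain ⟨q, hq, rfl⟩ := Finset.mem_image.1 hy
  exact h p hp q hq

lemma IsCollinear.exists_slope {X : Finset (ℤ × ℤ)} (hcol : IsCollinear X) {p q : ℤ × ℤ}
    (hp : p ∈ X) (hq : q ∈ X) (hpq : p.1 ≠ q.1) :
    ∃ α : ℝ, ∀ r ∈ X, ∀ s ∈ X, (r.2 : ℝ) - s.2 = α * (r.1 - s.1) := by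
  have hne : (q.1 : ℝ) - p.1 ≠ 0 := by
    rw [sub_ne_zero]; exact_mod_cast hpq.symm
  set α : ℝ := ((q.2 : ℝ) - p.2) / (q.1 - p.1) with hα
  have hline : ∀ r ∈ X, (r.2 : ℝ) - p.2 = α * (r.1 - p.1) := by
    intro r hr
    have e := hcol p hp q hq r hr
    have e' : ((q.1 : ℝ) - p.1) * (r.2 - p.2) = (q.2 - p.2) * (r.1 - p.1) := by exact_mod_cast e
    rw [hα, div_mul_eq_mul_div, eq_div_iff hne]; linarith
  refine ⟨α, fun r hr s hs => ?_⟩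
  have := hline r hr
  have := hline s hs
  linarith

namespace Shell

variable {M lam δ : ℝ} {g ψ : ℝ → ℝ} {S : Finset (ℤ × ℤ)}

lemma abs_sub_tangent_le (h : Shell M lam δ g ψ S) {x : ℤ × ℤ} (hx : x ∈ S) {c : ℝ}
    (hc : |c| ≤ M * lam) :
    |(x.2 : ℝ) - g c - ψ c * (x.1 - c)| ≤ M * δ + M * ((x.1 : ℝ) - c) ^ 2 / lam := by
  have hxu := h.upper x.1 c (h.fst_le _ hx) hc
  have hxl := h.lower x.1 c (h.fst_le _ hx) hc
  have hn := h.near x hx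
  have := h.M_pos
  have := h.lam_pos
  have hpos : 0 ≤ ((x.1 : ℝ) - c) ^ 2 / (M * lam) := by positivity
  rw [abs_le] at hn ⊢
  constructor <;> linarith

lemma card_le_of_fst (h : Shell M lam δ g ψ S) {X : Finset (ℤ × ℤ)} (hX : X ⊆ S) {n : ℝ}
    (hn : ((X.image Prod.fst).card : ℝ) ≤ n) : (X.card : ℝ) ≤ 3 * M * n := by
  have hM := h.M_pos
  refine (card_le_mul_card_image' X Prod.fst (c := 3 * M) fun z _ => ?_).trans (by gcongr)
  refine le_trans ?_ (h.card_fiber z)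
  exact_mod_cast Finset.card_le_card (Finset.filter_subset_filter _ hX)

lemma card_collinear_le (h : Shell M lam δ g ψ S) {X : Finset (ℤ × ℤ)} (hX : X ⊆ S)
    (hcol : IsCollinear X) : (X.card : ℝ) ≤ 30 * M ^ 2 * √(lam * δ) := by
  have hM := h.M_pos
  have hM1 := h.one_le_M
  have hL1 := h.one_le_sqrt
  have hL2 := h.sq_sqrt
  set L := √(lam * δ)
  have hlam := h.lam_pos
  have hML : 1 ≤ M * L := one_le_mul_of_one_le_of_one_le hM1 hL1
  suffices hn : ((X.image Prod.fst).card : ℝ) ≤ 10 * (M * L) by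
    refine (h.card_le_of_fst hX hn).trans (le_of_eq (by ring))
  by_cases hv : ∃ p ∈ X, ∃ q ∈ X, p.1 ≠ q.1
  swap
  · push Not at hv
    refine (floor_image_card_le X le_rfl fun p hp q hq => ?_).trans (by linarith)
    rw [hv p hp q hq, sub_self]
  obtain ⟨p, hp, q, hq, hpq⟩ := hv
  obtain ⟨α, hline⟩ := hcol.exists_slope hp hq hpq
  have hdist : ∀ m ∈ X, ∀ r ∈ X, 0 ≤ (ψ m.1 - α) * (r.1 - m.1) →
      |(r.1 : ℝ) - m.1| ≤ 2 * (M * L) := by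
    intro m hm r hr hs
    have e1 := h.lower r.1 m.1 (h.fst_le _ (hX hr)) (h.fst_le _ (hX hm))
    have e2 := abs_le.1 (h.near m (hX hm))
    have e3 := abs_le.1 (h.near r (hX hr))
    have e4 := hline r hr m hm
    have e6 : ((r.1 : ℝ) - m.1) ^ 2 / (M * lam) ≤ 2 * (M * δ) := by nlinarith
    rw [div_le_iff₀ (by positivity)] at e6
    refine abs_le_of_sq_le_sq ?_ (by positivity)
    calc _ ≤ _ := e6
      _ = 2 * M ^ 2 * (lam * δ) := by ring
      _ = 2 * M ^ 2 * L ^ 2 := by rw [hL2]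
      _ ≤ _ := by nlinarith [sq_nonneg (M * L)]
  have hXne : (X.image Prod.fst).Nonempty := ⟨p.1, Finset.mem_image_of_mem _ hp⟩
  obtain ⟨lo, hlo, elo⟩ := Finset.mem_image.1 ((X.image Prod.fst).min'_mem hXne)
  obtain ⟨hi, hhi, ehi⟩ := Finset.mem_image.1 ((X.image Prod.fst).max'_mem hXne)
  have hsub : X.image Prod.fst ⊆
      (X.image Prod.fst).filter (fun z : ℤ => |(z : ℝ) - lo.1| ≤ 2 * (M * L)) ∪
      (X.image Prod.fst).filter (fun z : ℤ => |(z : ℝ) - hi.1| ≤ 2 * (M * L)) := by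
    intro z hz
    obtain ⟨m, hm, rfl⟩ := Finset.mem_image.1 hz
    have b1 : (lo.1 : ℝ) ≤ m.1 := by
      rw [elo]; exact_mod_cast Finset.min'_le _ _ hz
    have b2 : (m.1 : ℝ) ≤ hi.1 := by
      rw [ehi]; exact_mod_cast Finset.le_max' _ _ hz
    rw [Finset.mem_union, Finset.mem_filter, Finset.mem_filter]
    rcases le_total 0 (ψ m.1 - α) with hs | hs
    · right
      refine ⟨hz, ?_⟩
      rw [abs_sub_comm]
      exact hdist m hm hi hhi (mul_nonneg hs (by linarith))
    · left
      refine ⟨hz, ?_⟩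
      rw [abs_sub_comm]
      exact hdist m hm lo hlo (mul_nonneg_of_nonpos_of_nonpos hs (by linarith))
  have hlow := card_le_of_dist_le ((X.image Prod.fst).filter
    fun z : ℤ => |(z : ℝ) - lo.1| ≤ 2 * (M * L)) lo.1 (by positivity)
    fun z hz => (Finset.mem_filter.1 hz).2
  have hhigh := card_le_of_dist_le ((X.image Prod.fst).filter
    fun z : ℤ => |(z : ℝ) - hi.1| ≤ 2 * (M * L)) hi.1 (by positivity)
    fun z hz => (Finset.mem_filter.1 hz).2
  have hun := (Nat.cast_le (α := ℝ)).2
    ((Finset.card_le_card hsub).trans (Finset.card_union_le _ _))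
  rw [Nat.cast_add] at hun
  linarith

lemma isCollinear_or_card_le (h : Shell M lam δ g ψ S) {X : Finset (ℤ × ℤ)} (hX : X ⊆ S) {l : ℝ}
    (hl : 0 < l) (hd : ∀ p ∈ X, ∀ q ∈ X, |(p.1 : ℝ) - q.1| ≤ l) :
    IsCollinear X ∨ (X.card : ℝ) ≤ 36 * M * (l * (δ + l ^ 2 / lam)) := by
  have hM := h.M_pos
  have hδ := h.pos
  have hlam := h.lam_pos
  rcases X.eq_empty_or_nonempty with rfl | ⟨c, hc⟩
  · left; intro p hp; simp at hp
  have hcM := h.fst_le c (hX hc)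
  have tan : ∀ p ∈ X, |(p.2 : ℝ) - g c.1 - ψ c.1 * (p.1 - c.1)| ≤ M * (δ + l ^ 2 / lam) := by
    intro p hp
    refine (h.abs_sub_tangent_le (hX hp) hcM).trans ?_
    have : ((p.1 : ℝ) - c.1) ^ 2 ≤ l ^ 2 := by
      rw [← sq_abs]; exact pow_le_pow_left₀ (abs_nonneg _) (hd p hp c hc) 2
    rw [mul_add, ← mul_div_assoc]
    gcongr
  rcases TorusShell.isCollinear_or_card_le (X := X) (θ := ψ c.1) (l := l)
    (w := 2 * (M * (δ + l ^ 2 / lam))) hl (by positivity) hd (fun p hp q hq => by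
      have e1 := abs_le.1 (tan p hp)
      have e2 := abs_le.1 (tan q hq)
      rw [abs_le]; constructor <;> linarith) with h1 | h1
  · exact Or.inl h1
  · exact Or.inr (h1.trans (le_of_eq (by ring)))

lemma abs_sub_le_of_capIndex_eq {l : ℝ} (hl : 0 < l) {p q : ℤ × ℤ}
    (hpq : capIndex l p = capIndex l q) : |(p.1 : ℝ) - q.1| ≤ l := by
  have e1 := capIndex_le hl p
  have e2 := lt_capIndex hl p
  have e3 := capIndex_le hl q
  have e4 := lt_capIndex hl q
  rw [hpq] at e1 e2
  rw [abs_le]; constructor <;> linarith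

lemma card_arc_le (h : Shell M lam δ g ψ S) {H : ℝ} (hH : 1 ≤ H) (hδH : δ * H ^ 3 ≤ 1) (j : ℤ) :
    ((S.filter fun k => capIndex (√(lam * δ) * H) k = j).card : ℝ) ≤ 72 * M ^ 2 * √(lam * δ) := by
  have hM := h.one_le_M
  have hL0 := h.sqrt_pos
  have hL2 := h.sq_sqrt
  have hδ := h.pos
  have hlam := h.lam_pos
  set L := √(lam * δ)
  have hM2 : M ≤ M ^ 2 := by nlinarith
  have hLH : 0 < L * H := by positivity
  rcases h.isCollinear_or_card_le (Finset.filter_subset (fun k => capIndex (L * H) k = j) S) hLH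
    fun p hp q hq => abs_sub_le_of_capIndex_eq hLH
      ((Finset.mem_filter.1 hp).2.trans (Finset.mem_filter.1 hq).2.symm) with h1 | h1
  · refine (h.card_collinear_le (Finset.filter_subset _ _) h1).trans ?_
    gcongr; norm_num
  · refine h1.trans ?_
    have e : (L * H) ^ 2 / lam = δ * H ^ 2 := by
      rw [mul_pow, hL2]; field_simp
    rw [e]
    have hH2 : 1 ≤ H ^ 2 := one_le_pow₀ hH
    calc _ ≤ 36 * M * (L * H * (δ * H ^ 2 + δ * H ^ 2)) := by
          gcongr
          exact le_mul_of_one_le_right hδ.le hH2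
      _ = 72 * M * L * (δ * H ^ 3) := by ring
      _ ≤ 72 * M * L * 1 := by gcongr
      _ ≤ 72 * M ^ 2 * L := by rw [mul_one]; gcongr

lemma exists_direction (h : Shell M lam δ g ψ S) {X : Finset (ℤ × ℤ)} (hX : X ⊆ S)
    (hd : ∀ p ∈ X, ∀ q ∈ X, |(p.1 : ℝ) - q.1| ≤ √(lam * δ)) {ν : ℝ} (hν : 4 * M ≤ ν)
    (hν' : 72 * M * (√(lam * δ) * δ) < ν) (hc : ν ≤ X.card) :
    ∃ c ∈ X, ∃ v : ℤ × ℤ, 1 ≤ v.1 ∧ v.1 * ν ≤ 2 * √(lam * δ) ∧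
      |(v.2 : ℝ) / v.1 - ψ c.1| ≤ 4 * M * δ / (ν * v.1) + M * δ / √(lam * δ) := by
  have hM := h.one_le_M
  have hM0 := h.M_pos
  have hL0 := h.sqrt_pos
  have hL2 := h.sq_sqrt
  have hδ := h.pos
  have hlam := h.lam_pos
  set L := √(lam * δ)
  have hν0 : 0 < ν := by linarith
  have hcol : IsCollinear X := by
    rcases h.isCollinear_or_card_le hX hL0 hd with h1 | h1
    · exact h1
    · exfalso
      rw [hL2, mul_div_cancel_left₀ _ hlam.ne'] at h1
      nlinarith
  obtain ⟨p, hp, q, hq, hpq⟩ : ∃ p ∈ X, ∃ q ∈ X, p.1 ≠ q.1 := by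
    by_contra hv
    push Not at hv
    have := h.card_le_of_fst hX (floor_image_card_le X le_rfl fun p hp q hq => by
      rw [hv p hp q hq, sub_self])
    linarith
  obtain ⟨α, hline⟩ := hcol.exists_slope hp hq hpq
  have hinj : Set.InjOn Prod.fst (X : Set (ℤ × ℤ)) := by
    intro r hr s hs hrs
    have e := hline r hr s hs
    rw [hrs, sub_self, mul_zero] at e
    refine Prod.ext hrs ?_
    have : (r.2 : ℝ) = s.2 := by linarith
    exact_mod_cast this
  have hXne : X.Nonempty := ⟨p, hp⟩
  obtain ⟨lo, hlo, elo⟩ := X.exists_min_image Prod.fst hXne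
  obtain ⟨hi, hhi, ehi⟩ := X.exists_max_image Prod.fst hXne
  set gaps := X.offDiag.filter fun z => z.1.1 < z.2.1 with hgaps
  have hgne : gaps.Nonempty := by
    rcases lt_or_gt_of_ne hpq with hlt | hlt
    · exact ⟨(p, q), Finset.mem_filter.2 ⟨Finset.mem_offDiag.2 ⟨hp, hq, fun e => hpq (congrArg Prod.fst e)⟩, hlt⟩⟩
    · exact ⟨(q, p), Finset.mem_filter.2 ⟨Finset.mem_offDiag.2 ⟨hq, hp, fun e => hpq (congrArg Prod.fst e).symm⟩, hlt⟩⟩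
  obtain ⟨⟨a, b⟩, hab, hmin⟩ := gaps.exists_min_image (fun z => z.2.1 - z.1.1) hgne
  obtain ⟨hab', hlt⟩ := Finset.mem_filter.1 hab
  obtain ⟨ha, hb, -⟩ := Finset.mem_offDiag.1 hab'
  replace hlt : a.1 < b.1 := hlt
  set v1 := b.1 - a.1 with hv1
  have hv1p : 0 < v1 := by omega
  have hsep : ∀ r ∈ X, ∀ s ∈ X, r.1 < s.1 → v1 ≤ s.1 - r.1 := fun r hr s hs hrs =>
    hmin (r, s) (Finset.mem_filter.2 ⟨Finset.mem_offDiag.2 ⟨hr, hs, fun e => by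
      have e' : r = s := e
      rw [e'] at hrs; exact lt_irrefl _ hrs⟩, hrs⟩)
  have hspread : ((X.card : ℝ) - 1) * v1 ≤ (hi.1 : ℝ) - lo.1 := by
    have hinj2 : Set.InjOn (fun r : ℤ × ℤ => (r.1 - lo.1) / v1) (X : Set (ℤ × ℤ)) := by
      intro r hr s hs hrs
      simp only at hrs
      have e1 := Int.ediv_mul_add_emod (r.1 - lo.1) v1
      have e2 := Int.ediv_mul_add_emod (s.1 - lo.1) v1
      have b1 := Int.emod_nonneg (r.1 - lo.1) hv1p.ne'
      have b2 := Int.emod_lt_of_pos (r.1 - lo.1) hv1p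
      have b3 := Int.emod_nonneg (s.1 - lo.1) hv1p.ne'
      have b4 := Int.emod_lt_of_pos (s.1 - lo.1) hv1p
      rw [hrs] at e1
      apply hinj hr hs
      rcases lt_trichotomy r.1 s.1 with hh | hh | hh
      · have := hsep r hr s hs hh; omega
      · exact hh
      · have := hsep s hs r hr hh; omega
    have hsub : X.image (fun r : ℤ × ℤ => (r.1 - lo.1) / v1) ⊆
        Finset.Icc 0 ((hi.1 - lo.1) / v1) := by
      intro z hz
      obtain ⟨r, hr, rfl⟩ := Finset.mem_image.1 hz
      rw [Finset.mem_Icc]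
      exact ⟨Int.ediv_nonneg (by have := elo r hr; omega) hv1p.le,
        Int.ediv_le_ediv hv1p (by have := ehi r hr; omega)⟩
    have hcard := Finset.card_le_card hsub
    rw [Finset.card_image_of_injOn hinj2, Int.card_Icc, sub_zero] at hcard
    have h0 : 0 ≤ (hi.1 - lo.1) / v1 := Int.ediv_nonneg (by have := elo hi hhi; omega) hv1p.le
    have h1 : (X.card : ℤ) - 1 ≤ (hi.1 - lo.1) / v1 := by omega
    rw [Int.le_ediv_iff_mul_le hv1p] at h1
    exact_mod_cast h1
  have hv1r : (1 : ℝ) ≤ v1 := by exact_mod_cast hv1p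
  have hd' : ν / 2 * v1 ≤ (hi.1 : ℝ) - lo.1 := by
    refine le_trans ?_ hspread
    gcongr; linarith
  have hdL : (hi.1 : ℝ) - lo.1 ≤ L := (le_abs_self _).trans (hd hi hhi lo hlo)
  refine ⟨lo, hlo, (v1, b.2 - a.2), by omega, by push_cast; linarith, ?_⟩
  have hα : (((b.2 - a.2 : ℤ) : ℝ)) / v1 = α := by
    rw [div_eq_iff (by linarith)]
    have := hline b hb a ha
    push_cast at this ⊢
    rw [hv1]; push_cast; linarith
  simp only
  rw [hα]
  set d : ℝ := (hi.1 : ℝ) - lo.1 with hdd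
  have hd0 : 0 < d := lt_of_lt_of_le (by positivity) hd'
  have t1 := abs_le.1 (h.abs_sub_tangent_le (hX hhi) (h.fst_le _ (hX hlo)))
  have t2 := abs_le.1 (h.near lo (hX hlo))
  have t3 := hline hi hhi lo hlo
  have hmul : |(α - ψ lo.1) * d| ≤ 2 * (M * δ) + M * d ^ 2 / lam := by
    rw [← hdd] at t1 t3
    rw [abs_le]; constructor <;> linarith
  rw [abs_mul, abs_of_pos hd0, ← le_div_iff₀ hd0] at hmul
  refine hmul.trans ?_
  rw [add_div]
  have hLl : M * δ / L = M * L / lam := by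
    rw [div_eq_div_iff hL0.ne' hlam.ne']
    calc _ = M * (lam * δ) := by ring
      _ = _ := by rw [← hL2]; ring
  have e2 : M * d ^ 2 / lam / d = M * d / lam := by field_simp
  rw [hLl, e2]
  have e1 : 2 * (M * δ) / d ≤ 4 * M * δ / (ν * v1) := by
    rw [div_le_div_iff₀ hd0 (by positivity)]
    have := mul_pos hM0 hδ
    nlinarith
  have e3 : M * d / lam ≤ M * L / lam := by gcongr
  linarith

end Shell

end

section

variable {Ω : Type*} [MeasurableSpace Ω] {T : Torus Ω}

namespace Shell

variable {M lam δ : ℝ} {g ψ : ℝ → ℝ} {S : Finset (ℤ × ℤ)}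

/-- The caps of length `√(λ δ)` with at least `ν` lattice points are few. -/
lemma card_rich_caps_le (h : Shell M lam δ g ψ S) {ν : ℝ} (hν : 4 * M ≤ ν)
    (hν' : 72 * M * (√(lam * δ) * δ) < ν) (J : Finset ℤ)
    (hJ : ∀ j ∈ J, ν ≤ ((S.filter fun k => capIndex √(lam * δ) k = j).card : ℝ)) :
    (J.card : ℝ) ≤ 140 * M ^ 3 * (√(lam * δ) / ν) ^ 2 := by
  have hM := h.one_le_M
  have hM0 := h.M_pos
  have hL1 := h.one_le_sqrt
  have hL0 := h.sqrt_pos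
  have hL2 := h.sq_sqrt
  have hδ := h.pos
  have hlam := h.lam_pos
  have hδ1 := h.le_one
  set L := √(lam * δ)
  have hν0 : 0 < ν := by linarith
  have key : ∀ j ∈ J, ∃ c ∈ S, ∃ v : ℤ × ℤ, capIndex L c = j ∧ 1 ≤ v.1 ∧ v.1 * ν ≤ 2 * L ∧
      |(v.2 : ℝ) / v.1 - ψ c.1| ≤ 4 * M * δ / (ν * v.1) + M * δ / L := by
    intro j hj
    obtain ⟨c, hc, v, h1, h2, h3⟩ := h.exists_direction
      (Finset.filter_subset (fun k => capIndex L k = j) S)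
      (fun p hp q hq => abs_sub_le_of_capIndex_eq hL0
        ((Finset.mem_filter.1 hp).2.trans (Finset.mem_filter.1 hq).2.symm)) hν hν' (hJ j hj)
    exact ⟨c, (Finset.mem_filter.1 hc).1, v, (Finset.mem_filter.1 hc).2, h1, h2, h3⟩
  choose! c hcS v hcj hv1 hvL hvψ using key
  have hMML : 1 ≤ M ^ 2 := one_le_pow₀ hM
  have fib : ∀ b ∈ J.image (fun j => (v j).1),
      ((J.filter fun j => (v j).1 = b).card : ℝ) ≤ 70 * M ^ 3 * (L / ν) := by
    intro b hb
    obtain ⟨j₀, hj₀, rfl⟩ := Finset.mem_image.1 hb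
    set b := (v j₀).1
    have hb1 : (1 : ℝ) ≤ b := by exact_mod_cast hv1 j₀ hj₀
    have hbL : (b : ℝ) * ν ≤ 2 * L := hvL j₀ hj₀
    have hb0 : (0 : ℝ) < b := by linarith
    have hx : 1 / 2 ≤ L / (ν * b) := by
      rw [le_div_iff₀ (by positivity)]; linarith
    set R := 4 * M * δ / (ν * b) + M * δ / L with hR
    have hR0 : 0 ≤ R := by positivity
    have hRle : R ≤ 1 + M := by
      rw [hR]
      refine add_le_add ?_ ?_
      · rw [div_le_one (by positivity)]
        calc 4 * M * δ ≤ 4 * M * 1 := by gcongr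
          _ ≤ ν * 1 := by linarith
          _ ≤ ν * b := by gcongr
      · rw [div_le_iff₀ hL0]
        calc M * δ ≤ M * 1 := by gcongr
          _ ≤ M * L := by gcongr
    have hRL : R * M * lam / L = 4 * M ^ 2 * (L / (ν * b)) + M ^ 2 := by
      rw [hR]
      field_simp
      rw [hL2]; ring
    have inner : ∀ z ∈ (J.filter fun j => (v j).1 = b).image (fun j => (v j).2),
        (((J.filter fun j => (v j).1 = b).filter fun j => (v j).2 = z).card : ℝ) ≤
          10 * M ^ 2 * (L / (ν * b)) := by
      intro z hz
      refine (card_le_of_diff_le _ (l := R * M * lam / L + 1) (by positivity) ?_).trans ?_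
      · intro i hi j hj
        obtain ⟨hi', hi2⟩ := Finset.mem_filter.1 hi
        obtain ⟨hj', hj2⟩ := Finset.mem_filter.1 hj
        obtain ⟨hiJ, hi1⟩ := Finset.mem_filter.1 hi'
        obtain ⟨hjJ, hj1⟩ := Finset.mem_filter.1 hj'
        have ei := hvψ i hiJ
        have ej := hvψ j hjJ
        rw [hi1, hi2] at ei
        rw [hj1, hj2] at ej
        have hpsi : |ψ (c i).1 - ψ (c j).1| ≤ 2 * R := by
          have := abs_le.1 ei
          have := abs_le.1 ej
          rw [abs_le]; constructor <;> linarith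
        have mono := h.psi_mono (h.fst_le _ (hcS i hiJ)) (h.fst_le _ (hcS j hjJ))
        have hdist : |((c i).1 : ℝ) - (c j).1| ≤ R * M * lam := by
          rw [div_le_iff₀ (by positivity)] at mono
          by_contra! hlt
          have h2 : (ψ (c i).1 - ψ (c j).1) * ((c i).1 - (c j).1) ≤
              2 * R * |((c i).1 : ℝ) - (c j).1| := by
            refine (le_abs_self _).trans ?_
            rw [abs_mul]; gcongr
          have h3 : 0 < |((c i).1 : ℝ) - (c j).1| := lt_of_le_of_lt (by positivity) hlt
          rw [← sq_abs] at mono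
          have h4 : 2 * R * |((c i).1 : ℝ) - (c j).1| * (M * lam) <
              2 * |((c i).1 : ℝ) - (c j).1| ^ 2 := by nlinarith
          have h5 := mul_le_mul_of_nonneg_right h2 (by positivity : 0 ≤ M * lam)
          linarith
        have q1 := capIndex_le hL0 (c i)
        have q2 := lt_capIndex hL0 (c j)
        rw [hcj i hiJ] at q1
        rw [hcj j hjJ] at q2
        have := (abs_le.1 hdist).2
        have e : ((i : ℝ) - j - 1) * L ≤ R * M * lam := by linarith
        rw [← le_div_iff₀ hL0] at e
        linarith
      · rw [hRL]
        nlinarith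
    have outer : (((J.filter fun j => (v j).1 = b).image fun j => (v j).2).card : ℝ) ≤
        7 * M * b := by
      refine (card_le_of_dist_le _ 0 (r := 3 * M * b) (by positivity) ?_).trans ?_
      · intro z hz
        obtain ⟨j, hj, rfl⟩ := Finset.mem_image.1 hz
        obtain ⟨hjJ, hj1⟩ := Finset.mem_filter.1 hj
        have ej := abs_le.1 (hvψ j hjJ)
        rw [hj1] at ej
        have es := abs_le.1 (h.slope _ (h.fst_le _ (hcS j hjJ)))
        have : |((v j).2 : ℝ) / b| ≤ 3 * M := by rw [abs_le]; constructor <;> linarith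
        rw [abs_div, abs_of_pos hb0, div_le_iff₀ hb0] at this
        rwa [sub_zero]
      · nlinarith
    refine (card_le_mul_card_image' _ _ inner).trans ?_
    calc _ ≤ 10 * M ^ 2 * (L / (ν * b)) * (7 * M * b) := by gcongr
      _ = 70 * M ^ 3 * (L / ν) := by field_simp; ring
  refine (card_le_mul_card_image' _ _ fib).trans ?_
  rcases J.eq_empty_or_nonempty with rfl | ⟨j₀, hj₀⟩
  · simp; positivity
  have : ((J.image fun j => (v j).1).card : ℝ) ≤ 2 * L / ν := by
    have h0 := hv1 j₀ hj₀
    have h1 := hvL j₀ hj₀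
    have h0' : (1 : ℝ) ≤ (v j₀).1 := by exact_mod_cast h0
    rw [← le_div_iff₀ hν0] at h1
    refine (card_le_of_diff_le _ (l := 2 * L / ν - 1) (by linarith) ?_).trans (by linarith)
    intro x hx y hy
    obtain ⟨i, hi, rfl⟩ := Finset.mem_image.1 hx
    obtain ⟨j, hj, rfl⟩ := Finset.mem_image.1 hy
    have e1 := hvL i hi
    rw [← le_div_iff₀ hν0] at e1
    have e2 : (1 : ℝ) ≤ (v j).1 := by exact_mod_cast hv1 j hj
    linarith
  calc _ ≤ 70 * M ^ 3 * (L / ν) * (2 * L / ν) := by gcongr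
    _ = _ := by ring

end Shell

end

section

variable {Ω : Type*} [MeasurableSpace Ω] {T : Torus Ω}

/-- A form of Parseval's identity with repeated frequencies. -/
lemma integral_norm_sum_chr_sq_le {α : Type*} (F : Finset α) (σ : α → ℤ × ℤ) (b : α → ℂ) {R : ℝ}
    (hR : ∀ p ∈ F, ((F.filter fun q => σ q = σ p).card : ℝ) ≤ R) :
    ∫ w, ‖∑ p ∈ F, b p * T.chr (σ p) w‖ ^ 2 ∂T.μ ≤ R * ∑ p ∈ F, ‖b p‖ ^ 2 := by
  set c : ℤ × ℤ → ℂ := fun n => ∑ p ∈ F.filter (fun q => σ q = n), b p with hc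
  have e : ∀ w, ∑ p ∈ F, b p * T.chr (σ p) w = T.trig (F.image σ) c w := by
    intro w
    rw [Torus.trig, ← Finset.sum_fiberwise_of_maps_to (g := σ)
      fun p (hp : p ∈ F) => Finset.mem_image_of_mem _ hp]
    refine Finset.sum_congr rfl fun n _ => ?_
    simp only [hc, Finset.sum_mul]
    exact Finset.sum_congr rfl fun p hp => by rw [(Finset.mem_filter.1 hp).2]
  simp only [e]
  rw [integral_norm_trig_sq, nsq, ← Finset.sum_fiberwise_of_maps_to (g := σ) (s := F)
    fun p (hp : p ∈ F) => Finset.mem_image_of_mem _ hp, Finset.mul_sum]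
  refine Finset.sum_le_sum fun n hn => ?_
  obtain ⟨p, hp, rfl⟩ := Finset.mem_image.1 hn
  calc ‖c (σ p)‖ ^ 2 ≤ (∑ q ∈ F.filter (fun q => σ q = σ p), ‖b q‖) ^ 2 := by
        gcongr; exact norm_sum_le _ _
    _ ≤ (F.filter fun q => σ q = σ p).card * ∑ q ∈ F.filter (fun q => σ q = σ p), ‖b q‖ ^ 2 :=
        sq_sum_le_card_mul_sum_sq
    _ ≤ _ := by
        gcongr
        exact hR p hp

lemma card_filter_add_eq_le (S : Finset (ℤ × ℤ)) {F : Finset ((ℤ × ℤ) × (ℤ × ℤ))}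
    (hF : F ⊆ S ×ˢ S) (n : ℤ × ℤ) :
    (F.filter fun q => q.1 + q.2 = n).card ≤ (S.filter fun l => n - l ∈ S).card := by
  refine Finset.card_le_card_of_injOn Prod.fst ?_ ?_
  · intro q hq
    obtain ⟨hqS, hqn⟩ := Finset.mem_filter.1 hq
    obtain ⟨hq1, hq2⟩ := Finset.mem_product.1 (hF hqS)
    refine Finset.mem_filter.2 ⟨hq1, ?_⟩
    rw [← hqn, add_sub_cancel_left]; exact hq2
  · intro q hq q' hq' e
    have e1 := (Finset.mem_filter.1 hq).2
    have e2 := (Finset.mem_filter.1 hq').2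
    refine Prod.ext e ?_
    have e3 : q.1 + q.2 = q'.1 + q'.2 := e1.trans e2.symm
    rw [e] at e3
    exact add_left_cancel e3

/-- The contribution to the square of a sum over caps of pairs of adjacent caps. -/
lemma norm_sum_near_le (S : Finset (ℤ × ℤ)) (a : ℤ × ℤ → ℂ) (ι : ℤ × ℤ → ℤ) (w : Ω) :
    ‖∑ p ∈ (S ×ˢ S).filter (fun p => |ι p.1 - ι p.2| ≤ 1), a p.1 * a p.2 * T.chr (p.1 + p.2) w‖ ≤
      3 * ∑ j ∈ S.image ι, ‖T.trig (S.filter fun k => ι k = j) a w‖ ^ 2 := by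
  set J := S.image ι
  set N := (J ×ˢ J).filter fun j => |j.1 - j.2| ≤ 1 with hN
  set f : ℤ → ℂ := fun j => T.trig (S.filter fun k => ι k = j) a w with hf
  have e : ∑ p ∈ (S ×ˢ S).filter (fun p => |ι p.1 - ι p.2| ≤ 1), a p.1 * a p.2 * T.chr (p.1 + p.2) w
      = ∑ j ∈ N, f j.1 * f j.2 := by
    rw [← Finset.sum_fiberwise_of_maps_to (t := N) (g := fun p => (ι p.1, ι p.2))]
    · refine Finset.sum_congr rfl fun j hj => ?_
      have hj2 := (Finset.mem_filter.1 hj).2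
      simp only [hf, Torus.trig]
      rw [Finset.sum_mul_sum, ← Finset.sum_product']
      refine Finset.sum_congr ?_ fun p _ => by rw [chr_add]; ring
      ext ⟨p, q⟩
      simp only [Finset.mem_filter, Finset.mem_product, Prod.ext_iff]
      constructor
      · rintro ⟨⟨⟨h1, h2⟩, -⟩, h3, h4⟩; exact ⟨⟨h1, h3⟩, h2, h4⟩
      · rintro ⟨⟨h1, h3⟩, h2, h4⟩
        refine ⟨⟨⟨h1, h2⟩, ?_⟩, h3, h4⟩
        rw [h3, h4]; exact hj2
    · intro p hp
      obtain ⟨h1, h2⟩ := Finset.mem_filter.1 hp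
      obtain ⟨h3, h4⟩ := Finset.mem_product.1 h1
      exact Finset.mem_filter.2 ⟨Finset.mem_product.2
        ⟨Finset.mem_image_of_mem _ h3, Finset.mem_image_of_mem _ h4⟩, h2⟩
  rw [e]
  have three : ∀ i : ℤ, (J.filter fun j => |i - j| ≤ 1).card ≤ 3 := by
    intro i
    refine (Finset.card_le_card (t := Finset.Icc (i - 1) (i + 1)) fun j hj => ?_).trans
      (by rw [Int.card_Icc]; omega)
    have := abs_le.1 (Finset.mem_filter.1 hj).2
    rw [Finset.mem_Icc]; omega
  have half1 : ∑ j ∈ N, ‖f j.1‖ ^ 2 ≤ 3 * ∑ j ∈ J, ‖f j‖ ^ 2 := by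
    rw [hN, Finset.sum_filter, Finset.sum_product, Finset.mul_sum]
    refine Finset.sum_le_sum fun i _ => ?_
    rw [← Finset.sum_filter]
    simp only [Finset.sum_const, nsmul_eq_mul]
    gcongr
    exact_mod_cast three i
  have half2 : ∑ j ∈ N, ‖f j.2‖ ^ 2 ≤ 3 * ∑ j ∈ J, ‖f j‖ ^ 2 := by
    rw [hN, Finset.sum_filter, Finset.sum_product_right, Finset.mul_sum]
    refine Finset.sum_le_sum fun i _ => ?_
    rw [← Finset.sum_filter]
    simp only [Finset.sum_const, nsmul_eq_mul]
    gcongr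
    simp only [abs_sub_comm _ i]
    exact_mod_cast three i
  calc _ ≤ ∑ j ∈ N, ‖f j.1‖ * ‖f j.2‖ := (norm_sum_le _ _).trans_eq (by simp only [norm_mul])
    _ ≤ ∑ j ∈ N, (‖f j.1‖ ^ 2 + ‖f j.2‖ ^ 2) / 2 := by
        refine Finset.sum_le_sum fun j _ => ?_
        nlinarith [sq_nonneg (‖f j.1‖ - ‖f j.2‖)]
    _ = (∑ j ∈ N, ‖f j.1‖ ^ 2 + ∑ j ∈ N, ‖f j.2‖ ^ 2) / 2 := by
        rw [← Finset.sum_add_distrib, Finset.sum_div]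
    _ ≤ _ := by linarith

namespace Shell

variable {M lam δ : ℝ} {g ψ : ℝ → ℝ} {S : Finset (ℤ × ℤ)}

lemma integral_far_le (h : Shell M lam δ g ψ S) (a : ℤ × ℤ → ℂ) (ha : nsq S a ≤ 1) {l : ℝ}
    (hl : 0 < l) :
    ∫ w, ‖∑ p ∈ (S ×ˢ S).filter (fun p => ¬ |capIndex l p.1 - capIndex l p.2| ≤ 1),
      a p.1 * a p.2 * T.chr (p.1 + p.2) w‖ ^ 2 ∂T.μ ≤ 108 * M ^ 3 * (1 + lam * δ / l) := by
  have hM := h.M_pos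
  have hP := h.one_le_mul
  refine (integral_norm_sum_chr_sq_le _ (fun p : (ℤ × ℤ) × (ℤ × ℤ) => p.1 + p.2)
    (fun p => a p.1 * a p.2) (R := 108 * M ^ 3 * (1 + lam * δ / l)) ?_).trans ?_
  · intro p hp
    obtain ⟨h1, h2⟩ := Finset.mem_filter.1 hp
    obtain ⟨h3, h4⟩ := Finset.mem_product.1 h1
    refine (Nat.cast_le.2 (card_filter_add_eq_le S (Finset.filter_subset _ _) _)).trans
      ((h.card_rep_le h3 h4).trans ?_)
    have hd : l ≤ 1 + |(p.1.1 : ℝ) - p.2.1| := by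
      have q1 := capIndex_le hl p.1
      have q2 := lt_capIndex hl p.1
      have q3 := capIndex_le hl p.2
      have q4 := lt_capIndex hl p.2
      push Not at h2
      rcases lt_abs.1 h2 with h5 | h5
      · have h6 : (2 : ℝ) ≤ capIndex l p.1 - capIndex l p.2 := by exact_mod_cast h5
        have := le_abs_self ((p.1.1 : ℝ) - p.2.1)
        nlinarith
      · have h6 : (2 : ℝ) ≤ -((capIndex l p.1 : ℝ) - capIndex l p.2) := by exact_mod_cast h5
        have := neg_abs_le ((p.1.1 : ℝ) - p.2.1)
        nlinarith
    gcongr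
  · have hsum : ∑ p ∈ (S ×ˢ S).filter (fun p => ¬ |capIndex l p.1 - capIndex l p.2| ≤ 1),
        ‖a p.1 * a p.2‖ ^ 2 ≤ 1 := by
      calc _ ≤ ∑ p ∈ S ×ˢ S, ‖a p.1 * a p.2‖ ^ 2 :=
            Finset.sum_le_sum_of_subset_of_nonneg (Finset.filter_subset _ _)
              fun _ _ _ => by positivity
        _ = nsq S a * nsq S a := by
            rw [nsq, Finset.sum_mul_sum, Finset.sum_product]
            simp only [norm_mul, mul_pow]
        _ ≤ 1 := mul_le_one₀ ha (nsq_nonneg _ _) ha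
    have : 0 ≤ 108 * M ^ 3 * (1 + lam * δ / l) := by positivity
    exact mul_le_of_le_one_right this hsum

/-- Higher moments over the set where the polynomial is not too large, from the bounded number of
lattice points on long arcs. -/
theorem setIntegral_rpow_le_of_le (h : Shell M lam δ g ψ S) (a : ℤ × ℤ → ℂ) (ha : nsq S a ≤ 1)
    {p H A : ℝ} (hp : 4 ≤ p) (hA : 0 ≤ A) (hH : 1 ≤ H) (hδH : δ * H ^ 3 ≤ 1) :
    ∫ w in {w | ‖T.trig S a w‖ ≤ A}, ‖T.trig S a w‖ ^ p ∂T.μ ≤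
      432 * M ^ 3 * (A ^ (p - 4) * (1 + √(lam * δ) / H)) +
        6 ^ (p / 2) * (72 * M ^ 2 * √(lam * δ)) ^ (p / 2 - 1) := by
  have hM := h.one_le_M
  have hM0 := h.M_pos
  have hL1 := h.one_le_sqrt
  have hL0 := h.sqrt_pos
  have hL2 := h.sq_sqrt
  have hP := h.one_le_mul
  set L := √(lam * δ)
  have hl : 0 < L * H := by positivity
  set ι := capIndex (L * H) with hι
  set f := T.trig S a with hf
  set far : Ω → ℂ := fun w => ∑ p ∈ (S ×ˢ S).filter (fun p => ¬ |ι p.1 - ι p.2| ≤ 1),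
      a p.1 * a p.2 * T.chr (p.1 + p.2) w with hfar
  set s : Ω → ℝ := fun w => ∑ j ∈ S.image ι, ‖T.trig (S.filter fun k => ι k = j) a w‖ ^ 2 with hs
  have hs0 : ∀ w, 0 ≤ s w := fun w => Finset.sum_nonneg fun _ _ => by positivity
  have hsL : ∀ w, s w ≤ 72 * M ^ 2 * L := by
    intro w
    calc s w ≤ ∑ j ∈ S.image ι, 72 * M ^ 2 * L * nsq (S.filter fun k => ι k = j) a := by
          refine Finset.sum_le_sum fun j _ => (norm_trig_sq_le _ _ _).trans ?_
          have := nsq_nonneg (S.filter fun k => ι k = j) a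
          gcongr
          exact h.card_arc_le hH hδH j
      _ = 72 * M ^ 2 * L * nsq S a := by rw [← Finset.mul_sum, sum_nsq_filter]
      _ ≤ _ := mul_le_of_le_one_right (by positivity) ha
  have hsint : ∫ w, s w ∂T.μ ≤ 1 := by
    rw [hs, integral_finsetSum _ fun j _ => ((BM.trig _ _).norm.pow 2).integrable]
    simp only [integral_norm_trig_sq]
    rwa [sum_nsq_filter]
  have hsBM : BM s := BM.sum _ fun j _ => (BM.trig _ _).norm.pow 2
  have hfarBM : BM far := by
    refine BM.sum _ fun q _ => ⟨by fun_prop, ‖a q.1 * a q.2‖, fun w => ?_⟩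
    rw [norm_mul, norm_chr, mul_one]
  have hsplit : ∀ w, ‖f w‖ ^ 2 ≤ ‖far w‖ + 3 * s w := by
    intro w
    have e1 : f w ^ 2 = ∑ p ∈ S ×ˢ S, a p.1 * a p.2 * T.chr (p.1 + p.2) w := by
      rw [pow_two, hf, Torus.trig, Finset.sum_mul_sum, ← Finset.sum_product']
      exact Finset.sum_congr rfl fun p _ => by rw [chr_add]; ring
    rw [← norm_pow, e1, ← Finset.sum_filter_add_sum_filter_not _
      (fun p : (ℤ × ℤ) × (ℤ × ℤ) => |ι p.1 - ι p.2| ≤ 1), add_comm]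
    exact (norm_add_le _ _).trans (add_le_add le_rfl (norm_sum_near_le S a ι w))
  have hpt : ∀ w ∈ {w | ‖f w‖ ≤ A}, ‖f w‖ ^ p ≤ 4 * A ^ (p - 4) * ‖far w‖ ^ 2 +
      6 ^ (p / 2) * (72 * M ^ 2 * L) ^ (p / 2 - 1) * s w := by
    intro w hw
    have hw' : ‖f w‖ ≤ A := hw
    have hA0 : 0 ≤ A := (norm_nonneg _).trans hw'
    have h1 := hsplit w
    rcases le_total (3 * s w) ‖far w‖ with h2 | h2
    · have h3 : ‖f w‖ ^ p = ‖f w‖ ^ (p - 4) * (‖f w‖ ^ 2) ^ 2 := by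
        rw [← pow_mul, ← Real.rpow_natCast, ← Real.rpow_add' (norm_nonneg _)]
        · norm_num
        · norm_num; linarith
      have h4 : (‖f w‖ ^ 2) ^ 2 ≤ (2 * ‖far w‖) ^ 2 := by gcongr; linarith
      have h5 : ‖f w‖ ^ p ≤ A ^ (p - 4) * (2 * ‖far w‖) ^ 2 := by
        rw [h3]; gcongr
      have h6 : 0 ≤ 6 ^ (p / 2) * (72 * M ^ 2 * L) ^ (p / 2 - 1) * s w :=
        mul_nonneg (by positivity) (hs0 w)
      calc _ ≤ _ := h5
        _ = 4 * A ^ (p - 4) * ‖far w‖ ^ 2 := by ring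
        _ ≤ _ := by linarith
    · have h3 : ‖f w‖ ^ p = (‖f w‖ ^ 2) ^ (p / 2) := by
        rw [← Real.rpow_natCast, ← Real.rpow_mul (norm_nonneg _)]
        congr 1; push_cast; ring
      have h4 : ‖f w‖ ^ p ≤ (6 * s w) ^ (p / 2) := by
        rw [h3]; gcongr; linarith
      have h5 : s w ^ (p / 2) ≤ (72 * M ^ 2 * L) ^ (p / 2 - 1) * s w := by
        calc s w ^ (p / 2) = s w ^ (p / 2 - 1) * s w ^ (1 : ℝ) := by
              rw [← Real.rpow_add' (hs0 w)]
              · norm_num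
              · norm_num; linarith
          _ ≤ _ := by
            rw [Real.rpow_one]
            gcongr
            · linarith
            · exact hsL w
      have h6 : 0 ≤ 4 * A ^ (p - 4) * ‖far w‖ ^ 2 := by positivity
      calc _ ≤ _ := h4
        _ = 6 ^ (p / 2) * s w ^ (p / 2) := Real.mul_rpow (by norm_num) (hs0 w)
        _ ≤ 6 ^ (p / 2) * ((72 * M ^ 2 * L) ^ (p / 2 - 1) * s w) := by gcongr
        _ ≤ _ := by linarith
  have hmeas : MeasurableSet {w | ‖f w‖ ≤ A} := measurableSet_le (by fun_prop) measurable_const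
  have hI1 : Integrable (fun w => 4 * A ^ (p - 4) * ‖far w‖ ^ 2 +
      6 ^ (p / 2) * (72 * M ^ 2 * L) ^ (p / 2 - 1) * s w) T.μ :=
    ((hfarBM.norm.pow 2).const_mul _).integrable.add (hsBM.const_mul _).integrable
  have hfarint := h.integral_far_le (T := T) a ha hl
  have hPl : lam * δ / (L * H) = L / H := by
    rw [← hL2]; field_simp
  rw [hPl] at hfarint
  calc _ ≤ ∫ w in {w | ‖f w‖ ≤ A}, (4 * A ^ (p - 4) * ‖far w‖ ^ 2 +
      6 ^ (p / 2) * (72 * M ^ 2 * L) ^ (p / 2 - 1) * s w) ∂T.μ :=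
        setIntegral_mono_on ((BM.trig S a).norm.rpow (fun w => norm_nonneg _)
          (by linarith)).integrable.integrableOn hI1.integrableOn hmeas hpt
    _ ≤ ∫ w, (4 * A ^ (p - 4) * ‖far w‖ ^ 2 +
      6 ^ (p / 2) * (72 * M ^ 2 * L) ^ (p / 2 - 1) * s w) ∂T.μ := by
        refine setIntegral_le_integral hI1 (ae_of_all _ fun w => ?_)
        have := hs0 w
        simp only [Pi.zero_apply]
        positivity
    _ = 4 * A ^ (p - 4) * ∫ w, ‖far w‖ ^ 2 ∂T.μ +
        6 ^ (p / 2) * (72 * M ^ 2 * L) ^ (p / 2 - 1) * ∫ w, s w ∂T.μ := by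
        rw [integral_add ((hfarBM.norm.pow 2).const_mul _).integrable (hsBM.const_mul _).integrable,
          integral_const_mul, integral_const_mul]
    _ ≤ 4 * A ^ (p - 4) * (108 * M ^ 3 * (1 + L / H)) +
        6 ^ (p / 2) * (72 * M ^ 2 * L) ^ (p / 2 - 1) * 1 := by gcongr
    _ = _ := by ring

end Shell

end

section

variable {Ω : Type*} [MeasurableSpace Ω] {T : Torus Ω}

/-! ### The second derivative test -/

lemma ee_sub (s t : ℝ) : ee (s - t) = ee s / ee t := by
  have h : ee t ≠ 0 := by rw [← norm_ne_zero_iff, norm_ee]; exact one_ne_zero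
  rw [eq_div_iff h, ← ee_add, sub_add_cancel]

lemma norm_ee_sub_ee_le (s t : ℝ) : ‖ee s - ee t‖ ≤ 2 * Real.pi * |s - t| := by
  have h : ee s - ee t = ee t * (ee (s - t) - 1) := by
    rw [mul_sub, ← ee_add]; ring_nf
  rw [h, norm_mul, norm_ee, one_mul]
  have := Real.norm_exp_I_mul_ofReal_sub_one_le (x := 2 * Real.pi * (s - t))
  rw [Real.norm_eq_abs, abs_mul, abs_of_pos Real.two_pi_pos] at this
  refine le_trans (le_of_eq ?_) this
  rw [ee]; congr 3; push_cast; ring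

lemma le_norm_ee_sub_one {t : ℝ} {k : ℤ} (h : |t - k| ≤ 1 / 2) : 4 * |t - k| ≤ ‖ee t - 1‖ := by
  have e1 : ee t = Complex.exp (Complex.I * ((2 * Real.pi * (t - k) : ℝ) : ℂ)) := by
    have : ee t = ee (t - k) := by rw [ee_sub, ee_int, div_one]
    rw [this, ee]; congr 1; push_cast; ring
  rw [e1, Complex.norm_exp_I_mul_ofReal_sub_one, Real.norm_eq_abs, abs_mul, abs_two]
  have e2 : |Real.sin (2 * Real.pi * (t - k) / 2)| = Real.sin (Real.pi * |t - k|) := by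
    have h0 : 0 ≤ Real.sin (Real.pi * |t - k|) := Real.sin_nonneg_of_nonneg_of_le_pi
      (by positivity) (by nlinarith [Real.pi_pos])
    rw [← abs_of_nonneg h0]
    rcases abs_cases (t - k) with ⟨h1, -⟩ | ⟨h1, -⟩
    · rw [h1]; congr 2; ring
    · rw [h1, mul_neg, Real.sin_neg, abs_neg]; congr 2; ring
  rw [e2]
  have := Real.mul_le_sin (x := Real.pi * |t - k|) (by positivity) (by nlinarith [Real.pi_pos])
  have e3 : 2 / Real.pi * (Real.pi * |t - k|) = 2 * |t - k| := by field_simp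
  linarith

lemma norm_sum_ee_le_of_variation (φ : ℕ → ℝ) {a b : ℕ} (hab : a < b) {B : ℝ} (v : ℕ → ℝ)
    (hne : ∀ n, a ≤ n → n < b → ee (φ (n + 1) - φ n) ≠ 1)
    (hB : ∀ n, a ≤ n → n < b → ‖(ee (φ (n + 1) - φ n) - 1)⁻¹‖ ≤ B)
    (hv : ∀ n, a ≤ n → n + 1 < b →
      ‖(ee (φ (n + 1) - φ n) - 1)⁻¹ - (ee (φ (n + 2) - φ (n + 1)) - 1)⁻¹‖ ≤ v (n + 1) - v n) :
    ‖∑ n ∈ Finset.Ico a b, ee (φ n)‖ ≤ 2 * B + (v (b - 1) - v a) := by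
  set G : ℕ → ℂ := fun n => (ee (φ (n + 1) - φ n) - 1)⁻¹ with hG
  have hGe : ∀ n, a ≤ n → n < b → ee (φ (n + 1)) * G n = ee (φ n) + ee (φ n) * G n := by
    intro n h1 h2
    have h3 := sub_ne_zero.2 (hne n h1 h2)
    have h4 : ee (φ (n + 1)) = ee (φ n) * ee (φ (n + 1) - φ n) := by rw [← ee_add]; ring_nf
    have h5 : (ee (φ (n + 1) - φ n) - 1) * G n = 1 := mul_inv_cancel₀ h3
    rw [h4]
    linear_combination ee (φ n) * h5
  have main : ∀ m, a + 1 ≤ m → m ≤ b →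
      ‖∑ n ∈ Finset.Ico a m, ee (φ n) - ee (φ m) * G (m - 1)‖ ≤ B + (v (m - 1) - v a) := by
    intro m hm
    induction m, hm using Nat.le_induction with
    | base =>
      intro h1
      rw [Finset.sum_Ico_succ_top le_rfl, Finset.Ico_self, Finset.sum_empty, zero_add,
        Nat.add_sub_cancel, hGe a le_rfl h1, sub_add_cancel_left, norm_neg, norm_mul, norm_ee,
        one_mul, sub_self, add_zero]
      exact hB a le_rfl h1
    | succ m hm ih =>
      intro h1
      obtain ⟨n, rfl⟩ : ∃ n, m = n + 1 := ⟨m - 1, by omega⟩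
      have h2 := ih (by omega)
      rw [Nat.add_sub_cancel] at h2 ⊢
      have h3 := hv n (by omega) (by omega)
      have h4 : ∑ k ∈ Finset.Ico a (n + 1 + 1), ee (φ k) - ee (φ (n + 1 + 1)) * G (n + 1) =
          (∑ k ∈ Finset.Ico a (n + 1), ee (φ k) - ee (φ (n + 1)) * G n) +
            ee (φ (n + 1)) * (G n - G (n + 1)) := by
        rw [Finset.sum_Ico_succ_top (by omega), hGe (n + 1) (by omega) (by omega)]; ring
      rw [h4]
      refine (norm_add_le _ _).trans ?_
      rw [norm_mul (ee _), norm_ee, one_mul]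
      have h5 : ‖G n - G (n + 1)‖ ≤ v (n + 1) - v n := h3
      linarith
  have h1 := main b hab le_rfl
  have h2 : ‖ee (φ b) * G (b - 1)‖ ≤ B := by
    rw [norm_mul, norm_ee, one_mul]; exact hB (b - 1) (by omega) (by omega)
  calc _ = ‖(∑ n ∈ Finset.Ico a b, ee (φ n) - ee (φ b) * G (b - 1)) + ee (φ b) * G (b - 1)‖ := by
        rw [sub_add_cancel]
    _ ≤ _ := norm_add_le _ _
    _ ≤ _ := by linarith

/-- The Kusmin–Landau inequality on a range where the increments of the phase stay on one side of
an integer `k`. -/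
lemma norm_sum_ee_le_inv (φ : ℕ → ℝ) (a b : ℕ) {θ : ℝ} (hθ : 0 < θ) (k : ℤ)
    (hd : ∀ n, a ≤ n → n < b → θ ≤ |φ (n + 1) - φ n - k| ∧ |φ (n + 1) - φ n - k| ≤ 1 / 2)
    (hs : (∀ n, a ≤ n → n < b → 0 < φ (n + 1) - φ n - k) ∨
      ∀ n, a ≤ n → n < b → φ (n + 1) - φ n - k < 0)
    (hmono : ∀ n, a ≤ n → n + 1 < b → φ (n + 1) - φ n ≤ φ (n + 2) - φ (n + 1)) :
    ‖∑ n ∈ Finset.Ico a b, ee (φ n)‖ ≤ 1 / θ := by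
  rcases le_or_gt b a with hab | hab
  · rw [Finset.Ico_eq_empty_of_le hab, Finset.sum_empty, norm_zero]; positivity
  set t : ℕ → ℝ := fun n => φ (n + 1) - φ n - k with ht
  have hlow : ∀ n, a ≤ n → n < b → 4 * |t n| ≤ ‖ee (φ (n + 1) - φ n) - 1‖ := fun n h1 h2 =>
    le_norm_ee_sub_one (hd n h1 h2).2
  have ht0 : ∀ n, a ≤ n → n < b → 0 < |t n| := fun n h1 h2 => hθ.trans_le (hd n h1 h2).1
  have hne : ∀ n, a ≤ n → n < b → ee (φ (n + 1) - φ n) ≠ 1 := by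
    intro n h1 h2 h3
    have h4 := hlow n h1 h2
    rw [h3, sub_self, norm_zero] at h4
    linarith [ht0 n h1 h2]
  have hBn : ∀ n, a ≤ n → n < b → ‖(ee (φ (n + 1) - φ n) - 1)⁻¹‖ ≤ 1 / 4 / θ := by
    intro n h1 h2
    rw [norm_inv, div_div, one_div]
    have := (hd n h1 h2).1
    have h3 := hlow n h1 h2
    exact inv_anti₀ (by positivity) (by linarith)
  have hvn : ∀ n, a ≤ n → n + 1 < b →
      ‖(ee (φ (n + 1) - φ n) - 1)⁻¹ - (ee (φ (n + 2) - φ (n + 1)) - 1)⁻¹‖ ≤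
        (-(1 / 2) / t (n + 1)) - (-(1 / 2) / t n) := by
    intro n h1 h2
    have n1 := sub_ne_zero.2 (hne n h1 (by omega))
    have n2 := sub_ne_zero.2 (hne (n + 1) (by omega) h2)
    have h3 := hlow n h1 (by omega)
    have h4 := hlow (n + 1) (by omega) h2
    have p1 := ht0 n h1 (by omega)
    have p2 := ht0 (n + 1) (by omega) h2
    have hm : t n ≤ t (n + 1) := by have := hmono n h1 h2; simp only [ht]; linarith
    have hprod : |t n| * |t (n + 1)| = t n * t (n + 1) := by
      rw [← abs_mul]
      apply abs_of_nonneg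
      rcases hs with hs | hs
      · exact mul_nonneg (hs n h1 (by omega)).le (hs (n + 1) (by omega) h2).le
      · exact mul_nonneg_of_nonpos_of_nonpos (hs n h1 (by omega)).le (hs (n + 1) (by omega) h2).le
    rw [inv_sub_inv n1 n2, norm_div, norm_mul]
    have h5 : ‖ee (φ (n + 2) - φ (n + 1)) - 1 - (ee (φ (n + 1) - φ n) - 1)‖ ≤
        8 * (t (n + 1) - t n) := by
      rw [sub_sub_sub_cancel_right]
      refine (norm_ee_sub_ee_le _ _).trans ?_
      have e : φ (n + 2) - φ (n + 1) - (φ (n + 1) - φ n) = t (n + 1) - t n := by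
        simp only [ht]; ring_nf
      rw [e, abs_of_nonneg (by linarith)]
      have := Real.pi_lt_four
      nlinarith
    have p3 : 0 < t n * t (n + 1) := hprod ▸ mul_pos p1 p2
    have q1 : t n ≠ 0 := abs_pos.1 p1
    have q2 : t (n + 1) ≠ 0 := abs_pos.1 p2
    have e : (-(1 / 2) / t (n + 1)) - (-(1 / 2) / t n) =
        8 * (t (n + 1) - t n) / (16 * (t n * t (n + 1))) := by field_simp; ring
    rw [e]
    refine div_le_div₀ (by linarith) h5 (by positivity) ?_
    rw [← hprod]
    calc _ = 4 * |t n| * (4 * |t (n + 1)|) := by ring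
      _ ≤ _ := by gcongr
  refine (norm_sum_ee_le_of_variation φ hab (fun n => -(1 / 2) / t n) hne hBn hvn).trans ?_
  have hinv : ∀ n, a ≤ n → n < b → |(1 / 2) / t n| ≤ 1 / 2 / θ := by
    intro n h1 h2
    rw [abs_div, abs_of_pos (by norm_num : (0 : ℝ) < 1 / 2)]
    have := (hd n h1 h2).1
    gcongr
  have i1 := hinv a le_rfl hab
  have i2 := hinv (b - 1) (by omega) (by omega)
  rw [neg_div, neg_div]
  have hone : 1 / θ = 2 * (1 / 4 / θ) + 1 / 2 / θ := by ring
  rw [hone]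
  rcases hs with hs | hs
  · have s1 : 0 ≤ 1 / 2 / t (b - 1) := div_nonneg (by norm_num) (hs _ (by omega) (by omega)).le
    have := le_abs_self (1 / 2 / t a)
    linarith
  · have s1 : 1 / 2 / t a ≤ 0 := div_nonpos_of_nonneg_of_nonpos (by norm_num)
      (hs _ le_rfl hab).le
    have := neg_abs_le (1 / 2 / t (b - 1))
    linarith

lemma exists_split {P : ℕ → Prop} {a b : ℕ} (hab : a ≤ b)
    (hP : ∀ n, a ≤ n → n + 1 < b → P n → P (n + 1)) :
    ∃ m, a ≤ m ∧ m ≤ b ∧ (∀ n, a ≤ n → n < m → ¬ P n) ∧ ∀ n, m ≤ n → n < b → P n := by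
  classical
  by_cases h : ∃ n, a ≤ n ∧ n < b ∧ P n
  · obtain ⟨h1, h2, h3⟩ := Nat.find_spec h
    refine ⟨Nat.find h, h1, h2.le, fun n hn hn' hp =>
      Nat.find_min h hn' ⟨hn, by omega, hp⟩, fun n hn => ?_⟩
    induction n, hn using Nat.le_induction with
    | base => exact fun _ => h3
    | succ n hn ih => exact fun hb => hP n (by omega) hb (ih (by omega))
  · push Not at h
    exact ⟨b, hab, le_rfl, fun n h1 h2 => h n h1 h2, fun n h1 h2 => absurd h1 (by omega)⟩

lemma norm_sum_ee_le_card (φ : ℕ → ℝ) (a b : ℕ) :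
    ‖∑ n ∈ Finset.Ico a b, ee (φ n)‖ ≤ ((b - a : ℕ) : ℝ) := by
  refine (norm_sum_le _ _).trans (le_of_eq ?_)
  simp

/-- A block on which the increments lie in a single half-integer interval. -/
lemma norm_sum_ee_le_block (φ : ℕ → ℝ) {a b : ℕ} (hab : a ≤ b) {μ : ℝ} (hμ : 0 < μ) (hμ1 : μ ≤ 1)
    (q : ℤ) (hq : ∀ n, a ≤ n → n < b →
      (q : ℝ) / 2 ≤ φ (n + 1) - φ n ∧ φ (n + 1) - φ n < (q + 1) / 2)
    (hmono : ∀ n, a ≤ n → n + 1 < b → φ (n + 1) - φ n + μ ≤ φ (n + 2) - φ (n + 1)) :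
    ‖∑ n ∈ Finset.Ico a b, ee (φ n)‖ ≤ 3 / √μ := by
  have hs : 0 < √μ := Real.sqrt_pos.2 hμ
  have hs2 : √μ ^ 2 = μ := Real.sq_sqrt hμ.le
  have hs1 : √μ ≤ 1 := Real.sqrt_le_one.2 hμ1
  set θ := √μ
  have hmono' : ∀ n, a ≤ n → n + 1 < b → φ (n + 1) - φ n ≤ φ (n + 2) - φ (n + 1) := fun n h1 h2 => by
    have := hmono n h1 h2; linarith
  have hstep : ∀ a' m, a ≤ a' → ∀ n, a' ≤ n → n < m → m ≤ b →
      φ (a' + 1) - φ a' + ((n - a' : ℕ) : ℝ) * μ ≤ φ (n + 1) - φ n := by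
    intro a' m ha' n hn
    induction n, hn using Nat.le_induction with
    | base => intro _ _; simp
    | succ n hn ih =>
      intro h1 h2
      have := ih (by omega) h2
      have h3 := hmono n (by omega) (by omega)
      rw [Nat.succ_sub hn]
      push_cast
      have e : φ (n + 1 + 1) = φ (n + 2) := rfl
      rw [e]; linarith
  have hcount : ∀ a' m, a ≤ a' → m ≤ b → ∀ c : ℝ,
      (∀ n, a' ≤ n → n < m → c ≤ φ (n + 1) - φ n ∧ φ (n + 1) - φ n ≤ c + θ) →
      ‖∑ n ∈ Finset.Ico a' m, ee (φ n)‖ ≤ 2 / θ := by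
    intro a' m h1 h2 c hc
    refine (norm_sum_ee_le_card _ _ _).trans ?_
    rcases le_or_gt m a' with h3 | h3
    · rw [Nat.sub_eq_zero_of_le h3, Nat.cast_zero]; positivity
    have h4 := hstep a' m h1 (m - 1) (by omega) (by omega) h2
    have h5 := hc a' le_rfl h3
    have h6 := hc (m - 1) (by omega) (by omega)
    have h7 : ((m - 1 - a' : ℕ) : ℝ) * μ ≤ θ := by linarith
    have h8 : ((m - a' : ℕ) : ℝ) = ((m - 1 - a' : ℕ) : ℝ) + 1 := by
      rw [show m - a' = m - 1 - a' + 1 by omega]; push_cast; ring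
    rw [h8, le_div_iff₀ hs]
    rw [← hs2] at h7
    nlinarith
  have hsplit : ∀ m, a ≤ m → m ≤ b → ∑ n ∈ Finset.Ico a b, ee (φ n) =
      ∑ n ∈ Finset.Ico a m, ee (φ n) + ∑ n ∈ Finset.Ico m b, ee (φ n) := fun m h1 h2 =>
    (Finset.sum_Ico_consecutive _ h1 h2).symm
  rcases Int.even_or_odd' q with ⟨k, rfl | rfl⟩
  · push_cast at hq
    obtain ⟨m, h1, h2, h3, h4⟩ := exists_split (P := fun n => k + θ ≤ φ (n + 1) - φ n) hab
      fun n h1 h2 h3 => h3.trans (hmono' n h1 h2)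
    rw [hsplit m h1 h2]
    have b1 := hcount a m le_rfl h2 k fun n n1 n2 => by
      have := hq n n1 (by omega)
      have := h3 n n1 n2
      push Not at this
      constructor <;> linarith
    have b2 := norm_sum_ee_le_inv φ m b hs k (fun n n1 n2 => by
        have e1 := hq n (by omega) n2
        have e2 := h4 n n1 n2
        rw [abs_of_nonneg (by linarith)]
        constructor <;> linarith) (Or.inl fun n n1 n2 => by
          have e2 := h4 n n1 n2
          linarith) fun n n1 n2 => hmono' n (by omega) n2
    refine (norm_add_le _ _).trans ((add_le_add b1 b2).trans (le_of_eq (by ring)))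
  · push_cast at hq
    obtain ⟨m, h1, h2, h3, h4⟩ := exists_split (P := fun n => k + 1 - θ < φ (n + 1) - φ n) hab
      fun n h1 h2 h3 => h3.trans_le (hmono' n h1 h2)
    rw [hsplit m h1 h2]
    have b1 := hcount m b h1 le_rfl (k + 1 - θ) fun n n1 n2 => by
      have := hq n (by omega) n2
      have e2 := h4 n n1 n2
      constructor <;> linarith
    have b2 := norm_sum_ee_le_inv φ a m hs (k + 1) (fun n n1 n2 => by
        have e1 := hq n (by omega) (by omega)
        have e2 := h3 n n1 n2
        push Not at e2
        push_cast
        rw [abs_of_nonpos (by linarith)]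
        constructor <;> linarith) (Or.inr fun n n1 n2 => by
          have e2 := hq n (by omega) (by omega)
          push_cast
          linarith) fun n n1 n2 => hmono' n (by omega) (by omega)
    refine (norm_add_le _ _).trans ((add_le_add b2 b1).trans (le_of_eq (by ring)))

/-- The second derivative test for exponential sums. -/
theorem norm_sum_ee_le (φ : ℕ → ℝ) (N : ℕ) {μ A : ℝ} (hμ : 0 < μ) (hμ1 : μ ≤ 1) (hA : 1 ≤ A)
    (hl : ∀ n, n + 1 < N → μ ≤ φ (n + 2) - φ (n + 1) - (φ (n + 1) - φ n))
    (hu : ∀ n, n + 1 < N → φ (n + 2) - φ (n + 1) - (φ (n + 1) - φ n) ≤ A * μ) :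
    ‖∑ n ∈ Finset.range N, ee (φ n)‖ ≤ 6 * A * N * √μ + 6 / √μ := by
  have hs : 0 < √μ := Real.sqrt_pos.2 hμ
  have hs2 : √μ ^ 2 = μ := Real.sq_sqrt hμ.le
  have main : ∀ (r : ℕ) (q : ℤ) (b : ℕ), b ≤ N → (∀ n < b,
      (q : ℝ) / 2 ≤ φ (n + 1) - φ n ∧ φ (n + 1) - φ n < (q + r) / 2) →
      ‖∑ n ∈ Finset.Ico 0 b, ee (φ n)‖ ≤ r * (3 / √μ) := by
    intro r
    induction r with
    | zero =>
      intro q b hb hq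
      rcases Nat.eq_zero_or_pos b with rfl | hb0
      · simp
      · have := hq 0 hb0
        push_cast at this
        linarith
    | succ r ih =>
      intro q b hb hq
      obtain ⟨m, h1, h2, h3, h4⟩ := exists_split
        (P := fun n => ((q + r : ℤ) : ℝ) / 2 ≤ φ (n + 1) - φ n) (Nat.zero_le b)
        fun n h1 h2 h3 => by
          have := hl n (by omega)
          have e : φ (n + 1 + 1) = φ (n + 2) := rfl
          rw [e]; linarith
      rw [← Finset.sum_Ico_consecutive _ h1 h2]
      have b1 := ih q m (by omega) fun n hn => ⟨(hq n (by omega)).1, by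
        have := h3 n (Nat.zero_le _) hn
        push Not at this
        push_cast at this
        exact this⟩
      have b2 := norm_sum_ee_le_block φ h2 hμ hμ1 (q + r) (fun n n1 n2 => ⟨h4 n n1 n2, by
        have := (hq n n2).2
        push_cast at this ⊢
        linarith⟩) fun n n1 n2 => by have := hl n (by omega); linarith
      refine (norm_add_le _ _).trans ((add_le_add b1 b2).trans (le_of_eq ?_))
      push_cast; ring
  have hup : ∀ n, n < N → φ (n + 1) - φ n ≤ φ 1 - φ 0 + n * (A * μ) := by
    intro n
    induction n with
    | zero => intro _; simp
    | succ n ih =>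
      intro h1
      have := ih (by omega)
      have h2 := hu n h1
      have e : φ (n + 1 + 1) = φ (n + 2) := rfl
      push_cast
      rw [e]; linarith
  have hlo : ∀ n, n < N → φ 1 - φ 0 ≤ φ (n + 1) - φ n := by
    intro n
    induction n with
    | zero => intro _; simp
    | succ n ih =>
      intro h1
      have := ih (by omega)
      have h2 := hl n h1
      have e : φ (n + 1 + 1) = φ (n + 2) := rfl
      rw [e]; linarith
  set q := ⌊2 * (φ 1 - φ 0)⌋ with hq
  set r := ⌊2 * N * A * μ⌋₊ + 2 with hr
  have q1 := Int.floor_le (2 * (φ 1 - φ 0))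
  have q2 := Int.lt_floor_add_one (2 * (φ 1 - φ 0))
  have r1 := Nat.lt_floor_add_one (2 * N * A * μ)
  have r2 := Nat.floor_le (a := 2 * N * A * μ) (by positivity)
  have h0 := main r q N le_rfl fun n hn => by
    have n1 := hlo n hn
    have n2 := hup n hn
    have n3 : (n : ℝ) * (A * μ) ≤ N * (A * μ) := by gcongr
    constructor
    · linarith
    · rw [hr]; push_cast; linarith
  rw [Finset.range_eq_Ico]
  refine h0.trans ?_
  have hr3 : (r : ℝ) ≤ 2 * N * A * μ + 2 := by rw [hr]; push_cast; linarith
  calc (r : ℝ) * (3 / √μ) ≤ (2 * N * A * μ + 2) * (3 / √μ) := by gcongr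
    _ = (2 * N * A * √μ ^ 2 + 2) * (3 / √μ) := by rw [hs2]
    _ = _ := by field_simp; ring

end

section

/-- The Gaussian `e^{-πt²}`. -/
noncomputable def gauss (t : ℝ) : ℝ := Real.exp (-(Real.pi * t ^ 2))

lemma gauss_pos (t : ℝ) : 0 < gauss t := Real.exp_pos _

lemma gauss_le_one (t : ℝ) : gauss t ≤ 1 := by
  rw [gauss, Real.exp_le_one_iff]
  have := Real.pi_pos
  nlinarith [mul_nonneg Real.pi_pos.le (sq_nonneg t)]

lemma gauss_anti {s t : ℝ} (h : |s| ≤ |t|) : gauss t ≤ gauss s := by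
  have := sq_le_sq.2 h
  unfold gauss
  have := Real.pi_pos
  gcongr

lemma gauss_mul_ee_eq (s g y : ℝ) (m : ℤ) :
    ((gauss (s * (m - g)) : ℝ) : ℂ) * ee (m * y) =
      ((Real.exp (-(Real.pi * (s * g) ^ 2)) : ℝ) : ℂ) *
        Complex.exp (-Real.pi * (s ^ 2 : ℝ) * m ^ 2 +
          2 * Real.pi * (((s ^ 2 * g : ℝ) : ℂ) + Complex.I * y) * m) := by
  unfold gauss ee
  rw [Complex.ofReal_exp, Complex.ofReal_exp, ← Complex.exp_add, ← Complex.exp_add]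
  congr 1
  push_cast; ring

lemma summable_gauss {s : ℝ} (hs : 0 < s) (g : ℝ) :
    Summable fun m : ℤ => gauss (s * (m - g)) := by
  have h := (summable_jacobiTheta₂_term_iff (-(Complex.I * (s ^ 2 * g : ℝ)))
    (Complex.I * (s ^ 2 : ℝ))).2 (by rw [Complex.im_mul_ofReal, Complex.I_im]; positivity)
  have h2 := (h.norm.mul_left (Real.exp (-(Real.pi * (s * g) ^ 2))))
  refine h2.congr fun m => ?_
  rw [jacobiTheta₂_term, Complex.norm_exp, ← Real.exp_add, gauss]
  congr 1
  have : (2 * Real.pi * Complex.I * m * -(Complex.I * ((s ^ 2 * g : ℝ) : ℂ)) +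
      Real.pi * Complex.I * m ^ 2 * (Complex.I * ((s ^ 2 : ℝ) : ℂ)) : ℂ) =
      ((2 * Real.pi * m * (s ^ 2 * g) - Real.pi * m ^ 2 * s ^ 2 : ℝ) : ℂ) := by
    push_cast
    linear_combination (-2 * Real.pi * m * s ^ 2 * g + Real.pi * m ^ 2 * s ^ 2) * Complex.I_sq
  rw [this, Complex.ofReal_re]; ring

/-- Poisson summation for a modulated Gaussian. -/
lemma tsum_gauss_mul_ee {s : ℝ} (hs : 0 < s) (g y : ℝ) :
    ∑' m : ℤ, ((gauss (s * (m - g)) : ℝ) : ℂ) * ee (m * y) =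
      (s⁻¹ : ℝ) * ∑' h : ℤ, ((gauss (s⁻¹ * (h - y)) : ℝ) : ℂ) * ee (-((h - y) * g)) := by
  simp_rw [gauss_mul_ee_eq]
  rw [tsum_mul_left, Complex.tsum_exp_neg_quadratic (by rw [Complex.ofReal_re]; positivity)]
  have e : (1 : ℂ) / ((s ^ 2 : ℝ) : ℂ) ^ (1 / 2 : ℂ) = (s⁻¹ : ℝ) := by
    rw [show (1 / 2 : ℂ) = ((1 / 2 : ℝ) : ℂ) by push_cast; ring,
      ← Complex.ofReal_cpow (by positivity), ← Real.sqrt_eq_rpow, Real.sqrt_sq hs.le]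
    push_cast; rw [one_div]
  rw [e, mul_left_comm, ← tsum_mul_left]
  congr 1
  refine tsum_congr fun h => ?_
  unfold gauss ee
  rw [Complex.ofReal_exp, Complex.ofReal_exp, ← Complex.exp_add, ← Complex.exp_add]
  congr 1
  have hs' : (s : ℂ) ≠ 0 := by exact_mod_cast hs.ne'
  have e2 : Complex.I * (((s ^ 2 * g : ℝ) : ℂ) + Complex.I * y) = Complex.I * s ^ 2 * g - y := by
    push_cast; linear_combination (y : ℂ) * Complex.I_sq
  rw [e2]
  push_cast
  field_simp
  linear_combination (-(s : ℂ) ^ 4 * g ^ 2) * Complex.I_sq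

/-- The sum of the Gaussian over the integers. -/
noncomputable def gaussConst : ℝ := ∑' m : ℤ, gauss m

lemma summable_gauss_int : Summable fun m : ℤ => gauss m := by
  simpa using summable_gauss one_pos 0

lemma one_le_gaussConst : 1 ≤ gaussConst := by
  have := summable_gauss_int.sum_le_tsum (f := fun m : ℤ => gauss m) {0}
    fun m _ => (gauss_pos m).le
  simpa [gauss, gaussConst] using this

lemma norm_gauss_mul_ee (u v : ℝ) : ‖((gauss u : ℝ) : ℂ) * ee v‖ = gauss u := by
  rw [norm_mul, norm_ee, mul_one, Complex.norm_real, Real.norm_of_nonneg (gauss_pos _).le]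

lemma summable_gauss_mul_ee {s : ℝ} (hs : 0 < s) (g : ℝ) (φ : ℤ → ℝ) :
    Summable fun m : ℤ => ((gauss (s * (m - g)) : ℝ) : ℂ) * ee (φ m) :=
  Summable.of_norm <| by simpa only [norm_gauss_mul_ee] using summable_gauss hs g

lemma tsum_gauss_le {s : ℝ} (hs : 0 < s) (hs1 : s ≤ 1) (y : ℝ) :
    ∑' h : ℤ, gauss (s * (h - y)) ≤ gaussConst / s := by
  have h := tsum_gauss_mul_ee (inv_pos.2 hs) 0 y
  simp only [inv_inv, mul_zero, neg_zero, ee_zero, mul_one] at h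
  rw [← Complex.ofReal_tsum, ← Complex.ofReal_mul] at h
  have h1 : 0 ≤ ∑' h : ℤ, gauss (s * (h - y)) := tsum_nonneg fun h => (gauss_pos _).le
  have h2 := congrArg norm h
  rw [Complex.norm_real, Real.norm_of_nonneg (by positivity)] at h2
  rw [le_div_iff₀ hs, mul_comm, ← h2]
  have h3 := summable_gauss (inv_pos.2 hs) 0
  refine (norm_tsum_le_tsum_norm (by simpa only [norm_gauss_mul_ee] using h3)).trans ?_
  simp only [norm_gauss_mul_ee]
  refine h3.tsum_le_tsum (fun m => gauss_anti ?_) summable_gauss_int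
  rw [sub_zero, abs_mul, abs_of_pos (inv_pos.2 hs)]
  exact le_mul_of_one_le_left (abs_nonneg _) (one_le_inv_iff₀.2 ⟨hs, hs1⟩)

lemma gauss_sub_mul_le {δ s : ℝ} (hδ : 0 < δ) (hδ1 : δ ≤ 1) (hs : 0 < s) :
    (gauss (δ * s) - gauss s) * (√s + 1 / √s) ≤ 20 * (1 / √δ) * gauss (δ / 2 * s) := by
  have hsδ : 0 < √δ := Real.sqrt_pos.2 hδ
  have hsδ1 : √δ ≤ 1 := Real.sqrt_le_one.2 hδ1
  have hss : 0 < √s := Real.sqrt_pos.2 hs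
  have pi3 := Real.pi_gt_three
  have pi4 := Real.pi_lt_d2
  have h1 : 1 ≤ 1 / √δ := by rw [le_div_iff₀ hsδ]; linarith
  rcases le_total s 1 with h | h
  · have hss1 : √s ≤ 1 := Real.sqrt_le_one.2 h
    have a1 : gauss (δ * s) - gauss s ≤ Real.pi * s ^ 2 := by
      have b1 := gauss_le_one (δ * s)
      have b2 := Real.add_one_le_exp (-(Real.pi * s ^ 2))
      unfold gauss at *
      linarith
    have a2 : Real.exp (-1) ≤ gauss (δ / 2 * s) := by
      unfold gauss
      apply Real.exp_le_exp.2
      have : δ * s ≤ 1 := by nlinarith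
      have : (δ * s) ^ 2 ≤ 1 := by nlinarith [mul_pos hδ hs]
      nlinarith
    have a3 : (1 : ℝ) / 3 ≤ Real.exp (-1) := by
      rw [Real.exp_neg, one_div]
      gcongr
      linarith [Real.exp_one_lt_d9]
    have a4 : s ^ 2 * (√s + 1 / √s) ≤ 2 := by
      have e : s ^ 2 * (√s + 1 / √s) = √s ^ 5 + √s ^ 3 := by
        nth_rewrite 1 [← Real.sq_sqrt hs.le]
        field_simp
      rw [e]
      have := pow_le_one₀ (n := 5) hss.le hss1
      have := pow_le_one₀ (n := 3) hss.le hss1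
      linarith
    calc (gauss (δ * s) - gauss s) * (√s + 1 / √s) ≤ (Real.pi * s ^ 2) * (√s + 1 / √s) := by gcongr
      _ = Real.pi * (s ^ 2 * (√s + 1 / √s)) := by ring
      _ ≤ 3.15 * 2 := by gcongr
      _ ≤ 20 * 1 * (1 / 3) := by norm_num
      _ ≤ _ := by gcongr; exact a3.trans a2
  · have hss1 : 1 ≤ √s := Real.one_le_sqrt.2 h
    have a1 : gauss (δ * s) - gauss s ≤ gauss (δ * s) := by linarith [gauss_pos s]
    have a2 : √s + 1 / √s ≤ 2 * √s := by
      have : 1 / √s ≤ 1 := by rw [div_le_iff₀ hss]; linarith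
      linarith
    have a3 : √s ≤ (1 / √δ) * (1 + (δ * s) ^ 2) := by
      have e : √s = (1 / √δ) * √(δ * s) := by
        rw [Real.sqrt_mul hδ.le]; field_simp
      rw [e]
      gcongr
      have q := Real.sq_sqrt (mul_pos hδ hs).le
      set r := √(δ * s)
      rw [← q]
      nlinarith [sq_nonneg (r - 1), sq_nonneg (r ^ 2 - 1)]
    have a4 : (1 + (δ * s) ^ 2) * gauss (δ * s) ≤ gauss (δ / 2 * s) := by
      unfold gauss
      have h0 : 1 + (δ * s) ^ 2 ≤ Real.exp ((δ * s) ^ 2) := by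
        rw [add_comm]; exact Real.add_one_le_exp _
      refine (mul_le_mul_of_nonneg_right h0 (Real.exp_pos _).le).trans ?_
      rw [← Real.exp_add]
      apply Real.exp_le_exp.2
      nlinarith [sq_nonneg (δ * s)]
    calc (gauss (δ * s) - gauss s) * (√s + 1 / √s) ≤ gauss (δ * s) * (2 * √s) := by
          gcongr; exact (gauss_pos _).le
      _ ≤ gauss (δ * s) * (2 * ((1 / √δ) * (1 + (δ * s) ^ 2))) := by
          gcongr; exact (gauss_pos _).le
      _ = 2 * (1 / √δ) * ((1 + (δ * s) ^ 2) * gauss (δ * s)) := by ring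
      _ ≤ 2 * (1 / √δ) * gauss (δ / 2 * s) := by gcongr
      _ ≤ _ := by
          have := (gauss_pos (δ / 2 * s)).le
          gcongr; norm_num

namespace Shell

variable {M lam δ : ℝ} {g ψ : ℝ → ℝ} {S : Finset (ℤ × ℤ)}

lemma norm_sum_ee_graph_le (h : Shell M lam δ g ψ S) (x : ℝ) {s : ℝ} (hs : 0 < s) :
    ‖∑ n ∈ Finset.Icc (-⌊M * lam⌋) ⌊M * lam⌋, ee (s * g n - n * x)‖ ≤
      30 * M ^ 3 * √lam * (√s + 1 / √s) := by
  have hM := h.one_le_M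
  have hM0 := h.M_pos
  have hl := h.one_le_lam
  have hl0 := h.lam_pos
  have hML : 1 ≤ M * lam := by nlinarith
  obtain ⟨K, hK⟩ := Int.eq_ofNat_of_zero_le (Int.floor_nonneg.2 (by linarith : 0 ≤ M * lam))
  have hK' : (K : ℝ) ≤ M * lam := by
    have := Int.floor_le (M * lam)
    rw [hK] at this; exact_mod_cast this
  rw [hK]
  set φ : ℕ → ℝ := fun i => s * g ((i : ℝ) - K) - ((i : ℝ) - K) * x with hφ
  have e : ∑ n ∈ Finset.Icc (-(K : ℤ)) K, ee (s * g n - n * x) = ∑ i ∈ Finset.range (2 * K + 1), ee (φ i) := by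
    symm
    refine Finset.sum_nbij (fun i : ℕ => (i : ℤ) - K) ?_ ?_ ?_ ?_
    · intro i hi
      simp only [Finset.mem_range, Finset.mem_Icc] at *
      omega
    · intro i _ j _ hij
      simp only at hij
      omega
    · intro n hn
      simp only [Finset.coe_Icc, Set.mem_Icc, Finset.coe_range, Set.mem_image, Set.mem_Iio] at *
      exact ⟨(n + K).toNat, by omega, by omega⟩
    · intro i _
      simp [hφ]
  have hsl : 0 < √lam := Real.sqrt_pos.2 hl0
  have hss : 0 < √s := Real.sqrt_pos.2 hs
  have hsl1 : 1 ≤ √lam := Real.one_le_sqrt.2 hl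
  have hlsq : √lam ^ 2 = lam := Real.sq_sqrt hl0.le
  have hssq : √s ^ 2 = s := Real.sq_sqrt hs.le
  have hM3 : 1 ≤ M ^ 3 := one_le_pow₀ hM
  have hcard : ((2 * K + 1 : ℕ) : ℝ) ≤ 3 * (M * lam) := by push_cast; linarith
  rw [e]
  set μ := 2 * s / (M * lam) with hμ
  have hμ0 : 0 < μ := by positivity
  by_cases hμ1 : μ ≤ 1
  · have hdd : ∀ n, n + 1 < 2 * K → μ ≤ φ (n + 2) - φ (n + 1) - (φ (n + 1) - φ n) ∧
        φ (n + 2) - φ (n + 1) - (φ (n + 1) - φ n) ≤ M ^ 2 * μ := by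
      intro n hn
      have hn' : (n : ℝ) + 2 ≤ 2 * K := by exact_mod_cast (by omega : n + 2 ≤ 2 * K)
      have hn0 : (0 : ℝ) ≤ n := Nat.cast_nonneg n
      set c : ℝ := (n : ℝ) + 1 - K with hc
      have c1 : |c| ≤ M * lam := abs_le.2 ⟨by linarith, by linarith⟩
      have c2 : |c + 1| ≤ M * lam := abs_le.2 ⟨by linarith, by linarith⟩
      have c3 : |c - 1| ≤ M * lam := abs_le.2 ⟨by linarith, by linarith⟩
      have l1 := h.lower _ _ c2 c1
      have l2 := h.lower _ _ c3 c1
      have u1 := h.upper _ _ c2 c1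
      have u2 := h.upper _ _ c3 c1
      have eφ : φ (n + 2) - φ (n + 1) - (φ (n + 1) - φ n) =
          s * ((g (c + 1) - g c - ψ c * (c + 1 - c)) + (g (c - 1) - g c - ψ c * (c - 1 - c))) := by
        simp only [hφ]
        push_cast
        rw [show (n : ℝ) + 2 - K = c + 1 by rw [hc]; ring,
          show (n : ℝ) + 1 - K = c from rfl, show (n : ℝ) - K = c - 1 by rw [hc]; ring]
        ring
      rw [eφ]
      have e1 : (c + 1 - c) ^ 2 = 1 := by ring
      have e2 : (c - 1 - c) ^ 2 = 1 := by ring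
      rw [e1] at l1 u1
      rw [e2] at l2 u2
      constructor
      · calc μ = s * (1 / (M * lam) + 1 / (M * lam)) := by rw [hμ]; ring
          _ ≤ _ := by gcongr
      · calc _ ≤ s * (M * 1 / lam + M * 1 / lam) := by gcongr
          _ = M ^ 2 * μ := by rw [hμ]; field_simp; ring
    have hV := norm_sum_ee_le φ (2 * K) hμ0 hμ1 (one_le_pow₀ hM : 1 ≤ M ^ 2)
      (fun n hn => (hdd n hn).1) (fun n hn => (hdd n hn).2)
    rw [Finset.sum_range_succ]
    refine (norm_add_le _ _).trans ((add_le_add_left hV _).trans ?_)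
    rw [norm_ee]
    have m1 : √μ ≤ 2 * √s / √lam := by
      apply Real.sqrt_le_iff.2 ⟨by positivity, ?_⟩
      rw [div_pow, mul_pow, hlsq, hssq, hμ]
      rw [div_le_div_iff₀ (by positivity) (by positivity)]
      nlinarith [mul_pos hs hl0]
    have m2 : √s / (M * √lam) ≤ √μ := by
      apply Real.le_sqrt_of_sq_le
      rw [div_pow, mul_pow, hlsq, hssq, hμ]
      rw [div_le_div_iff₀ (by positivity) (by positivity)]
      have : 0 < s * M * lam := by positivity
      nlinarith
    have m3 : 1 ≤ √lam * (√s + 1 / √s) := by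
      have : 1 ≤ √s + 1 / √s := by
        rcases le_total 1 (√s) with q | q
        · have : 0 < 1 / √s := by positivity
          linarith
        · have : 1 ≤ 1 / √s := by rw [le_div_iff₀ hss]; linarith
          linarith
      nlinarith
    have t1 : 6 * M ^ 2 * ((2 * K : ℕ) : ℝ) * √μ ≤ 24 * M ^ 3 * √lam * √s := by
      calc _ ≤ 6 * M ^ 2 * (2 * (M * lam)) * (2 * √s / √lam) := by
            push_cast; gcongr
        _ = 24 * M ^ 3 * (lam / √lam) * √s := by ring
        _ = _ := by rw [Real.div_sqrt]
    have t2 : 6 / √μ ≤ 6 * M ^ 3 * √lam * (1 / √s) := by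
      calc 6 / √μ ≤ 6 / (√s / (M * √lam)) := by gcongr
        _ = 6 * M * √lam * (1 / √s) := by field_simp
        _ ≤ _ := by
          have : M ≤ M ^ 3 := le_self_pow₀ hM (by norm_num)
          gcongr
    have t3 : 1 ≤ M ^ 3 * √lam * (√s + 1 / √s) := by
      rw [mul_assoc]; exact one_le_mul_of_one_le_of_one_le hM3 m3
    have t4 : 0 ≤ M ^ 3 * √lam * (1 / √s) := by positivity
    have t5 : 0 ≤ M ^ 3 * √lam * √s := by positivity
    linarith
  · push Not at hμ1
    have h1 : M * lam ≤ 2 * s := by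
      rw [hμ, lt_div_iff₀ (by positivity)] at hμ1; linarith
    have h2 : √lam ≤ 2 * √s := by
      apply Real.sqrt_le_iff.2 ⟨by positivity, ?_⟩
      rw [mul_pow, hssq]; nlinarith
    refine (norm_sum_le _ _).trans ?_
    simp only [norm_ee, Finset.sum_const, Finset.card_range, nsmul_eq_mul, mul_one]
    refine hcard.trans ?_
    calc 3 * (M * lam) = 3 * M * √lam * √lam := by rw [mul_assoc (3 * M), ← sq, hlsq]; ring
      _ ≤ 3 * M ^ 3 * √lam * (2 * √s) := by
        have : M ≤ M ^ 3 := le_self_pow₀ hM (by norm_num)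
        gcongr
      _ = 6 * (M ^ 3 * √lam * √s) := by ring
      _ ≤ 30 * (M ^ 3 * √lam * √s) + 30 * (M ^ 3 * √lam * (1 / √s)) := by
        have t4 : 0 ≤ M ^ 3 * √lam * (1 / √s) := by positivity
        have t5 : 0 ≤ M ^ 3 * √lam * √s := by positivity
        linarith
      _ = _ := by ring

end Shell

end

section

/-- The difference of two Gaussians at scales `δ` and `1`, with equal integrals. -/
noncomputable def wt (δ t : ℝ) : ℝ := gauss (δ⁻¹ * t) - δ * gauss (1 * t)

lemma summable_wt_mul_ee {δ : ℝ} (hδ : 0 < δ) (g : ℝ) (φ : ℤ → ℝ) :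
    Summable fun m : ℤ => ((wt δ (m - g) : ℝ) : ℂ) * ee (φ m) := by
  refine ((summable_gauss_mul_ee (inv_pos.2 hδ) g φ).sub
    ((summable_gauss_mul_ee one_pos g φ).mul_left (δ : ℂ))).congr fun m => ?_
  rw [wt]; push_cast; ring

lemma tsum_wt_mul_ee {δ : ℝ} (hδ : 0 < δ) (g x y : ℝ) :
    ∑' m : ℤ, ((wt δ (m - g) : ℝ) : ℂ) * ee (x + m * y) =
      δ * ∑' h : ℤ, ((gauss (δ * (h - y)) - gauss (1 * (h - y)) : ℝ) : ℂ) *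
        ee (x - (h - y) * g) := by
  have h1 := tsum_gauss_mul_ee (inv_pos.2 hδ) g y
  have h2 := tsum_gauss_mul_ee one_pos g y
  rw [inv_inv] at h1
  rw [inv_one, Complex.ofReal_one, one_mul] at h2
  have e1 : ∀ m : ℤ, ((wt δ (m - g) : ℝ) : ℂ) * ee (x + m * y) =
      ee x * (((gauss (δ⁻¹ * (m - g)) : ℝ) : ℂ) * ee (m * y) -
        δ * (((gauss (1 * (m - g)) : ℝ) : ℂ) * ee (m * y))) := fun m => by
    rw [ee_add, wt]; push_cast; ring
  have e2 : ∀ h : ℤ, ((gauss (δ * (h - y)) - gauss (1 * (h - y)) : ℝ) : ℂ) *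
      ee (x - (h - y) * g) = ee x * (((gauss (δ * (h - y)) : ℝ) : ℂ) * ee (-((h - y) * g)) -
        ((gauss (1 * (h - y)) : ℝ) : ℂ) * ee (-((h - y) * g))) := fun h => by
    rw [sub_eq_add_neg x, ee_add]; push_cast; ring
  simp_rw [e1, e2]
  rw [tsum_mul_left, tsum_mul_left,
    Summable.tsum_sub (summable_gauss_mul_ee (inv_pos.2 hδ) g _)
      ((summable_gauss_mul_ee one_pos g _).mul_left _), tsum_mul_left, h1, h2,
    Summable.tsum_sub (summable_gauss_mul_ee hδ y _) (summable_gauss_mul_ee one_pos y _)]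
  ring

namespace Shell

variable {M lam δ : ℝ} {g ψ : ℝ → ℝ} {S : Finset (ℤ × ℤ)}

lemma norm_sum_ee_graph_le' (h : Shell M lam δ g ψ S) (x : ℝ) {z : ℝ} (hz : z ≠ 0) :
    ‖∑ n ∈ Finset.Icc (-⌊M * lam⌋) ⌊M * lam⌋, ee (n * x - z * g n)‖ ≤
      30 * M ^ 3 * √lam * (√|z| + 1 / √|z|) := by
  rcases lt_or_gt_of_ne hz with hz | hz
  · have := h.norm_sum_ee_graph_le (-x) (neg_pos.2 hz)
    rw [abs_of_neg hz]
    have e : ∀ n : ℤ, ee (n * x - z * g n) = ee (-z * g n - n * -x) := fun n => by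
      congr 1; ring
    simpa only [e] using this
  · have := h.norm_sum_ee_graph_le x hz
    have e : ∀ n : ℤ, (starRingEnd ℂ) (ee (n * x - z * g n)) = ee (z * g n - n * x) := fun n => by
      rw [conj_ee]; congr 1; ring
    rw [abs_of_pos hz, ← Complex.norm_conj, map_sum]
    simpa only [e] using this

/-- The kernel bound: the smoothed exponential sum over the shell, with its mean removed. -/
lemma norm_sum_tsum_wt_le (h : Shell M lam δ g ψ S) (x y : ℝ) :
    ‖∑ n ∈ Finset.Icc (-⌊M * lam⌋) ⌊M * lam⌋,
      ∑' m : ℤ, ((wt δ (m - g n) : ℝ) : ℂ) * ee (n * x + m * y)‖ ≤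
      1200 * gaussConst * M ^ 3 * (√lam / √δ) := by
  have hM0 := h.M_pos
  have hδ := h.pos
  have hδ1 := h.le_one
  simp_rw [tsum_wt_mul_ee hδ]
  rw [← Finset.mul_sum, ← Summable.tsum_finsetSum]
  swap
  · intro n _
    refine ((summable_gauss_mul_ee hδ y fun k : ℤ => n * x - (k - y) * g n).sub
      (summable_gauss_mul_ee one_pos y fun k : ℤ => n * x - (k - y) * g n)).congr fun k => ?_
    push_cast; ring
  rw [norm_mul, Complex.norm_real, Real.norm_of_nonneg hδ.le]
  have hs := summable_gauss (half_pos hδ) y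
  have hb : ∀ k : ℤ, ‖∑ n ∈ Finset.Icc (-⌊M * lam⌋) ⌊M * lam⌋,
      ((gauss (δ * (k - y)) - gauss (1 * (k - y)) : ℝ) : ℂ) * ee (n * x - (k - y) * g n)‖ ≤
      600 * M ^ 3 * (√lam / √δ) * gauss (δ / 2 * (k - y)) := by
    intro k
    rw [← Finset.mul_sum, norm_mul, Complex.norm_real]
    set z := (k : ℝ) - y with hz
    by_cases hz0 : z = 0
    · simp only [hz0, mul_zero, sub_self, norm_zero, zero_mul]
      have := (gauss_pos 0).le
      positivity
    have ge : ∀ c : ℝ, gauss (c * z) = gauss (c * |z|) := fun c => by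
      simp only [gauss, mul_pow, sq_abs]
    have hz1 : 0 < |z| := abs_pos.2 hz0
    have hg : gauss (1 * z) ≤ gauss (δ * z) := gauss_anti <| by
      rw [abs_mul, abs_mul, abs_of_pos hδ, abs_one]; gcongr
    rw [Real.norm_of_nonneg (by linarith)]
    calc _ ≤ (gauss (δ * z) - gauss (1 * z)) * (30 * M ^ 3 * √lam * (√|z| + 1 / √|z|)) := by
          have := h.norm_sum_ee_graph_le' x hz0
          gcongr
      _ = 30 * M ^ 3 * √lam * ((gauss (δ * |z|) - gauss |z|) * (√|z| + 1 / √|z|)) := by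
          rw [ge, ge, one_mul]; ring
      _ ≤ 30 * M ^ 3 * √lam * (20 * (1 / √δ) * gauss (δ / 2 * |z|)) := by
          have := gauss_sub_mul_le hδ hδ1 hz1
          gcongr
      _ = _ := by rw [ge]; ring
  have hb2 := tsum_of_norm_bounded (hs.hasSum.mul_left _) hb
  have hb3 := tsum_gauss_le (half_pos hδ) (by linarith) y
  have hg1 := one_le_gaussConst
  calc _ ≤ δ * (600 * M ^ 3 * (√lam / √δ) * (gaussConst / (δ / 2))) := by
        gcongr
        exact hb2.trans (by gcongr)
    _ = _ := by field_simp; ring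

lemma mem_Icc_fst (h : Shell M lam δ g ψ S) {k : ℤ × ℤ} (hk : k ∈ S) :
    k.1 ∈ Finset.Icc (-⌊M * lam⌋) ⌊M * lam⌋ := by
  have h1 := abs_le.1 (h.fst_le k hk)
  rw [Finset.mem_Icc]
  constructor
  · rw [neg_le]; apply Int.le_floor.2; push_cast; linarith
  · apply Int.le_floor.2; linarith

lemma card_Icc_le (h : Shell M lam δ g ψ S) :
    ((Finset.Icc (-⌊M * lam⌋) ⌊M * lam⌋).card : ℝ) ≤ 3 * M * lam := by
  have hM := h.one_le_M
  have hl := h.one_le_lam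
  have h1 : 1 ≤ M * lam := by nlinarith
  have h0 : 0 ≤ ⌊M * lam⌋ := Int.floor_nonneg.2 (by linarith)
  have h2 := Int.floor_le (M * lam)
  rw [Int.card_Icc]
  have h3 : (((⌊M * lam⌋ + 1 - -⌊M * lam⌋).toNat : ℤ) : ℝ) = 2 * ⌊M * lam⌋ + 1 := by
    rw [Int.toNat_of_nonneg (by omega)]; push_cast; ring
  have h4 : ((⌊M * lam⌋ + 1 - -⌊M * lam⌋).toNat : ℝ) = 2 * ⌊M * lam⌋ + 1 := by exact_mod_cast h3
  rw [h4]; linarith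

/-- The weight `e^{-πM²}` is a lower bound of the smoothed indicator on the shell. -/
lemma gauss_le_of_mem (h : Shell M lam δ g ψ S) {k : ℤ × ℤ} (hk : k ∈ S) :
    gauss M ≤ gauss (δ⁻¹ * (k.2 - g k.1)) := by
  apply gauss_anti
  have hδ := h.pos
  rw [abs_mul, abs_of_pos (inv_pos.2 hδ), abs_of_pos h.M_pos, inv_mul_le_iff₀ hδ, mul_comm]
  exact h.near k hk

/-- The number of lattice points in a shell. -/
lemma card_le_add (h : Shell M lam δ g ψ S) :
    gauss M * S.card ≤ 3 * M * gaussConst * (lam * δ) +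
      1200 * gaussConst * M ^ 3 * (√lam / √δ) := by
  classical
  have hδ := h.pos
  have hδ1 := h.le_one
  set I := Finset.Icc (-⌊M * lam⌋) ⌊M * lam⌋ with hI
  have hK := h.norm_sum_tsum_wt_le 0 0
  simp only [mul_zero, add_zero, ee_zero, mul_one] at hK
  have s1 : ∀ n : ℤ, Summable fun m : ℤ => gauss (δ⁻¹ * (m - g n)) := fun n =>
    summable_gauss (inv_pos.2 hδ) _
  have s2 : ∀ n : ℤ, Summable fun m : ℤ => gauss (1 * (m - g n)) := fun n =>
    summable_gauss one_pos _
  have e1 : ∑ n ∈ I, ∑' m : ℤ, ((wt δ (m - g n) : ℝ) : ℂ) =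
      ((∑ n ∈ I, (∑' m : ℤ, gauss (δ⁻¹ * (m - g n)) - δ * ∑' m : ℤ, gauss (1 * (m - g n))) : ℝ) : ℂ) := by
    rw [Complex.ofReal_sum]
    refine Finset.sum_congr rfl fun n _ => ?_
    rw [← Complex.ofReal_tsum, ← tsum_mul_left, ← (s1 n).tsum_sub ((s2 n).mul_left δ)]
    rfl
  rw [e1, Complex.norm_real] at hK
  have h1 := (le_abs_self _).trans hK
  rw [Finset.sum_sub_distrib] at h1
  have h2 : ∑ n ∈ I, δ * ∑' m : ℤ, gauss (1 * (m - g n)) ≤ 3 * M * gaussConst * (lam * δ) := by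
    calc _ ≤ ∑ _n ∈ I, δ * gaussConst := by
          gcongr with n _
          simpa using tsum_gauss_le one_pos le_rfl (g n)
      _ = I.card * (δ * gaussConst) := by simp only [Finset.sum_const, nsmul_eq_mul]
      _ ≤ 3 * M * lam * (δ * gaussConst) := by
          have := one_le_gaussConst
          have := h.card_Icc_le
          gcongr
      _ = _ := by ring
  have h3 : gauss M * S.card ≤ ∑ n ∈ I, ∑' m : ℤ, gauss (δ⁻¹ * (m - g n)) := by
    calc gauss M * S.card = ∑ k ∈ S, gauss M := by
          simp only [Finset.sum_const, nsmul_eq_mul]; ring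
      _ ≤ ∑ k ∈ S, gauss (δ⁻¹ * (k.2 - g k.1)) := Finset.sum_le_sum fun k hk => h.gauss_le_of_mem hk
      _ ≤ ∑ k ∈ I ×ˢ S.image Prod.snd, gauss (δ⁻¹ * (k.2 - g k.1)) := by
          refine Finset.sum_le_sum_of_subset_of_nonneg (fun k hk => ?_) fun k _ _ => (gauss_pos _).le
          exact Finset.mem_product.2 ⟨h.mem_Icc_fst hk, Finset.mem_image_of_mem _ hk⟩
      _ = ∑ n ∈ I, ∑ m ∈ S.image Prod.snd, gauss (δ⁻¹ * (m - g n)) := by rw [Finset.sum_product]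
      _ ≤ _ := by
          gcongr with n _
          exact (s1 n).sum_le_tsum _ fun m _ => (gauss_pos _).le
  linarith

end Shell

end

section

variable {Ω : Type*} [MeasurableSpace Ω] {T : Torus Ω}

/-- The Fourier coefficient of `G` at the frequency `k`. -/
noncomputable def Torus.coeff (T : Torus Ω) (G : Ω → ℂ) (k : ℤ × ℤ) : ℂ :=
  ∫ w, G w * (starRingEnd ℂ) (T.chr k w) ∂T.μ

lemma BM.chr (k : ℤ × ℤ) : BM (T.chr k) := ⟨by fun_prop, 1, by simp⟩

lemma integral_mul_conj_trig {G : Ω → ℂ} (hG : BM G) (S : Finset (ℤ × ℤ)) (a : ℤ × ℤ → ℂ) :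
    ∫ w, G w * (starRingEnd ℂ) (T.trig S a w) ∂T.μ =
      ∑ k ∈ S, (starRingEnd ℂ) (a k) * T.coeff G k := by
  have e : ∀ w, G w * (starRingEnd ℂ) (T.trig S a w) =
      ∑ k ∈ S, (starRingEnd ℂ) (a k) * (G w * (starRingEnd ℂ) (T.chr k w)) := fun w => by
    rw [Torus.trig, map_sum, Finset.mul_sum]
    refine Finset.sum_congr rfl fun k _ => ?_
    rw [map_mul]; ring
  simp_rw [e]
  rw [integral_finsetSum _ fun k _ => (hG.mul (BM.chr k).conj).integrable_complex.const_mul _]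
  simp_rw [integral_const_mul]
  rfl

lemma norm_integral_mul_conj_trig_le {G : Ω → ℂ} (S : Finset (ℤ × ℤ))
    (a : ℤ × ℤ → ℂ) : ‖∫ w, G w * (starRingEnd ℂ) (T.trig S a w) ∂T.μ‖ ≤
      ∫ w, ‖G w‖ * ‖T.trig S a w‖ ∂T.μ :=
  (norm_integral_le_integral_norm _).trans_eq <| by simp only [norm_mul, Complex.norm_conj]

lemma sum_mul_norm_coeff_sq_le {G : Ω → ℂ} (hG : BM G) (B : Finset (ℤ × ℤ)) (c : ℤ × ℤ → ℝ)
    {K : ℝ} (hK : ∀ x y : ℝ, ‖∑ k ∈ B, (c k : ℂ) * ee (k.1 * x + k.2 * y)‖ ≤ K) :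
    ∑ k ∈ B, c k * ‖T.coeff G k‖ ^ 2 ≤ K * (∫ w, ‖G w‖ ∂T.μ) ^ 2 := by
  have h1 := integral_mul_conj_trig (T := T) hG B fun k => c k * T.coeff G k
  have e1 : ∑ k ∈ B, (starRingEnd ℂ) (c k * T.coeff G k) * T.coeff G k =
      ((∑ k ∈ B, c k * ‖T.coeff G k‖ ^ 2 : ℝ) : ℂ) := by
    push_cast
    refine Finset.sum_congr rfl fun k _ => ?_
    rw [map_mul, Complex.conj_ofReal, mul_assoc, mul_comm ((starRingEnd ℂ) _), Complex.mul_conj,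
      Complex.normSq_eq_norm_sq]
    push_cast; rfl
  have h2 : ∀ w, ‖T.trig B (fun k => c k * T.coeff G k) w‖ ≤ K * ∫ v, ‖G v‖ ∂T.μ := by
    intro w
    have h3 := integral_mul_conj_trig (T := T) hG B fun k => c k * (starRingEnd ℂ) (T.chr k w)
    have e2 : ∑ k ∈ B, (starRingEnd ℂ) (c k * (starRingEnd ℂ) (T.chr k w)) * T.coeff G k =
        T.trig B (fun k => c k * T.coeff G k) w := by
      refine Finset.sum_congr rfl fun k _ => ?_
      rw [map_mul, Complex.conj_ofReal, Complex.conj_conj]; ring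
    rw [← e2, ← h3]
    refine (norm_integral_mul_conj_trig_le _ _).trans ?_
    rw [mul_comm K, ← integral_mul_const]
    refine integral_mono (hG.norm.mul (BM.trig _ _).norm).integrable
      (hG.norm.integrable.mul_const _) fun v => ?_
    refine mul_le_mul_of_nonneg_left ?_ (norm_nonneg _)
    have e3 : T.trig B (fun k => c k * (starRingEnd ℂ) (T.chr k w)) v =
        ∑ k ∈ B, (c k : ℂ) * ee (k.1 * (T.X v - T.X w) + k.2 * (T.Y v - T.Y w)) := by
      refine Finset.sum_congr rfl fun k _ => ?_
      rw [mul_assoc, Torus.chr, Torus.chr, conj_ee, ← ee_add]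
      congr 2; ring
    rw [e3]
    exact hK _ _
  have h4 := norm_integral_mul_conj_trig_le (T := T) (G := G) B fun k => c k * T.coeff G k
  rw [h1, e1, Complex.norm_real] at h4
  refine ((le_abs_self _).trans h4).trans ?_
  rw [sq, ← mul_assoc, ← integral_const_mul]
  refine integral_mono (hG.norm.mul (BM.trig _ _).norm).integrable
    (hG.norm.integrable.const_mul _) fun v => ?_
  rw [mul_comm]
  exact mul_le_mul_of_nonneg_right (h2 v) (norm_nonneg _)

lemma integral_mul_pow_six_le {μ : Measure Ω} [IsFiniteMeasure μ] {f g : Ω → ℝ}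
    (hf : BM f) (hg : BM g) (hf0 : ∀ w, 0 ≤ f w) (hg0 : ∀ w, 0 ≤ g w) :
    (∫ w, f w * g w ∂μ) ^ 6 ≤ (∫ w, f w ^ (6 / 5 : ℝ) ∂μ) ^ 5 * ∫ w, g w ^ 6 ∂μ := by
  have hpq : (6 / 5 : ℝ).HolderConjugate 6 :=
    Real.holderConjugate_iff.2 ⟨by norm_num, by norm_num⟩
  have h := integral_mul_le_of_holderConjugate (μ := μ) hpq hf hg hf0 hg0
  have h0 : 0 ≤ ∫ w, f w * g w ∂μ := integral_nonneg fun w => mul_nonneg (hf0 w) (hg0 w)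
  have e : ∀ w, g w ^ (6 : ℝ) = g w ^ 6 := fun w => by
    rw [show (6 : ℝ) = ((6 : ℕ) : ℝ) by norm_num, Real.rpow_natCast]
  simp_rw [e] at h
  have hF : 0 ≤ ∫ w, f w ^ (6 / 5 : ℝ) ∂μ := integral_nonneg fun w => Real.rpow_nonneg (hf0 w) _
  have hG : 0 ≤ ∫ w, g w ^ 6 ∂μ := integral_nonneg fun w => pow_nonneg (hg0 w) _
  calc _ ≤ ((∫ w, f w ^ (6 / 5 : ℝ) ∂μ) ^ (1 / (6 / 5) : ℝ) *
        (∫ w, g w ^ 6 ∂μ) ^ (1 / 6 : ℝ)) ^ 6 := by gcongr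
    _ = _ := by
      rw [mul_pow, ← Real.rpow_mul_natCast hF, ← Real.rpow_mul_natCast hG]
      norm_num

/-- A finite box on which the truncated kernel obeys the same bound up to an additive constant. -/
lemma exists_box {δ K : ℝ} (hδ : 0 < δ) (g : ℝ → ℝ) (I J₀ : Finset ℤ)
    (hK : ∀ x y : ℝ, ‖∑ n ∈ I, ∑' m : ℤ, ((wt δ (m - g n) : ℝ) : ℂ) * ee (n * x + m * y)‖ ≤ K) :
    ∃ J : Finset ℤ, J₀ ⊆ J ∧ ∀ x y : ℝ,
      ‖∑ k ∈ I ×ˢ J, ((wt δ (k.2 - g k.1) : ℝ) : ℂ) * ee (k.1 * x + k.2 * y)‖ ≤ K + 1 := by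
  have hd1 : Summable fun m : ℤ => ∑ n ∈ I, ‖((wt δ (m - g n) : ℝ) : ℂ)‖ :=
    summable_sum fun n _ => by
      have := (summable_wt_mul_ee hδ (g n) fun _ => 0).norm
      simpa only [ee_zero, mul_one] using this
  obtain ⟨d, hd⟩ : ∃ d : ℤ → ℝ, d = fun m : ℤ => ∑ n ∈ I, ‖((wt δ (m - g n) : ℝ) : ℂ)‖ := ⟨_, rfl⟩
  rw [← hd] at hd1
  have ht := (tendsto_tsum_compl_atTop_zero d).eventually_le_const one_pos
  obtain ⟨J, hJ1, hJ2⟩ := (ht.and (Filter.eventually_ge_atTop J₀)).exists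
  refine ⟨J, hJ2, fun x y => ?_⟩
  obtain ⟨f, hf⟩ : ∃ f : ℤ → ℂ, f = fun m : ℤ =>
    ∑ n ∈ I, ((wt δ (m - g n) : ℝ) : ℂ) * ee (n * x + m * y) := ⟨_, rfl⟩
  have hfd : ∀ m, ‖f m‖ ≤ d m := fun m => by
    rw [hf, hd]
    refine (norm_sum_le _ _).trans ?_
    simp only [norm_mul, norm_ee, mul_one, le_refl]
  have hfs : Summable f := Summable.of_norm_bounded hd1 hfd
  have e1 := hfs.sum_add_tsum_subtype_compl J
  have e2 : ∑' m, f m = ∑ n ∈ I, ∑' m : ℤ, ((wt δ (m - g n) : ℝ) : ℂ) * ee (n * x + m * y) := by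
    rw [hf]
    exact Summable.tsum_finsetSum fun n _ => summable_wt_mul_ee hδ _ _
  have e3 : ∑ k ∈ I ×ˢ J, ((wt δ (k.2 - g k.1) : ℝ) : ℂ) * ee (k.1 * x + k.2 * y) =
      ∑ m ∈ J, f m := by rw [Finset.sum_product_right, hf]
  rw [e3, eq_sub_of_add_eq e1, e2]
  refine (norm_sub_le _ _).trans (add_le_add (hK x y) ?_)
  exact (tsum_of_norm_bounded (hd1.subtype (fun m => m ∉ J)).hasSum fun m => hfd m).trans hJ1

namespace Shell

variable {M lam δ : ℝ} {g ψ : ℝ → ℝ} {S : Finset (ℤ × ℤ)}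

/-- The dual form of the sixth moment bound. -/
lemma sum_norm_coeff_sq_pow_three_le (h : Shell M lam δ g ψ S) {G : Ω → ℂ} (hG : BM G) :
    (∑ k ∈ S, ‖T.coeff G k‖ ^ 2) ^ 3 ≤
      (∫ w, ‖G w‖ ^ (6 / 5 : ℝ) ∂T.μ) ^ 5 * (2 * 10 ^ 7 * M ^ 6 * (S.card + lam * δ)) := by
  set D := ∑ k ∈ S, ‖T.coeff G k‖ ^ 2 with hD
  have hM := h.M_pos
  have hP := h.one_le_mul
  have hY : 0 ≤ ∫ w, ‖G w‖ ^ (6 / 5 : ℝ) ∂T.μ :=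
    integral_nonneg fun w => Real.rpow_nonneg (norm_nonneg _) _
  have hD0 : 0 ≤ D := Finset.sum_nonneg fun k _ => by positivity
  rcases hD0.eq_or_lt with h0 | h0
  · rw [← h0, zero_pow (by norm_num)]; positivity
  have hs : √D ^ 2 = D := Real.sq_sqrt hD0
  have hs0 : 0 < √D := Real.sqrt_pos.2 h0
  set a : ℤ × ℤ → ℂ := fun k => T.coeff G k / (√D : ℝ) with ha
  have h1 : nsq S a = 1 := by
    simp only [nsq, ha, norm_div, Complex.norm_real, Real.norm_of_nonneg hs0.le, div_pow, hs]
    rw [← Finset.sum_div, ← hD, div_self h0.ne']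
  have h2 : ∑ k ∈ S, (starRingEnd ℂ) (a k) * T.coeff G k = ((√D : ℝ) : ℂ) := by
    have : ∀ k, (starRingEnd ℂ) (a k) * T.coeff G k = ((‖T.coeff G k‖ ^ 2 / √D : ℝ) : ℂ) := fun k => by
      rw [ha, map_div₀, Complex.conj_ofReal, div_mul_eq_mul_div, mul_comm, Complex.mul_conj,
        Complex.normSq_eq_norm_sq]
      push_cast; rfl
    simp_rw [this]
    rw [← Complex.ofReal_sum, ← Finset.sum_div, ← hD]
    congr 1
    rw [div_eq_iff hs0.ne', ← sq, hs]
  have h3 := norm_integral_mul_conj_trig_le (T := T) (G := G) S a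
  rw [integral_mul_conj_trig hG, h2, Complex.norm_real, Real.norm_of_nonneg hs0.le] at h3
  calc D ^ 3 = √D ^ 6 := by rw [← hs]; ring_nf; rw [Real.sq_sqrt hD0]
    _ ≤ (∫ w, ‖G w‖ * ‖T.trig S a w‖ ∂T.μ) ^ 6 := by gcongr
    _ ≤ _ := integral_mul_pow_six_le hG.norm (BM.trig _ _).norm (fun _ => norm_nonneg _)
        fun _ => norm_nonneg _
    _ ≤ _ := by gcongr; exact h.integral_norm_pow_six_le a h1.le

end Shell

end

section

variable {Ω : Type*} [MeasurableSpace Ω] {T : Torus Ω}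

namespace Shell

variable {M lam δ : ℝ} {g ψ : ℝ → ℝ} {S : Finset (ℤ × ℤ)}

/-- A translate of the shell, thickened to unit width. -/
lemma translate (h : Shell M lam δ g ψ S) (j : ℤ) {B : Finset (ℤ × ℤ)}
    (hB1 : ∀ k ∈ B, k.1 ∈ Finset.Icc (-⌊M * lam⌋) ⌊M * lam⌋)
    (hB2 : ∀ k ∈ B, k.2 - ⌊g k.1⌋ = j) : Shell M lam 1 (fun u => g u + j) ψ B where
  one_le_M := h.one_le_M
  one_le_lam := h.one_le_lam
  pos := one_pos
  le_one := le_rfl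
  one_le_mul := by rw [mul_one]; exact h.one_le_lam
  fst_le k hk := by
    have h1 := Finset.mem_Icc.1 (hB1 k hk)
    have h2 := Int.floor_le (M * lam)
    have h3 : (-⌊M * lam⌋ : ℝ) ≤ k.1 := by exact_mod_cast h1.1
    have h4 : (k.1 : ℝ) ≤ ⌊M * lam⌋ := by exact_mod_cast h1.2
    exact abs_le.2 ⟨by linarith, by linarith⟩
  near k hk := by
    have h1 : (j : ℝ) = k.2 - ⌊g k.1⌋ := by exact_mod_cast (hB2 k hk).symm
    have h2 := Int.floor_le (g k.1)
    have h3 := Int.lt_floor_add_one (g k.1)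
    have := h.one_le_M
    rw [h1]
    exact abs_le.2 ⟨by linarith, by linarith⟩
  lower u c hu hc := by simpa using h.lower u c hu hc
  upper u c hu hc := by simpa using h.upper u c hu hc
  slope := h.slope

lemma card_translate_le (h : Shell M lam δ g ψ S) (j : ℤ) {B : Finset (ℤ × ℤ)}
    (hB1 : ∀ k ∈ B, k.1 ∈ Finset.Icc (-⌊M * lam⌋) ⌊M * lam⌋)
    (hB2 : ∀ k ∈ B, k.2 - ⌊g k.1⌋ = j) : (B.card : ℝ) ≤ 3 * M * lam := by
  refine le_trans ?_ h.card_Icc_le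
  exact_mod_cast Finset.card_le_card_of_injOn Prod.fst hB1 fun k hk l hl hkl => by
    have h1 := hB2 k hk
    have h2 := hB2 l hl
    ext
    · exact hkl
    · rw [hkl] at h1; omega

lemma gauss_sub_le (g : ℝ) (m : ℤ) :
    gauss (1 * (m - g)) ≤ Real.exp Real.pi * gauss (1 / 2 * (((m - ⌊g⌋ : ℤ) : ℝ) - 0)) := by
  unfold gauss
  rw [← Real.exp_add]
  apply Real.exp_le_exp.2
  push_cast
  have h2 := Int.floor_le g
  have h3 := Int.lt_floor_add_one g
  have h4 : (1 / 2 * ((m : ℝ) - ⌊g⌋ - 0)) ^ 2 ≤ (1 * (m - g)) ^ 2 + 1 := by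
    nlinarith [sq_nonneg ((m : ℝ) - g - (g - ⌊g⌋))]
  nlinarith [Real.pi_pos]

/-- The smoothed unit-width shell, in dual form. -/
lemma sum_gauss_mul_norm_coeff_sq_le (h : Shell M lam δ g ψ S) {G : Ω → ℂ} (hG : BM G)
    (J : Finset ℤ) {R : ℝ} (hR0 : 0 ≤ R)
    (hR : (∫ w, ‖G w‖ ^ (6 / 5 : ℝ) ∂T.μ) ^ 5 * (8 * 10 ^ 7 * M ^ 7 * lam) ≤ R ^ 3) :
    ∑ k ∈ Finset.Icc (-⌊M * lam⌋) ⌊M * lam⌋ ×ˢ J,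
      gauss (1 * (k.2 - g k.1)) * ‖T.coeff G k‖ ^ 2 ≤ 2 * Real.exp Real.pi * gaussConst * R := by
  classical
  set B := Finset.Icc (-⌊M * lam⌋) ⌊M * lam⌋ ×ˢ J with hB
  have hM := h.one_le_M
  have hM0 := h.M_pos
  have hl := h.lam_pos
  set q : ℤ × ℤ → ℤ := fun k => k.2 - ⌊g k.1⌋ with hq
  have hY : 0 ≤ ∫ w, ‖G w‖ ^ (6 / 5 : ℝ) ∂T.μ :=
    integral_nonneg fun w => Real.rpow_nonneg (norm_nonneg _) _
  have hj : ∀ j, ∑ k ∈ B.filter (fun k => q k = j), ‖T.coeff G k‖ ^ 2 ≤ R := by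
    intro j
    have b1 : ∀ k ∈ B.filter (fun k => q k = j), k.1 ∈ Finset.Icc (-⌊M * lam⌋) ⌊M * lam⌋ :=
      fun k hk => (Finset.mem_product.1 (Finset.mem_filter.1 hk).1).1
    have b2 : ∀ k ∈ B.filter (fun k => q k = j), k.2 - ⌊g k.1⌋ = j :=
      fun k hk => (Finset.mem_filter.1 hk).2
    have h1 := (h.translate j b1 b2).sum_norm_coeff_sq_pow_three_le (T := T) hG
    have h2 := h.card_translate_le j b1 b2
    refine le_of_pow_le_pow_left₀ (n := 3) (by norm_num) hR0 (h1.trans (le_trans ?_ hR))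
    have h3 : 2 * 10 ^ 7 * M ^ 6 * (((B.filter fun k => q k = j).card : ℝ) + lam * 1) ≤
        8 * 10 ^ 7 * M ^ 7 * lam := by
      have h4 : lam * 1 ≤ M * lam := by nlinarith
      calc _ ≤ 2 * 10 ^ 7 * M ^ 6 * (3 * M * lam + M * lam) := by gcongr
        _ = _ := by ring
    gcongr
  have hsum : ∑ j ∈ B.image q, gauss (1 / 2 * ((j : ℝ) - 0)) ≤ 2 * gaussConst := by
    have h1 := (summable_gauss (one_half_pos (α := ℝ)) 0).sum_le_tsum (B.image q)
      fun m _ => (gauss_pos _).le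
    have h2 := tsum_gauss_le (one_half_pos (α := ℝ)) (by norm_num) 0
    calc _ ≤ _ := h1
      _ ≤ _ := h2
      _ = _ := by ring
  rw [← Finset.sum_fiberwise_of_maps_to (g := q) (t := B.image q)
    fun k hk => Finset.mem_image_of_mem q hk]
  calc _ ≤ ∑ j ∈ B.image q, Real.exp Real.pi * gauss (1 / 2 * ((j : ℝ) - 0)) * R := by
        refine Finset.sum_le_sum fun j _ => ?_
        have hc : 0 ≤ Real.exp Real.pi * gauss (1 / 2 * ((j : ℝ) - 0)) :=
          mul_nonneg (Real.exp_pos _).le (gauss_pos _).le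
        refine le_trans ?_ (mul_le_mul_of_nonneg_left (hj j) hc)
        rw [Finset.mul_sum]
        refine Finset.sum_le_sum fun k hk => ?_
        have := gauss_sub_le (g k.1) k.2
        rw [show k.2 - ⌊g k.1⌋ = j from (Finset.mem_filter.1 hk).2] at this
        gcongr
    _ = (∑ j ∈ B.image q, gauss (1 / 2 * ((j : ℝ) - 0))) * (Real.exp Real.pi * R) := by
        rw [Finset.sum_mul]; exact Finset.sum_congr rfl fun j _ => by ring
    _ ≤ (2 * gaussConst) * (Real.exp Real.pi * R) := by
        have := Real.exp_pos Real.pi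
        gcongr
    _ = _ := by ring

/-- The sixth moment over the set where the polynomial is large. -/
theorem setIntegral_pow_six_le_of_lt (h : Shell M lam δ g ψ S) (a : ℤ × ℤ → ℂ)
    (ha : nsq S a ≤ 1) {A : ℝ} (hA0 : 0 < A)
    (hA : 4 * (1200 * gaussConst * M ^ 3 * (√lam / √δ) + 1) ≤ gauss M * A ^ 2) :
    gauss M ^ 3 * ∫ w in {w | A < ‖T.trig S a w‖}, ‖T.trig S a w‖ ^ 6 ∂T.μ ≤
      (4 * Real.exp Real.pi * gaussConst) ^ 3 * (8 * 10 ^ 7 * M ^ 7) * (δ ^ 3 * lam) := by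
  classical
  have hM0 := h.M_pos
  have hl := h.lam_pos
  have hδ := h.pos
  have hC := one_le_gaussConst
  have hgM := gauss_pos M
  have hexp := Real.exp_pos Real.pi
  set f := T.trig S a with hf
  have hfm : Measurable f := measurable_trig S a
  set E : Set Ω := {w | A < ‖f w‖} with hE
  have hEm : MeasurableSet E := measurableSet_lt measurable_const hfm.norm
  set X := ∫ w in E, ‖f w‖ ^ 6 ∂T.μ with hX
  have hX0 : 0 ≤ X := integral_nonneg fun w => by positivity
  have hfB : BM f := BM.trig S a
  set G : Ω → ℂ := E.indicator fun w => ((‖f w‖ ^ 4 : ℝ) : ℂ) * f w with hG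
  have hGB : BM G := ((hfB.norm.pow 4).ofReal.mul hfB).indicator hEm
  have hGn : ∀ w, ‖G w‖ = E.indicator (fun w => ‖f w‖ ^ 5) w := fun w => by
    rw [hG, norm_indicator_eq_indicator_norm]
    congr 1; ext w
    rw [norm_mul, Complex.norm_real, norm_pow, norm_norm]; ring
  -- the three integrals of `G`
  have hGf : ∫ w, G w * (starRingEnd ℂ) (f w) ∂T.μ = (X : ℂ) := by
    have : ∀ w, G w * (starRingEnd ℂ) (f w) = ((E.indicator (fun w => ‖f w‖ ^ 6) w : ℝ) : ℂ) := by
      intro w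
      by_cases hw : w ∈ E
      · rw [hG, Set.indicator_of_mem hw, Set.indicator_of_mem hw, mul_assoc, Complex.mul_conj,
          Complex.normSq_eq_norm_sq]
        push_cast; ring
      · rw [hG, Set.indicator_of_notMem hw, Set.indicator_of_notMem hw]; simp
    simp_rw [this]
    rw [integral_complex_ofReal, integral_indicator hEm]
  have hG1 : ∫ w, ‖G w‖ ∂T.μ ≤ X / A := by
    simp_rw [hGn]
    rw [integral_indicator hEm, le_div_iff₀ hA0, ← integral_mul_const]
    refine setIntegral_mono_on ((hfB.norm.pow 5).integrable.mul_const _)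
      (hfB.norm.pow 6).integrable hEm fun w hw => ?_
    have : A < ‖f w‖ := hw
    rw [pow_succ _ 5]
    gcongr
  have hG65 : ∫ w, ‖G w‖ ^ (6 / 5 : ℝ) ∂T.μ = X := by
    have : ∀ w, ‖G w‖ ^ (6 / 5 : ℝ) = E.indicator (fun w => ‖f w‖ ^ 6) w := fun w => by
      rw [hGn]
      by_cases hw : w ∈ E
      · rw [Set.indicator_of_mem hw, Set.indicator_of_mem hw, ← Real.rpow_natCast,
          ← Real.rpow_mul (norm_nonneg _), ← Real.rpow_natCast]
        norm_num
      · rw [Set.indicator_of_notMem hw, Set.indicator_of_notMem hw, Real.zero_rpow (by norm_num)]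
    simp_rw [this]
    rw [integral_indicator hEm]
  -- Cauchy-Schwarz
  set D := ∑ k ∈ S, ‖T.coeff G k‖ ^ 2 with hD
  have hXD : X ^ 2 ≤ D := by
    have h1 := integral_mul_conj_trig (T := T) hGB S a
    rw [← hf, hGf] at h1
    have h2 : X ≤ ∑ k ∈ S, ‖a k‖ * ‖T.coeff G k‖ := by
      have := congrArg norm h1
      rw [Complex.norm_real, Real.norm_of_nonneg hX0] at this
      rw [this]
      refine (norm_sum_le _ _).trans (le_of_eq ?_)
      simp only [norm_mul, Complex.norm_conj]
    calc X ^ 2 ≤ (∑ k ∈ S, ‖a k‖ * ‖T.coeff G k‖) ^ 2 := by gcongr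
      _ ≤ nsq S a * D := Finset.sum_mul_sq_le_sq_mul_sq _ _ _
      _ ≤ 1 * D := by
        have : 0 ≤ D := Finset.sum_nonneg fun k _ => by positivity
        gcongr
      _ = D := one_mul D
  obtain ⟨J, hJ1, hJ2⟩ := exists_box hδ g (Finset.Icc (-⌊M * lam⌋) ⌊M * lam⌋) (S.image Prod.snd)
    h.norm_sum_tsum_wt_le
  set B := Finset.Icc (-⌊M * lam⌋) ⌊M * lam⌋ ×ˢ J with hB
  have hSB : S ⊆ B := fun k hk =>
    Finset.mem_product.2 ⟨h.mem_Icc_fst hk, hJ1 (Finset.mem_image_of_mem _ hk)⟩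
  set K := 1200 * gaussConst * M ^ 3 * (√lam / √δ) + 1 with hK
  have hK0 : 0 < K := by positivity
  obtain ⟨R, hR0, hR⟩ : ∃ R : ℝ, 0 ≤ R ∧ R ^ 3 = X ^ 5 * (8 * 10 ^ 7 * M ^ 7 * lam) := by
    refine ⟨(X ^ 5 * (8 * 10 ^ 7 * M ^ 7 * lam)) ^ (1 / 3 : ℝ), by positivity, ?_⟩
    rw [← Real.rpow_mul_natCast (by positivity)]
    norm_num
  have h1 : gauss M * D ≤ K * (X / A) ^ 2 + δ * (2 * Real.exp Real.pi * gaussConst * R) := by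
    calc gauss M * D ≤ ∑ k ∈ S, gauss (δ⁻¹ * (k.2 - g k.1)) * ‖T.coeff G k‖ ^ 2 := by
          rw [hD, Finset.mul_sum]
          refine Finset.sum_le_sum fun k hk => ?_
          have := h.gauss_le_of_mem hk
          gcongr
      _ ≤ ∑ k ∈ B, gauss (δ⁻¹ * (k.2 - g k.1)) * ‖T.coeff G k‖ ^ 2 :=
          Finset.sum_le_sum_of_subset_of_nonneg hSB fun k _ _ =>
            mul_nonneg (gauss_pos _).le (by positivity)
      _ = ∑ k ∈ B, wt δ (k.2 - g k.1) * ‖T.coeff G k‖ ^ 2 +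
          δ * ∑ k ∈ B, gauss (1 * (k.2 - g k.1)) * ‖T.coeff G k‖ ^ 2 := by
          rw [Finset.mul_sum, ← Finset.sum_add_distrib]
          refine Finset.sum_congr rfl fun k _ => ?_
          rw [wt]; ring
      _ ≤ _ := by
          have b1 := sum_mul_norm_coeff_sq_le (T := T) hGB B (fun k => wt δ (k.2 - g k.1)) hJ2
          have b2 := h.sum_gauss_mul_norm_coeff_sq_le (T := T) hGB J hR0 (by rw [hG65, hR])
          have b3 : 0 ≤ ∫ w, ‖G w‖ ∂T.μ := integral_nonneg fun _ => norm_nonneg _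
          refine add_le_add (b1.trans ?_) ?_ <;> gcongr
  have h2 : K * (X / A) ^ 2 ≤ gauss M * X ^ 2 / 4 := by
    rw [div_pow, ← mul_div_assoc, div_le_iff₀ (by positivity)]
    nlinarith [mul_le_mul_of_nonneg_right hA (sq_nonneg X)]
  have h3 : gauss M * X ^ 2 ≤ 4 * Real.exp Real.pi * gaussConst * (δ * R) := by
    have : gauss M * X ^ 2 ≤ gauss M * D := by gcongr
    have : 0 ≤ Real.exp Real.pi * gaussConst * (δ * R) := by positivity
    nlinarith
  have h4 : (gauss M ^ 3 * X) * X ^ 5 ≤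
      ((4 * Real.exp Real.pi * gaussConst) ^ 3 * (8 * 10 ^ 7 * M ^ 7) * (δ ^ 3 * lam)) * X ^ 5 := by
    calc _ = (gauss M * X ^ 2) ^ 3 := by ring
      _ ≤ (4 * Real.exp Real.pi * gaussConst * (δ * R)) ^ 3 := by gcongr
      _ = (4 * Real.exp Real.pi * gaussConst) ^ 3 * δ ^ 3 * R ^ 3 := by ring
      _ = _ := by rw [hR]; ring
  rcases hX0.eq_or_lt with h0 | h0
  · rw [← h0, mul_zero]; positivity
  · exact le_of_mul_le_mul_right h4 (by positivity)

end Shell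

end

section

variable {Ω : Type*} [MeasurableSpace Ω] {T : Torus Ω}

lemma rpow_le_rpow_add {t L p q : ℝ} (ht : 0 ≤ t) (hL : 0 < L) (hp : 2 ≤ p) (hpq : p ≤ q) :
    t ^ p ≤ L ^ (p - 2) * t ^ 2 + L ^ (p - q) * t ^ q := by
  rcases le_total t L with h | h
  · have e : t ^ p = t ^ (p - 2) * t ^ 2 := by
      rw [← Real.rpow_two, ← Real.rpow_add_of_nonneg ht (by linarith) (by norm_num)]
      congr 1; ring
    have h1 : t ^ (p - 2) ≤ L ^ (p - 2) := Real.rpow_le_rpow ht h (by linarith)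
    have : 0 ≤ L ^ (p - q) * t ^ q := by positivity
    rw [e]
    nlinarith [mul_le_mul_of_nonneg_right h1 (sq_nonneg t)]
  · have ht0 : 0 < t := by linarith
    have e : t ^ p = t ^ (p - q) * t ^ q := by
      rw [← Real.rpow_add ht0]; congr 1; ring
    have h1 : t ^ (p - q) ≤ L ^ (p - q) := Real.rpow_le_rpow_of_nonpos hL h (by linarith)
    have : 0 ≤ L ^ (p - 2) * t ^ 2 := by positivity
    rw [e]
    nlinarith [mul_le_mul_of_nonneg_right h1 (Real.rpow_nonneg ht q)]

/-- Interpolation of a moment between the second one and a higher one. -/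
lemma integral_rpow_le_of_integral_rpow_le {S : Finset (ℤ × ℤ)} {a : ℤ × ℤ → ℂ}
    (ha : nsq S a ≤ 1) {p q C L : ℝ} (hp : 2 ≤ p) (hpq : p ≤ q) (hL : 0 < L)
    (hq : ∫ w, ‖T.trig S a w‖ ^ q ∂T.μ ≤ C * L ^ (q - 2)) :
    ∫ w, ‖T.trig S a w‖ ^ p ∂T.μ ≤ (1 + C) * L ^ (p - 2) := by
  have hf := (BM.trig (T := T) S a).norm
  have i2 := ((hf.pow 2).const_mul (L ^ (p - 2))).integrable (μ := T.μ)
  have iq := ((hf.rpow (fun _ => norm_nonneg _) (by linarith : 0 ≤ q)).const_mul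
    (L ^ (p - q))).integrable (μ := T.μ)
  calc _ ≤ ∫ w, (L ^ (p - 2) * ‖T.trig S a w‖ ^ 2 + L ^ (p - q) * ‖T.trig S a w‖ ^ q) ∂T.μ :=
        integral_mono (hf.rpow (fun _ => norm_nonneg _) (by linarith)).integrable (i2.add iq)
          fun w => rpow_le_rpow_add (norm_nonneg _) hL hp hpq
    _ = L ^ (p - 2) * nsq S a + L ^ (p - q) * ∫ w, ‖T.trig S a w‖ ^ q ∂T.μ := by
        rw [integral_add i2 iq, integral_const_mul, integral_const_mul, integral_norm_trig_sq]
    _ ≤ L ^ (p - 2) * 1 + L ^ (p - q) * (C * L ^ (q - 2)) := by gcongr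
    _ = (1 + C) * L ^ (p - 2) := by
        have : L ^ (p - q) * L ^ (q - 2) = L ^ (p - 2) := by
          rw [← Real.rpow_add hL]; congr 1; ring
        rw [mul_left_comm, this]; ring

/-- A higher moment is controlled by a lower one and the supremum. -/
lemma setIntegral_rpow_le_mul {f : Ω → ℂ} (hf : BM f) {μ : Measure Ω} [IsFiniteMeasure μ]
    {E : Set Ω} (hE : MeasurableSet E) {p q A : ℝ} (hq : 0 ≤ q) (hqp : q ≤ p)
    (hfA : ∀ w ∈ E, ‖f w‖ ≤ A) :
    ∫ w in E, ‖f w‖ ^ p ∂μ ≤ A ^ (p - q) * ∫ w in E, ‖f w‖ ^ q ∂μ := by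
  rw [← integral_const_mul]
  refine setIntegral_mono_on (hf.norm.rpow (fun _ => norm_nonneg _) (by linarith)).integrable
    ((hf.norm.rpow (fun _ => norm_nonneg _) hq).const_mul _).integrable hE fun w hw => ?_
  have e : ‖f w‖ ^ p = ‖f w‖ ^ (p - q) * ‖f w‖ ^ q := by
    rw [← Real.rpow_add_of_nonneg (norm_nonneg _) (by linarith) hq]; congr 1; ring
  rw [e]
  have := Real.rpow_le_rpow (norm_nonneg _) (hfA w hw) (by linarith : 0 ≤ p - q)
  gcongr

lemma integral_rpow_le_mul {f : Ω → ℂ} (hf : BM f) {μ : Measure Ω} [IsFiniteMeasure μ]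
    {p q A : ℝ} (hq : 0 ≤ q) (hqp : q ≤ p) (hfA : ∀ w, ‖f w‖ ≤ A) :
    ∫ w, ‖f w‖ ^ p ∂μ ≤ A ^ (p - q) * ∫ w, ‖f w‖ ^ q ∂μ := by
  simpa using setIntegral_rpow_le_mul (μ := μ) hf MeasurableSet.univ hq hqp fun w _ => hfA w

lemma norm_trig_le_sqrt {S : Finset (ℤ × ℤ)} {a : ℤ × ℤ → ℂ} (ha : nsq S a ≤ 1) {N : ℝ}
    (hN : (S.card : ℝ) ≤ N) (w : Ω) : ‖T.trig S a w‖ ≤ √N := by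
  apply Real.le_sqrt_of_sq_le
  calc _ ≤ S.card * nsq S a := norm_trig_sq_le S a w
    _ ≤ S.card * 1 := by gcongr
    _ ≤ N := by rw [mul_one]; exact hN

namespace Shell

lemma exists_card_le {M : ℝ} (hM : 1 ≤ M) : ∃ C : ℝ, 1 ≤ C ∧
    ∀ (lam δ : ℝ) (g ψ : ℝ → ℝ) (S : Finset (ℤ × ℤ)), Shell M lam δ g ψ S →
      1 ≤ lam * δ ^ 3 → (S.card : ℝ) ≤ C * (lam * δ) := by
  have hg := gauss_pos M
  have hC := one_le_gaussConst
  refine ⟨(3 * M * gaussConst + 1200 * gaussConst * M ^ 3) / gauss M, ?_,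
    fun lam δ g ψ S h h3 => ?_⟩
  · rw [le_div_iff₀ hg]
    have := gauss_le_one M
    have : 1 ≤ M * gaussConst := one_le_mul_of_one_le_of_one_le hM hC
    have : 0 ≤ gaussConst * M ^ 3 := by positivity
    linarith
  · have hδ := h.pos
    have hl := h.lam_pos
    have h1 : √lam / √δ ≤ lam * δ := by
      rw [← Real.sqrt_div hl.le]
      apply Real.sqrt_le_iff.2 ⟨by positivity, ?_⟩
      rw [div_le_iff₀ hδ]
      have := mul_le_mul_of_nonneg_left h3 hl.le
      linarith
    rw [div_mul_eq_mul_div, le_div_iff₀ hg, mul_comm]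
    refine h.card_le_add.trans ?_
    rw [add_mul]
    have : 0 ≤ 1200 * gaussConst * M ^ 3 := by positivity
    gcongr

lemma exists_integral_rpow_six_le (T : Torus Ω) {M : ℝ} (hM : 1 ≤ M) : ∃ C : ℝ, 1 ≤ C ∧
    ∀ (lam δ : ℝ) (g ψ : ℝ → ℝ) (S : Finset (ℤ × ℤ)) (a : ℤ × ℤ → ℂ), Shell M lam δ g ψ S →
      nsq S a ≤ 1 → 1 ≤ lam * δ ^ 3 → ∫ w, ‖T.trig S a w‖ ^ (6 : ℝ) ∂T.μ ≤ C * (lam * δ) := by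
  obtain ⟨C, hC, hc⟩ := exists_card_le hM
  have hM6 : 1 ≤ M ^ 6 := one_le_pow₀ hM
  refine ⟨2 * 10 ^ 7 * M ^ 6 * (C + 1), by nlinarith, fun lam δ g ψ S a h ha h3 => ?_⟩
  simp_rw [show (6 : ℝ) = ((6 : ℕ) : ℝ) by norm_num, Real.rpow_natCast]
  refine (h.integral_norm_pow_six_le a ha).trans ?_
  have := hc _ _ _ _ _ h h3
  calc _ ≤ 2 * 10 ^ 7 * M ^ 6 * (C * (lam * δ) + lam * δ) := by gcongr
    _ = _ := by ring

lemma exists_integral_rpow_le_of_le_six (T : Torus Ω) {M : ℝ} (hM : 1 ≤ M) {p : ℝ} (hp : 2 ≤ p)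
    (hp6 : p ≤ 6) : ∃ C : ℝ, 1 ≤ C ∧
    ∀ (lam δ : ℝ) (g ψ : ℝ → ℝ) (S : Finset (ℤ × ℤ)) (a : ℤ × ℤ → ℂ), Shell M lam δ g ψ S →
      nsq S a ≤ 1 → 1 ≤ lam * δ ^ 3 →
      ∫ w, ‖T.trig S a w‖ ^ p ∂T.μ ≤ C * (lam * δ) ^ ((p - 2) / 4) := by
  obtain ⟨C, hC, hc⟩ := exists_integral_rpow_six_le T hM
  refine ⟨1 + C, by linarith, fun lam δ g ψ S a h ha h3 => ?_⟩
  have hP : 0 < lam * δ := mul_pos h.lam_pos h.pos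
  have := integral_rpow_le_of_integral_rpow_le (T := T) (C := C) (L := (lam * δ) ^ (1 / 4 : ℝ)) ha hp
    hp6 (by positivity) ((hc _ _ _ _ _ _ h ha h3).trans (le_of_eq ?_))
  · rw [← Real.rpow_mul hP.le] at this
    convert this using 3
    ring
  · rw [← Real.rpow_mul hP.le]; norm_num

end Shell

end

section

variable {Ω : Type*} [MeasurableSpace Ω] {T : Torus Ω}

lemma integral_eq_setIntegral_add {f : Ω → ℂ} (hf : BM f) {μ : Measure Ω} [IsFiniteMeasure μ]
    {p : ℝ} (hp : 0 ≤ p) (A : ℝ) :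
    ∫ w, ‖f w‖ ^ p ∂μ = ∫ w in {w | ‖f w‖ ≤ A}, ‖f w‖ ^ p ∂μ +
      ∫ w in {w | A < ‖f w‖}, ‖f w‖ ^ p ∂μ := by
  have hE : MeasurableSet {w | ‖f w‖ ≤ A} := measurableSet_le hf.1.norm measurable_const
  rw [← integral_add_compl hE (hf.norm.rpow (fun _ => norm_nonneg _) hp).integrable]
  congr 3
  ext w
  simp

/-- A lower moment on the set where the function is large is controlled by a higher one. -/
lemma setIntegral_rpow_le_of_lt {f : Ω → ℂ} (hf : BM f) {μ : Measure Ω} [IsFiniteMeasure μ]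
    {p q A : ℝ} (hA : 0 < A) (hp : 0 ≤ p) (hpq : p ≤ q) :
    ∫ w in {w | A < ‖f w‖}, ‖f w‖ ^ p ∂μ ≤ A ^ (p - q) * ∫ w, ‖f w‖ ^ q ∂μ := by
  have hE : MeasurableSet {w | A < ‖f w‖} := measurableSet_lt measurable_const hf.1.norm
  have iq := ((hf.norm.rpow (fun _ => norm_nonneg _) (by linarith : 0 ≤ q)).const_mul
    (A ^ (p - q))).integrable (μ := μ)
  rw [← integral_const_mul]
  refine le_trans (setIntegral_mono_on (hf.norm.rpow (fun _ => norm_nonneg _) hp).integrable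
    iq.integrableOn hE fun w hw => ?_)
    (setIntegral_le_integral iq (Filter.Eventually.of_forall fun w => by positivity))
  have hw' : A < ‖f w‖ := hw
  have e : ‖f w‖ ^ p = ‖f w‖ ^ (p - q) * ‖f w‖ ^ q := by
    rw [← Real.rpow_add (hA.trans hw')]; congr 1; ring
  rw [e]
  have := Real.rpow_le_rpow_of_nonpos hA hw'.le (by linarith : p - q ≤ 0)
  gcongr

lemma exists_exp_eq {t : ℝ} (ht : 0 < t) : ∃ x, t = Real.exp x := ⟨Real.log t, (Real.exp_log ht).symm⟩

lemma sqrt_exp (x : ℝ) : √(Real.exp x) = Real.exp (x / 2) := by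
  rw [Real.exp_half]

lemma exp_rpow (x s : ℝ) : Real.exp x ^ s = Real.exp (x * s) := (Real.exp_mul x s).symm

namespace Shell

variable {M lam δ : ℝ} {g ψ : ℝ → ℝ} {S : Finset (ℤ × ℤ)}

lemma card_cap_le (h : Shell M lam δ g ψ S) (j : ℤ) :
    ((S.filter fun k => capIndex √(lam * δ) k = j).card : ℝ) ≤ 72 * M ^ 2 * √(lam * δ) := by
  have := h.card_arc_le le_rfl (by simpa using h.le_one) j
  simpa using this

lemma exists_integral_rpow_five_le (T : Torus Ω) {M : ℝ} (hM : 1 ≤ M) {κ : ℝ} (hκ : 0 < κ) :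
    ∃ C : ℝ, 1 ≤ C ∧
    ∀ (lam δ : ℝ) (g ψ : ℝ → ℝ) (S : Finset (ℤ × ℤ)) (a : ℤ × ℤ → ℂ), Shell M lam δ g ψ S →
      nsq S a ≤ 1 → lam ^ (-1 + κ) < δ →
      ∫ w, ‖T.trig S a w‖ ^ (5 : ℝ) ∂T.μ ≤ C * (lam * δ) ^ (3 / 4 : ℝ) := by
  obtain ⟨h, hh⟩ : ∃ h, h = min (κ / 2) (1 / 9) := ⟨_, rfl⟩
  have h0 : 0 < h := hh ▸ lt_min (by linarith) (by norm_num)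
  have h1 : 2 * h ≤ κ := by have := hh ▸ min_le_left (κ / 2) (1 / 9); linarith
  have h2 : h ≤ 1 / 9 := hh ▸ min_le_right _ _
  obtain ⟨C5, hC5, H5⟩ := exists_integral_rpow_le_of_le_six T hM (p := 5) (by norm_num) (by norm_num)
  obtain ⟨C6, hC6, H6⟩ := integral_pow_six_le_of_card_cap T hM h0
  refine ⟨C5 + (864 * M ^ 3 + 6 ^ ((5 : ℝ) / 2) * (72 * M ^ 2) ^ ((5 : ℝ) / 2 - 1) +
    C6 * (72 * M ^ 2) ^ 2), le_add_of_le_of_nonneg hC5 (by positivity), ?_⟩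
  intro lam δ g ψ S a hs ha hδ
  have hlam := hs.one_le_lam
  obtain ⟨x, rfl⟩ := exists_exp_eq hs.lam_pos
  obtain ⟨y, rfl⟩ := exists_exp_eq hs.pos
  have hx : 0 ≤ x := by simpa using hlam
  have hy : y ≤ 0 := by simpa using hs.le_one
  rw [exp_rpow, Real.exp_lt_exp] at hδ
  have hP : 0 ≤ (Real.exp x * Real.exp y) ^ (3 / 4 : ℝ) := by positivity
  rcases le_total (Real.exp (-(3 * h * x))) (Real.exp y) with hc | hc
  · rw [Real.exp_le_exp] at hc
    have h3 := H5 _ _ g ψ S a hs ha (by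
      rw [← Real.exp_nat_mul, ← Real.exp_add, Real.one_le_exp_iff]; push_cast; nlinarith)
    rw [show ((5 : ℝ) - 2) / 4 = 3 / 4 by norm_num] at h3
    refine h3.trans ?_
    gcongr
    exact le_add_of_nonneg_right (by positivity)
  · rw [Real.exp_le_exp] at hc
    have hPe : √(Real.exp x * Real.exp y) = Real.exp ((x + y) / 2) := by
      rw [← Real.exp_add, sqrt_exp]
    have hPe' : (Real.exp x * Real.exp y) ^ (3 / 4 : ℝ) = Real.exp ((x + y) * (3 / 4)) := by
      rw [← Real.exp_add, exp_rpow]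
    have hA0 : 0 < Real.exp ((x + y) / 4 + h * x) := Real.exp_pos _
    have e1 := hs.setIntegral_rpow_le_of_le (T := T) a ha (p := 5) (H := Real.exp (h * x))
      (by norm_num) hA0.le (by rw [Real.one_le_exp_iff]; positivity) (by
        rw [← Real.exp_nat_mul, ← Real.exp_add, Real.exp_le_one_iff]; push_cast; linarith)
    have e2 := setIntegral_rpow_le_of_lt (BM.trig (T := T) S a) (μ := T.μ) hA0
      (by norm_num : (0 : ℝ) ≤ 5) (by norm_num : (5 : ℝ) ≤ 6)
    have e3 := H6 _ _ g ψ S a _ hs ha hs.card_cap_le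
    rw [integral_eq_setIntegral_add (BM.trig S a) (by norm_num) (Real.exp ((x + y) / 4 + h * x)),
      hPe']
    rw [hPe] at e1 e3
    have e6 : ∀ w, ‖T.trig S a w‖ ^ (6 : ℝ) = ‖T.trig S a w‖ ^ 6 := fun w => by
      rw [show (6 : ℝ) = ((6 : ℕ) : ℝ) by norm_num, Real.rpow_natCast]
    simp only [e6] at e2
    have f1 : Real.exp ((x + y) / 4 + h * x) ^ ((5 : ℝ) - 4) *
        (1 + Real.exp ((x + y) / 2) / Real.exp (h * x)) ≤ 2 * Real.exp ((x + y) * (3 / 4)) := by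
      rw [exp_rpow, ← Real.exp_sub, mul_add, ← Real.exp_add, two_mul]
      gcongr ?_ + ?_
      · rw [mul_one, Real.exp_le_exp]; nlinarith
      · rw [Real.exp_le_exp]; nlinarith
    have f2 : (72 * M ^ 2 * Real.exp ((x + y) / 2)) ^ ((5 : ℝ) / 2 - 1) =
        (72 * M ^ 2) ^ ((5 : ℝ) / 2 - 1) * Real.exp ((x + y) * (3 / 4)) := by
      rw [Real.mul_rpow (by positivity) (Real.exp_pos _).le, exp_rpow]; ring_nf
    have f3 : Real.exp ((x + y) / 4 + h * x) ^ ((5 : ℝ) - 6) *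
        (C6 * Real.exp x ^ h * (72 * M ^ 2 * Real.exp ((x + y) / 2)) ^ 2) =
        C6 * (72 * M ^ 2) ^ 2 * Real.exp ((x + y) * (3 / 4)) := by
      rw [exp_rpow, exp_rpow, mul_pow, ← Real.exp_nat_mul]
      have : Real.exp ((x + y) * (3 / 4)) = Real.exp (((x + y) / 4 + h * x) * (5 - 6)) *
          Real.exp (x * h) * Real.exp (((2 : ℕ) : ℝ) * ((x + y) / 2)) := by
        rw [← Real.exp_add, ← Real.exp_add]; congr 1; push_cast; ring
      rw [this]; ring
    have e2' := e2.trans (mul_le_mul_of_nonneg_left e3 (by positivity))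
    rw [f3] at e2'
    rw [f2] at e1
    have hM0 := hs.M_pos
    have g1 := mul_le_mul_of_nonneg_left f1 (by positivity : 0 ≤ 432 * M ^ 3)
    have g2 : 0 ≤ C5 * Real.exp ((x + y) * (3 / 4)) := by positivity
    linarith

end Shell

end

section

variable {Ω : Type*} [MeasurableSpace Ω] {T : Torus Ω}

lemma nsq_mono {S S' : Finset (ℤ × ℤ)} (hS : S' ⊆ S) (a : ℤ × ℤ → ℂ) : nsq S' a ≤ nsq S a :=
  Finset.sum_le_sum_of_subset_of_nonneg hS fun _ _ _ => by positivity

/-- Decomposition of an exponential sum according to the level sets of `n`. -/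
lemma trig_filter_eq_sum_add (S : Finset (ℤ × ℤ)) (a : ℤ × ℤ → ℂ) (n : ℤ × ℤ → ℝ) {θ : ℕ → ℝ}
    (hθ : Antitone θ) (m : ℕ) (w : Ω) :
    T.trig (S.filter fun k => n k ≤ θ 0) a w =
      ∑ i ∈ Finset.range m, T.trig (S.filter fun k => θ (i + 1) < n k ∧ n k ≤ θ i) a w +
        T.trig (S.filter fun k => n k ≤ θ m) a w := by
  induction m with
  | zero => simp
  | succ m ih =>
    rw [ih, Finset.sum_range_succ, add_assoc]
    congr 1
    have hd : Disjoint (S.filter fun k => θ (m + 1) < n k ∧ n k ≤ θ m)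
        (S.filter fun k => n k ≤ θ (m + 1)) := by
      rw [Finset.disjoint_filter]
      intro k _ h1 h2
      linarith [h1.1]
    have hu : S.filter (fun k => n k ≤ θ m) = (S.filter fun k => θ (m + 1) < n k ∧ n k ≤ θ m) ∪
        (S.filter fun k => n k ≤ θ (m + 1)) := by
      ext k
      have := hθ (Nat.le_succ m)
      simp only [Finset.mem_filter, Finset.mem_union]
      constructor
      · rintro ⟨h1, h2⟩
        rcases lt_or_ge (θ (m + 1)) (n k) with h | h
        · exact Or.inl ⟨h1, h, h2⟩
        · exact Or.inr ⟨h1, h⟩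
      · rintro (⟨h1, h2⟩ | ⟨h1, h2⟩)
        · exact ⟨h1, h2.2⟩
        · exact ⟨h1, h2.trans this⟩
    simp only [Torus.trig]
    rw [hu, Finset.sum_union hd]

lemma exists_norm_le_mul {ι : Type*} {s : Finset ι} {f : ι → ℂ} {z v : ℂ} {K : ℝ}
    (hK : (s.card : ℝ) + 1 ≤ K) (hz : z = ∑ i ∈ s, f i + v) :
    (∃ i ∈ s, ‖z‖ ≤ K * ‖f i‖) ∨ ‖z‖ ≤ K * ‖v‖ := by
  by_contra! hc
  obtain ⟨h1, h2⟩ := hc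
  have hK0 : 0 < K := by have : (0 : ℝ) ≤ s.card := Nat.cast_nonneg _; linarith
  have h3 : ‖z‖ ≤ ∑ i ∈ s, ‖f i‖ + ‖v‖ := by
    rw [hz]; exact (norm_add_le _ _).trans (by gcongr; exact norm_sum_le _ _)
  have h4 : ∑ i ∈ s, K * ‖f i‖ ≤ ∑ i ∈ s, ‖z‖ := Finset.sum_le_sum fun i hi => (h1 i hi).le
  rw [← Finset.mul_sum] at h4
  simp only [Finset.sum_const, nsmul_eq_mul] at h4
  have h5 : K * ‖z‖ < s.card * ‖z‖ + ‖z‖ := by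
    calc K * ‖z‖ ≤ K * (∑ i ∈ s, ‖f i‖ + ‖v‖) := by gcongr
      _ < s.card * ‖z‖ + ‖z‖ := by rw [mul_add]; exact add_lt_add_of_le_of_lt h4 h2
  nlinarith [norm_nonneg z]

/-- If a function is a sum of few pieces, its moment over a range of values is controlled by the
large values of the pieces and by the sixth moment of the last one. -/
lemma setIntegral_rpow_le_sum {ι : Type*} {s : Finset ι} {F : ι → Ω → ℂ} {f v : Ω → ℂ}
    (hF : ∀ i, BM (F i)) (hv : BM v) (hf : BM f) {μ : Measure Ω} [IsFiniteMeasure μ]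
    (hz : ∀ w, f w = ∑ i ∈ s, F i w + v w) {p K A₁ A₂ : ℝ} (hp : 6 ≤ p)
    (hA : 0 ≤ A₂) (hK : (s.card : ℝ) + 1 ≤ K) :
    ∫ w in {w | A₁ < ‖f w‖ ∧ ‖f w‖ ≤ A₂}, ‖f w‖ ^ p ∂μ ≤
      ∑ i ∈ s, K ^ p * ∫ w in {w | A₁ < K * ‖F i w‖}, ‖F i w‖ ^ p ∂μ +
        A₂ ^ (p - 6) * K ^ 6 * ∫ w, ‖v w‖ ^ 6 ∂μ := by
  have hK0 : 0 < K := by have : (0 : ℝ) ≤ s.card := Nat.cast_nonneg _; linarith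
  have hE : MeasurableSet {w | A₁ < ‖f w‖ ∧ ‖f w‖ ≤ A₂} :=
    (measurableSet_lt measurable_const hf.1.norm).inter
      (measurableSet_le hf.1.norm measurable_const)
  have hEi : ∀ i, MeasurableSet {w | A₁ < K * ‖F i w‖} := fun i =>
    measurableSet_lt measurable_const ((hF i).1.norm.const_mul K)
  have hb : ∀ i, BM fun w => ({w | A₁ < K * ‖F i w‖}).indicator (fun w => ‖F i w‖ ^ p) w :=
    fun i => ((hF i).norm.rpow (fun _ => norm_nonneg _) (by linarith)).indicator (hEi i)
  have ib : ∀ i, Integrable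
      (fun w => K ^ p * ({w | A₁ < K * ‖F i w‖}).indicator (fun w => ‖F i w‖ ^ p) w) μ :=
    fun i => ((hb i).const_mul (K ^ p)).integrable
  have iv : Integrable (fun w => A₂ ^ (p - 6) * K ^ 6 * ‖v w‖ ^ 6) μ :=
    ((hv.norm.pow 6).const_mul _).integrable
  have is := integrable_finsetSum s fun i _ => ib i
  have i6 : 0 ≤ fun w => ∑ i ∈ s, K ^ p * ({w | A₁ < K * ‖F i w‖}).indicator
      (fun w => ‖F i w‖ ^ p) w + A₂ ^ (p - 6) * K ^ 6 * ‖v w‖ ^ 6 := fun w =>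
    add_nonneg (Finset.sum_nonneg fun i _ => mul_nonneg (by positivity)
      (Set.indicator_nonneg (fun _ _ => by positivity) _)) (by positivity)
  calc _ ≤ ∫ w in {w | A₁ < ‖f w‖ ∧ ‖f w‖ ≤ A₂},
        (∑ i ∈ s, K ^ p * ({w | A₁ < K * ‖F i w‖}).indicator (fun w => ‖F i w‖ ^ p) w +
          A₂ ^ (p - 6) * K ^ 6 * ‖v w‖ ^ 6) ∂μ := by
        refine setIntegral_mono_on (hf.norm.rpow (fun _ => norm_nonneg _) (by linarith)).integrable
          (is.add iv).integrableOn hE fun w hw => ?_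
        obtain ⟨hw1, hw2⟩ := hw
        have hn : ∀ i ∈ s, 0 ≤ K ^ p * ({w | A₁ < K * ‖F i w‖}).indicator
            (fun w => ‖F i w‖ ^ p) w := fun i _ =>
          mul_nonneg (by positivity) (Set.indicator_nonneg (fun _ _ => by positivity) _)
        have hn' : 0 ≤ A₂ ^ (p - 6) * K ^ 6 * ‖v w‖ ^ 6 := by positivity
        rcases exists_norm_le_mul hK (hz w) with ⟨i, hi, hle⟩ | hle
        · have h1 := Finset.single_le_sum hn hi
          rw [Set.indicator_of_mem (show w ∈ {w | A₁ < K * ‖F i w‖} from hw1.trans_le hle)] at h1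
          have h2 : ‖f w‖ ^ p ≤ K ^ p * ‖F i w‖ ^ p := by
            rw [← Real.mul_rpow hK0.le (norm_nonneg _)]
            exact Real.rpow_le_rpow (norm_nonneg _) hle (by linarith)
          linarith
        · have h2 : ‖f w‖ ^ p = ‖f w‖ ^ (p - 6) * ‖f w‖ ^ 6 := by
            rw [← Real.rpow_natCast, ← Real.rpow_add_of_nonneg (norm_nonneg _) (by linarith)
              (by norm_num)]
            congr 1; push_cast; ring
          have h3 : ‖f w‖ ^ (p - 6) * ‖f w‖ ^ 6 ≤ A₂ ^ (p - 6) * (K * ‖v w‖) ^ 6 := by gcongr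
          rw [mul_pow] at h3
          have := Finset.sum_nonneg hn
          rw [h2]; linarith
    _ ≤ ∫ w, (∑ i ∈ s, K ^ p * ({w | A₁ < K * ‖F i w‖}).indicator (fun w => ‖F i w‖ ^ p) w +
          A₂ ^ (p - 6) * K ^ 6 * ‖v w‖ ^ 6) ∂μ :=
        setIntegral_le_integral (is.add iv) (Filter.Eventually.of_forall i6)
    _ = _ := by
        rw [integral_add is iv, integral_finsetSum _ fun i _ => ib i, integral_const_mul]
        congr 1
        refine Finset.sum_congr rfl fun i _ => ?_
        rw [integral_const_mul, integral_indicator (hEi i)]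

end

section

variable {Ω : Type*} [MeasurableSpace Ω] {T : Torus Ω}

namespace Shell

variable {M lam δ : ℝ} {g ψ : ℝ → ℝ} {S : Finset (ℤ × ℤ)}

lemma card_cap_le_of_subset {S S' : Finset (ℤ × ℤ)} (hS : S' ⊆ S) {l N : ℝ} (hN : 0 ≤ N)
    (hn : ∀ k ∈ S', ((S.filter fun k' => capIndex l k' = capIndex l k).card : ℝ) ≤ N) (j : ℤ) :
    ((S'.filter fun k => capIndex l k = j).card : ℝ) ≤ N := by
  rcases (S'.filter fun k => capIndex l k = j).eq_empty_or_nonempty with h | ⟨k, hk⟩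
  · simpa [h] using hN
  · rw [Finset.mem_filter] at hk
    refine le_trans ?_ (hn k hk.1)
    rw [hk.2]
    exact_mod_cast Finset.card_le_card (Finset.filter_subset_filter _ hS)

/-- The number of frequencies lying in caps with a prescribed number of frequencies. -/
lemma card_class_le (h : Shell M lam δ g ψ S) {S' : Finset (ℤ × ℤ)} (hS : S' ⊆ S) {ν N : ℝ}
    (hν : 4 * M ≤ ν) (hν' : 72 * M * (√(lam * δ) * δ) < ν) (hN : 0 ≤ N)
    (hn : ∀ k ∈ S', ((S.filter fun k' => capIndex √(lam * δ) k' = capIndex √(lam * δ) k).card : ℝ)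
      ≤ N)
    (hn' : ∀ k ∈ S', ν ≤
      ((S.filter fun k' => capIndex √(lam * δ) k' = capIndex √(lam * δ) k).card : ℝ)) :
    (S'.card : ℝ) ≤ 140 * M ^ 3 * (√(lam * δ) / ν) ^ 2 * N := by
  have h1 := h.card_rich_caps_le hν hν' (S'.image (capIndex √(lam * δ))) (by
    intro j hj
    obtain ⟨k, hk, rfl⟩ := Finset.mem_image.1 hj
    exact hn' k hk)
  rw [Finset.card_eq_sum_card_image (capIndex √(lam * δ)) S']
  push_cast
  calc _ ≤ ∑ j ∈ S'.image (capIndex √(lam * δ)), N :=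
        Finset.sum_le_sum fun j _ => card_cap_le_of_subset hS hN hn j
    _ = (S'.image (capIndex √(lam * δ))).card * N := by
        simp only [Finset.sum_const, nsmul_eq_mul]
    _ ≤ _ := by gcongr

/-- The large values of the part of an exponential sum that comes from caps with a prescribed
number of frequencies. -/
lemma setIntegral_class_le {x l u e ε p K C D N : ℝ} (hx : 0 ≤ x) {S' : Finset (ℤ × ℤ)}
    {a : ℤ × ℤ → ℂ} (ha : nsq S' a ≤ 1) (hp : 6 ≤ p) (hp' : p < 10) (hD : 0 < D) (hK : 0 < K)
    (hC : 0 < C) (hε : 0 ≤ ε) (heε : 16 * ε ≤ e * (10 - p))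
    (hcard : (S'.card : ℝ) ≤ D * Real.exp (l + u + 2 * (ε * x)))
    (h6 : ∫ w, ‖T.trig S' a w‖ ^ 6 ∂T.μ ≤ C * Real.exp (ε * x) * (N * Real.exp (l - u)) ^ 2) :
    ∫ w in {w | Real.exp (l / 2 + e * x) < K * ‖T.trig S' a w‖}, ‖T.trig S' a w‖ ^ p ∂T.μ ≤
      (K ^ 2 * D) ^ ((10 - p) / 2) * D ^ ((p - 6) / 2) * (C * N ^ 2) *
        Real.exp (l * (p / 2 - 1)) := by
  have hE : MeasurableSet {w | Real.exp (l / 2 + e * x) < K * ‖T.trig S' a w‖} :=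
    measurableSet_lt measurable_const ((BM.trig S' a).1.norm.const_mul K)
  rcases Set.eq_empty_or_nonempty {w | Real.exp (l / 2 + e * x) < K * ‖T.trig S' a w‖} with h | h
  · rw [h]; simp only [Measure.restrict_empty, integral_zero_measure]; positivity
  obtain ⟨w, hw⟩ := h
  have hw1 : Real.exp (l / 2 + e * x) < K * ‖T.trig S' a w‖ := hw
  have hw2 := norm_trig_le_sqrt (T := T) ha hcard w
  have hw3 : Real.exp (l + 2 * (e * x)) ≤ K ^ 2 * (D * Real.exp (l + u + 2 * (ε * x))) := by
    calc _ = Real.exp (l / 2 + e * x) ^ 2 := by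
          rw [← Real.exp_nat_mul]; congr 1; push_cast; ring
      _ ≤ (K * √(D * Real.exp (l + u + 2 * (ε * x)))) ^ 2 := by
          gcongr; exact hw1.le.trans (by gcongr)
      _ = _ := by rw [mul_pow, Real.sq_sqrt (by positivity)]
  have hw4 : Real.exp (-u) ≤ K ^ 2 * D * Real.exp (-(2 * (e * x) - 2 * (ε * x))) := by
    have : Real.exp (-u) = Real.exp (l + 2 * (e * x)) *
      Real.exp (-(l + u + 2 * (e * x))) := by rw [← Real.exp_add]; congr 1; ring
    rw [this]
    refine (mul_le_mul_of_nonneg_right hw3 (Real.exp_pos _).le).trans_eq ?_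
    have : Real.exp (-(2 * (e * x) - 2 * (ε * x))) = Real.exp (l + u + 2 * (ε * x)) *
      Real.exp (-(l + u + 2 * (e * x))) := by rw [← Real.exp_add]; congr 1; ring
    rw [this]; ring
  have hw5 : Real.exp (-(u * ((10 - p) / 2))) ≤ (K ^ 2 * D) ^ ((10 - p) / 2) *
      Real.exp (-((e * x - ε * x) * (10 - p))) := by
    have := Real.rpow_le_rpow (Real.exp_pos _).le hw4 (by linarith : 0 ≤ (10 - p) / 2)
    rw [Real.mul_rpow (by positivity) (Real.exp_pos _).le, exp_rpow, exp_rpow] at this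
    convert this using 3 <;> ring
  have hw6 : Real.exp (-((e * x - ε * x) * (10 - p)) + ε * x * (p - 6) + ε * x) ≤ 1 := by
    rw [Real.exp_le_one_iff]
    have h1 : 16 * ε * x ≤ e * (10 - p) * x := by gcongr
    have h2 : 0 ≤ ε * x := by positivity
    nlinarith
  have e6 : ∀ w, ‖T.trig S' a w‖ ^ (6 : ℝ) = ‖T.trig S' a w‖ ^ 6 := fun w => by
    rw [show (6 : ℝ) = ((6 : ℕ) : ℝ) by norm_num, Real.rpow_natCast]
  have h1 := setIntegral_rpow_le_mul (BM.trig (T := T) S' a) (μ := T.μ) hE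
    (by norm_num : (0 : ℝ) ≤ 6) hp (A := √(D * Real.exp (l + u + 2 * (ε * x))))
    fun w _ => norm_trig_le_sqrt ha hcard w
  simp only [e6] at h1
  have h2 : ∫ w in {w | Real.exp (l / 2 + e * x) < K * ‖T.trig S' a w‖}, ‖T.trig S' a w‖ ^ 6 ∂T.μ
      ≤ ∫ w, ‖T.trig S' a w‖ ^ 6 ∂T.μ :=
    setIntegral_le_integral ((BM.trig S' a).norm.pow 6).integrable
      (Filter.Eventually.of_forall fun w => by positivity)
  have h3 : √(D * Real.exp (l + u + 2 * (ε * x))) ^ (p - 6) =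
      D ^ ((p - 6) / 2) * Real.exp ((l + u + 2 * (ε * x)) * ((p - 6) / 2)) := by
    rw [Real.sqrt_eq_rpow, ← Real.rpow_mul (by positivity), Real.mul_rpow hD.le (Real.exp_pos _).le,
      exp_rpow]
    congr 2 <;> ring
  calc _ ≤ _ := h1
    _ ≤ √(D * Real.exp (l + u + 2 * (ε * x))) ^ (p - 6) *
        (C * Real.exp (ε * x) * (N * Real.exp (l - u)) ^ 2) := by
        gcongr; exact h2.trans h6
    _ = D ^ ((p - 6) / 2) * (C * N ^ 2) * Real.exp (l * (p / 2 - 1)) *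
        Real.exp (ε * x * (p - 6) + ε * x) * Real.exp (-(u * ((10 - p) / 2))) := by
        rw [h3, mul_pow, ← Real.exp_nat_mul]
        have : Real.exp (l * (p / 2 - 1)) *
            Real.exp (ε * x * (p - 6) + ε * x) * Real.exp (-(u * ((10 - p) / 2))) =
            Real.exp ((l + u + 2 * (ε * x)) * ((p - 6) / 2)) * Real.exp (ε * x) *
              Real.exp (((2 : ℕ) : ℝ) * (l - u)) := by
          simp only [← Real.exp_add]; congr 1; push_cast; ring
        linear_combination D ^ ((p - 6) / 2) * (C * N ^ 2) * (-this)
    _ ≤ D ^ ((p - 6) / 2) * (C * N ^ 2) * Real.exp (l * (p / 2 - 1)) *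
        Real.exp (ε * x * (p - 6) + ε * x) * ((K ^ 2 * D) ^ ((10 - p) / 2) *
      Real.exp (-((e * x - ε * x) * (10 - p)))) := by gcongr
    _ = (K ^ 2 * D) ^ ((10 - p) / 2) * D ^ ((p - 6) / 2) * (C * N ^ 2) *
        Real.exp (l * (p / 2 - 1)) *
        Real.exp (-((e * x - ε * x) * (10 - p)) + ε * x * (p - 6) + ε * x) := by
        have : Real.exp (-((e * x - ε * x) * (10 - p)) + ε * x * (p - 6) + ε * x) =
            Real.exp (ε * x * (p - 6) + ε * x) * Real.exp (-((e * x - ε * x) * (10 - p))) := by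
          rw [← Real.exp_add]; congr 1; ring
        rw [this]; ring
    _ ≤ _ := mul_le_of_le_one_right (by positivity) hw6

end Shell

end

section

variable {Ω : Type*} [MeasurableSpace Ω] {T : Torus Ω}

namespace Shell

set_option maxHeartbeats 1000000 in
/-- The contribution of the intermediate values. -/
lemma exists_setIntegral_mid_le (T : Torus Ω) {M : ℝ} (hM : 1 ≤ M) {p κ e B : ℝ} (hp : 6 < p)
    (hp' : p < 10) (hκ : 0 < κ) (he : 0 < e) (hB : 0 < B) : ∃ C : ℝ, 0 ≤ C ∧
    ∀ (x y : ℝ) (g ψ : ℝ → ℝ) (S : Finset (ℤ × ℤ)) (a : ℤ × ℤ → ℂ),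
      Shell M (Real.exp x) (Real.exp y) g ψ S → nsq S a ≤ 1 → (-(1 / 3) + κ) * x < y →
      ∫ w in {w | Real.exp ((x + y) / 2 / 2 + e * x) < ‖T.trig S a w‖ ∧
          ‖T.trig S a w‖ ≤ B * Real.exp ((x - y) / 4)}, ‖T.trig S a w‖ ^ p ∂T.μ ≤
        C * (Real.exp (x * (p / 2 - 2) + y * (p / 2)) +
          Real.exp ((x + y) / 2 * (p / 2 - 1))) := by
  obtain ⟨ε, hεd⟩ : ∃ ε, ε = min (e * (10 - p) / 16) (κ * (p - 6) / 4) := ⟨_, rfl⟩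
  have hε : 0 < ε := hεd ▸ lt_min (div_pos (mul_pos he (by linarith)) (by norm_num))
    (div_pos (mul_pos hκ (by linarith)) (by norm_num))
  have hε1 : 16 * ε ≤ e * (10 - p) := by
    have := hεd ▸ min_le_left (e * (10 - p) / 16) (κ * (p - 6) / 4); linarith
  have hε2 : 4 * ε ≤ κ * (p - 6) := by
    have := hεd ▸ min_le_right (e * (10 - p) / 16) (κ * (p - 6) / 4); linarith
  clear hεd
  obtain ⟨C, hC, H6⟩ := integral_pow_six_le_of_card_cap T hM hε
  have hM0 : 0 < M := by linarith
  obtain ⟨K, hK⟩ : ∃ K, K = 1 + 1 / (3 * ε) := ⟨_, rfl⟩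
  obtain ⟨N, hN⟩ : ∃ N, N = 144 * M ^ 2 := ⟨_, rfl⟩
  obtain ⟨D, hD⟩ : ∃ D, D = 140 * M ^ 3 / N := ⟨_, rfl⟩
  have hK0 : 0 < K := by rw [hK]; positivity
  have hN0 : 0 < N := by rw [hN]; positivity
  have hD0 : 0 < D := by rw [hD]; positivity
  obtain ⟨X, hX⟩ : ∃ X, X = (K ^ 2 * D) ^ ((10 - p) / 2) * D ^ ((p - 6) / 2) * (C * N ^ 2) :=
    ⟨_, rfl⟩
  have hX0 : 0 ≤ X := by rw [hX]; positivity
  have hY0 : 0 ≤ B ^ (p - 6) * K ^ 6 * (C * N ^ 2) := by positivity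
  refine ⟨K * (K ^ p * X) + B ^ (p - 6) * K ^ 6 * (C * N ^ 2), by positivity, ?_⟩
  intro x y g ψ S a hs ha hxy
  have hx0 : 0 ≤ x := by simpa using hs.one_le_lam
  have hy : y ≤ 0 := by simpa using hs.le_one
  have hx : 0 < x := by
    rcases hx0.lt_or_eq with h | h
    · exact h
    · rw [← h] at hxy; simp at hxy; linarith
  have hx3 : 0 ≤ x + 3 * y := by nlinarith [mul_pos hκ hx]
  obtain ⟨l, hl⟩ : ∃ l, l = (x + y) / 2 := ⟨_, rfl⟩
  have hL : √(Real.exp x * Real.exp y) = Real.exp l := by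
    rw [← Real.exp_add, sqrt_exp, hl]
  rw [← hl]
  obtain ⟨m, hm1, hm2⟩ := exists_nat_pow_near (x := Real.exp (-y)) (y := Real.exp (ε * x))
    (by simpa using hy) (by simpa using mul_pos hε hx)
  rw [← Real.exp_nat_mul, Real.exp_le_exp] at hm1
  rw [← Real.exp_nat_mul, Real.exp_lt_exp] at hm2
  push_cast at hm2
  have hmK : (m : ℝ) + 1 ≤ K := by
    rw [hK, add_comm]
    gcongr
    rw [le_div_iff₀ (by positivity)]
    have : (m : ℝ) * (3 * ε) * x ≤ 1 * x := by nlinarith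
    exact le_of_mul_le_mul_right this hx
  obtain ⟨n, hn⟩ : ∃ n : ℤ × ℤ → ℝ, n = fun k => ((S.filter fun k' =>
    capIndex (Real.exp l) k' = capIndex (Real.exp l) k).card : ℝ) := ⟨_, rfl⟩
  obtain ⟨θ, hθ⟩ : ∃ θ : ℕ → ℝ, θ = fun i : ℕ => N * Real.exp (l - i * (ε * x)) := ⟨_, rfl⟩
  have hθ0 : ∀ i, 0 < θ i := fun i => by rw [hθ]; positivity
  have hθa : Antitone θ := by
    intro i j hij
    rw [hθ]
    have : (i : ℝ) ≤ j := by exact_mod_cast hij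
    dsimp only
    gcongr
  have hS0 : (S.filter fun k => n k ≤ θ 0) = S := by
    refine Finset.filter_true_of_mem fun k _ => ?_
    have := hs.card_cap_le (capIndex (Real.exp l) k)
    rw [hL] at this
    rw [hn, hθ]
    refine this.trans ?_
    rw [hN]
    simp only [Nat.cast_zero, zero_mul, sub_zero]
    gcongr
    norm_num
  have hsplit : ∀ w, T.trig S a w =
      ∑ i ∈ Finset.range m, T.trig (S.filter fun k => θ (i + 1) < n k ∧ n k ≤ θ i) a w +
        T.trig (S.filter fun k => n k ≤ θ m) a w := fun w => by
    rw [← trig_filter_eq_sum_add S a n hθa m w, hS0]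
  have hsum := setIntegral_rpow_le_sum (μ := T.μ) (s := Finset.range m)
    (F := fun i w => T.trig (S.filter fun k => θ (i + 1) < n k ∧ n k ≤ θ i) a w)
    (v := fun w => T.trig (S.filter fun k => n k ≤ θ m) a w)
    (f := fun w => T.trig S a w) (p := p) (K := K) (A₁ := Real.exp (l / 2 + e * x))
    (A₂ := B * Real.exp ((x - y) / 4)) (fun i => BM.trig _ a) (BM.trig _ a) (BM.trig _ a)
    hsplit hp.le (by positivity) (by simpa using hmK)
  refine hsum.trans ?_
  have hsix : ∀ (S' : Finset (ℤ × ℤ)) (i : ℕ), S' ⊆ S → (∀ k ∈ S', n k ≤ θ i) →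
      ∫ w, ‖T.trig S' a w‖ ^ 6 ∂T.μ ≤ C * Real.exp x ^ ε * (θ i) ^ 2 := by
    intro S' i hS' hk
    refine H6 _ _ g ψ S' a (θ i) (hs.mono hS') ((nsq_mono hS' a).trans ha) ?_
    rw [hL]
    refine card_cap_le_of_subset hS' (hθ0 i).le ?_
    rw [hn] at hk
    exact hk
  have hcls : ∀ i ∈ Finset.range m, K ^ p * ∫ w in {w | Real.exp (l / 2 + e * x) < K *
      ‖T.trig (S.filter fun k => θ (i + 1) < n k ∧ n k ≤ θ i) a w‖},
      ‖T.trig (S.filter fun k => θ (i + 1) < n k ∧ n k ≤ θ i) a w‖ ^ p ∂T.μ ≤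
      K ^ p * (X * Real.exp (l * (p / 2 - 1))) := by
    intro i hi
    have him : (i : ℝ) + 1 ≤ m := by exact_mod_cast Finset.mem_range.1 hi
    have hsub : (S.filter fun k => θ (i + 1) < n k ∧ n k ≤ θ i) ⊆ S := Finset.filter_subset _ _
    gcongr
    rw [hX]
    refine setIntegral_class_le (u := i * (ε * x)) hx.le ((nsq_mono hsub a).trans ha) hp.le hp'
      hD0 hK0 hC hε.le hε1 ?_ ?_
    · have hν : N * Real.exp (l + y) ≤ θ (i + 1) := by
        rw [hθ]
        dsimp only
        push_cast
        gcongr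
        have : ((i : ℝ) + 1) * (ε * x) ≤ m * (ε * x) := by gcongr
        linarith
      have h1 : 1 ≤ Real.exp (l + y) := by rw [Real.one_le_exp_iff]; linarith
      have hMM : M ≤ M ^ 2 := by nlinarith
      have := hs.card_class_le hsub (ν := θ (i + 1)) (N := θ i)
        (by
          refine le_trans ?_ hν
          rw [hN]
          nlinarith)
        (by
          refine lt_of_lt_of_le ?_ hν
          rw [hL, ← Real.exp_add, hN]
          have : 0 < M ^ 2 * Real.exp (l + y) := by positivity
          nlinarith)
        (hθ0 i).le
        (by
          intro k hk
          rw [Finset.mem_filter] at hk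
          have := hk.2.2
          rw [hn] at this
          rw [hL]
          exact this)
        (by
          intro k hk
          rw [Finset.mem_filter] at hk
          have := hk.2.1.le
          rw [hn] at this
          rw [hL]
          exact this)
      refine this.trans_eq ?_
      rw [hL, hθ, hD]
      dsimp only
      push_cast
      have e1 : Real.exp (l + i * (ε * x) + 2 * (ε * x)) =
        (Real.exp l / Real.exp (l - (i + 1) * (ε * x))) ^ 2 * Real.exp (l - i * (ε * x)) := by
        rw [← Real.exp_sub, ← Real.exp_nat_mul, ← Real.exp_add]; congr 1; push_cast; ring
      rw [e1]
      field_simp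
    · have := hsix _ i hsub (fun k hk => (Finset.mem_filter.1 hk).2.2)
      rw [exp_rpow, mul_comm x ε] at this
      have e2 : θ i = N * Real.exp (l - i * (ε * x)) := by rw [hθ]
      rw [← e2]
      exact this
  have hlast : (B * Real.exp ((x - y) / 4)) ^ (p - 6) * K ^ 6 *
      ∫ w, ‖T.trig (S.filter fun k => n k ≤ θ m) a w‖ ^ 6 ∂T.μ ≤
      B ^ (p - 6) * K ^ 6 * (C * N ^ 2) * Real.exp (x * (p / 2 - 2) + y * (p / 2)) := by
    have h1 := hsix _ m (Finset.filter_subset _ _) (fun k hk => (Finset.mem_filter.1 hk).2)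
    have h2 : θ m ≤ N * Real.exp (l + y + ε * x) := by
      rw [hθ]
      dsimp only
      gcongr
      linarith
    calc _ ≤ (B * Real.exp ((x - y) / 4)) ^ (p - 6) * K ^ 6 *
          (C * Real.exp x ^ ε * (N * Real.exp (l + y + ε * x)) ^ 2) := by
          refine mul_le_mul_of_nonneg_left (h1.trans ?_) (by positivity)
          have := (hθ0 m).le
          gcongr
      _ = B ^ (p - 6) * K ^ 6 * (C * N ^ 2) *
          Real.exp ((x - y) / 4 * (p - 6) + x * ε + 2 * (l + y + ε * x)) := by
          rw [Real.mul_rpow hB.le (Real.exp_pos _).le, exp_rpow, exp_rpow, mul_pow,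
            ← Real.exp_nat_mul, Real.exp_add, Real.exp_add]
          push_cast
          ring
      _ ≤ _ := by
          refine mul_le_mul_of_nonneg_left (Real.exp_le_exp.2 ?_) hY0
          have h3 : 4 * ε * x ≤ κ * (p - 6) * x := by gcongr
          have h4 : 3 * (κ * x) * (p - 6) ≤ (x + 3 * y) * (p - 6) := by
            apply mul_le_mul_of_nonneg_right _ (by linarith)
            linarith
          rw [hl]
          linarith
  have h5 := Finset.sum_le_sum hcls
  simp only [Finset.sum_const, nsmul_eq_mul, Finset.card_range] at h5
  have h6 : (m : ℝ) * (K ^ p * (X * Real.exp (l * (p / 2 - 1)))) ≤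
      K * (K ^ p * (X * Real.exp (l * (p / 2 - 1)))) := by
    gcongr; linarith
  have h7 : 0 ≤ K * (K ^ p * X) * Real.exp (x * (p / 2 - 2) + y * (p / 2)) := by positivity
  have h8 : 0 ≤ B ^ (p - 6) * K ^ 6 * (C * N ^ 2) * Real.exp (l * (p / 2 - 1)) := by positivity
  calc _ ≤ K * (K ^ p * (X * Real.exp (l * (p / 2 - 1)))) +
      B ^ (p - 6) * K ^ 6 * (C * N ^ 2) * Real.exp (x * (p / 2 - 2) + y * (p / 2)) :=
        add_le_add (h5.trans h6) hlast
    _ ≤ _ := by linarith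

end Shell

end

section

variable {Ω : Type*} [MeasurableSpace Ω] {T : Torus Ω}

namespace Shell

lemma one_le_mul_exp_pow_three {x y κ : ℝ} (hx : 0 ≤ x) (hκ : 0 < κ)
    (hxy : (-(1 / 3) + κ) * x < y) : 1 ≤ Real.exp x * Real.exp y ^ 3 := by
  rw [← Real.exp_nat_mul, ← Real.exp_add, Real.one_le_exp_iff]
  push_cast
  nlinarith [mul_nonneg hκ.le hx]

/-- The contribution of the large values. -/
lemma exists_setIntegral_large_le (T : Torus Ω) {M : ℝ} (hM : 1 ≤ M) {p : ℝ} (hp : 6 ≤ p) :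
    ∃ B C : ℝ, 0 < B ∧ 0 ≤ C ∧
    ∀ (x y : ℝ) (g ψ : ℝ → ℝ) (S : Finset (ℤ × ℤ)) (a : ℤ × ℤ → ℂ),
      Shell M (Real.exp x) (Real.exp y) g ψ S → nsq S a ≤ 1 →
      1 ≤ Real.exp x * Real.exp y ^ 3 →
      ∫ w in {w | B * Real.exp ((x - y) / 4) < ‖T.trig S a w‖}, ‖T.trig S a w‖ ^ p ∂T.μ ≤
        C * Real.exp (x * (p / 2 - 2) + y * (p / 2)) := by
  obtain ⟨C, hC, HC⟩ := exists_card_le hM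
  have hM0 : 0 < M := by linarith
  have hg := gauss_pos M
  have hG := one_le_gaussConst
  obtain ⟨B, hB⟩ : ∃ B, B = 4 * (1200 * gaussConst * M ^ 3 + 1) / gauss M := ⟨_, rfl⟩
  obtain ⟨R, hR⟩ : ∃ R, R = (4 * Real.exp Real.pi * gaussConst) ^ 3 * (8 * 10 ^ 7 * M ^ 7) :=
    ⟨_, rfl⟩
  have hB0 : 0 < B := by rw [hB]; positivity
  have hR0 : 0 < R := by rw [hR]; positivity
  refine ⟨√B, C ^ ((p - 6) / 2) * (R / gauss M ^ 3), by positivity, by positivity, ?_⟩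
  intro x y g ψ S a hs ha h3
  have hx : 0 ≤ x := by simpa using hs.one_le_lam
  have hy : y ≤ 0 := by simpa using hs.le_one
  have hA0 : 0 < √B * Real.exp ((x - y) / 4) := by positivity
  have h1 := hs.setIntegral_pow_six_le_of_lt (T := T) a ha hA0 (by
    rw [mul_pow, Real.sq_sqrt hB0.le, sqrt_exp, sqrt_exp, ← Real.exp_sub, ← Real.exp_nat_mul, hB]
    have e1 : ((2 : ℕ) : ℝ) * ((x - y) / 4) = (x - y) / 2 := by push_cast; ring
    have e2 : 1 ≤ Real.exp ((x - y) / 2) := by rw [Real.one_le_exp_iff]; linarith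
    rw [e1, ← sub_div]
    field_simp
    linarith)
  rw [← hR] at h1
  have hE : MeasurableSet {w | √B * Real.exp ((x - y) / 4) < ‖T.trig S a w‖} :=
    measurableSet_lt measurable_const (BM.trig S a).1.norm
  have h2 := setIntegral_rpow_le_mul (BM.trig (T := T) S a) (μ := T.μ) hE
    (by norm_num : (0 : ℝ) ≤ 6) hp
    fun w _ => norm_trig_le_sqrt ha (HC _ _ g ψ S hs h3) w
  have e6 : ∀ w, ‖T.trig S a w‖ ^ (6 : ℝ) = ‖T.trig S a w‖ ^ 6 := fun w => by
    rw [show (6 : ℝ) = ((6 : ℕ) : ℝ) by norm_num, Real.rpow_natCast]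
  simp only [e6] at h2
  have h4 : √(C * (Real.exp x * Real.exp y)) ^ (p - 6) =
      C ^ ((p - 6) / 2) * Real.exp ((x + y) * ((p - 6) / 2)) := by
    rw [Real.sqrt_eq_rpow, ← Real.rpow_mul (by positivity), ← Real.exp_add,
      Real.mul_rpow (by positivity) (Real.exp_pos _).le, exp_rpow]
    congr 2 <;> ring
  rw [← le_div_iff₀' (by positivity)] at h1
  calc _ ≤ _ := h2
    _ ≤ √(C * (Real.exp x * Real.exp y)) ^ (p - 6) *
        (R * (Real.exp y ^ 3 * Real.exp x) / gauss M ^ 3) := by gcongr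
    _ = _ := by
      have e1 : Real.exp (x * (p / 2 - 2) + y * (p / 2)) = Real.exp ((x + y) * ((p - 6) / 2)) *
          (Real.exp y ^ 3 * Real.exp x) := by
        rw [← Real.exp_nat_mul, ← Real.exp_add, ← Real.exp_add]; congr 1; push_cast; ring
      rw [h4, e1]; ring

lemma setIntegral_le_add_of_le {f : Ω → ℂ} (hf : BM f) {μ : Measure Ω} [IsFiniteMeasure μ]
    {p : ℝ} (hp : 0 ≤ p) (A₁ A₂ : ℝ) :
    ∫ w in {w | ‖f w‖ ≤ A₂}, ‖f w‖ ^ p ∂μ ≤ ∫ w in {w | ‖f w‖ ≤ A₁}, ‖f w‖ ^ p ∂μ +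
      ∫ w in {w | A₁ < ‖f w‖ ∧ ‖f w‖ ≤ A₂}, ‖f w‖ ^ p ∂μ := by
  have i1 := (hf.norm.rpow (fun _ => norm_nonneg _) hp).integrable (μ := μ)
  have hE : MeasurableSet {w | ‖f w‖ ≤ A₁} := measurableSet_le hf.1.norm measurable_const
  rw [← integral_inter_add_sdiff (s := {w | ‖f w‖ ≤ A₂}) hE i1.integrableOn]
  gcongr ?_ + ?_
  · exact setIntegral_mono_set i1.integrableOn
      (Filter.Eventually.of_forall fun w => by positivity) (Set.inter_subset_right.eventuallyLE)
  · refine le_of_eq ?_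
    congr 2
    ext w
    simp [and_comm]

lemma exists_setIntegral_small_le (T : Torus Ω) {M : ℝ} (hM : 1 ≤ M) {p κ B : ℝ} (hp : 6 < p)
    (hp' : p < 10) (hκ : 0 < κ) (hB : 0 < B) : ∃ C : ℝ, 0 ≤ C ∧
    ∀ (x y : ℝ) (g ψ : ℝ → ℝ) (S : Finset (ℤ × ℤ)) (a : ℤ × ℤ → ℂ),
      Shell M (Real.exp x) (Real.exp y) g ψ S → nsq S a ≤ 1 → (-(1 / 3) + κ) * x < y →
      ∫ w in {w | ‖T.trig S a w‖ ≤ B * Real.exp ((x - y) / 4)}, ‖T.trig S a w‖ ^ p ∂T.μ ≤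
        C * (Real.exp (x * (p / 2 - 2) + y * (p / 2)) +
          Real.exp ((x + y) / 2 * (p / 2 - 1))) := by
  have hM0 : 0 < M := by linarith
  obtain ⟨h, hh⟩ : ∃ h, h = (p - 6) / 60 := ⟨_, rfl⟩
  have h0 : 0 < h := by rw [hh]; apply div_pos <;> linarith
  have h1 : h < 1 / 15 := by rw [hh]; linarith
  obtain ⟨C₆, hC₆, H₆⟩ := exists_integral_rpow_six_le T hM
  obtain ⟨C₂, hC₂, H₂⟩ := exists_setIntegral_mid_le T hM (e := h / 6) hp hp' hκ (by positivity) hB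
  obtain ⟨C₁, hC₁⟩ : ∃ C₁, C₁ = 864 * M ^ 3 + 6 ^ (p / 2) * (72 * M ^ 2) ^ (p / 2 - 1) := ⟨_, rfl⟩
  have hC₁0 : 0 < C₁ := by rw [hC₁]; positivity
  refine ⟨B ^ (p - 6) * C₆ + (C₁ + C₂), by positivity, ?_⟩
  intro x y g ψ S a hs ha hxy
  have hx : 0 ≤ x := by simpa using hs.one_le_lam
  have hy : y ≤ 0 := by simpa using hs.le_one
  have h3 := one_le_mul_exp_pow_three hx hκ hxy
  have hκx := mul_nonneg hκ.le hx
  have hw1 := (Real.exp_pos (x * (p / 2 - 2) + y * (p / 2))).le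
  have hw2 := (Real.exp_pos ((x + y) / 2 * (p / 2 - 1))).le
  rcases le_total (-(3 * h * x)) y with hc | hc
  · have hE : MeasurableSet {w | ‖T.trig S a w‖ ≤ B * Real.exp ((x - y) / 4)} :=
      measurableSet_le (BM.trig S a).1.norm measurable_const
    have e1 := setIntegral_rpow_le_mul (BM.trig (T := T) S a) (μ := T.μ) hE
      (by norm_num : (0 : ℝ) ≤ 6) hp.le fun w hw => hw
    have e2 : ∫ w in {w | ‖T.trig S a w‖ ≤ B * Real.exp ((x - y) / 4)},
        ‖T.trig S a w‖ ^ (6 : ℝ) ∂T.μ ≤ ∫ w, ‖T.trig S a w‖ ^ (6 : ℝ) ∂T.μ :=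
      setIntegral_le_integral
        ((BM.trig S a).norm.rpow (fun _ => norm_nonneg _) (by norm_num)).integrable
        (Filter.Eventually.of_forall fun w => by positivity)
    have e3 := H₆ _ _ g ψ S a hs ha h3
    calc _ ≤ _ := e1
      _ ≤ (B * Real.exp ((x - y) / 4)) ^ (p - 6) * (C₆ * (Real.exp x * Real.exp y)) := by
          refine mul_le_mul_of_nonneg_left (e2.trans e3) (by positivity)
      _ = B ^ (p - 6) * C₆ * Real.exp ((x - y) / 4 * (p - 6) + (x + y)) := by
          rw [Real.mul_rpow hB.le (Real.exp_pos _).le, exp_rpow, Real.exp_add, Real.exp_add]; ring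
      _ ≤ B ^ (p - 6) * C₆ * Real.exp (x * (p / 2 - 2) + y * (p / 2)) := by
          refine mul_le_mul_of_nonneg_left (Real.exp_le_exp.2 ?_) (by positivity)
          rw [hh] at hc
          nlinarith [mul_nonneg hx (by linarith : 0 ≤ p - 6),
            mul_le_mul_of_nonneg_right hc (by linarith : 0 ≤ (3 * p - 10) / 4),
            mul_nonneg (mul_nonneg hx (by linarith : 0 ≤ p - 6)) (by linarith : 0 ≤ 10 - p)]
      _ ≤ _ := by
          have : 0 ≤ B ^ (p - 6) * C₆ := by positivity
          nlinarith [mul_nonneg this hw2, mul_nonneg (add_nonneg hC₁0.le hC₂) (add_nonneg hw1 hw2)]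
  · obtain ⟨l, hl⟩ : ∃ l, l = (x + y) / 2 := ⟨_, rfl⟩
    have hL : √(Real.exp x * Real.exp y) = Real.exp l := by
      rw [← Real.exp_add, sqrt_exp, hl]
    have hlx : x / 3 ≤ l := by rw [hl]; linarith
    have e0 := setIntegral_le_add_of_le (BM.trig (T := T) S a) (μ := T.μ) (p := p) (by linarith)
      (Real.exp (l / 2 + h / 6 * x)) (B * Real.exp ((x - y) / 4))
    have e2 := H₂ x y g ψ S a hs ha hxy
    have e1 := hs.setIntegral_rpow_le_of_le (T := T) a ha (p := p) (H := Real.exp (h * x))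
      (A := Real.exp (l / 2 + h / 6 * x))
      (by linarith) (Real.exp_pos _).le (by rw [Real.one_le_exp_iff]; positivity) (by
        rw [← Real.exp_nat_mul, ← Real.exp_add, Real.exp_le_one_iff]; push_cast; linarith)
    rw [hL] at e1
    rw [← hl] at e2 ⊢
    have hhx : 0 ≤ h * x := by positivity
    have f1 : Real.exp (l / 2 + h / 6 * x) ^ (p - 4) * (1 + Real.exp l / Real.exp (h * x)) ≤
        2 * Real.exp (l * (p / 2 - 1)) := by
      have g1 : h / 6 * x * (p - 4) ≤ h * x := by nlinarith
      rw [exp_rpow, ← Real.exp_sub, mul_add, ← Real.exp_add, two_mul]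
      refine add_le_add ?_ ?_
      · rw [mul_one, Real.exp_le_exp]; nlinarith
      · rw [Real.exp_le_exp]; nlinarith
    have f2 : (72 * M ^ 2 * Real.exp l) ^ (p / 2 - 1) =
        (72 * M ^ 2) ^ (p / 2 - 1) * Real.exp (l * (p / 2 - 1)) := by
      rw [Real.mul_rpow (by positivity) (Real.exp_pos _).le, exp_rpow]
    rw [f2] at e1
    rw [← hl] at hw2
    have e3 := mul_le_mul_of_nonneg_left f1 (by positivity : 0 ≤ 432 * M ^ 3)
    have e4 : ∫ w in {w | ‖T.trig S a w‖ ≤ Real.exp (l / 2 + h / 6 * x)},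
        ‖T.trig S a w‖ ^ p ∂T.μ ≤ C₁ * Real.exp (l * (p / 2 - 1)) := by
      rw [hC₁]; linarith
    have g1 : 0 ≤ B ^ (p - 6) * C₆ := by positivity
    have := mul_nonneg g1 (add_nonneg hw1 hw2)
    have := mul_nonneg hC₁0.le hw1
    linarith

lemma exists_integral_rpow_le_of_lt_ten (T : Torus Ω) {M : ℝ} (hM : 1 ≤ M) {p κ : ℝ} (hp : 6 < p)
    (hp' : p < 10) (hκ : 0 < κ) : ∃ C : ℝ, 0 ≤ C ∧
    ∀ (x y : ℝ) (g ψ : ℝ → ℝ) (S : Finset (ℤ × ℤ)) (a : ℤ × ℤ → ℂ),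
      Shell M (Real.exp x) (Real.exp y) g ψ S → nsq S a ≤ 1 → (-(1 / 3) + κ) * x < y →
      ∫ w, ‖T.trig S a w‖ ^ p ∂T.μ ≤ C * (Real.exp (x * (p / 2 - 2) + y * (p / 2)) +
          Real.exp ((x + y) / 2 * (p / 2 - 1))) := by
  obtain ⟨B, C₁, hB, hC₁, H₁⟩ := exists_setIntegral_large_le T hM hp.le
  obtain ⟨C₂, hC₂, H₂⟩ := exists_setIntegral_small_le T hM hp hp' hκ hB
  refine ⟨C₁ + C₂, by positivity, ?_⟩
  intro x y g ψ S a hs ha hxy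
  have hx : 0 ≤ x := by simpa using hs.one_le_lam
  rw [integral_eq_setIntegral_add (BM.trig S a) (by linarith) (B * Real.exp ((x - y) / 4))]
  have h1 := H₁ x y g ψ S a hs ha (one_le_mul_exp_pow_three hx hκ hxy)
  have h2 := H₂ x y g ψ S a hs ha hxy
  have := mul_nonneg hC₁ (Real.exp_pos ((x + y) / 2 * (p / 2 - 1))).le
  linarith

lemma exists_integral_rpow_le_of_ten_le (T : Torus Ω) {M : ℝ} (hM : 1 ≤ M) {p κ : ℝ}
    (hp : 10 ≤ p) (hκ : 0 < κ) : ∃ C : ℝ, 0 ≤ C ∧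
    ∀ (x y : ℝ) (g ψ : ℝ → ℝ) (S : Finset (ℤ × ℤ)) (a : ℤ × ℤ → ℂ),
      Shell M (Real.exp x) (Real.exp y) g ψ S → nsq S a ≤ 1 → (-(1 / 3) + κ) * x < y →
      ∫ w, ‖T.trig S a w‖ ^ p ∂T.μ ≤ C * Real.exp (x * (p / 2 - 2) + y * (p / 2)) := by
  obtain ⟨t, ht⟩ : ∃ t, t = min κ 1 := ⟨_, rfl⟩
  have ht0 : 0 < t := ht ▸ lt_min hκ one_pos
  have ht1 : t ≤ 1 := ht ▸ min_le_right _ _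
  have htκ : t ≤ κ := ht ▸ min_le_left _ _
  obtain ⟨C₁, hC₁, H₁⟩ := exists_card_le hM
  obtain ⟨C₂, hC₂, H₂⟩ := exists_integral_rpow_le_of_lt_ten T hM (p := 10 - t) (by linarith)
    (by linarith) hκ
  refine ⟨2 * (C₁ ^ ((p - (10 - t)) / 2) * C₂), by positivity, ?_⟩
  intro x y g ψ S a hs ha hxy
  have hx : 0 ≤ x := by simpa using hs.one_le_lam
  have h3 := one_le_mul_exp_pow_three hx hκ hxy
  have h1 := integral_rpow_le_mul (BM.trig (T := T) S a) (μ := T.μ) (p := p) (q := 10 - t)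
    (by linarith) (by linarith) fun w => norm_trig_le_sqrt ha (H₁ _ _ g ψ S hs h3) w
  have h2 := H₂ x y g ψ S a hs ha hxy
  have h4 : √(C₁ * (Real.exp x * Real.exp y)) ^ (p - (10 - t)) =
      C₁ ^ ((p - (10 - t)) / 2) * Real.exp ((x + y) * ((p - (10 - t)) / 2)) := by
    rw [Real.sqrt_eq_rpow, ← Real.rpow_mul (by positivity), ← Real.exp_add,
      Real.mul_rpow (by positivity) (Real.exp_pos _).le, exp_rpow]
    congr 2 <;> ring
  calc _ ≤ _ := h1
    _ ≤ C₁ ^ ((p - (10 - t)) / 2) * Real.exp ((x + y) * ((p - (10 - t)) / 2)) *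
        (C₂ * (Real.exp (x * ((10 - t) / 2 - 2) + y * ((10 - t) / 2)) +
          Real.exp ((x + y) / 2 * ((10 - t) / 2 - 1)))) := by
        rw [h4]; gcongr
    _ = C₁ ^ ((p - (10 - t)) / 2) * C₂ * (Real.exp ((x + y) * ((p - (10 - t)) / 2) +
        (x * ((10 - t) / 2 - 2) + y * ((10 - t) / 2))) +
        Real.exp ((x + y) * ((p - (10 - t)) / 2) + (x + y) / 2 * ((10 - t) / 2 - 1))) := by
        rw [Real.exp_add ((x + y) * ((p - (10 - t)) / 2)),
          Real.exp_add ((x + y) * ((p - (10 - t)) / 2))]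
        ring
    _ ≤ C₁ ^ ((p - (10 - t)) / 2) * C₂ * (Real.exp (x * (p / 2 - 2) + y * (p / 2)) +
        Real.exp (x * (p / 2 - 2) + y * (p / 2))) := by
        refine mul_le_mul_of_nonneg_left (add_le_add (Real.exp_le_exp.2 ?_)
          (Real.exp_le_exp.2 ?_)) (by positivity)
        · linarith
        · have h5 : (12 - t) / 4 * ((2 / 3 + κ) * x) ≤ (12 - t) / 4 * (x + y) :=
            mul_le_mul_of_nonneg_left (by linarith) (by linarith)
          have h6 : 2 * x ≤ (12 - t) / 4 * ((2 / 3 + κ) * x) := by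
            rw [← mul_assoc]
            refine mul_le_mul_of_nonneg_right ?_ hx
            nlinarith
          linarith
    _ = _ := by ring

end Shell

end

section

variable {Ω : Type*} [MeasurableSpace Ω] {T : Torus Ω}

/-- The moment estimate for exponential sums with frequencies in a shell over a convex graph. -/
theorem Shell.exists_integral_rpow_le (T : Torus Ω) {M : ℝ} (hM : 1 ≤ M) {p κ κ' : ℝ} (hp : 2 ≤ p)
    (hκ : 0 < κ) (hκ' : 0 < κ') : ∃ C : ℝ, 1 ≤ C ∧
    ∀ (lam δ : ℝ) (g ψ : ℝ → ℝ) (S : Finset (ℤ × ℤ)) (a : ℤ × ℤ → ℂ), Shell M lam δ g ψ S →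
      nsq S a ≤ 1 →
      (lam ^ (-(1 / 3 : ℝ) + κ) < δ ∨ (p < 5 - κ ∧ lam ^ (-1 + κ') < δ)) →
      ∫ w, ‖T.trig S a w‖ ^ p ∂T.μ ≤
        C * (lam ^ (p / 2 - 2) * δ ^ (p / 2) + (lam * δ) ^ ((p - 2) / 4)) := by
  have key : ∀ C : ℝ, 0 ≤ C → (∀ (x y : ℝ) (g ψ : ℝ → ℝ) (S : Finset (ℤ × ℤ)) (a : ℤ × ℤ → ℂ),
      Shell M (Real.exp x) (Real.exp y) g ψ S → nsq S a ≤ 1 → (-(1 / 3) + κ) * x < y →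
      ∫ w, ‖T.trig S a w‖ ^ p ∂T.μ ≤ C * (Real.exp (x * (p / 2 - 2) + y * (p / 2)) +
          Real.exp ((x + y) / 2 * (p / 2 - 1)))) →
      ∀ (lam δ : ℝ) (g ψ : ℝ → ℝ) (S : Finset (ℤ × ℤ)) (a : ℤ × ℤ → ℂ), Shell M lam δ g ψ S →
      nsq S a ≤ 1 → lam ^ (-(1 / 3 : ℝ) + κ) < δ →
      ∫ w, ‖T.trig S a w‖ ^ p ∂T.μ ≤
        C * (lam ^ (p / 2 - 2) * δ ^ (p / 2) + (lam * δ) ^ ((p - 2) / 4)) := by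
    intro C _ H lam δ g ψ S a hs ha hδ
    obtain ⟨x, rfl⟩ := exists_exp_eq hs.lam_pos
    obtain ⟨y, rfl⟩ := exists_exp_eq hs.pos
    rw [exp_rpow, Real.exp_lt_exp] at hδ
    have := H x y g ψ S a hs ha (by linarith)
    rw [exp_rpow, exp_rpow, ← Real.exp_add, ← Real.exp_add, exp_rpow]
    convert this using 4
    ring
  have hfirst : ∃ C : ℝ, 0 ≤ C ∧ ∀ (x y : ℝ) (g ψ : ℝ → ℝ) (S : Finset (ℤ × ℤ)) (a : ℤ × ℤ → ℂ),
      Shell M (Real.exp x) (Real.exp y) g ψ S → nsq S a ≤ 1 → (-(1 / 3) + κ) * x < y →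
      ∫ w, ‖T.trig S a w‖ ^ p ∂T.μ ≤ C * (Real.exp (x * (p / 2 - 2) + y * (p / 2)) +
          Real.exp ((x + y) / 2 * (p / 2 - 1))) := by
    rcases le_or_gt p 6 with h6 | h6
    · obtain ⟨C, hC, H⟩ := exists_integral_rpow_le_of_le_six T hM hp h6
      refine ⟨C, by linarith, fun x y g ψ S a hs ha hxy => ?_⟩
      have hx : 0 ≤ x := by simpa using hs.one_le_lam
      have h1 := H _ _ g ψ S a hs ha (one_le_mul_exp_pow_three hx hκ hxy)
      rw [← Real.exp_add, exp_rpow, show (x + y) * ((p - 2) / 4) = (x + y) / 2 * (p / 2 - 1) by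
        ring] at h1
      refine h1.trans (mul_le_mul_of_nonneg_left ?_ (by linarith))
      exact le_add_of_nonneg_left (Real.exp_pos _).le
    rcases lt_or_ge p 10 with h10 | h10
    · exact exists_integral_rpow_le_of_lt_ten T hM h6 h10 hκ
    · obtain ⟨C, hC, H⟩ := exists_integral_rpow_le_of_ten_le T hM h10 hκ
      refine ⟨C, hC, fun x y g ψ S a hs ha hxy => ?_⟩
      refine (H x y g ψ S a hs ha hxy).trans (mul_le_mul_of_nonneg_left ?_ hC)
      exact le_add_of_nonneg_right (Real.exp_pos _).le
  obtain ⟨C₁, hC₁, H₁⟩ := hfirst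
  obtain ⟨C₂, hC₂, H₂⟩ := exists_integral_rpow_five_le T hM hκ'
  refine ⟨C₁ + (1 + C₂), by linarith, ?_⟩
  intro lam δ g ψ S a hs ha hδ
  have hl := hs.lam_pos
  have hd := hs.pos
  have h0 : 0 ≤ lam ^ (p / 2 - 2) * δ ^ (p / 2) := by positivity
  have h0' : 0 ≤ (lam * δ) ^ ((p - 2) / 4) := by positivity
  rcases hδ with hδ | ⟨hp5, hδ⟩
  · refine (key C₁ hC₁ H₁ lam δ g ψ S a hs ha hδ).trans ?_
    gcongr
    linarith
  · have h1 := H₂ lam δ g ψ S a hs ha hδ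
    have hL : 0 < (lam * δ) ^ (1 / 4 : ℝ) := by positivity
    have h2 := integral_rpow_le_of_integral_rpow_le (T := T) ha (p := p) (q := 5) (C := C₂)
      (L := (lam * δ) ^ (1 / 4 : ℝ)) hp (by linarith) hL (by
        rw [← Real.rpow_mul (by positivity)]
        convert h1 using 3
        norm_num)
    rw [← Real.rpow_mul (by positivity), show 1 / 4 * (p - 2) = (p - 2) / 4 by ring] at h2
    refine h2.trans ?_
    have := mul_nonneg hC₁ (add_nonneg h0 h0')
    have := mul_nonneg (by linarith : 0 ≤ 1 + C₂) h0
    linarith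

end

section

/-- A primitive of a bi-Lipschitz increasing function is uniformly convex with quadratic bounds. -/
lemma primitive_sub_bounds {ψ : ℝ → ℝ} (hψ : Continuous ψ) {m M : ℝ}
    (hm : ∀ c t, c ≤ t → m * (t - c) ≤ ψ t - ψ c) (hM : ∀ c t, c ≤ t → ψ t - ψ c ≤ M * (t - c))
    (u c : ℝ) :
    m / 2 * (u - c) ^ 2 ≤
        (∫ t in (0 : ℝ)..u, ψ t) - (∫ t in (0 : ℝ)..c, ψ t) - ψ c * (u - c) ∧
      (∫ t in (0 : ℝ)..u, ψ t) - (∫ t in (0 : ℝ)..c, ψ t) - ψ c * (u - c) ≤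
        M / 2 * (u - c) ^ 2 := by
  have hi : ∀ x y, IntervalIntegrable ψ volume x y := fun x y => hψ.intervalIntegrable x y
  have h1 : (∫ t in (0 : ℝ)..u, ψ t) - (∫ t in (0 : ℝ)..c, ψ t) - ψ c * (u - c) =
      ∫ t in c..u, (ψ t - ψ c) := by
    rw [intervalIntegral.integral_interval_sub_left (hi _ _) (hi _ _),
      intervalIntegral.integral_sub (hi _ _) (by simp)]
    simp [mul_comm]
  have h2 : ∀ K : ℝ, ∫ t in c..u, K * (t - c) = K / 2 * (u - c) ^ 2 := by
    intro K
    rw [intervalIntegral.integral_const_mul, intervalIntegral.integral_comp_sub_right (fun t => t) c]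
    simp
    ring
  have hc : Continuous fun t => ψ t - ψ c := by fun_prop
  have hK : ∀ K : ℝ, Continuous fun t => K * (t - c) := fun K => by fun_prop
  rw [h1, ← h2, ← h2]
  rcases le_total c u with h | h
  · exact ⟨intervalIntegral.integral_mono_on h ((hK m).intervalIntegrable _ _)
        (hc.intervalIntegrable _ _) fun t ht => hm c t ht.1,
      intervalIntegral.integral_mono_on h (hc.intervalIntegrable _ _)
        ((hK M).intervalIntegrable _ _) fun t ht => hM c t ht.1⟩
  · rw [intervalIntegral.integral_symm u c, intervalIntegral.integral_symm u c,
      intervalIntegral.integral_symm u c]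
    refine ⟨neg_le_neg (intervalIntegral.integral_mono_on h (hc.intervalIntegrable _ _)
        ((hK m).intervalIntegrable _ _) fun t ht => ?_),
      neg_le_neg (intervalIntegral.integral_mono_on h ((hK M).intervalIntegrable _ _)
        (hc.intervalIntegrable _ _) fun t ht => ?_)⟩
    · have := hm t c ht.2; linarith
    · have := hM t c ht.2; linarith

/-- Increments of `s / √(γ - D s²)`. -/
lemma div_sqrt_sub_div_sqrt_bounds {γ D σ t c : ℝ} (hγ : 0 < γ) (hD : 0 < D) (hσ : D * σ ^ 2 < γ)
    (hc : -σ ≤ c) (hct : c ≤ t) (ht : t ≤ σ) :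
    (γ - D * σ ^ 2) / (2 * √γ ^ 3) * (t - c) ≤ t / √(γ - D * t ^ 2) - c / √(γ - D * c ^ 2) ∧
      t / √(γ - D * t ^ 2) - c / √(γ - D * c ^ 2) ≤
        3 * γ / (2 * √(γ - D * σ ^ 2) ^ 3) * (t - c) := by
  have bd : ∀ s, -σ ≤ s → s ≤ σ → s ^ 2 ≤ σ ^ 2 := fun s h1 h2 => sq_le_sq' h1 h2
  have hc2 := bd c hc (hct.trans ht)
  have ht2 := bd t (hc.trans hct) ht
  obtain ⟨r, hr⟩ : ∃ r, r = √(γ - D * σ ^ 2) := ⟨_, rfl⟩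
  obtain ⟨a, ha⟩ : ∃ a, a = √(γ - D * t ^ 2) := ⟨_, rfl⟩
  obtain ⟨b, hb⟩ : ∃ b, b = √(γ - D * c ^ 2) := ⟨_, rfl⟩
  have hr0 : 0 < r := by rw [hr]; exact Real.sqrt_pos.2 (by linarith)
  have hra : r ≤ a := by rw [hr, ha]; exact Real.sqrt_le_sqrt (by nlinarith)
  have hrb : r ≤ b := by rw [hr, hb]; exact Real.sqrt_le_sqrt (by nlinarith)
  have haγ : a ≤ √γ := by rw [ha]; exact Real.sqrt_le_sqrt (by nlinarith [sq_nonneg t])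
  have hbγ : b ≤ √γ := by rw [hb]; exact Real.sqrt_le_sqrt (by nlinarith [sq_nonneg c])
  have ha2 : a ^ 2 = γ - D * t ^ 2 := by rw [ha]; exact Real.sq_sqrt (by nlinarith)
  have hb2 : b ^ 2 = γ - D * c ^ 2 := by rw [hb]; exact Real.sq_sqrt (by nlinarith)
  have ha0 : 0 < a := hr0.trans_le hra
  have hb0 : 0 < b := hr0.trans_le hrb
  have hγs : √γ ^ 2 = γ := Real.sq_sqrt hγ.le
  rw [← ha, ← hb, ← hr]
  have key : t / a - c / b = (γ + a * b + D * c * t) / (a * b * (a + b)) * (t - c) := by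
    field_simp
    linear_combination t * hb2 - c * ha2
  rw [key]
  have hct2 : abs (c * t) ≤ σ ^ 2 := by
    rw [abs_le]; constructor <;> nlinarith [sq_nonneg (c - t), sq_nonneg (c + t)]
  rw [abs_le] at hct2
  have hDct : D * -(σ ^ 2) ≤ D * (c * t) := mul_le_mul_of_nonneg_left hct2.1 hD.le
  have hDct' : D * (c * t) ≤ D * σ ^ 2 := mul_le_mul_of_nonneg_left hct2.2 hD.le
  have hab : a * b ≤ γ := by rw [← hγs]; nlinarith
  have hab0 : 0 < a * b := mul_pos ha0 hb0
  have hs0 : 0 < √γ := Real.sqrt_pos.2 hγ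
  have htc : 0 ≤ t - c := by linarith
  have h1 : a * b * (a + b) ≤ 2 * √γ ^ 3 := by
    calc a * b * (a + b) ≤ √γ * √γ * (√γ + √γ) := by gcongr
      _ = 2 * √γ ^ 3 := by ring
  have h2 : 2 * r ^ 3 ≤ a * b * (a + b) := by
    calc 2 * r ^ 3 = r * r * (r + r) := by ring
      _ ≤ a * b * (a + b) := by gcongr
  constructor
  · refine mul_le_mul_of_nonneg_right (div_le_div₀ ?_ ?_ ?_ h1) htc
    · linarith
    · linarith
    · positivity
  · refine mul_le_mul_of_nonneg_right (div_le_div₀ ?_ ?_ ?_ h2) htc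
    · linarith
    · linarith
    · positivity

end

section

/-- An arc of an ellipse extends to the graph of a uniformly convex function on the line. -/
lemma exists_convex_extension {γ D σ : ℝ} (b : ℝ) (hγ : 0 < γ) (hD : 0 < D) (hσ0 : 0 < σ)
    (hσ : D * σ ^ 2 < γ) : ∃ (G Ψ : ℝ → ℝ) (m M B : ℝ), 0 < m ∧ 0 < M ∧ 0 ≤ B ∧
      (∀ s, |s| ≤ σ → G s = (b * s - √(γ - D * s ^ 2)) / γ) ∧
      (∀ u c, m * (u - c) ^ 2 ≤ G u - G c - Ψ c * (u - c) ∧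
        G u - G c - Ψ c * (u - c) ≤ M * (u - c) ^ 2) ∧
      ∀ c, |Ψ c| ≤ B + |c| / 2 := by
  obtain ⟨cl, hcl⟩ : ∃ cl : ℝ → ℝ, cl = fun s => max (-σ) (min s σ) := ⟨_, rfl⟩
  have hcl1 : ∀ s, -σ ≤ cl s := fun s => by rw [hcl]; exact le_max_left _ _
  have hcl2 : ∀ s, cl s ≤ σ := fun s => by
    rw [hcl]; exact max_le (by linarith) (min_le_right _ _)
  have hcl3 : ∀ s t, s ≤ t → cl s ≤ cl t := fun s t h => by rw [hcl]; dsimp only; gcongr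
  have hcl4 : ∀ s t, s ≤ t → cl t - cl s ≤ t - s := fun s t h => by
    rw [hcl]; dsimp only
    rcases max_cases (-σ) (min s σ) with h1 | h1 <;> rcases max_cases (-σ) (min t σ) with h2 | h2 <;>
      rcases min_cases s σ with h3 | h3 <;> rcases min_cases t σ with h4 | h4 <;> linarith
  have hcl5 : ∀ s, |s| ≤ σ → cl s = s := fun s h => by
    rw [abs_le] at h
    rw [hcl]; dsimp only; rw [min_eq_left h.2, max_eq_right h.1]
  have hclc : Continuous cl := by rw [hcl]; fun_prop
  have hcl6 : ∀ s, 0 < γ - D * cl s ^ 2 := fun s => by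
    have : cl s ^ 2 ≤ σ ^ 2 := sq_le_sq' (hcl1 s) (hcl2 s)
    nlinarith
  obtain ⟨m₁, hm₁⟩ : ∃ m₁, m₁ = (γ - D * σ ^ 2) / (2 * √γ ^ 3) := ⟨_, rfl⟩
  obtain ⟨M₁, hM₁⟩ : ∃ M₁, M₁ = 3 * γ / (2 * √(γ - D * σ ^ 2) ^ 3) := ⟨_, rfl⟩
  have hσγ : 0 < γ - D * σ ^ 2 := by linarith
  have hm₁0 : 0 < m₁ := by rw [hm₁]; positivity
  have hM₁0 : 0 < M₁ := by rw [hM₁]; positivity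
  obtain ⟨Ψ, hΨ⟩ : ∃ Ψ : ℝ → ℝ, Ψ = fun s => b / γ +
    D / γ * (cl s / √(γ - D * cl s ^ 2)) + 1 / 2 * (s - cl s) := ⟨_, rfl⟩
  have hΨc : Continuous Ψ := by
    rw [hΨ]
    have : Continuous fun s => cl s / √(γ - D * cl s ^ 2) :=
      hclc.div (by fun_prop) fun s => (Real.sqrt_pos.2 (hcl6 s)).ne'
    fun_prop
  have hDγ : 0 < D / γ := div_pos hD hγ
  have hlow : ∀ c t, c ≤ t → min (D / γ * m₁) (1 / 2) * (t - c) ≤ Ψ t - Ψ c := by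
    intro c t h
    have h1 := (div_sqrt_sub_div_sqrt_bounds hγ hD hσ (hcl1 c) (hcl3 c t h) (hcl2 t)).1
    rw [← hm₁] at h1
    have h2 := mul_le_mul_of_nonneg_left h1 hDγ.le
    have h3 : min (D / γ * m₁) (1 / 2) * (cl t - cl c) ≤ D / γ * m₁ * (cl t - cl c) :=
      mul_le_mul_of_nonneg_right (min_le_left _ _) (by linarith [hcl3 c t h])
    have h4 : min (D / γ * m₁) (1 / 2) * ((t - c) - (cl t - cl c)) ≤
        1 / 2 * ((t - c) - (cl t - cl c)) :=
      mul_le_mul_of_nonneg_right (min_le_right _ _) (by linarith [hcl4 c t h])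
    rw [hΨ]; dsimp only
    linarith
  have hup : ∀ c t, c ≤ t → Ψ t - Ψ c ≤ max (D / γ * M₁) (1 / 2) * (t - c) := by
    intro c t h
    have h1 := (div_sqrt_sub_div_sqrt_bounds hγ hD hσ (hcl1 c) (hcl3 c t h) (hcl2 t)).2
    rw [← hM₁] at h1
    have h2 := mul_le_mul_of_nonneg_left h1 hDγ.le
    have h3 : D / γ * M₁ * (cl t - cl c) ≤ max (D / γ * M₁) (1 / 2) * (cl t - cl c) :=
      mul_le_mul_of_nonneg_right (le_max_left _ _) (by linarith [hcl3 c t h])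
    have h4 : 1 / 2 * ((t - c) - (cl t - cl c)) ≤
        max (D / γ * M₁) (1 / 2) * ((t - c) - (cl t - cl c)) :=
      mul_le_mul_of_nonneg_right (le_max_right _ _) (by linarith [hcl4 c t h])
    rw [hΨ]; dsimp only
    linarith
  refine ⟨fun s => -√γ / γ + ∫ t in (0 : ℝ)..s, Ψ t, Ψ, min (D / γ * m₁) (1 / 2) / 2,
    max (D / γ * M₁) (1 / 2) / 2, |b| / γ + D / γ * (σ / √(γ - D * σ ^ 2)), by positivity,
    by positivity, by positivity, ?_, ?_, ?_⟩
  · intro s hs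
    have h1 : ∀ x ∈ Set.uIcc 0 s,
        HasDerivAt (fun x => (b * x - √(γ - D * x ^ 2)) / γ) (Ψ x) x := by
      intro x hx
      have hxσ : |x| ≤ σ := by
        have := Set.abs_sub_left_of_mem_uIcc hx
        simp only [sub_zero] at this
        exact this.trans hs
      have hpos := hcl6 x
      rw [hcl5 x hxσ] at hpos
      have h2 : HasDerivAt (fun x => γ - D * x ^ 2) (-(D * (2 * x))) x := by
        have := ((hasDerivAt_id x).pow 2).const_mul D |>.const_sub γ
        refine this.congr_deriv ?_
        simp
      have h3 := (((hasDerivAt_id x).const_mul b).sub (h2.sqrt hpos.ne')).div_const γ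
      refine h3.congr_deriv ?_
      rw [hΨ]; dsimp only
      rw [hcl5 x hxσ]
      field_simp
      ring
    have h2 := intervalIntegral.integral_eq_sub_of_hasDerivAt h1 (hΨc.intervalIntegrable _ _)
    simp only [h2]
    simp
  · intro u c
    have := primitive_sub_bounds hΨc hlow hup u c
    dsimp only
    constructor <;> linarith [this.1, this.2]
  · intro c
    have h1 : |cl c / √(γ - D * cl c ^ 2)| ≤ σ / √(γ - D * σ ^ 2) := by
      rw [abs_div, abs_of_nonneg (Real.sqrt_nonneg _)]
      have : cl c ^ 2 ≤ σ ^ 2 := sq_le_sq' (hcl1 c) (hcl2 c)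
      gcongr
      exact abs_le.2 ⟨hcl1 c, hcl2 c⟩
    have h2 : |c - cl c| ≤ |c| := by
      have h0 := hcl5 0 (by simpa using hσ0.le)
      rcases le_total 0 c with h | h
      · have h3 := hcl3 0 c h
        have h4 := hcl4 0 c h
        rw [h0] at h3 h4
        rw [abs_of_nonneg (by linarith), abs_of_nonneg h]; linarith
      · have h3 := hcl3 c 0 h
        have h4 := hcl4 c 0 h
        rw [h0] at h3 h4
        rw [abs_of_nonpos (by linarith), abs_of_nonpos h]; linarith
    rw [hΨ]; dsimp only
    calc _ ≤ |b / γ| + |D / γ * (cl c / √(γ - D * cl c ^ 2))| + |1 / 2 * (c - cl c)| :=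
          abs_add_three _ _ _
      _ = |b| / γ + D / γ * |cl c / √(γ - D * cl c ^ 2)| + 1 / 2 * |c - cl c| := by
          rw [abs_mul, abs_mul, abs_div b, abs_of_pos hγ, abs_of_pos hDγ,
            abs_of_pos (by norm_num : (0 : ℝ) < 1 / 2)]
      _ ≤ |b| / γ + D / γ * (σ / √(γ - D * σ ^ 2)) + 1 / 2 * |c| := by gcongr
      _ = _ := by ring

end

section

lemma abs_sqrt_sub_le {x y r : ℝ} (hy : 0 ≤ y) (hx : 0 < x) (h : |y - x ^ 2| ≤ r * x) :
    |√y - x| ≤ r := by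
  have h1 := Real.sqrt_nonneg y
  have h2 : y - x ^ 2 = (√y - x) * (√y + x) := by linear_combination -Real.sq_sqrt hy
  rw [h2, abs_mul, abs_of_pos (by linarith : 0 < √y + x)] at h
  have h3 : |√y - x| * x ≤ |√y - x| * (√y + x) :=
    mul_le_mul_of_nonneg_left (by linarith) (abs_nonneg _)
  exact le_of_mul_le_mul_right (h3.trans h) hx

set_option maxHeartbeats 400000 in
/-- The part of an elliptic shell on which the normal stays away from the horizontal direction,
on its lower side, is a `Shell`. -/
lemma exists_shell_of_ellipse {α b γ c₀ : ℝ} (hγ : 0 < γ) (hD : 0 < α * γ - b ^ 2)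
    (hc₀ : 0 < c₀) (hc : c₀ ^ 2 < 2 * γ) : ∃ M Λ : ℝ, 1 ≤ M ∧ 1 ≤ Λ ∧
      ∀ (lam δ : ℝ) (S : Finset (ℤ × ℤ)), Λ ≤ lam → 0 < δ → δ ≤ 1 → 1 ≤ lam * δ →
        (∀ k ∈ S, |√(α * k.1 ^ 2 + 2 * b * k.1 * k.2 + γ * k.2 ^ 2) - lam| < δ ∧
          γ * k.2 + b * k.1 ≤ -(c₀ * lam)) →
        ∃ g ψ : ℝ → ℝ, Shell M lam δ g ψ S := by
  obtain ⟨D, hDd⟩ : ∃ D, D = α * γ - b ^ 2 := ⟨_, rfl⟩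
  rw [← hDd] at hD
  have hσp : 0 < (γ - c₀ ^ 2 / 2) / D := div_pos (by linarith) hD
  obtain ⟨σ, hσd⟩ : ∃ σ, σ = √((γ - c₀ ^ 2 / 2) / D) := ⟨_, rfl⟩
  have hσ0 : 0 < σ := by rw [hσd]; exact Real.sqrt_pos.2 hσp
  have hσ2 : D * σ ^ 2 = γ - c₀ ^ 2 / 2 := by
    rw [hσd, Real.sq_sqrt hσp.le]; field_simp
  obtain ⟨G, Ψ, m, M₁, B, hm, hM₁, hB, hG, hGΨ, hΨ⟩ :=
    exists_convex_extension (-b) hγ hD hσ0 (by rw [hσ2]; linarith [sq_pos_of_pos hc₀])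
  obtain ⟨M, hM⟩ : ∃ M, M = 1 + 1 / m + M₁ + 2 * B + σ + 3 / c₀ := ⟨_, rfl⟩
  have hm' : 0 < 1 / m := by positivity
  have hc' : 0 < 3 / c₀ := by positivity
  have hM0 : 0 < M := by rw [hM]; positivity
  refine ⟨M, 1 + 6 * γ / c₀ ^ 2, by linarith, by linarith [show 0 < 6 * γ / c₀ ^ 2 by positivity],
    fun lam δ S hlam hδ hδ1 hlδ hS => ⟨fun u => lam * G (u / lam), fun u => Ψ (u / lam), ?_⟩⟩
  have hl1 : 1 ≤ lam := by linarith [show 0 < 6 * γ / c₀ ^ 2 by positivity]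
  have hl0 : 0 < lam := by linarith
  have hl6 : 6 * γ ≤ c₀ ^ 2 * lam := by
    have : 6 * γ / c₀ ^ 2 ≤ lam := by linarith
    rw [div_le_iff₀ (by positivity)] at this
    linarith
  have key : ∀ k ∈ S, |(k.1 : ℝ)| ≤ σ * lam ∧ |(k.2 : ℝ) - lam * G (k.1 / lam)| ≤ 3 / c₀ * δ := by
    intro k hk
    obtain ⟨hq, hv⟩ := hS k hk
    obtain ⟨u, hu⟩ : ∃ u : ℝ, u = k.1 := ⟨_, rfl⟩
    obtain ⟨w, hw⟩ : ∃ w : ℝ, w = k.2 := ⟨_, rfl⟩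
    rw [← hu, ← hw] at hq hv ⊢
    obtain ⟨q, hqd⟩ : ∃ q, q = α * u ^ 2 + 2 * b * u * w + γ * w ^ 2 := ⟨_, rfl⟩
    obtain ⟨v, hvd⟩ : ∃ v, v = γ * w + b * u := ⟨_, rfl⟩
    rw [← hqd] at hq
    rw [← hvd] at hv
    have hγq : γ * q = v ^ 2 + D * u ^ 2 := by rw [hqd, hvd, hDd]; ring
    have hq0 : 0 ≤ q := by
      have : 0 ≤ γ * q := by rw [hγq]; positivity
      exact nonneg_of_mul_nonneg_right this hγ
    have hqs : |q - lam ^ 2| ≤ 3 * (lam * δ) := by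
      have h1 : q - lam ^ 2 = (√q - lam) * (√q + lam) := by linear_combination -Real.sq_sqrt hq0
      have h2 := abs_lt.1 hq
      rw [h1, abs_mul, abs_of_pos (by linarith [Real.sqrt_nonneg q] : 0 < √q + lam)]
      calc _ ≤ δ * (3 * lam) :=
            mul_le_mul hq.le (by linarith) (by linarith [Real.sqrt_nonneg q]) hδ.le
        _ = _ := by ring
    have hqs' := abs_le.1 hqs
    have hcl : 0 < c₀ * lam := by positivity
    have hv2 : c₀ ^ 2 * lam ^ 2 ≤ v ^ 2 := by
      rw [← mul_pow, ← neg_sq v]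
      exact pow_le_pow_left₀ hcl.le (by linarith) 2
    have hlδ' : lam * δ ≤ lam := mul_le_of_le_one_right hl0.le hδ1
    have hy : c₀ ^ 2 * lam ^ 2 / 2 ≤ γ * lam ^ 2 - D * u ^ 2 := by
      have h1 : γ * lam ^ 2 - D * u ^ 2 = v ^ 2 - γ * (q - lam ^ 2) := by linarith
      have h2 : γ * (q - lam ^ 2) ≤ γ * (3 * lam) :=
        mul_le_mul_of_nonneg_left (by linarith) hγ.le
      have h3 : 6 * γ * lam ≤ c₀ ^ 2 * lam * lam := mul_le_mul_of_nonneg_right hl6 hl0.le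
      rw [h1]; linarith
    have hus : |u| ≤ σ * lam := by
      refine abs_le_of_sq_le_sq ?_ (by positivity)
      have : D * u ^ 2 ≤ D * (σ * lam) ^ 2 := by
        rw [mul_pow, ← mul_assoc, hσ2]; linarith
      exact le_of_mul_le_mul_left this hD
    refine ⟨hus, ?_⟩
    have hus' : |u / lam| ≤ σ := by
      rw [abs_div, abs_of_pos hl0, div_le_iff₀ hl0]; exact hus
    have hy0 : 0 ≤ γ * lam ^ 2 - D * u ^ 2 := le_trans (by positivity) hy
    have hs : lam * √(γ - D * (u / lam) ^ 2) = √(γ * lam ^ 2 - D * u ^ 2) := by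
      rw [← Real.sqrt_sq hl0.le, ← Real.sqrt_mul (sq_nonneg lam), Real.sqrt_sq hl0.le]
      congr 1
      field_simp
    have hdiff : w - lam * G (u / lam) = (√(γ * lam ^ 2 - D * u ^ 2) - -v) / γ := by
      rw [hG _ hus', ← hs, hvd]
      field_simp
      ring
    rw [hdiff, abs_div, abs_of_pos hγ, div_le_iff₀ hγ]
    refine abs_sqrt_sub_le hy0 (by linarith) ?_
    have h1 : γ * lam ^ 2 - D * u ^ 2 - (-v) ^ 2 = -(γ * (q - lam ^ 2)) := by
      rw [neg_sq]; linarith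
    rw [h1, abs_neg, abs_mul, abs_of_pos hγ]
    calc γ * |q - lam ^ 2| ≤ γ * (3 * (lam * δ)) := mul_le_mul_of_nonneg_left hqs hγ.le
      _ = 3 / c₀ * δ * γ * (c₀ * lam) := by field_simp
      _ ≤ 3 / c₀ * δ * γ * -v := mul_le_mul_of_nonneg_left (by linarith) (by positivity)
  have hscale : ∀ u c : ℝ, lam * G (u / lam) - lam * G (c / lam) - Ψ (c / lam) * (u - c) =
      lam * (G (u / lam) - G (c / lam) - Ψ (c / lam) * (u / lam - c / lam)) := by
    intro u c; field_simp
  have hsq : ∀ u c : ℝ, lam * (u / lam - c / lam) ^ 2 = (u - c) ^ 2 / lam := by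
    intro u c; field_simp
  exact
  { one_le_M := by linarith
    one_le_lam := hl1
    pos := hδ
    le_one := hδ1
    one_le_mul := hlδ
    fst_le := fun k hk => (key k hk).1.trans (by gcongr; linarith)
    near := fun k hk => (key k hk).2.trans (by gcongr; linarith)
    lower := fun u c _ _ => by
      rw [hscale]
      have h1 := mul_le_mul_of_nonneg_left (hGΨ (u / lam) (c / lam)).1 hl0.le
      refine le_trans ?_ h1
      rw [mul_left_comm, hsq, mul_comm M, ← div_div, div_le_iff₀ hM0, mul_comm, ← mul_assoc]
      refine le_mul_of_one_le_left (by positivity) ?_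
      have : 1 / m ≤ M := by linarith
      rwa [div_le_iff₀ hm] at this
    upper := fun u c _ _ => by
      rw [hscale]
      have h1 := mul_le_mul_of_nonneg_left (hGΨ (u / lam) (c / lam)).2 hl0.le
      refine h1.trans ?_
      rw [mul_left_comm, hsq, ← mul_div_assoc]
      gcongr
      linarith
    slope := fun c hc => by
      refine (hΨ (c / lam)).trans ?_
      rw [abs_div, abs_of_pos hl0]
      have : |c| / lam ≤ M := by rwa [div_le_iff₀ hl0]
      linarith }

/-- An elliptic shell is covered by four charts: one of the partial derivatives of the quadratic
form is comparable to `λ` in absolute value. -/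
lemma chart_cover {α b γ : ℝ} (hα : 0 < α) (hγ : 0 < γ) (hD : 0 < α * γ - b ^ 2) :
    ∃ c₀ : ℝ, 0 < c₀ ∧ c₀ ^ 2 < 2 * γ ∧ c₀ ^ 2 < 2 * α ∧ ∀ u w lam δ : ℝ, 2 ≤ lam → δ ≤ 1 →
      |√(α * u ^ 2 + 2 * b * u * w + γ * w ^ 2) - lam| < δ →
      γ * w + b * u ≤ -(c₀ * lam) ∨ c₀ * lam ≤ γ * w + b * u ∨
      α * u + b * w ≤ -(c₀ * lam) ∨ c₀ * lam ≤ α * u + b * w := by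
  obtain ⟨D, hDd⟩ : ∃ D, D = α * γ - b ^ 2 := ⟨_, rfl⟩
  rw [← hDd] at hD
  obtain ⟨ε, hε⟩ : ∃ ε, ε = D / (8 * (α + γ)) := ⟨_, rfl⟩
  have hε0 : 0 < ε := by rw [hε]; positivity
  have hDα : D ≤ α * γ := by rw [hDd]; nlinarith [sq_nonneg b]
  have h8 : 8 * (ε * (α + γ)) = D := by rw [hε]; field_simp
  have hεγ : ε < γ := by
    have : 8 * (ε * (α + γ)) < 8 * (γ * (α + γ)) := by
      rw [h8]; nlinarith [mul_pos hα hγ, sq_pos_of_pos hγ]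
    nlinarith
  have hεα : ε < α := by
    have : 8 * (ε * (α + γ)) < 8 * (α * (α + γ)) := by
      rw [h8]; nlinarith [mul_pos hα hγ, sq_pos_of_pos hα]
    nlinarith
  refine ⟨√ε, Real.sqrt_pos.2 hε0, by rw [Real.sq_sqrt hε0.le]; linarith,
    by rw [Real.sq_sqrt hε0.le]; linarith, fun u w lam δ hl hδ h => ?_⟩
  by_contra! hcon
  obtain ⟨h1, h2, h3, h4⟩ := hcon
  obtain ⟨q, hqd⟩ : ∃ q, q = α * u ^ 2 + 2 * b * u * w + γ * w ^ 2 := ⟨_, rfl⟩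
  rw [← hqd] at h
  have h5 := abs_lt.1 h
  have h6 : lam / 2 < √q := by linarith
  have h7 : lam ^ 2 / 4 < q := by
    have := (Real.lt_sqrt (by linarith)).1 h6
    linarith
  have hc2 : (√ε * lam) ^ 2 = ε * lam ^ 2 := by rw [mul_pow, Real.sq_sqrt hε0.le]
  have hv : (γ * w + b * u) ^ 2 ≤ ε * lam ^ 2 := by
    rw [← hc2]; exact sq_le_sq' h1.le h2.le
  have hv' : (α * u + b * w) ^ 2 ≤ ε * lam ^ 2 := by
    rw [← hc2]; exact sq_le_sq' h3.le h4.le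
  have hid : D * q = γ * (α * u + b * w) ^ 2 - 2 * b * (α * u + b * w) * (γ * w + b * u) +
      α * (γ * w + b * u) ^ 2 := by rw [hqd, hDd]; ring
  have hb : (D + b ^ 2) = α * γ := by rw [hDd]; ring
  have hin : D * q ≤ 2 * (γ * (α * u + b * w) ^ 2 + α * (γ * w + b * u) ^ 2) := by
    obtain ⟨x, hx⟩ : ∃ x, x = α * u + b * w := ⟨_, rfl⟩
    obtain ⟨y, hy⟩ : ∃ y, y = γ * w + b * u := ⟨_, rfl⟩
    rw [hid, ← hx, ← hy]
    have : 0 ≤ γ * (γ * x ^ 2 + 2 * b * x * y + α * y ^ 2) := by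
      have e : γ * (γ * x ^ 2 + 2 * b * x * y + α * y ^ 2) = (γ * x + b * y) ^ 2 + D * y ^ 2 := by
        rw [hDd]; ring
      rw [e]; positivity
    have := nonneg_of_mul_nonneg_right this hγ
    linarith
  have h9 := mul_le_mul_of_nonneg_left hv hα.le
  have h10 := mul_le_mul_of_nonneg_left hv' hγ.le
  have h11 := mul_lt_mul_of_pos_left h7 hD
  have h12 : D * lam ^ 2 = 8 * (ε * (α + γ)) * lam ^ 2 := by rw [h8]
  linarith

end

section

variable {Ω : Type*} [MeasurableSpace Ω]

lemma integral_rpow_le_mul_nsq_rpow (T : Torus Ω) {p K : ℝ} (hp : 2 ≤ p) (hK : 0 ≤ K)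
    {S : Finset (ℤ × ℤ)}
    (h : ∀ a : ℤ × ℤ → ℂ, nsq S a ≤ 1 → ∫ w, ‖T.trig S a w‖ ^ p ∂T.μ ≤ K) (a : ℤ × ℤ → ℂ) :
    ∫ w, ‖T.trig S a w‖ ^ p ∂T.μ ≤ K * nsq S a ^ (p / 2) := by
  have hp0 : p ≠ 0 := by linarith
  rcases (nsq_nonneg S a).eq_or_lt with h0 | h0
  · have h1 : ∀ k ∈ S, a k = 0 := by
      intro k hk
      have := (Finset.sum_eq_zero_iff_of_nonneg fun k _ => by positivity).1 h0.symm k hk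
      simpa using this
    have h2 : ∀ w, T.trig S a w = 0 := fun w =>
      Finset.sum_eq_zero fun k hk => by rw [h1 k hk, zero_mul]
    simp only [h2, norm_zero, Real.zero_rpow hp0, integral_zero]
    exact mul_nonneg hK (Real.rpow_nonneg h0.le _)
  · obtain ⟨r, hr⟩ : ∃ r, r = √(nsq S a) := ⟨_, rfl⟩
    have hr0 : 0 < r := by rw [hr]; exact Real.sqrt_pos.2 h0
    have hr2 : r ^ 2 = nsq S a := by rw [hr, Real.sq_sqrt h0.le]
    have hn : ‖((r⁻¹ : ℝ) : ℂ)‖ = r⁻¹ := by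
      rw [Complex.norm_real, Real.norm_of_nonneg (by positivity)]
    have h1 := h (fun k => ((r⁻¹ : ℝ) : ℂ) * a k) (by
      simp only [nsq, norm_mul, hn, mul_pow, ← Finset.mul_sum]
      rw [← nsq, ← hr2, ← mul_pow, inv_mul_cancel₀ hr0.ne', one_pow])
    simp only [trig_smul, norm_mul, hn, Real.mul_rpow (inv_nonneg.2 hr0.le) (norm_nonneg _),
      integral_const_mul] at h1
    rw [Real.inv_rpow hr0.le, inv_mul_le_iff₀ (by positivity)] at h1
    rw [← hr2, ← Real.rpow_natCast, ← Real.rpow_mul hr0.le]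
    rw [show ((2 : ℕ) : ℝ) * (p / 2) = p by push_cast; ring]
    linarith

/-- The moment bound for the part of an elliptic shell covered by one chart. -/
lemma exists_integral_rpow_le_of_ellipse (T : Torus Ω) {α b γ c₀ p κ κ' : ℝ} (hγ : 0 < γ)
    (hD : 0 < α * γ - b ^ 2) (hc₀ : 0 < c₀) (hc : c₀ ^ 2 < 2 * γ) (hp : 2 ≤ p) (hκ : 0 < κ)
    (hκ' : 0 < κ') : ∃ C Λ : ℝ, 1 ≤ C ∧ 1 ≤ Λ ∧
      ∀ (lam δ : ℝ) (S : Finset (ℤ × ℤ)) (a : ℤ × ℤ → ℂ),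
        Λ ≤ lam → 0 < δ → δ ≤ 1 → 1 ≤ lam * δ →
        (lam ^ (-(1 / 3 : ℝ) + κ) < δ ∨ (p < 5 - κ ∧ lam ^ (-1 + κ') < δ)) →
        (∀ k ∈ S, |√(α * k.1 ^ 2 + 2 * b * k.1 * k.2 + γ * k.2 ^ 2) - lam| < δ ∧
          γ * k.2 + b * k.1 ≤ -(c₀ * lam)) →
        ∫ w, ‖T.trig S a w‖ ^ p ∂T.μ ≤
          C * (lam ^ (p / 2 - 2) * δ ^ (p / 2) + (lam * δ) ^ ((p - 2) / 4)) *
            nsq S a ^ (p / 2) := by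
  obtain ⟨M, Λ, hM, hΛ, H⟩ := exists_shell_of_ellipse hγ hD hc₀ hc
  obtain ⟨C, hC, H'⟩ := Shell.exists_integral_rpow_le T hM hp hκ hκ'
  refine ⟨C, Λ, hC, hΛ, fun lam δ S a hl hδ hδ1 hlδ hreg hS => ?_⟩
  obtain ⟨g, ψ, hs⟩ := H lam δ S hl hδ hδ1 hlδ hS
  have := hs.lam_pos
  exact integral_rpow_le_mul_nsq_rpow T hp (by positivity)
    (fun a ha => H' lam δ g ψ S a hs ha hreg) a

/-! ### The square torus -/

lemma integral_ee_int_mul (n : ℤ) (hn : n ≠ 0) :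
    ∫ t in Set.Icc (0 : ℝ) 1, ee (n * t) = 0 := by
  rw [integral_Icc_eq_integral_Ioc, ← intervalIntegral.integral_of_le zero_le_one]
  have h0 : (2 * Real.pi * Complex.I * n : ℂ) ≠ 0 := by
    simp [Real.pi_ne_zero, hn]
  have h1 : ∀ t : ℝ, ee (n * t) = Complex.exp (2 * Real.pi * Complex.I * n * t) := by
    intro t; rw [ee]; congr 1; push_cast; ring
  simp only [h1]
  rw [integral_exp_mul_complex h0, ← h1, ← h1, mul_one, mul_zero, ee_int, ee_zero, sub_self,
    zero_div]

/-- The measure on the unit square. -/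
noncomputable def boxMeasure : Measure (Fin 2 → ℝ) :=
  volume.restrict (Set.univ.pi fun _ : Fin 2 => Set.Icc (0 : ℝ) 1)

lemma boxMeasure_eq_pi :
    boxMeasure = Measure.pi fun _ : Fin 2 => volume.restrict (Set.Icc (0 : ℝ) 1) := by
  rw [boxMeasure, volume_pi, Measure.restrict_pi_pi]

instance : IsProbabilityMeasure boxMeasure := by
  constructor
  rw [boxMeasure, Measure.restrict_apply_univ, volume_pi, Measure.pi_pi]
  simp

lemma ee_sum (n : Fin 2 → ℤ) (x : Fin 2 → ℝ) :
    ee (∑ l, (n l : ℝ) * x l) = ∏ l, ee (n l * x l) := by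
  simp only [Fin.sum_univ_two, Fin.prod_univ_two, ee_add]

lemma integral_ee_sum (n : Fin 2 → ℤ) (hn : n ≠ 0) :
    ∫ x, ee (∑ l, (n l : ℝ) * x l) ∂boxMeasure = 0 := by
  obtain ⟨l, hl⟩ := Function.ne_iff.1 hn
  simp only [ee_sum]
  rw [boxMeasure_eq_pi, integral_fintype_prod_eq_prod (fun l t => ee (n l * t))]
  exact Finset.prod_eq_zero (Finset.mem_univ l) (integral_ee_int_mul _ hl)

/-- The frequency with coordinates `k i` and `s * k j`, where `{i, j} = {0, 1}` and `s = ± 1`. -/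
def chart (i : Fin 2) (s : ℤ) (k : Fin 2 → ℤ) : ℤ × ℤ := (k i, s * k (1 - i))

lemma chart_sum (i : Fin 2) {s : ℤ} (hs : s ^ 2 = 1) (k : Fin 2 → ℤ) (x : Fin 2 → ℝ) :
    ((chart i s k).1 : ℝ) * x i + ((chart i s k).2 : ℝ) * (s * x (1 - i)) =
      ∑ l, (k l : ℝ) * x l := by
  have hs' : (s : ℝ) ^ 2 = 1 := by exact_mod_cast hs
  fin_cases i
  · simp [chart, Fin.sum_univ_two]
    linear_combination (k 1 : ℝ) * x 1 * hs'
  · simp [chart, Fin.sum_univ_two]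
    linear_combination (k 0 : ℝ) * x 0 * hs'

/-- The inverse of `chart i s`. -/
def chartInv (i : Fin 2) (s : ℤ) (k : ℤ × ℤ) : Fin 2 → ℤ := fun l => if l = i then k.1 else s * k.2

lemma chartInv_chart (i : Fin 2) {s : ℤ} (hs : s ^ 2 = 1) (k : Fin 2 → ℤ) :
    chartInv i s (chart i s k) = k := by
  have h : ∀ t : ℤ, s * (s * t) = t := fun t => by linear_combination t * hs
  funext l
  fin_cases i <;> fin_cases l <;> simp [chartInv, chart, h]

lemma chart_chartInv (i : Fin 2) {s : ℤ} (hs : s ^ 2 = 1) (k : ℤ × ℤ) :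
    chart i s (chartInv i s k) = k := by
  have h : ∀ t : ℤ, s * (s * t) = t := fun t => by linear_combination t * hs
  fin_cases i <;> ext <;> simp [chartInv, chart, h]

/-- The square torus, with one of its coordinates possibly reversed. -/
noncomputable def squareTorus (i : Fin 2) (s : ℤ) (hs : s ^ 2 = 1) : Torus (Fin 2 → ℝ) where
  μ := boxMeasure
  X x := x i
  Y x := s * x (1 - i)
  prob := inferInstance
  measX := by fun_prop
  measY := by fun_prop
  orth k hk := by
    have h := integral_ee_sum (chartInv i s k) (by
      rintro h
      apply hk
      rw [← chart_chartInv i hs k, h]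
      simp [chart])
    simp only [← chart_sum i hs, chart_chartInv i hs] at h
    exact h

/-- The trigonometric polynomial on the square with frequencies in `F`. -/
noncomputable def boxTrig (F : Finset (Fin 2 → ℤ)) (a : (Fin 2 → ℤ) → ℂ) (x : Fin 2 → ℝ) : ℂ :=
  ∑ k ∈ F, a k * ee (∑ l, (k l : ℝ) * x l)

lemma trig_squareTorus (i : Fin 2) (s : ℤ) (hs : s ^ 2 = 1) (F : Finset (Fin 2 → ℤ))
    (a : (Fin 2 → ℤ) → ℂ) (x : Fin 2 → ℝ) :
    (squareTorus i s hs).trig (F.image (chart i s)) (a ∘ chartInv i s) x = boxTrig F a x := by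
  rw [Torus.trig, Finset.sum_image (Function.LeftInverse.injective (chartInv_chart i hs)).injOn]
  refine Finset.sum_congr rfl fun k _ => ?_
  rw [Function.comp_apply, chartInv_chart i hs, Torus.chr, ← chart_sum i hs]
  rfl

lemma nsq_chart (i : Fin 2) (s : ℤ) (hs : s ^ 2 = 1) (F : Finset (Fin 2 → ℤ))
    (a : (Fin 2 → ℤ) → ℂ) :
    nsq (F.image (chart i s)) (a ∘ chartInv i s) = ∑ k ∈ F, ‖a k‖ ^ 2 := by
  rw [nsq, Finset.sum_image (Function.LeftInverse.injective (chartInv_chart i hs)).injOn]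
  exact Finset.sum_congr rfl fun k _ => by rw [Function.comp_apply, chartInv_chart i hs]

lemma exists_integral_boxTrig_le_of_chart (i : Fin 2) (s : ℤ) (hs : s ^ 2 = 1)
    {α b γ c₀ p κ κ' : ℝ} (hγ : 0 < γ) (hD : 0 < α * γ - b ^ 2) (hc₀ : 0 < c₀)
    (hc : c₀ ^ 2 < 2 * γ) (hp : 2 ≤ p) (hκ : 0 < κ) (hκ' : 0 < κ') :
    ∃ C Λ : ℝ, 1 ≤ C ∧ 1 ≤ Λ ∧ ∀ (lam δ : ℝ) (F : Finset (Fin 2 → ℤ)) (a : (Fin 2 → ℤ) → ℂ),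
      Λ ≤ lam → 0 < δ → δ ≤ 1 → 1 ≤ lam * δ →
      (lam ^ (-(1 / 3 : ℝ) + κ) < δ ∨ (p < 5 - κ ∧ lam ^ (-1 + κ') < δ)) →
      (∀ k ∈ F, |√(α * k i ^ 2 + 2 * b * k i * k (1 - i) + γ * k (1 - i) ^ 2) - lam| < δ ∧
        s * (γ * k (1 - i) + b * k i) ≤ -(c₀ * lam)) →
      ∫ x, ‖boxTrig F a x‖ ^ p ∂boxMeasure ≤
        C * (lam ^ (p / 2 - 2) * δ ^ (p / 2) + (lam * δ) ^ ((p - 2) / 4)) *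
          (∑ k ∈ F, ‖a k‖ ^ 2) ^ (p / 2) := by
  have hs' : (s : ℝ) ^ 2 = 1 := by exact_mod_cast hs
  obtain ⟨C, Λ, hC, hΛ, H⟩ := exists_integral_rpow_le_of_ellipse (squareTorus i s hs) (α := α) (b := s * b)
    hγ (by rw [mul_pow, hs', one_mul]; exact hD) hc₀ hc hp hκ hκ'
  refine ⟨C, Λ, hC, hΛ, fun lam δ F a hl hδ hδ1 hlδ hreg hF => ?_⟩
  have h := H lam δ (F.image (chart i s)) (a ∘ chartInv i s) hl hδ hδ1 hlδ hreg (by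
    simp only [Finset.forall_mem_image]
    intro k hk
    obtain ⟨h1, h2⟩ := hF k hk
    simp only [chart]
    push_cast
    constructor
    · convert h1 using 5
      · linear_combination 2 * b * k i * k (1 - i) * hs'
      · rw [mul_pow, hs', one_mul]
    · linarith)
  simp only [trig_squareTorus, nsq_chart i s hs] at h
  exact h

end

section

lemma bm_boxTrig (F : Finset (Fin 2 → ℤ)) (a : (Fin 2 → ℤ) → ℂ) : BM (boxTrig F a) := by
  have : boxTrig F a = (squareTorus 0 1 (one_pow 2)).trig (F.image (chart 0 1))
      (a ∘ chartInv 0 1) := by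
    ext x; rw [trig_squareTorus]
  rw [this]
  exact BM.trig _ _

lemma norm_add_rpow_le (x y : ℂ) {p : ℝ} (hp : 0 ≤ p) :
    ‖x + y‖ ^ p ≤ 2 ^ p * (‖x‖ ^ p + ‖y‖ ^ p) := by
  have hx := Real.rpow_nonneg (norm_nonneg x) p
  have hy := Real.rpow_nonneg (norm_nonneg y) p
  calc ‖x + y‖ ^ p ≤ (2 * max ‖x‖ ‖y‖) ^ p := by
        refine Real.rpow_le_rpow (norm_nonneg _) ((norm_add_le x y).trans ?_) hp
        linarith [le_max_left ‖x‖ ‖y‖, le_max_right ‖x‖ ‖y‖]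
    _ = 2 ^ p * max ‖x‖ ‖y‖ ^ p :=
        Real.mul_rpow (by norm_num) (le_max_of_le_left (norm_nonneg _))
    _ ≤ _ := by
        refine mul_le_mul_of_nonneg_left ?_ (by positivity)
        rcases max_cases ‖x‖ ‖y‖ with h | h <;> rw [h.1] <;> linarith

lemma integral_boxTrig_le_of_or {p K₁ K₂ : ℝ} (hp : 0 ≤ p) {F : Finset (Fin 2 → ℤ)}
    {a : (Fin 2 → ℤ) → ℂ} {P₁ P₂ : (Fin 2 → ℤ) → Prop}
    (h₁ : ∀ F' ⊆ F, (∀ k ∈ F', P₁ k) → ∫ x, ‖boxTrig F' a x‖ ^ p ∂boxMeasure ≤ K₁)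
    (h₂ : ∀ F' ⊆ F, (∀ k ∈ F', P₂ k) → ∫ x, ‖boxTrig F' a x‖ ^ p ∂boxMeasure ≤ K₂) :
    ∀ F' ⊆ F, (∀ k ∈ F', P₁ k ∨ P₂ k) →
      ∫ x, ‖boxTrig F' a x‖ ^ p ∂boxMeasure ≤ 2 ^ p * (K₁ + K₂) := by
  classical
  intro F' hF' h
  have hint : ∀ F : Finset (Fin 2 → ℤ), Integrable (fun x => ‖boxTrig F a x‖ ^ p) boxMeasure :=
    fun F => ((bm_boxTrig F a).norm.rpow (fun _ => norm_nonneg _) hp).integrable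
  have hsplit : ∀ x, boxTrig F' a x =
      boxTrig (F'.filter P₁) a x + boxTrig (F'.filter fun k => ¬ P₁ k) a x := fun x =>
    (Finset.sum_filter_add_sum_filter_not F' P₁ _).symm
  have e₁ := h₁ (F'.filter P₁) ((Finset.filter_subset _ _).trans hF')
    fun k hk => (Finset.mem_filter.1 hk).2
  have e₂ := h₂ (F'.filter fun k => ¬ P₁ k) ((Finset.filter_subset _ _).trans hF')
    fun k hk => (h k (Finset.mem_filter.1 hk).1).resolve_left (Finset.mem_filter.1 hk).2
  calc ∫ x, ‖boxTrig F' a x‖ ^ p ∂boxMeasure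
      ≤ ∫ x, 2 ^ p * (‖boxTrig (F'.filter P₁) a x‖ ^ p +
          ‖boxTrig (F'.filter fun k => ¬ P₁ k) a x‖ ^ p) ∂boxMeasure := by
        refine integral_mono (hint _) (((hint _).add (hint _)).const_mul _) fun x => ?_
        simp only [hsplit x]
        exact norm_add_rpow_le _ _ hp
    _ = 2 ^ p * (∫ x, ‖boxTrig (F'.filter P₁) a x‖ ^ p ∂boxMeasure +
          ∫ x, ‖boxTrig (F'.filter fun k => ¬ P₁ k) a x‖ ^ p ∂boxMeasure) := by
        rw [integral_const_mul, integral_add (hint _) (hint _)]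
    _ ≤ _ := mul_le_mul_of_nonneg_left (add_le_add e₁ e₂) (by positivity)

lemma integral_boxTrig_le_card {p : ℝ} (hp : 0 ≤ p) (F : Finset (Fin 2 → ℤ))
    (a : (Fin 2 → ℤ) → ℂ) : ∫ x, ‖boxTrig F a x‖ ^ p ∂boxMeasure ≤
      (F.card : ℝ) ^ (p / 2) * (∑ k ∈ F, ‖a k‖ ^ 2) ^ (p / 2) := by
  have hb : ∀ x, ‖boxTrig F a x‖ ^ p ≤ (F.card : ℝ) ^ (p / 2) * (∑ k ∈ F, ‖a k‖ ^ 2) ^ (p / 2) := by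
    intro x
    have h0 : ‖boxTrig F a x‖ ≤ ∑ k ∈ F, ‖a k‖ := by
      refine (norm_sum_le _ _).trans (le_of_eq ?_)
      simp
    have h1 : ‖boxTrig F a x‖ ^ 2 ≤ F.card * ∑ k ∈ F, ‖a k‖ ^ 2 :=
      (pow_le_pow_left₀ (norm_nonneg _) h0 2).trans sq_sum_le_card_mul_sum_sq
    have h2 : 0 ≤ ∑ k ∈ F, ‖a k‖ ^ 2 := Finset.sum_nonneg fun _ _ => by positivity
    rw [← Real.mul_rpow (by positivity) h2]
    calc ‖boxTrig F a x‖ ^ p = (‖boxTrig F a x‖ ^ 2) ^ (p / 2) := by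
          rw [← Real.rpow_natCast, ← Real.rpow_mul (norm_nonneg _)]
          congr 1; push_cast; ring
      _ ≤ _ := Real.rpow_le_rpow (by positivity) h1 (by linarith)
  calc _ ≤ ∫ _, (F.card : ℝ) ^ (p / 2) * (∑ k ∈ F, ‖a k‖ ^ 2) ^ (p / 2) ∂boxMeasure :=
        integral_mono ((bm_boxTrig F a).norm.rpow (fun _ => norm_nonneg _) hp).integrable
          (integrable_const _) hb
    _ = _ := by simp

/-- A bounded elliptic region contains boundedly many lattice points. -/
lemma exists_card_le_of_ellipse {α b γ : ℝ} (hα : 0 < α) (hγ : 0 < γ) (hD : 0 < α * γ - b ^ 2)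
    (R : ℝ) : ∃ N : ℕ, ∀ F : Finset (Fin 2 → ℤ),
      (∀ k ∈ F, √(α * k 0 ^ 2 + 2 * b * k 0 * k 1 + γ * k 1 ^ 2) ≤ R) → F.card ≤ N := by
  obtain ⟨D, hDd⟩ : ∃ D, D = α * γ - b ^ 2 := ⟨_, rfl⟩
  rw [← hDd] at hD
  obtain ⟨L, hL⟩ : ∃ L : ℝ, L = 1 + (α + γ) * R ^ 2 / D := ⟨_, rfl⟩
  have hL1 : 1 ≤ L := by rw [hL]; linarith [show 0 ≤ (α + γ) * R ^ 2 / D by positivity]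
  obtain ⟨n, hn⟩ := exists_nat_ge L
  refine ⟨(Fintype.piFinset fun _ : Fin 2 => Finset.Icc (-(n : ℤ)) n).card,
    fun F hF => Finset.card_le_card fun k hk => ?_⟩
  obtain ⟨u, hu⟩ : ∃ u : ℝ, u = k 0 := ⟨_, rfl⟩
  obtain ⟨w, hw⟩ : ∃ w : ℝ, w = k 1 := ⟨_, rfl⟩
  have h := hF k hk
  rw [← hu, ← hw] at h
  obtain ⟨q, hqd⟩ : ∃ q, q = α * u ^ 2 + 2 * b * u * w + γ * w ^ 2 := ⟨_, rfl⟩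
  rw [← hqd] at h
  have hq : q ≤ R ^ 2 := by
    have hR := (Real.sqrt_nonneg q).trans h
    exact (Real.sqrt_le_left hR).1 h
  have h1 : D * u ^ 2 ≤ γ * q := by
    have : γ * q = (γ * w + b * u) ^ 2 + D * u ^ 2 := by rw [hqd, hDd]; ring
    rw [this]; linarith [sq_nonneg (γ * w + b * u)]
  have h2 : D * w ^ 2 ≤ α * q := by
    have : α * q = (α * u + b * w) ^ 2 + D * w ^ 2 := by rw [hqd, hDd]; ring
    rw [this]; linarith [sq_nonneg (α * u + b * w)]
  have hb : ∀ t : ℝ, D * t ^ 2 ≤ (α + γ) * R ^ 2 → |t| ≤ n := by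
    intro t ht
    have h3 : t ^ 2 ≤ L := by
      rw [mul_comm, ← le_div_iff₀ hD] at ht; linarith
    refine (abs_le_of_sq_le_sq (h3.trans ?_) (by linarith)).trans hn
    nlinarith
  have h3 := mul_le_mul_of_nonneg_left hq hα.le
  have h4 := mul_le_mul_of_nonneg_left hq hγ.le
  have hR2 := sq_nonneg R
  have h5 : 0 ≤ α * R ^ 2 := by positivity
  have h6 : 0 ≤ γ * R ^ 2 := by positivity
  have hu' := abs_le.1 (hb u (by linarith))
  have hw' := abs_le.1 (hb w (by linarith))
  rw [hu] at hu'
  rw [hw] at hw'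
  rw [Fintype.mem_piFinset, Fin.forall_fin_two]
  simp only [Finset.mem_Icc]
  refine ⟨⟨?_, ?_⟩, ?_, ?_⟩
  · exact_mod_cast hu'.1
  · exact_mod_cast hu'.2
  · exact_mod_cast hw'.1
  · exact_mod_cast hw'.2

lemma one_le_mul_of_regime {lam δ p κ κ' : ℝ} (hl : 1 < lam) (hκ : 0 < κ) (hκ' : 0 < κ')
    (h : lam ^ (-(1 / 3 : ℝ) + κ) < δ ∨ (p < 5 - κ ∧ lam ^ (-1 + κ') < δ)) : 1 ≤ lam * δ := by
  have key : ∀ e : ℝ, -1 ≤ e → lam ^ e < δ → 1 ≤ lam * δ := by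
    intro e he h
    calc (1 : ℝ) ≤ lam ^ (1 + e) := Real.one_le_rpow hl.le (by linarith)
      _ = lam * lam ^ e := by rw [Real.rpow_add (by linarith), Real.rpow_one]
      _ ≤ lam * δ := mul_le_mul_of_nonneg_left h.le (by linarith)
  rcases h with h | ⟨-, h⟩
  · exact key _ (by linarith) h
  · exact key _ (by linarith) h

/-- The moment bound for elliptic shells. -/
theorem exists_integral_boxTrig_le {α b γ p κ κ' : ℝ} (hα : 0 < α) (hγ : 0 < γ)
    (hD : 0 < α * γ - b ^ 2) (hp : 2 ≤ p) (hκ : 0 < κ) (hκ' : 0 < κ') :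
    ∃ C : ℝ, 0 < C ∧ ∀ (lam δ : ℝ) (F : Finset (Fin 2 → ℤ)) (a : (Fin 2 → ℤ) → ℂ),
      1 < lam → 0 < δ → δ < 1 →
      (lam ^ (-(1 / 3 : ℝ) + κ) < δ ∨ (p < 5 - κ ∧ lam ^ (-1 + κ') < δ)) →
      (∀ k ∈ F, |√(α * k 0 ^ 2 + 2 * b * k 0 * k 1 + γ * k 1 ^ 2) - lam| < δ) →
      ∫ x, ‖boxTrig F a x‖ ^ p ∂boxMeasure ≤
        C * (lam ^ (p / 2 - 2) * δ ^ (p / 2) + (lam * δ) ^ ((p - 2) / 4)) *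
          (∑ k ∈ F, ‖a k‖ ^ 2) ^ (p / 2) := by
  have hp0 : 0 ≤ p := by linarith
  obtain ⟨c₀, hc₀, hcγ, hcα, hcov⟩ := chart_cover hα hγ hD
  have hD' : 0 < γ * α - b ^ 2 := by rwa [mul_comm]
  have hneg : (-1 : ℤ) ^ 2 = 1 := by norm_num
  obtain ⟨C₁, Λ₁, hC₁, hΛ₁, H₁⟩ :=
    exists_integral_boxTrig_le_of_chart 0 1 (one_pow 2) hγ hD hc₀ hcγ hp hκ hκ'
  obtain ⟨C₂, Λ₂, hC₂, hΛ₂, H₂⟩ :=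
    exists_integral_boxTrig_le_of_chart 0 (-1) hneg hγ hD hc₀ hcγ hp hκ hκ'
  obtain ⟨C₃, Λ₃, hC₃, hΛ₃, H₃⟩ :=
    exists_integral_boxTrig_le_of_chart 1 1 (one_pow 2) hα hD' hc₀ hcα hp hκ hκ'
  obtain ⟨C₄, Λ₄, hC₄, hΛ₄, H₄⟩ :=
    exists_integral_boxTrig_le_of_chart 1 (-1) hneg hα hD' hc₀ hcα hp hκ hκ'
  obtain ⟨Λ, hΛ⟩ : ∃ Λ, Λ = 2 + Λ₁ + Λ₂ + Λ₃ + Λ₄ := ⟨_, rfl⟩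
  obtain ⟨N, hN⟩ := exists_card_le_of_ellipse hα hγ hD (Λ + 1)
  obtain ⟨C', hC'⟩ : ∃ C' : ℝ, C' = 2 ^ p * (C₁ + 2 ^ p * (C₂ + 2 ^ p * (C₃ + C₄))) := ⟨_, rfl⟩
  have hC'0 : 0 < C' := by
    have : 0 < C₁ := by linarith
    have : 0 < C₂ := by linarith
    have : 0 < C₃ := by linarith
    have : 0 < C₄ := by linarith
    rw [hC']; positivity
  have hN0 : 0 ≤ (N : ℝ) ^ (p / 2) := by positivity
  refine ⟨C' + (N : ℝ) ^ (p / 2), by linarith, fun lam δ F a hl hδ hδ1 hreg hF => ?_⟩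
  have hlδ := one_le_mul_of_regime hl hκ hκ' hreg
  have hl0 : 0 < lam := by linarith
  obtain ⟨W, hW⟩ : ∃ W, W = lam ^ (p / 2 - 2) * δ ^ (p / 2) + (lam * δ) ^ ((p - 2) / 4) :=
    ⟨_, rfl⟩
  have hW1 : 1 ≤ W := by
    have h1 : 1 ≤ (lam * δ) ^ ((p - 2) / 4) := Real.one_le_rpow hlδ (by linarith)
    have h2 : 0 ≤ lam ^ (p / 2 - 2) * δ ^ (p / 2) := by positivity
    rw [hW]; linarith
  obtain ⟨V, hV⟩ : ∃ V, V = (∑ k ∈ F, ‖a k‖ ^ 2) ^ (p / 2) := ⟨_, rfl⟩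
  have hV0 : 0 ≤ V := by
    rw [hV]; exact Real.rpow_nonneg (Finset.sum_nonneg fun _ _ => by positivity) _
  have hmonoV : ∀ F' ⊆ F, (∑ k ∈ F', ‖a k‖ ^ 2) ^ (p / 2) ≤ V := by
    intro F' hF'
    rw [hV]
    refine Real.rpow_le_rpow (Finset.sum_nonneg fun _ _ => by positivity) ?_ (by linarith)
    exact Finset.sum_le_sum_of_subset_of_nonneg hF' fun _ _ _ => by positivity
  rw [← hW, ← hV]
  rcases lt_or_ge lam Λ with hlΛ | hlΛ
  · have h1 : (F.card : ℝ) ≤ N := by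
      exact_mod_cast hN F fun k hk => by linarith [(abs_lt.1 (hF k hk)).2]
    calc _ ≤ (F.card : ℝ) ^ (p / 2) * V := by rw [hV]; exact integral_boxTrig_le_card hp0 F a
      _ ≤ (N : ℝ) ^ (p / 2) * V := mul_le_mul_of_nonneg_right
          (Real.rpow_le_rpow (by positivity) h1 (by linarith)) hV0
      _ ≤ (C' + (N : ℝ) ^ (p / 2)) * W * V := by
          refine mul_le_mul_of_nonneg_right ?_ hV0
          nlinarith
  have hstep : ∀ (C : ℝ), 1 ≤ C → ∀ F' ⊆ F,
      C * W * (∑ k ∈ F', ‖a k‖ ^ 2) ^ (p / 2) ≤ C * (W * V) := by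
    intro C hC F' hF'
    rw [mul_assoc]
    exact mul_le_mul_of_nonneg_left
      (mul_le_mul_of_nonneg_left (hmonoV F' hF') (by linarith)) (by linarith)
  simp only [sub_zero, sub_self, Int.cast_one, one_mul, Int.cast_neg, neg_one_mul]
    at H₁ H₂ H₃ H₄
  have h₁ : ∀ F' ⊆ F, (∀ k ∈ F', γ * k 1 + b * k 0 ≤ -(c₀ * lam)) →
      ∫ x, ‖boxTrig F' a x‖ ^ p ∂boxMeasure ≤ C₁ * (W * V) := by
    intro F' hF' hP
    rw [hW] at hstep ⊢
    exact (H₁ lam δ F' a (by linarith) hδ hδ1.le hlδ hreg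
      fun k hk => ⟨hF k (hF' hk), hP k hk⟩).trans (hstep C₁ hC₁ F' hF')
  have h₂ : ∀ F' ⊆ F, (∀ k ∈ F', c₀ * lam ≤ γ * k 1 + b * k 0) →
      ∫ x, ‖boxTrig F' a x‖ ^ p ∂boxMeasure ≤ C₂ * (W * V) := by
    intro F' hF' hP
    rw [hW] at hstep ⊢
    exact (H₂ lam δ F' a (by linarith) hδ hδ1.le hlδ hreg
      fun k hk => ⟨hF k (hF' hk), neg_le_neg (hP k hk)⟩).trans (hstep C₂ hC₂ F' hF')
  have hswap : ∀ k ∈ F, |√(γ * k 1 ^ 2 + 2 * b * k 1 * k 0 + α * k 0 ^ 2) - lam| < δ := by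
    intro k hk
    have := hF k hk
    rwa [show (γ : ℝ) * k 1 ^ 2 + 2 * b * k 1 * k 0 + α * k 0 ^ 2 =
      α * k 0 ^ 2 + 2 * b * k 0 * k 1 + γ * k 1 ^ 2 by ring]
  have h₃ : ∀ F' ⊆ F, (∀ k ∈ F', α * k 0 + b * k 1 ≤ -(c₀ * lam)) →
      ∫ x, ‖boxTrig F' a x‖ ^ p ∂boxMeasure ≤ C₃ * (W * V) := by
    intro F' hF' hP
    rw [hW] at hstep ⊢
    exact (H₃ lam δ F' a (by linarith) hδ hδ1.le hlδ hreg
      fun k hk => ⟨hswap k (hF' hk), hP k hk⟩).trans (hstep C₃ hC₃ F' hF')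
  have h₄ : ∀ F' ⊆ F, (∀ k ∈ F', c₀ * lam ≤ α * k 0 + b * k 1) →
      ∫ x, ‖boxTrig F' a x‖ ^ p ∂boxMeasure ≤ C₄ * (W * V) := by
    intro F' hF' hP
    rw [hW] at hstep ⊢
    exact (H₄ lam δ F' a (by linarith) hδ hδ1.le hlδ hreg
      fun k hk => ⟨hswap k (hF' hk), neg_le_neg (hP k hk)⟩).trans (hstep C₄ hC₄ F' hF')
  have h := integral_boxTrig_le_of_or hp0 h₁ (integral_boxTrig_le_of_or hp0 h₂
    (integral_boxTrig_le_of_or hp0 h₃ h₄)) F subset_rfl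
    fun k hk => hcov _ _ lam δ (by linarith) hδ1.le (hF k hk)
  refine h.trans ?_
  have h0 : 0 ≤ (N : ℝ) ^ (p / 2) * (W * V) := by positivity
  rw [hC']
  linarith

end

end TorusShell

theorem statement5 (A : Matrix (Fin 2) (Fin 2) ℝ) (hA : A.IsSymm) (hApd : A.PosDef)
    (κ κ' : ℝ) (hκ : 0 < κ) (hκ' : 0 < κ') :
    ∀ p : ℝ, 2 ≤ p →
      ∃ C : ℝ, 0 < C ∧
        ∀ lam δ : ℝ, 1 < lam → 0 < δ → δ < 1 →
          (lam ^ (-(1 / 3 : ℝ) + κ) < δ ∨ (p < 5 - κ ∧ lam ^ (-1 + κ') < δ)) →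
          ∀ a : (Fin 2 → ℤ) →₀ ℂ,
            (∀ k ∈ a.support, |Real.sqrt (Qform2 A fun i => (k i : ℝ)) - lam| < δ) →
            lpNorm2 p a ≤
              C * (lam ^ (1 / 2 - 2 / p) * δ ^ ((1:ℝ) / 2) +
                (lam * δ) ^ ((1 / 2 : ℝ) * (1 / 2 - 1 / p))) * l2Norm2 a := by
  intro p hp
  have hsym : A 1 0 = A 0 1 := hA.apply 0 1
  have hD : 0 < A 0 0 * A 1 1 - A 0 1 ^ 2 := by
    have := hApd.det_pos
    rwa [Matrix.det_fin_two, hsym, ← sq] at this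
  obtain ⟨C, hC, H⟩ := TorusShell.exists_integral_boxTrig_le hApd.diag_pos hApd.diag_pos hD hp hκ
    hκ'
  have hp0 : 0 < p := by linarith
  refine ⟨C ^ (1 / p), by positivity, fun lam δ hl hδ hδ1 hreg a ha => ?_⟩
  have hl0 : 0 < lam := by linarith
  have h := H lam δ a.support a hl hδ hδ1 hreg fun k hk => by
    have := ha k hk
    simp only [Qform2, Fin.sum_univ_two, hsym] at this
    convert this using 4
    ring
  have hV0 : 0 ≤ ∑ k ∈ a.support, ‖a k‖ ^ 2 := Finset.sum_nonneg fun _ _ => by positivity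
  have hle : lpNorm2 p a ≤ (C * (lam ^ (p / 2 - 2) * δ ^ (p / 2) + (lam * δ) ^ ((p - 2) / 4)) *
      (∑ k ∈ a.support, ‖a k‖ ^ 2) ^ (p / 2)) ^ (1 / p) :=
    Real.rpow_le_rpow (integral_nonneg fun _ => by positivity) h (by positivity)
  refine hle.trans ?_
  rw [Real.mul_rpow (by positivity) (by positivity), Real.mul_rpow hC.le (by positivity), l2Norm2,
    ← Real.rpow_mul hV0, show p / 2 * (1 / p) = 1 / 2 by field_simp]
  refine mul_le_mul_of_nonneg_right (mul_le_mul_of_nonneg_left ?_ (by positivity)) (by positivity)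
  refine (Real.rpow_add_le_add_rpow (by positivity) (by positivity) (by positivity)
    ((div_le_one hp0).2 (by linarith))).trans (le_of_eq ?_)
  rw [Real.mul_rpow (by positivity) (by positivity), ← Real.rpow_mul hl0.le, ← Real.rpow_mul hδ.le,
    ← Real.rpow_mul (by positivity), show (p / 2 - 2) * (1 / p) = 1 / 2 - 2 / p by field_simp,
    show p / 2 * (1 / p) = 1 / 2 by field_simp,
    show (p - 2) / 4 * (1 / p) = 1 / 2 * (1 / 2 - 1 / p) by field_simp; ring]
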